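/- Let H be a C^∞ Tonelli Hamiltonian on T*𝕋ⁿ without conjugate points, and let F : ℝⁿ × ℝⁿ → ℝⁿ be a continuous map as in the foliation theorem: F is ℤⁿ-periodic in the first variable; for each c ∈ ℝⁿ the graph 𝒯_c = {(x, F(x,c))} is a Lipschitz Lagrangian graph of cohomology class c invariant under the Hamiltonian flow (φ^H_t); and for each x the map c ↦ F(x,c) is a homeomorphism of ℝⁿ, so the graphs 𝒯_c partition T*𝕋ⁿ. Then there exists a dense Gδ subset G of ℝⁿ such that for every c ∈ G, the restriction of the time-one map φ^H_1 to 𝒯_c is strictly ergodic: it admits exactly one invariant Borel probability measure, and the support of this measure is all of 𝒯_c. -/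

import Mathlib

open MeasureTheory Filter
open scoped NNReal

noncomputable section

abbrev E (n : ℕ) : Type := Fin n → ℝ

/-- The vector of `ℝⁿ` whose coordinates are the integers `m i`. -/
def intVec {n : ℕ} (m : Fin n → ℤ) : E n := fun i => (m i : ℝ)

/-- A Tonelli Hamiltonian on `T*𝕋ⁿ`, identified with a `ℤⁿ`-periodic (in `x`) function
on `ℝⁿ × ℝⁿ` which is `Cᵏ`, uniformly superlinear in `p` and with positive definite
fiberwise Hessian. -/
structure IsTonelliHamiltonian (n : ℕ) (k : ℕ∞) (H : E n × E n → ℝ) : Prop where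
  smooth : ContDiff ℝ k H
  periodic : ∀ (x p : E n) (m : Fin n → ℤ), H (x + intVec m, p) = H (x, p)
  superlinear : ∀ C : ℝ, ∃ R : ℝ, ∀ (x p : E n), R ≤ ‖p‖ → C * ‖p‖ ≤ H (x, p)
  posdef : ∀ (x p w : E n), w ≠ 0 →
    0 < fderiv ℝ (fun p' => fderiv ℝ (fun p'' => H (x, p'')) p' w) p w

/-- The gradient of `H` in the fiber direction, `∂H/∂p (x, p)`, as a vector of `ℝⁿ`. -/
def gradP (n : ℕ) (H : E n × E n → ℝ) (x p : E n) : E n :=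
  fun i => fderiv ℝ (fun p' => H (x, p')) p (Pi.single i 1)

/-- The gradient of `H` in the base direction, `∂H/∂x (x, p)`, as a vector of `ℝⁿ`. -/
def gradX (n : ℕ) (H : E n × E n → ℝ) (x p : E n) : E n :=
  fun i => fderiv ℝ (fun x' => H (x', p)) x (Pi.single i 1)

/-- The Hamiltonian vector field `X_H (x, p) = (∂H/∂p, -∂H/∂x)`. -/
def hamVF (n : ℕ) (H : E n × E n → ℝ) (z : E n × E n) : E n × E n :=
  (gradP n H z.1 z.2, -gradX n H z.1 z.2)

/-- `φ` is the complete Hamiltonian flow of `H` on `ℝⁿ × ℝⁿ`. -/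
def IsHamFlow (n : ℕ) (H : E n × E n → ℝ) (φ : ℝ → E n × E n → E n × E n) : Prop :=
  (∀ z : E n × E n, φ 0 z = z) ∧
  ∀ (z : E n × E n) (t : ℝ), HasDerivAt (fun s => φ s z) (hamVF n H (φ t z)) t

/-- The flow `φ` has no conjugate points: for `t ≠ 0` the image of the vertical
subspace `{0} × ℝⁿ` under `Dφ_t(z)` meets `{0} × ℝⁿ` only in `0`. -/
def NoConjugatePoints (n : ℕ) (φ : ℝ → E n × E n → E n × E n) : Prop :=
  ∀ (z : E n × E n) (t : ℝ), t ≠ 0 → ∀ w : E n,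
    (fderiv ℝ (φ t) z (0, w)).1 = 0 → w = 0

/-- The gradient of a function `u : ℝⁿ → ℝ`, as a vector of `ℝⁿ`. -/
def gradF (n : ℕ) (u : E n → ℝ) (x : E n) : E n :=
  fun i => fderiv ℝ u x (Pi.single i 1)

/-- The euclidean pairing of two vectors of `ℝⁿ`. -/
def dotP (n : ℕ) (a b : E n) : ℝ := ∑ i, a i * b i

/-- The standard symplectic form `ω₀((a,b),(a',b')) = ⟨b, a'⟩ − ⟨a, b'⟩` on `ℝⁿ × ℝⁿ`. -/
def omega0 (n : ℕ) (w w' : E n × E n) : ℝ := dotP n w.2 w'.1 - dotP n w.1 w'.2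

/-- The Jacobian matrix of a map `ψ : ℝⁿ → ℝⁿ` at `x`. -/
def jacobian (n : ℕ) (ψ : E n → E n) (x : E n) : Matrix (Fin n) (Fin n) ℝ :=
  Matrix.of fun i j => fderiv ℝ (fun y => ψ y i) x (Pi.single j 1)

/-- `R = O(Iˢ)` near the zero section: on some neighborhood `{‖I‖ ≤ ε}` of `𝕋ⁿ × {0}`,
all mixed partial derivatives `∂_θ^a ∂_I^b R` with `b < s` are bounded by
`C_{a,b} ‖I‖^{s-b}`. -/
def BigOI (n : ℕ) (s : ℕ) (R : E n × E n → E n) : Prop :=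
  ∃ ε : ℝ, 0 < ε ∧ ∀ a b : ℕ, b < s → ∃ C : ℝ, ∀ θ I : E n, ‖I‖ ≤ ε →
    ‖iteratedFDeriv ℝ a (fun θ' => iteratedFDeriv ℝ b (fun I' => R (θ', I')) I) θ‖
      ≤ C * ‖I‖ ^ (s - b)

/-- A strongly Diophantine vector of `ℝⁿ`. -/
def StronglyDiophantine (n : ℕ) (ω : E n) : Prop :=
  ∃ γ : ℝ, 0 < γ ∧ ∃ τ : ℝ, ∀ k : Fin n → ℤ, k ≠ 0 → ∀ l : ℤ,
    γ / ‖intVec k‖ ^ τ ≤ |dotP n (intVec k) ω + (l : ℝ)|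

/-- The `Cᵏ` norm of a map `ℝⁿ → ℝⁿ` (the supremum of the norms of all its iterated
derivatives of order `≤ k`; a genuine supremum for periodic smooth maps). -/
noncomputable def CkNorm (n k : ℕ) (f : E n → E n) : ℝ :=
  ⨆ p : E n × Fin (k + 1), ‖iteratedFDeriv ℝ (p.2 : ℕ) f p.1‖

/-- The configuration torus `𝕋ⁿ = ℝⁿ/ℤⁿ`. -/
abbrev Torus (n : ℕ) : Type := Fin n → AddCircle (1 : ℝ)

/-- The canonical projection `T*ℝⁿ → T*𝕋ⁿ`. -/
def projT (n : ℕ) (z : E n × E n) : Torus n × E n :=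
  (fun i => (z.1 i : AddCircle (1 : ℝ)), z.2)

open scoped Matrix Topology

/-- The behaviour of a foliated symplectic twist map near a leaf made of fixed points, in
coordinates in which that leaf is the zero section: `δ c` is the leaf of class `c`, `D c` a
primitive of it, `ψ c` the dynamics on the leaf and `Ψ` the map itself. -/
structure LocalModel (n : ℕ) where
  A : E n → Matrix (Fin n) (Fin n) ℝ
  g : E n → Matrix (Fin n) (Fin n) ℝ
  δ : E n → E n → E n
  D : E n → E n → ℝ
  ψ : E n → E n → E n
  a : E n → ℝ
  Ψ : E n × E n → E n × E n
  C : ℝ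
  κ : ℝ
  r₀ : ℝ
  one_le_C : 1 ≤ C
  κ_pos : 0 < κ
  r₀_pos : 0 < r₀
  A_symm : ∀ x, (A x)ᵀ = A x
  A_coer : ∀ x v, κ * ‖v‖ ^ 2 ≤ v ⬝ᵥ A x *ᵥ v
  A_bdd : ∀ x v, ‖A x *ᵥ v‖ ≤ C * ‖v‖
  g_bdd : ∀ x v, ‖g x *ᵥ v‖ ≤ C * ‖v‖
  g_mul_A : ∀ x, g x * A x = 1
  A_lip : ∀ x y v, ‖(A x - A y) *ᵥ v‖ ≤ C * ‖x - y‖ * ‖v‖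
  A_per : ∀ x (m : Fin n → ℤ), A (x + intVec m) = A x
  δ_cont : ∀ c, Continuous (δ c)
  δ_per : ∀ c x (m : Fin n → ℤ), δ c (x + intVec m) = δ c x
  D_deriv : ∀ c x, HasFDerivAt (D c) (dotProductBilin ℝ ℝ (δ c x)).toContinuousLinearMap x
  D_per : ∀ c x (m : Fin n → ℤ), D c (x + intVec m) = D c x + c ⬝ᵥ intVec m
  leaf : ∀ x I, ∃ c, δ c x = I
  leaf_small : ∀ ρ > 0, ∃ σ > 0, ∀ x c, ‖δ c x‖ ≤ σ → ‖c‖ ≤ ρ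
  δ_small : ∀ σ > 0, ∃ ρ > 0, ∀ c, ‖c‖ ≤ ρ → ∀ x, ‖δ c x‖ ≤ σ
  ψ_surj : ∀ c, Function.Surjective (ψ c)
  Ψ_leaf : ∀ c x, Ψ (x, δ c x) = (ψ c x, δ c (ψ c x))
  Ψ_per : ∀ x I (m : Fin n → ℤ), Ψ (x + intVec m, I) = Ψ (x, I) + (intVec m, 0)
  Ψ_mp : MeasurePreserving Ψ volume volume
  step : ∀ c x, ‖δ c x‖ ≤ r₀ → ‖ψ c x - x - A x *ᵥ δ c x‖ ≤ C * ‖δ c x‖ ^ 2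
  mom : ∀ c x, ‖δ c x‖ ≤ r₀ → ‖δ c (ψ c x) - δ c x‖ ≤ C * ‖δ c x‖ ^ 2
  gain : ∀ c x, ‖δ c x‖ ≤ r₀ →
    a c + (δ c x ⬝ᵥ A x *ᵥ δ c x) / 2 - C * ‖δ c x‖ ^ 3 ≤ D c (ψ c x) - D c x
  dom : ∀ c x r, ‖r‖ ≤ r₀ → D c (x + r) - D c x ≤ a c + (r ⬝ᵥ g x *ᵥ r) / 2 + C * ‖r‖ ^ 3
  a_pos : ∀ c, c ≠ 0 → 0 < a c
  join : ∀ ρ > 0, ∀ R : ℝ, ∃ N₀ : ℕ, ∀ N ≥ N₀, ∀ x y, ‖x - y‖ ≤ R →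
    ∃ c, ‖c‖ ≤ ρ ∧ (ψ c)^[N] x = y

lemma abs_dotProduct_le {n : ℕ} (u v : E n) : |u ⬝ᵥ v| ≤ n * (‖u‖ * ‖v‖) := by
  unfold dotProduct
  calc |∑ i, u i * v i| ≤ ∑ i, |u i * v i| := Finset.abs_sum_le_sum_abs _ _
    _ ≤ ∑ _i : Fin n, ‖u‖ * ‖v‖ := by
        refine Finset.sum_le_sum fun i _ => ?_
        rw [abs_mul]
        exact mul_le_mul (norm_le_pi_norm u i) (norm_le_pi_norm v i) (abs_nonneg _) (norm_nonneg _)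
    _ = n * (‖u‖ * ‖v‖) := by simp

lemma dotProduct_le' {n : ℕ} (u v : E n) : u ⬝ᵥ v ≤ n * (‖u‖ * ‖v‖) :=
  (le_abs_self _).trans (abs_dotProduct_le u v)

lemma intVec_add {n : ℕ} (m k : Fin n → ℤ) : intVec (m + k) = intVec m + intVec k := by
  ext i; simp [intVec]

lemma intVec_neg {n : ℕ} (m : Fin n → ℤ) : intVec (-m) = -intVec m := by
  ext i; simp [intVec]

lemma exists_intVec_sub_mem_Icc {n : ℕ} (x : E n) :
    ∃ m : Fin n → ℤ, x - intVec m ∈ Set.Icc (0 : E n) 1 := by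
  refine ⟨fun i => ⌊x i⌋, fun i => ?_, fun i => ?_⟩
  · simp [intVec]
  · simpa [intVec] using (Int.fract_lt_one (x i)).le

lemma norm_le_one_of_mem_Icc {n : ℕ} {x : E n} (hx : x ∈ Set.Icc (0 : E n) 1) : ‖x‖ ≤ 1 := by
  refine (pi_norm_le_iff_of_nonneg zero_le_one).2 fun i => ?_
  rw [Real.norm_eq_abs, abs_le]
  exact ⟨by linarith [show (0:ℝ) ≤ x i from hx.1 i], hx.2 i⟩

lemma exists_forall_le_of_periodic {n : ℕ} {f : E n → ℝ} (hf : Continuous f)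
    (hper : ∀ x (m : Fin n → ℤ), f (x + intVec m) = f x) : ∃ x₀, ∀ x, f x ≤ f x₀ := by
  obtain ⟨x₀, -, h⟩ := (isCompact_Icc : IsCompact (Set.Icc (0 : E n) 1)).exists_isMaxOn
    ⟨0, by simp⟩ hf.continuousOn
  refine ⟨x₀, fun x => ?_⟩
  obtain ⟨m, hm⟩ := exists_intVec_sub_mem_Icc x
  have := hper (x - intVec m) m
  rw [sub_add_cancel] at this
  rw [this]
  exact h hm

lemma exists_abs_le_of_periodic {n : ℕ} {f : E n → ℝ} (hf : Continuous f)
    (hper : ∀ x (m : Fin n → ℤ), f (x + intVec m) = f x) : ∃ M, ∀ x, |f x| ≤ M := by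
  obtain ⟨x₀, h⟩ := exists_forall_le_of_periodic hf.abs (fun x m => by rw [hper])
  exact ⟨_, h⟩

namespace LocalModel

variable {n : ℕ} (L : LocalModel n)

lemma C_pos : 0 < L.C := lt_of_lt_of_le one_pos L.one_le_C

lemma A_mul_g (x : E n) : L.A x * L.g x = 1 := mul_eq_one_comm.1 (L.g_mul_A x)

lemma g_mulVec_A (x v : E n) : L.g x *ᵥ (L.A x *ᵥ v) = v := by
  rw [Matrix.mulVec_mulVec, L.g_mul_A, Matrix.one_mulVec]

lemma A_dot_comm (x u v : E n) : u ⬝ᵥ L.A x *ᵥ v = v ⬝ᵥ L.A x *ᵥ u := by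
  rw [Matrix.dotProduct_mulVec, ← Matrix.mulVec_transpose, L.A_symm, dotProduct_comm]

lemma g_symm (x : E n) : (L.g x)ᵀ = L.g x := by
  have h : (L.g x)ᵀ * L.A x = 1 := by
    have := congrArg Matrix.transpose (L.A_mul_g x)
    rwa [Matrix.transpose_mul, L.A_symm, Matrix.transpose_one] at this
  calc (L.g x)ᵀ = (L.g x)ᵀ * (L.A x * L.g x) := by rw [L.A_mul_g, mul_one]
    _ = L.g x := by rw [← mul_assoc, h, one_mul]

lemma g_dot_comm (x u v : E n) : u ⬝ᵥ L.g x *ᵥ v = v ⬝ᵥ L.g x *ᵥ u := by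
  rw [Matrix.dotProduct_mulVec, ← Matrix.mulVec_transpose, L.g_symm, dotProduct_comm]

lemma g_lip (x y v : E n) : ‖(L.g x - L.g y) *ᵥ v‖ ≤ L.C ^ 3 * ‖x - y‖ * ‖v‖ := by
  have hC := L.C_pos
  have h : L.g x - L.g y = L.g x * ((L.A y - L.A x) * L.g y) := by
    rw [sub_mul, mul_sub, L.A_mul_g, mul_one, ← mul_assoc, L.g_mul_A, one_mul]
  rw [h, ← Matrix.mulVec_mulVec, ← Matrix.mulVec_mulVec]
  calc _ ≤ L.C * ‖(L.A y - L.A x) *ᵥ (L.g y *ᵥ v)‖ := L.g_bdd _ _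
    _ ≤ L.C * (L.C * ‖y - x‖ * (L.C * ‖v‖)) := by
        gcongr
        exact (L.A_lip _ _ _).trans (by gcongr; exact L.g_bdd _ _)
    _ = _ := by rw [norm_sub_rev]; ring

lemma D_sub_eq_of_taylor (c x e : E n) :
    ∃ t ∈ Set.Ioo (0 : ℝ) 1, L.D c (x + e) - L.D c x = L.δ c (x + t • e) ⬝ᵥ e := by
  have hd : ∀ t : ℝ, HasDerivAt (fun t : ℝ => L.D c (x + t • e)) (L.δ c (x + t • e) ⬝ᵥ e) t := by
    intro t
    have h1 : HasDerivAt (fun t : ℝ => x + t • e) e t := by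
      simpa using ((hasDerivAt_id t).smul_const e).const_add x
    exact ((L.D_deriv c (x + t • e)).comp_hasDerivAt t h1).congr_deriv (by simp)
  obtain ⟨t, ht, h⟩ := exists_hasDerivAt_eq_slope (fun t : ℝ => L.D c (x + t • e)) _ one_pos
    (fun t _ => (hd t).continuousAt.continuousWithinAt) (fun t _ => hd t)
  refine ⟨t, ht, ?_⟩
  simpa using h.symm

lemma D_continuous (c : E n) : Continuous (L.D c) :=
  continuous_iff_continuousAt.2 fun x => (L.D_deriv c x).continuousAt

/-- The periodic function `D c - ⟨c, ·⟩`. -/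
def w (c x : E n) : ℝ := L.D c x - c ⬝ᵥ x

lemma w_per (c x : E n) (m : Fin n → ℤ) : L.w c (x + intVec m) = L.w c x := by
  simp only [w, L.D_per, dotProduct_add]; ring

lemma w_cont (c : E n) : Continuous (L.w c) :=
  (L.D_continuous c).sub (by unfold dotProduct; fun_prop)

lemma exists_sup (c : E n) : ∃ x₀, ∀ x, ‖L.δ c x‖ ≤ ‖L.δ c x₀‖ :=
  exists_forall_le_of_periodic (L.δ_cont c).norm (fun x m => by rw [L.δ_per])

lemma exists_δ_eq (c : E n) : ∃ x, L.δ c x = c := by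
  obtain ⟨x, hx⟩ := exists_forall_le_of_periodic (L.w_cont c) (L.w_per c)
  refine ⟨x, ?_⟩
  have h1 : HasFDerivAt (L.w c) ((dotProductBilin ℝ ℝ (L.δ c x)).toContinuousLinearMap -
      (dotProductBilin ℝ ℝ c).toContinuousLinearMap) x :=
    (L.D_deriv c x).sub ((dotProductBilin ℝ ℝ c).toContinuousLinearMap.hasFDerivAt)
  have h2 := (IsLocalMax.hasFDerivAt_eq_zero (Filter.Eventually.of_forall hx) h1)
  ext i
  have := congrArg (fun l => l (Pi.single i 1)) h2
  simp at this
  linarith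

end LocalModel

namespace LocalModel

variable {n : ℕ} (L : LocalModel n)

lemma g_quad_le (x r : E n) : r ⬝ᵥ L.g x *ᵥ r ≤ n * L.C * ‖r‖ ^ 2 := by
  refine (dotProduct_le' _ _).trans ?_
  calc (n : ℝ) * (‖r‖ * ‖L.g x *ᵥ r‖) ≤ n * (‖r‖ * (L.C * ‖r‖)) := by gcongr; exact L.g_bdd _ _
    _ = _ := by ring

section Orbit

variable {L} {c : E n} {s : ℝ}

lemma step_le (hs : ∀ x, ‖L.δ c x‖ ≤ s) (h0 : s ≤ L.r₀) (h1 : s ≤ 1) (x : E n) :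
    ‖L.ψ c x - x‖ ≤ 2 * L.C * s := by
  have hC := L.C_pos
  have hd := hs x
  have hp : 0 ≤ s := (norm_nonneg _).trans hd
  calc ‖L.ψ c x - x‖ = ‖(L.ψ c x - x - L.A x *ᵥ L.δ c x) + L.A x *ᵥ L.δ c x‖ := by
        rw [sub_add_cancel]
    _ ≤ L.C * ‖L.δ c x‖ ^ 2 + L.C * ‖L.δ c x‖ :=
        (norm_add_le _ _).trans (add_le_add (L.step c x (hd.trans h0)) (L.A_bdd _ _))
    _ ≤ L.C * s ^ 2 + L.C * s := by gcongr
    _ ≤ L.C * s + L.C * s := by gcongr; nlinarith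
    _ = _ := by ring

lemma iterate_sub_norm_le (hs : ∀ x, ‖L.δ c x‖ ≤ s) (h0 : s ≤ L.r₀) (h1 : s ≤ 1) (x : E n)
    (N : ℕ) : ‖(L.ψ c)^[N] x - x‖ ≤ N * (2 * L.C * s) := by
  induction N with
  | zero => simp
  | succ N ih =>
    rw [Function.iterate_succ_apply']
    calc _ = ‖(L.ψ c ((L.ψ c)^[N] x) - (L.ψ c)^[N] x) + ((L.ψ c)^[N] x - x)‖ := by
          rw [sub_add_sub_cancel]
      _ ≤ 2 * L.C * s + N * (2 * L.C * s) :=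
          (norm_add_le _ _).trans (add_le_add (step_le hs h0 h1 _) ih)
      _ = _ := by push_cast; ring

lemma iterate_mom_le (hs : ∀ x, ‖L.δ c x‖ ≤ s) (h0 : s ≤ L.r₀) (x : E n)
    (N : ℕ) : ‖L.δ c ((L.ψ c)^[N] x) - L.δ c x‖ ≤ N * (L.C * s ^ 2) := by
  have hC := L.C_pos
  induction N with
  | zero => simp
  | succ N ih =>
    rw [Function.iterate_succ_apply']
    calc _ = ‖(L.δ c (L.ψ c ((L.ψ c)^[N] x)) - L.δ c ((L.ψ c)^[N] x)) +
          (L.δ c ((L.ψ c)^[N] x) - L.δ c x)‖ := by rw [sub_add_sub_cancel]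
      _ ≤ L.C * s ^ 2 + N * (L.C * s ^ 2) := by
          refine (norm_add_le _ _).trans (add_le_add ((L.mom c _ ((hs _).trans h0)).trans ?_) ih)
          gcongr
          exact hs _
      _ = _ := by push_cast; ring

lemma iterate_D_ge {b : ℝ} (x : E n) (N : ℕ)
    (hb : ∀ k < N, b ≤ L.D c (L.ψ c ((L.ψ c)^[k] x)) - L.D c ((L.ψ c)^[k] x)) :
    N * b ≤ L.D c ((L.ψ c)^[N] x) - L.D c x := by
  have h := Finset.sum_range_sub (fun k => L.D c ((L.ψ c)^[k] x)) N
  simp only [Function.iterate_zero, id] at h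
  rw [← h]
  calc N * b = ∑ _k ∈ Finset.range N, b := by simp
    _ ≤ _ := Finset.sum_le_sum fun k hk => by
        rw [Function.iterate_succ_apply']; exact hb k (Finset.mem_range.1 hk)

end Orbit

lemma dom_chain (c x r : E n) {N : ℕ} (hN : 1 ≤ N) (hr : ‖r‖ ≤ N * L.r₀) :
    L.D c (x + r) - L.D c x ≤ N * L.a c + (n * L.C + L.C * L.r₀) * ‖r‖ ^ 2 / N := by
  have hN' : (0:ℝ) < N := by exact_mod_cast hN
  have hC := L.C_pos
  have hr0 := L.r₀_pos
  set q : E n := (N : ℝ)⁻¹ • r with hq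
  have hqn : ‖q‖ = ‖r‖ / N := by rw [hq, norm_smul, norm_inv, Real.norm_natCast]; ring
  have hq0 : ‖q‖ ≤ L.r₀ := by rw [hqn, div_le_iff₀ hN']; linarith
  have h := Finset.sum_range_sub (fun k : ℕ => L.D c (x + (k : ℝ) • q)) N
  have hNq : (N : ℝ) • q = r := by rw [hq, smul_inv_smul₀ hN'.ne']
  simp only [hNq, Nat.cast_zero, zero_smul, add_zero] at h
  rw [← h]
  have hk : ∀ k ∈ Finset.range N, L.D c (x + ((k + 1 : ℕ) : ℝ) • q) - L.D c (x + (k : ℝ) • q) ≤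
      L.a c + (n * L.C + L.C * L.r₀) * ‖q‖ ^ 2 := by
    intro k _
    have h1 : x + ((k + 1 : ℕ) : ℝ) • q = x + (k : ℝ) • q + q := by
      push_cast; rw [add_smul, one_smul, add_assoc]
    rw [h1]
    refine (L.dom c _ _ hq0).trans ?_
    have h2 := L.g_quad_le (x + (k : ℝ) • q) q
    have h3 : L.C * ‖q‖ ^ 3 ≤ L.C * (L.r₀ * ‖q‖ ^ 2) := by
      gcongr; rw [pow_succ']; gcongr
    have h4 : 0 ≤ n * L.C * ‖q‖ ^ 2 := by positivity
    nlinarith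
  refine (Finset.sum_le_sum hk).trans (le_of_eq ?_)
  rw [Finset.sum_const, Finset.card_range, nsmul_eq_mul, hqn]
  field_simp

lemma a_le_gain {c x : E n} (h0 : ‖L.δ c x‖ ≤ L.r₀) (h1 : ‖L.δ c x‖ ≤ L.κ / (16 * L.C)) :
    L.a c + L.κ / 4 * ‖L.δ c x‖ ^ 2 ≤ L.D c (L.ψ c x) - L.D c x := by
  have hC := L.C_pos
  refine le_trans ?_ (L.gain c x h0)
  have h2 := L.A_coer x (L.δ c x)
  have h3 : L.C * ‖L.δ c x‖ ^ 3 ≤ L.κ / 16 * ‖L.δ c x‖ ^ 2 := by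
    rw [pow_succ' _ 2, ← mul_assoc]
    gcongr
    rw [le_div_iff₀ (by positivity)] at h1
    linarith
  nlinarith [sq_nonneg ‖L.δ c x‖, L.κ_pos, mul_nonneg L.κ_pos.le (sq_nonneg ‖L.δ c x‖)]

lemma a_le_mul {c : E n} {s : ℝ} (hs : ∀ x, ‖L.δ c x‖ ≤ s) (h0 : s ≤ L.r₀) (h1 : s ≤ 1)
    (h2 : s ≤ L.κ / (16 * L.C)) : L.a c ≤ n * (‖c‖ * (2 * L.C * s)) := by
  obtain ⟨M, hM⟩ := exists_abs_le_of_periodic (L.w_cont c) (L.w_per c)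
  have key : ∀ N : ℕ, N * (L.a c - n * (‖c‖ * (2 * L.C * s))) ≤ 2 * M := by
    intro N
    have hg := iterate_D_ge (L := L) (c := c) (b := L.a c) 0 N (fun k _ => by
      have := L.a_le_gain (c := c) (x := (L.ψ c)^[k] 0) ((hs _).trans h0) ((hs _).trans h2)
      have h5 : 0 ≤ L.κ / 4 * ‖L.δ c ((L.ψ c)^[k] 0)‖ ^ 2 := by
        have := L.κ_pos; positivity
      linarith)
    set y := (L.ψ c)^[N] 0
    have e1 : L.D c y - L.D c 0 = L.w c y - L.w c 0 + c ⬝ᵥ (y - 0) := by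
      simp only [w, dotProduct_sub]; ring
    have e2 : c ⬝ᵥ (y - 0) ≤ n * (‖c‖ * (N * (2 * L.C * s))) :=
      (dotProduct_le' _ _).trans (by gcongr; exact iterate_sub_norm_le hs h0 h1 0 N)
    have := abs_le.1 (hM y)
    have := abs_le.1 (hM 0)
    nlinarith
  by_contra hcon
  push Not at hcon
  obtain ⟨N, hN⟩ := exists_nat_gt (2 * M / (L.a c - n * (‖c‖ * (2 * L.C * s))))
  rw [div_lt_iff₀ (by linarith)] at hN
  linarith [key N]

lemma sup_le_sqrt : ∃ K > 0, ∃ σ > 0, ∀ c, c ≠ 0 → ∀ s ≤ σ, (∀ x, ‖L.δ c x‖ ≤ s) →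
    (∃ x, ‖L.δ c x‖ = s) → L.a c ≤ 1 → Real.sqrt (L.a c) ≤ L.r₀ → s ≤ K * Real.sqrt (L.a c) := by
  have hC := L.C_pos
  have hκ := L.κ_pos
  have hr := L.r₀_pos
  set K₁ := n * L.C + L.C * L.r₀
  have hK₁ : 0 ≤ K₁ := by positivity
  refine ⟨64 * L.C / L.κ * (2 + K₁), by positivity,
    min (min L.r₀ 1) (min (L.κ / (16 * L.C)) (1 / (4 * L.C))), by positivity, ?_⟩
  intro c hc s hsσ hs ⟨x₀, hx₀⟩ ha1 har
  simp only [le_min_iff] at hsσ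
  obtain ⟨⟨h0, h1⟩, h2, h3⟩ := hsσ
  have ha := L.a_pos c hc
  have hs0 : 0 ≤ s := hx₀ ▸ norm_nonneg _
  rcases hs0.eq_or_lt with hs0 | hs0
  · rw [← hs0]; positivity
  set N := ⌊1 / (2 * L.C * s)⌋₊
  have hN1 : (N : ℝ) ≤ 1 / (2 * L.C * s) := Nat.floor_le (by positivity)
  have hN2 : 1 / (4 * L.C * s) ≤ N := by
    have h4 := Nat.lt_floor_add_one (1 / (2 * L.C * s))
    have h5 : 1 ≤ 1 / (4 * L.C * s) := by
      rw [le_div_iff₀ (by positivity)] at h3 ⊢; linarith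
    have h6 : 1 / (2 * L.C * s) = 2 * (1 / (4 * L.C * s)) := by field_simp; norm_num
    have h7 : (⌊1 / (2 * L.C * s)⌋₊ : ℝ) = N := rfl
    linarith
  rw [le_div_iff₀ (by positivity)] at hN1
  have hg : N * (L.κ / 16 * s ^ 2) ≤ L.D c ((L.ψ c)^[N] x₀) - L.D c x₀ := by
    refine iterate_D_ge x₀ N fun k hk => ?_
    have h4 := iterate_mom_le hs h0 x₀ k
    have h5 : (k : ℝ) ≤ N := by exact_mod_cast hk.le
    have h6 : ‖L.δ c ((L.ψ c)^[k] x₀) - L.δ c x₀‖ ≤ s / 2 := by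
      refine h4.trans ?_
      calc (k : ℝ) * (L.C * s ^ 2) ≤ N * (L.C * s ^ 2) := by gcongr
        _ = (N * (2 * L.C * s)) * (s / 2) := by ring
        _ ≤ 1 * (s / 2) := by gcongr
        _ = _ := one_mul _
    have h7 : s / 2 ≤ ‖L.δ c ((L.ψ c)^[k] x₀)‖ := by
      have := norm_sub_norm_le (L.δ c x₀) (L.δ c ((L.ψ c)^[k] x₀))
      rw [norm_sub_rev] at this
      linarith
    have h8 := L.a_le_gain (c := c) (x := (L.ψ c)^[k] x₀) ((hs _).trans h0) ((hs _).trans h2)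
    have h9 : L.κ / 4 * (s / 2) ^ 2 ≤ L.κ / 4 * ‖L.δ c ((L.ψ c)^[k] x₀)‖ ^ 2 := by gcongr
    nlinarith
  have hg2 : L.κ / (64 * L.C) * s ≤ N * (L.κ / 16 * s ^ 2) := by
    calc L.κ / (64 * L.C) * s = 1 / (4 * L.C * s) * (L.κ / 16 * s ^ 2) := by
          field_simp; norm_num
      _ ≤ _ := by gcongr
  set r := (L.ψ c)^[N] x₀ - x₀ with hrdef
  have hrn : ‖r‖ ≤ 1 := by
    refine (iterate_sub_norm_le hs h0 h1 x₀ N).trans hN1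
  have hsq : 0 < Real.sqrt (L.a c) := Real.sqrt_pos.2 ha
  have hsq1 : Real.sqrt (L.a c) ≤ 1 := Real.sqrt_le_one.2 ha1
  have hss : Real.sqrt (L.a c) * Real.sqrt (L.a c) = L.a c := Real.mul_self_sqrt ha.le
  set q := Real.sqrt (L.a c)
  set N₁ := ⌈1 / q⌉₊
  have hN₁ : 1 / q ≤ N₁ := Nat.le_ceil _
  have hN₁' : (N₁ : ℝ) ≤ 2 / q := by
    have := Nat.ceil_lt_add_one (show 0 ≤ 1 / q by positivity)
    have h4 : 1 ≤ 1 / q := by rw [le_div_iff₀ hsq]; linarith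
    have h5 : 2 / q = 1 / q + 1 / q := by ring
    rw [h5]; linarith
  have hN₁pos : 1 ≤ N₁ := Nat.one_le_iff_ne_zero.2 (Nat.ceil_pos.2 (by positivity)).ne'
  have hd := L.dom_chain c x₀ r hN₁pos (by
    rw [div_le_iff₀ hsq] at hN₁
    have : (N₁ : ℝ) * q ≤ N₁ * L.r₀ := by gcongr
    linarith)
  have hd1 : L.D c (x₀ + r) - L.D c x₀ ≤ (2 + K₁) * q := by
    refine hd.trans ?_
    have h4 : N₁ * L.a c ≤ 2 * q := by
      calc N₁ * L.a c ≤ 2 / q * L.a c := by gcongr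
        _ = 2 * q := by rw [← hss]; field_simp
    have h5 : K₁ * ‖r‖ ^ 2 / N₁ ≤ K₁ * q := by
      rw [div_le_iff₀ (by exact_mod_cast hN₁pos), mul_assoc]
      rw [div_le_iff₀ hsq] at hN₁
      gcongr
      nlinarith [norm_nonneg r]
    linarith
  have hxr : x₀ + r = (L.ψ c)^[N] x₀ := by rw [hrdef]; abel
  rw [hxr] at hd1
  have : L.κ / (64 * L.C) * s ≤ (2 + K₁) * q := by linarith
  calc s = 64 * L.C / L.κ * (L.κ / (64 * L.C) * s) := by field_simp
    _ ≤ 64 * L.C / L.κ * ((2 + K₁) * q) := by gcongr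
    _ = _ := by ring

lemma δ_zero (x : E n) : L.δ 0 x = 0 := by
  rw [← norm_le_zero_iff]
  refine le_of_forall_pos_le_add fun σ hσ => ?_
  obtain ⟨ρ, hρ, h⟩ := L.δ_small σ hσ
  simpa using h 0 (by simpa using hρ.le) x

/-- Harnack type comparison: near `0` the size of the leaf `c` is comparable to `‖c‖`
everywhere, and `a c` is comparable to `‖c‖ ^ 2`. -/
lemma harnack : ∃ K ≥ 1, ∃ ρ > 0, ∀ c, ‖c‖ ≤ ρ →
    (∀ x, ‖L.δ c x‖ ≤ K * ‖c‖) ∧ (c ≠ 0 → ‖c‖ ^ 2 ≤ K * L.a c) ∧ L.a c ≤ K * ‖c‖ ^ 2 := by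
  have hC := L.C_pos
  have hκ := L.κ_pos
  have hr := L.r₀_pos
  obtain ⟨K, hK, σ, hσ, h⟩ := L.sup_le_sqrt
  set m := min (min L.r₀ 1) (min (L.κ / (16 * L.C)) σ) with hm
  set M := 2 * n * L.C with hM
  have hM0 : 0 ≤ M := by positivity
  have hm0 : 0 < m := by positivity
  obtain ⟨ρ, hρ, hρ'⟩ := L.δ_small m hm0
  obtain ⟨ρ₂, hρ₂, h₂⟩ : ∃ ρ₂ > 0, ∀ t ≤ ρ₂, M * t ≤ 1 ∧ M * t ≤ L.r₀ ^ 2 := by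
    refine ⟨min 1 (L.r₀ ^ 2) / (M + 1), by positivity, fun t ht => ?_⟩
    rw [le_div_iff₀ (by positivity)] at ht
    rcases le_or_gt 0 t with h0 | h0
    · have : M * t ≤ min 1 (L.r₀ ^ 2) := by nlinarith
      exact le_min_iff.1 this
    · have : M * t ≤ 0 := by nlinarith
      exact ⟨by linarith, this.trans (by positivity)⟩
  set K' := K ^ 2 * M + K ^ 2 + M * (K ^ 2 * M) + 1 with hK'
  refine ⟨K', by rw [hK', ge_iff_le, le_add_iff_nonneg_left]; positivity,
    min ρ ρ₂, by positivity, fun c hc => ?_⟩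
  obtain ⟨hc1, hc2⟩ := le_min_iff.1 hc
  obtain ⟨x₀, hx₀⟩ := L.exists_sup c
  obtain ⟨x₁, hx₁⟩ := L.exists_δ_eq c
  set s := ‖L.δ c x₀‖ with hs
  have hsm : s ≤ m := hρ' c hc1 x₀
  have hsm' := hsm
  rw [hm] at hsm'
  simp only [le_min_iff] at hsm'
  obtain ⟨⟨m0, m1⟩, m2, m3⟩ := hsm'
  have hcs : ‖c‖ ≤ s := by simpa only [hx₁] using hx₀ x₁
  have ha : L.a c ≤ M * (‖c‖ * s) := by
    have := L.a_le_mul hx₀ m0 m1 m2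
    calc _ ≤ _ := this
      _ = _ := by rw [hM]; ring
  have hsK : s ≤ K ^ 2 * M * ‖c‖ ∧ (c ≠ 0 → ‖c‖ ^ 2 ≤ K ^ 2 * L.a c) := by
    by_cases hc0 : c = 0
    · refine ⟨?_, fun h => absurd hc0 h⟩
      rw [hs, hc0, L.δ_zero]; simp
    have ha0 := L.a_pos c hc0
    have hMc := h₂ ‖c‖ hc2
    have hss : M * (‖c‖ * s) ≤ M * ‖c‖ := by
      gcongr; exact mul_le_of_le_one_right (norm_nonneg _) m1
    have hq := h c hc0 s m3 hx₀ ⟨x₀, rfl⟩ (by linarith)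
      (Real.sqrt_le_iff.2 ⟨hr.le, by linarith⟩)
    have hs0 : 0 < s := (norm_pos_iff.2 hc0).trans_le hcs
    have h3 : s ^ 2 ≤ K ^ 2 * L.a c := by
      calc s ^ 2 ≤ (K * Real.sqrt (L.a c)) ^ 2 := by gcongr
        _ = _ := by rw [mul_pow, Real.sq_sqrt ha0.le]
    refine ⟨?_, fun _ => le_trans (by gcongr) h3⟩
    have h4 : s * s ≤ (K ^ 2 * M * ‖c‖) * s := by
      calc s * s = s ^ 2 := by ring
        _ ≤ K ^ 2 * L.a c := h3
        _ ≤ K ^ 2 * (M * (‖c‖ * s)) := by gcongr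
        _ = _ := by ring
    exact le_of_mul_le_mul_right h4 hs0
  have e1 : K ^ 2 * M ≤ K' := by
    rw [hK']
    nlinarith [mul_nonneg hM0 (mul_nonneg (sq_nonneg K) hM0), sq_nonneg K]
  have e2 : K ^ 2 ≤ K' := by
    rw [hK']
    nlinarith [mul_nonneg hM0 (mul_nonneg (sq_nonneg K) hM0), mul_nonneg (sq_nonneg K) hM0]
  have e3 : M * (K ^ 2 * M) ≤ K' := by
    rw [hK']; nlinarith [sq_nonneg K, mul_nonneg (sq_nonneg K) hM0]
  refine ⟨fun x => ((hx₀ x).trans hsK.1).trans (by gcongr), fun hc0 => ?_, ?_⟩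
  · exact (hsK.2 hc0).trans (by gcongr; exact (L.a_pos c hc0).le)
  · calc L.a c ≤ M * (‖c‖ * s) := ha
      _ ≤ M * (‖c‖ * (K ^ 2 * M * ‖c‖)) := by gcongr; exact hsK.1
      _ = M * (K ^ 2 * M) * ‖c‖ ^ 2 := by ring
      _ ≤ _ := by gcongr

end LocalModel

namespace LocalModel

variable {n : ℕ} (L : LocalModel n)

lemma one_step : ∃ K > 0, ∃ s₀ > 0, ∀ c s, s ≤ s₀ → (∀ x, ‖L.δ c x‖ ≤ s) → ∀ x w q, ‖q‖ ≤ s →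
    L.D c (x + w + (L.ψ c x - x) + q) - L.D c (x + w) - (L.D c (L.ψ c x) - L.D c x) ≤
      L.δ c x ⬝ᵥ q + K * (‖q‖ ^ 2 + s ^ 3 + s ^ 2 * ‖w‖) := by
  have hC := L.C_pos
  have hC1 := L.one_le_C
  have hr0 := L.r₀_pos
  refine ⟨(n * L.C ^ 3 * 5 + n * L.C + L.C + 27 * L.C ^ 4) * L.C ^ 2, by positivity,
    min (min L.r₀ 1) (L.r₀ / (3 * L.C)), by positivity, fun c s hs0 hs x w q hq => ?_⟩
  simp only [le_min_iff] at hs0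
  obtain ⟨⟨h0, h1⟩, h2⟩ := hs0
  have hsp : 0 ≤ s := (norm_nonneg _).trans hq
  have hδ := hs x
  set δ := L.δ c x with hδd
  set d := L.ψ c x - x with hd
  set e := d - L.A x *ᵥ δ with he
  have hdn : ‖d‖ ≤ 2 * L.C * s := step_le hs h0 h1 x
  have hen : ‖e‖ ≤ L.C * s ^ 2 :=
    (L.step c x (hδ.trans h0)).trans (by gcongr)
  set r := d + q with hr
  have hrn : ‖r‖ ≤ 3 * L.C * s := by
    refine (norm_add_le _ _).trans ?_
    nlinarith
  rw [le_div_iff₀ (by positivity)] at h2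
  have hdom := L.dom c (x + w) r (by linarith)
  have hgain := L.gain c x (hδ.trans h0)
  rw [add_assoc, ← hr]
  have e1 : r ⬝ᵥ L.g (x + w) *ᵥ r ≤ r ⬝ᵥ L.g x *ᵥ r + n * (‖r‖ * (L.C ^ 3 * ‖w‖ * ‖r‖)) := by
    have : r ⬝ᵥ L.g (x + w) *ᵥ r = r ⬝ᵥ L.g x *ᵥ r + r ⬝ᵥ (L.g (x + w) - L.g x) *ᵥ r := by
      rw [Matrix.sub_mulVec, dotProduct_sub]; ring
    rw [this]
    gcongr
    refine (dotProduct_le' _ _).trans ?_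
    gcongr
    simpa using L.g_lip (x + w) x r
  have hrq : r = L.A x *ᵥ δ + (q + e) := by rw [hr, he]; abel
  have e2 : r ⬝ᵥ L.g x *ᵥ r = δ ⬝ᵥ L.A x *ᵥ δ + 2 * (δ ⬝ᵥ q + δ ⬝ᵥ e) +
      (q + e) ⬝ᵥ L.g x *ᵥ (q + e) := by
    rw [hrq, Matrix.mulVec_add, g_mulVec_A, add_dotProduct, dotProduct_add, dotProduct_add,
      L.g_dot_comm x (L.A x *ᵥ δ) (q + e), g_mulVec_A, dotProduct_comm (q + e) δ,
      dotProduct_add, dotProduct_comm (L.A x *ᵥ δ) δ]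
    ring
  have e3 : (q + e) ⬝ᵥ L.g x *ᵥ (q + e) ≤ n * L.C * (2 * ‖q‖ ^ 2 + 2 * (L.C ^ 2 * s ^ 3)) := by
    refine (L.g_quad_le _ _).trans ?_
    gcongr
    have : ‖q + e‖ ≤ ‖q‖ + L.C * s ^ 2 := (norm_add_le _ _).trans (by gcongr)
    calc ‖q + e‖ ^ 2 ≤ (‖q‖ + L.C * s ^ 2) ^ 2 := by gcongr
      _ ≤ 2 * ‖q‖ ^ 2 + 2 * (L.C * s ^ 2) ^ 2 := by nlinarith [sq_nonneg (‖q‖ - L.C * s ^ 2)]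
      _ = 2 * ‖q‖ ^ 2 + 2 * (L.C ^ 2 * (s ^ 3 * s)) := by ring
      _ ≤ 2 * ‖q‖ ^ 2 + 2 * (L.C ^ 2 * (s ^ 3 * 1)) := by gcongr
      _ = _ := by ring
  have e4 : δ ⬝ᵥ e ≤ n * (s * (L.C * s ^ 2)) := (dotProduct_le' _ _).trans (by gcongr)
  have e5 : n * (‖r‖ * (L.C ^ 3 * ‖w‖ * ‖r‖)) ≤
      n * (3 * L.C * s * (L.C ^ 3 * ‖w‖ * (3 * L.C * s))) := by
    gcongr
  have e6 : L.C * ‖r‖ ^ 3 ≤ L.C * (3 * L.C * s) ^ 3 := by gcongr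
  have e7 : L.C * ‖δ‖ ^ 3 ≤ L.C * s ^ 3 := by gcongr
  have f1 : 1 ≤ L.C ^ 2 := one_le_pow₀ hC1
  have key : L.D c (x + w + r) - L.D c (x + w) - (L.D c (L.ψ c x) - L.D c x) ≤ δ ⬝ᵥ q +
      (n * L.C * ‖q‖ ^ 2 + (n * L.C + n * L.C ^ 3 + 27 * L.C ^ 4 + L.C) * s ^ 3 +
        n * L.C ^ 5 * 5 * (s ^ 2 * ‖w‖)) := by
    have : 0 ≤ n * L.C ^ 5 * (s ^ 2 * ‖w‖) := by positivity
    nlinarith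
  refine key.trans (add_le_add_right ?_ _)
  set K := (n * L.C ^ 3 * 5 + n * L.C + L.C + 27 * L.C ^ 4) * L.C ^ 2 with hK
  have g0 : n * L.C + n * L.C ^ 3 + 27 * L.C ^ 4 + L.C ≤ K := by
    have : 0 ≤ n * L.C ^ 3 := by positivity
    calc _ ≤ (n * L.C ^ 3 * 5 + n * L.C + L.C + 27 * L.C ^ 4) * 1 := by linarith
      _ ≤ K := by rw [hK]; gcongr
  have g1 : n * L.C ≤ K := by
    refine le_trans ?_ g0
    have : 0 ≤ n * L.C ^ 3 + 27 * L.C ^ 4 + L.C := by positivity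
    linarith
  have g2 : n * L.C ^ 5 * 5 ≤ K := by
    rw [hK]
    have : 0 ≤ (n * L.C + L.C + 27 * L.C ^ 4) * L.C ^ 2 := by positivity
    nlinarith
  calc _ ≤ K * ‖q‖ ^ 2 + K * s ^ 3 + K * (s ^ 2 * ‖w‖) := by gcongr
    _ = _ := by ring

lemma perturb {K s₀ : ℝ} (hone : ∀ c s, s ≤ s₀ → (∀ x, ‖L.δ c x‖ ≤ s) → ∀ x w q, ‖q‖ ≤ s →
    L.D c (x + w + (L.ψ c x - x) + q) - L.D c (x + w) - (L.D c (L.ψ c x) - L.D c x) ≤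
      L.δ c x ⬝ᵥ q + K * (‖q‖ ^ 2 + s ^ 3 + s ^ 2 * ‖w‖)) (hK : 0 < K) {c : E n} {s W b : ℝ}
    (hs0 : s ≤ s₀) (hs : ∀ x, ‖L.δ c x‖ ≤ s) (z u q : E n) (hq : ‖q‖ ≤ s) (N : ℕ)
    (hW : ∀ k < N, ‖u + (k : ℝ) • q‖ ≤ W) (hb : ∀ k < N, L.δ c ((L.ψ c)^[k] z) ⬝ᵥ q ≤ b) :
    L.D c ((L.ψ c)^[N] z + (u + (N : ℝ) • q)) - L.D c (z + u) -
      (L.D c ((L.ψ c)^[N] z) - L.D c z) ≤ N * (b + K * (‖q‖ ^ 2 + s ^ 3 + s ^ 2 * W)) := by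
  induction N with
  | zero => simp
  | succ N ih =>
    have h1 := ih (fun k hk => hW k (hk.trans N.lt_succ_self))
      (fun k hk => hb k (hk.trans N.lt_succ_self))
    have h2 := hone c s hs0 hs ((L.ψ c)^[N] z) (u + (N : ℝ) • q) q hq
    have h3 := hb N N.lt_succ_self
    have h4 : K * (‖q‖ ^ 2 + s ^ 3 + s ^ 2 * ‖u + (N : ℝ) • q‖) ≤
        K * (‖q‖ ^ 2 + s ^ 3 + s ^ 2 * W) := by
      gcongr; exact hW N N.lt_succ_self
    have h5 : (L.ψ c)^[N] z + (u + (N : ℝ) • q) + (L.ψ c ((L.ψ c)^[N] z) - (L.ψ c)^[N] z) + q =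
        L.ψ c ((L.ψ c)^[N] z) + (u + ((N + 1 : ℕ) : ℝ) • q) := by
      push_cast; rw [add_smul, one_smul]; abel
    rw [h5] at h2
    rw [Function.iterate_succ_apply']
    push_cast at h2 ⊢
    linarith

/-- First order Taylor expansion of the primitives at scales larger than the size of the leaf. -/
lemma taylor : ∃ K > 0, ∃ s₀ > 0, ∀ c s, 0 < s → s ≤ s₀ → (∀ x, ‖L.δ c x‖ ≤ s) → ∀ y e,
    s ≤ ‖e‖ → ‖e‖ ≤ 1 →
      |L.D c (y + e) - L.D c y - L.δ c y ⬝ᵥ e| ≤ K * (s * (‖e‖ * Real.sqrt ‖e‖)) := by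
  have hC := L.C_pos
  have hr0 := L.r₀_pos
  obtain ⟨K, hK, s₀, hs₀, hone⟩ := L.one_step
  refine ⟨6 * K + n * (8 * L.C), by positivity, min s₀ (min L.r₀ 1), by positivity,
    fun c s hs hs0 hδ y e h1 h2 => ?_⟩
  simp only [le_min_iff] at hs0
  obtain ⟨h3, h4, h5⟩ := hs0
  set t := Real.sqrt ‖e‖ with ht
  have htt : t * t = ‖e‖ := Real.mul_self_sqrt (norm_nonneg _)
  have ht0 : 0 < t := Real.sqrt_pos.2 (hs.trans_le h1)
  have ht1 : t ≤ 1 := Real.sqrt_le_one.2 h2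
  have hst : s ≤ t := by nlinarith
  set N := ⌈t / s⌉₊ with hN
  have hN1 : t / s ≤ N := Nat.le_ceil _
  have hN2 : N * s ≤ 2 * t := by
    have := Nat.ceil_lt_add_one (show 0 ≤ t / s by positivity)
    calc N * s ≤ (t / s + 1) * s := by gcongr
      _ = t + s := by field_simp
      _ ≤ _ := by linarith
  have hN0 : (0:ℝ) < N := lt_of_lt_of_le (by positivity) hN1
  rw [div_le_iff₀ hs] at hN1
  set q : E n := (N : ℝ)⁻¹ • e with hq
  have hNq : (N : ℝ) • q = e := by rw [hq, smul_inv_smul₀ hN0.ne']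
  have hqn : ‖q‖ ≤ s * t := by
    rw [hq, norm_smul, norm_inv, Real.norm_natCast, ← htt, inv_mul_le_iff₀ hN0]
    nlinarith
  have hqs : ‖q‖ ≤ s := hqn.trans (mul_le_of_le_one_right hs.le ht1)
  have hfin : ∀ b, N * (b + n * (4 * L.C * (s * t * (s * t))) +
      K * (‖q‖ ^ 2 + s ^ 3 + s ^ 2 * ‖e‖)) ≤
      N * b + (6 * K + n * (8 * L.C)) * (s * (‖e‖ * t)) := by
    intro b
    have i1 : K * (‖q‖ ^ 2 + s ^ 3 + s ^ 2 * ‖e‖) ≤ K * (s * (3 * (s * ‖e‖))) := by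
      gcongr
      have : ‖q‖ ^ 2 ≤ (s * t) ^ 2 := by gcongr
      have : s ^ 3 ≤ s ^ 2 * ‖e‖ := by rw [pow_succ]; gcongr
      nlinarith
    have i2 : N * s * (3 * K * (s * ‖e‖) + n * (4 * L.C * (s * ‖e‖))) ≤
      2 * t * (3 * K * (s * ‖e‖) + n * (4 * L.C * (s * ‖e‖))) := by gcongr
    have i3 : s * t * (s * t) = s * (s * ‖e‖) := by rw [← htt]; ring
    rw [i3]
    nlinarith
  have hdot : ∀ z, ∀ j : ℕ, j ≤ N → ∀ k : ℕ, k ≤ N → ∀ q' : E n, ‖q'‖ = ‖q‖ →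
      L.δ c ((L.ψ c)^[j] z) ⬝ᵥ q' ≤ L.δ c ((L.ψ c)^[k] z) ⬝ᵥ q' +
        n * (4 * L.C * (s * t * (s * t))) := by
    intro z j hj k hk q' hq'
    have i0 : ∀ j : ℕ, j ≤ N → ‖L.δ c ((L.ψ c)^[j] z) - L.δ c z‖ ≤ 2 * L.C * (s * t) := by
      intro j hj
      refine (iterate_mom_le hδ h4 z j).trans ?_
      have : (j : ℝ) ≤ N := by exact_mod_cast hj
      calc (j : ℝ) * (L.C * s ^ 2) ≤ N * (L.C * s ^ 2) := by gcongr
        _ = N * s * (L.C * s) := by ring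
        _ ≤ 2 * t * (L.C * s) := by gcongr
        _ = _ := by ring
    have i1 : ‖L.δ c ((L.ψ c)^[j] z) - L.δ c ((L.ψ c)^[k] z)‖ ≤ 4 * L.C * (s * t) := by
      have := norm_sub_le (L.δ c ((L.ψ c)^[j] z) - L.δ c z) (L.δ c ((L.ψ c)^[k] z) - L.δ c z)
      rw [sub_sub_sub_cancel_right] at this
      linarith [i0 j hj, i0 k hk]
    have i2 := dotProduct_le' (L.δ c ((L.ψ c)^[j] z) - L.δ c ((L.ψ c)^[k] z)) q'
    rw [sub_dotProduct] at i2
    have i3 : (n : ℝ) * (‖L.δ c ((L.ψ c)^[j] z) - L.δ c ((L.ψ c)^[k] z)‖ * ‖q'‖) ≤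
        n * (4 * L.C * (s * t) * (s * t)) := by rw [hq']; gcongr
    linarith
  rw [abs_le]
  constructor
  · have := L.perturb hone hK h3 hδ y e (-q) (by rwa [norm_neg]) N (W := ‖e‖)
      (b := L.δ c y ⬝ᵥ (-q) + n * (4 * L.C * (s * t * (s * t)))) (fun k hk => by
        have : e + (k : ℝ) • (-q) = (1 - k / N : ℝ) • e := by
          rw [hq, sub_smul, one_smul, smul_neg, smul_smul, sub_eq_add_neg]; rfl
        rw [this, norm_smul]
        have hk' : (k : ℝ) < N := by exact_mod_cast hk
        refine mul_le_of_le_one_left (norm_nonneg _) ?_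
        rw [Real.norm_eq_abs, abs_le]
        have i1 : (k : ℝ) / N ≤ 1 := (div_le_one hN0).2 hk'.le
        have i2 : (0 : ℝ) ≤ k / N := by positivity
        constructor <;> linarith)
      (fun k hk => hdot y k hk.le 0 (Nat.zero_le _) (-q) (norm_neg _))
    rw [norm_neg, smul_neg, hNq, add_neg_cancel, add_zero] at this
    have h6 := hfin (L.δ c y ⬝ᵥ (-q))
    have h7 : N * (L.δ c y ⬝ᵥ (-q)) = - (L.δ c y ⬝ᵥ e) := by
      conv_rhs => rw [← hNq, dotProduct_smul, smul_eq_mul]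
      rw [dotProduct_neg]; ring
    linarith
  · obtain ⟨z, hz⟩ := (L.ψ_surj c).iterate N y
    have := L.perturb hone hK h3 hδ z 0 q hqs N (W := ‖e‖)
      (b := L.δ c y ⬝ᵥ q + n * (4 * L.C * (s * t * (s * t)))) (fun k hk => by
        have hk' : (k : ℝ) < N := by exact_mod_cast hk
        rw [zero_add, hq, smul_smul, norm_smul]
        refine mul_le_of_le_one_left (norm_nonneg _) ?_
        rw [Real.norm_eq_abs, abs_of_nonneg (by positivity), ← div_eq_mul_inv]
        exact (div_le_one hN0).2 hk'.le)
      (fun k hk => by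
        have := hdot z k hk.le N le_rfl q rfl
        rwa [hz] at this)
    rw [hz, zero_add, hNq, add_zero] at this
    have h6 := hfin (L.δ c y ⬝ᵥ q)
    have h7 : N * (L.δ c y ⬝ᵥ q) = L.δ c y ⬝ᵥ e := by
      conv_rhs => rw [← hNq, dotProduct_smul, smul_eq_mul]
    linarith

end LocalModel

lemma norm_le_of_forall_dotProduct_single {n : ℕ} {u : E n} {b : ℝ} (hb : 0 ≤ b)
    (h : ∀ i, |u ⬝ᵥ Pi.single i 1| ≤ b) : ‖u‖ ≤ b := by
  refine (pi_norm_le_iff_of_nonneg hb).2 fun i => ?_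
  simpa using h i

namespace LocalModel

variable {n : ℕ} (L : LocalModel n)

lemma holder : ∃ K > 0, ∃ s₀ > 0, ∀ c s, 0 < s → s ≤ s₀ → (∀ x, ‖L.δ c x‖ ≤ s) → ∀ x y,
    ‖L.δ c x - L.δ c y‖ ≤ K * (s * Real.sqrt (‖x - y‖ + s)) := by
  obtain ⟨K, hK, s₀, hs₀, ht⟩ := L.taylor
  have h1 : ∀ c s, 0 < s → s ≤ s₀ → (∀ x, ‖L.δ c x‖ ≤ s) → ∀ x y, s ≤ ‖x - y‖ →
      ‖x - y‖ ≤ 1 / 3 → ‖L.δ c x - L.δ c y‖ ≤ 9 * K * (s * Real.sqrt ‖x - y‖) := by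
    intro c s hs hs0 hδ x y h1 h2
    set d := ‖x - y‖ with hd
    have hd0 : 0 < d := hs.trans_le h1
    refine norm_le_of_forall_dotProduct_single (by positivity) fun i => ?_
    set e : E n := (2 * d) • Pi.single i 1 with he
    have hen : ‖e‖ = 2 * d := by
      rw [he, norm_smul, Pi.norm_single]; simp [abs_of_pos hd0]
    have e1 : ‖x - y + e‖ ≤ 3 * d := (norm_add_le _ _).trans (by rw [hen]; linarith)
    have e2 : d ≤ ‖x - y + e‖ := by
      have := norm_sub_norm_le e (-(x - y))
      rw [sub_neg_eq_add, norm_neg, add_comm, hen] at this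
      linarith
    have t1 := abs_le.1 (ht c s hs hs0 hδ x e (by linarith) (by linarith))
    have t2 := abs_le.1 (ht c s hs hs0 hδ y (x - y + e) (by linarith) (by linarith))
    have t3 := abs_le.1 (ht c s hs hs0 hδ y (x - y) h1 (by linarith))
    have i1 : y + (x - y + e) = x + e := by abel
    have i2 : y + (x - y) = x := by abel
    rw [i1, dotProduct_add] at t2
    rw [i2] at t3
    have hsq : Real.sqrt (3 * d) ≤ 2 * Real.sqrt d := by
      rw [Real.sqrt_le_left (by positivity), mul_pow, Real.sq_sqrt hd0.le]; linarith
    have hb : ∀ v : E n, ‖v‖ ≤ 3 * d →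
        s * (‖v‖ * Real.sqrt ‖v‖) ≤ s * (3 * d * (2 * Real.sqrt d)) :=
      fun v hv => by
        gcongr
        exact (Real.sqrt_le_sqrt hv).trans hsq
    have b1 := mul_le_mul_of_nonneg_left (hb e (by linarith)) hK.le
    have b2 := mul_le_mul_of_nonneg_left (hb _ e1) hK.le
    have b3 := mul_le_mul_of_nonneg_left (hb (x - y) (by linarith)) hK.le
    have hw : (2 * d) * |(L.δ c x - L.δ c y) ⬝ᵥ Pi.single i 1| ≤
        (2 * d) * (9 * K * (s * Real.sqrt d)) := by
      rw [← abs_of_pos (show 0 < 2 * d by positivity), ← abs_mul, ← smul_eq_mul (2 * d),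
        ← dotProduct_smul, ← he, sub_dotProduct, abs_le, abs_of_pos (show 0 < 2 * d by positivity)]
      constructor <;> linarith
    exact le_of_mul_le_mul_left hw (by positivity)
  refine ⟨4 + 36 * K, by positivity, min s₀ (1 / 9), by positivity, fun c s hs hs0 hδ x y => ?_⟩
  simp only [le_min_iff] at hs0
  obtain ⟨h0, h9⟩ := hs0
  set d := ‖x - y‖ with hd
  have hd0 : 0 ≤ d := norm_nonneg _
  have hsp : 0 ≤ s * Real.sqrt (d + s) := by positivity
  rcases le_or_gt d (1 / 3) with h3 | h3
  · rcases le_or_gt s d with h4 | h4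
    · have h5 := h1 c s hs h0 hδ x y h4 h3
      have h6 : s * Real.sqrt d ≤ s * Real.sqrt (d + s) := by gcongr; linarith
      have : K * (s * Real.sqrt d) ≤ K * (s * Real.sqrt (d + s)) := by gcongr
      have : 0 ≤ K * (s * Real.sqrt (d + s)) := by positivity
      linarith
    · rcases Nat.eq_zero_or_pos n with rfl | hn
      · rw [Subsingleton.elim (L.δ c x - L.δ c y) 0, norm_zero]; positivity
      set z : E n := x + (2 * s) • Pi.single ⟨0, hn⟩ 1 with hz
      have z1 : ‖x - z‖ = 2 * s := by
        rw [hz, sub_add_cancel_left, norm_neg, norm_smul, Pi.norm_single]; simp [abs_of_pos hs]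
      have z2 : ‖y - z‖ ≤ 3 * s := by
        have := norm_sub_le (x - z) (x - y)
        rw [sub_sub_sub_cancel_left] at this
        linarith
      have z3 : s ≤ ‖y - z‖ := by
        have := norm_sub_norm_le (x - z) (x - y)
        rw [sub_sub_sub_cancel_left] at this
        linarith
      have h5 := h1 c s hs h0 hδ x z (by linarith) (by linarith)
      have h6 := h1 c s hs h0 hδ y z (by linarith) (by linarith)
      have hsq : ∀ v : ℝ, v ≤ 4 * s → s * Real.sqrt v ≤ s * (2 * Real.sqrt (d + s)) := by
        intro v hv
        gcongr
        rw [Real.sqrt_le_left (by positivity), mul_pow, Real.sq_sqrt (by positivity)]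
        linarith
      have h7 := norm_sub_le (L.δ c x - L.δ c z) (L.δ c y - L.δ c z)
      rw [sub_sub_sub_cancel_right] at h7
      have b1 := mul_le_mul_of_nonneg_left (hsq _ (show ‖x - z‖ ≤ 4 * s by linarith)) hK.le
      have b2 := mul_le_mul_of_nonneg_left (hsq _ (show ‖y - z‖ ≤ 4 * s by linarith)) hK.le
      linarith
  · have h4 : 1 / 2 ≤ Real.sqrt (d + s) := by
      apply Real.le_sqrt_of_sq_le; linarith
    have h5 := norm_sub_le (L.δ c x) (L.δ c y)
    have h6 := hδ x
    have h7 := hδ y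
    have h8 : s * (1 / 2) ≤ s * Real.sqrt (d + s) := by gcongr
    have : 0 ≤ K * (s * Real.sqrt (d + s)) := by positivity
    linarith

lemma energy : ∃ K > 0, ∃ s₀ > 0, ∀ c s, 0 < s → s ≤ s₀ → (∀ x, ‖L.δ c x‖ ≤ s) → ∀ x,
    |L.δ c x ⬝ᵥ L.A x *ᵥ L.δ c x - 2 * L.a c| ≤ K * (s ^ 2 * Real.sqrt s) := by
  have hC := L.C_pos
  have hC1 := L.one_le_C
  have hr0 := L.r₀_pos
  obtain ⟨K, hK, s₀, hs₀, ht⟩ := L.holder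
  refine ⟨2 * (n * (2 * L.C * (K * (2 * L.C))) + n * L.C + L.C ^ 4), by positivity,
    min s₀ (min 1 (L.r₀ / L.C)), by positivity, fun c s hs hs0 hδ x => ?_⟩
  simp only [le_min_iff] at hs0
  obtain ⟨h0, h1, h2⟩ := hs0
  rw [le_div_iff₀ hC] at h2
  have h3 : s ≤ L.r₀ := by nlinarith
  set δ := L.δ c x with hδd
  have hδs : ‖δ‖ ≤ s := hδ x
  have hq : s ≤ Real.sqrt s := by
    apply Real.le_sqrt_of_sq_le; nlinarith
  have hs3 : s ^ 3 ≤ s ^ 2 * Real.sqrt s := by rw [pow_succ]; gcongr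
  have hmv : ∀ v : E n, ‖v‖ ≤ 2 * L.C * s →
      |L.D c (x + v) - L.D c x - δ ⬝ᵥ v| ≤
          n * (2 * L.C * (K * (2 * L.C))) * (s ^ 2 * Real.sqrt s) := by
    intro v hv
    obtain ⟨t, ht1, ht2⟩ := L.D_sub_eq_of_taylor c x v
    rw [ht2, ← sub_dotProduct]
    refine (abs_dotProduct_le _ _).trans ?_
    have e1 := ht c s hs h0 hδ (x + t • v) x
    have e2 : ‖x + t • v - x‖ ≤ 2 * L.C * s := by
      rw [add_sub_cancel_left, norm_smul, Real.norm_eq_abs, abs_of_pos ht1.1]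
      nlinarith [ht1.2, norm_nonneg v]
    have e3 : Real.sqrt (‖x + t • v - x‖ + s) ≤ 2 * L.C * Real.sqrt s := by
      rw [Real.sqrt_le_left (by positivity), mul_pow, Real.sq_sqrt hs.le]
      nlinarith [mul_nonneg (mul_nonneg (sub_nonneg.2 hC1) hC.le) hs.le,
        mul_nonneg (sub_nonneg.2 hC1) hs.le]
    calc (n : ℝ) * (‖L.δ c (x + t • v) - δ‖ * ‖v‖)
        ≤ n * ((K * (s * (2 * L.C * Real.sqrt s))) * (2 * L.C * s)) := by
          gcongr
          exact e1.trans (by gcongr)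
      _ = _ := by ring
  have m1 := abs_le.1 (hmv (L.ψ c x - x) (step_le hδ h3 h1 x))
  have hAn : ‖L.A x *ᵥ δ‖ ≤ L.C * s := (L.A_bdd x δ).trans (by gcongr)
  have m2 := abs_le.1 (hmv (L.A x *ᵥ δ) (by nlinarith))
  rw [add_sub_cancel] at m1
  have hg := L.gain c x (hδs.trans h3)
  have hd := L.dom c x (L.A x *ᵥ δ) (by linarith)
  rw [g_mulVec_A, dotProduct_comm _ δ] at hd
  have e1 : δ ⬝ᵥ (L.ψ c x - x) ≤ δ ⬝ᵥ L.A x *ᵥ δ + n * (s * (L.C * s ^ 2)) := by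
    have i1 : δ ⬝ᵥ (L.ψ c x - x) = δ ⬝ᵥ L.A x *ᵥ δ + δ ⬝ᵥ (L.ψ c x - x - L.A x *ᵥ δ) := by
      rw [dotProduct_sub _ _ (L.A x *ᵥ δ)]; ring
    rw [i1]
    gcongr
    refine (dotProduct_le' _ _).trans ?_
    gcongr
    exact (L.step c x (hδs.trans h3)).trans (by gcongr)
  have e2 : L.C * ‖δ‖ ^ 3 ≤ L.C ^ 4 * s ^ 3 := by
    gcongr
    exact le_self_pow₀ hC1 (by norm_num)
  have e3 : L.C * ‖L.A x *ᵥ δ‖ ^ 3 ≤ L.C ^ 4 * s ^ 3 := by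
    calc _ ≤ L.C * (L.C * s) ^ 3 := by gcongr
      _ = _ := by ring
  have e4 : L.C ^ 4 * s ^ 3 ≤ L.C ^ 4 * (s ^ 2 * Real.sqrt s) := by gcongr
  have e5 : n * (s * (L.C * s ^ 2)) ≤ n * L.C * (s ^ 2 * Real.sqrt s) := by
    calc n * (s * (L.C * s ^ 2)) = n * L.C * s ^ 3 := by ring
      _ ≤ _ := by gcongr
  have e6 : 0 ≤ n * L.C * (s ^ 2 * Real.sqrt s) := by positivity
  change |δ ⬝ᵥ L.A x *ᵥ δ - 2 * L.a c| ≤ _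
  rw [abs_le]
  constructor <;> linarith

end LocalModel

namespace LocalModel

variable {n : ℕ} (L : LocalModel n)

lemma a_nonneg (c : E n) : 0 ≤ L.a c := by
  simpa using L.dom c 0 0 (by simpa using L.r₀_pos.le)

lemma estimates : ∃ K ≥ 1, ∃ ρ > 0, ∀ c, ‖c‖ ≤ ρ →
    (∀ x, ‖L.δ c x‖ ≤ K * ‖c‖) ∧ ‖c‖ ^ 2 ≤ K * L.a c ∧ L.a c ≤ K * ‖c‖ ^ 2 ∧
    (∀ x y, ‖L.δ c x - L.δ c y‖ ≤ K * (‖c‖ * Real.sqrt (‖x - y‖ + K * ‖c‖))) ∧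
    (∀ x, |L.δ c x ⬝ᵥ L.A x *ᵥ L.δ c x - 2 * L.a c| ≤ K * (‖c‖ ^ 2 * Real.sqrt ‖c‖)) ∧
    (∀ x, ‖L.ψ c x - x - L.A x *ᵥ L.δ c x‖ ≤ K * ‖c‖ ^ 2) ∧
    (∀ x, ‖L.ψ c x - x‖ ≤ K * ‖c‖) ∧
    (∀ x, L.a c ≤ L.D c (L.ψ c x) - L.D c x) := by
  have hC := L.C_pos
  have hκ := L.κ_pos
  have hr := L.r₀_pos
  obtain ⟨K₁, hK₁, ρ₁, hρ₁, h₁⟩ := L.harnack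
  obtain ⟨K₂, hK₂, s₂, hs₂, h₂⟩ := L.holder
  obtain ⟨K₃, hK₃, s₃, hs₃, h₃⟩ := L.energy
  have hK₁0 : 0 < K₁ := by linarith
  set m := min (min L.r₀ 1) (min (L.κ / (16 * L.C)) (min s₂ s₃)) with hm
  have hm0 : 0 < m := by positivity
  set K := K₁ + K₂ * K₁ + K₃ * (K₁ ^ 2 * Real.sqrt K₁) + L.C * K₁ ^ 2 + 2 * L.C * K₁ with hK
  have k1 : K₁ ≤ K := by
    rw [hK]; have : 0 ≤ K₂ * K₁ + K₃ * (K₁ ^ 2 * Real.sqrt K₁) + L.C * K₁ ^ 2 + 2 * L.C * K₁ := by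
      positivity
    linarith
  have k2 : K₂ * K₁ ≤ K := by
    rw [hK]; have : 0 ≤ K₁ + K₃ * (K₁ ^ 2 * Real.sqrt K₁) + L.C * K₁ ^ 2 + 2 * L.C * K₁ := by
      positivity
    linarith
  have k3 : K₃ * (K₁ ^ 2 * Real.sqrt K₁) ≤ K := by
    rw [hK]; have : 0 ≤ K₁ + K₂ * K₁ + L.C * K₁ ^ 2 + 2 * L.C * K₁ := by positivity
    linarith
  have k4 : L.C * K₁ ^ 2 ≤ K := by
    rw [hK]; have : 0 ≤ K₁ + K₂ * K₁ + K₃ * (K₁ ^ 2 * Real.sqrt K₁) + 2 * L.C * K₁ := by positivity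
    linarith
  have k5 : 2 * L.C * K₁ ≤ K := by
    rw [hK]; have : 0 ≤ K₁ + K₂ * K₁ + K₃ * (K₁ ^ 2 * Real.sqrt K₁) + L.C * K₁ ^ 2 := by positivity
    linarith
  refine ⟨K, by linarith, min ρ₁ (m / K₁), by positivity, fun c hc => ?_⟩
  obtain ⟨hc1, hc2⟩ := le_min_iff.1 hc
  rw [le_div_iff₀ hK₁0, mul_comm] at hc2
  obtain ⟨i1, i2, i3⟩ := h₁ c hc1
  have hc0 := norm_nonneg c
  have hcm := hc2
  simp only [hm, le_min_iff] at hcm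
  obtain ⟨⟨m1, m2⟩, m3, m4, m5⟩ := hcm
  have hA := L.a_nonneg c
  have hstep : ∀ x, ‖L.ψ c x - x - L.A x *ᵥ L.δ c x‖ ≤ K * ‖c‖ ^ 2 := fun x => by
    refine (L.step c x ((i1 x).trans m1)).trans ?_
    calc L.C * ‖L.δ c x‖ ^ 2 ≤ L.C * (K₁ * ‖c‖) ^ 2 := by gcongr; exact i1 x
      _ = L.C * K₁ ^ 2 * ‖c‖ ^ 2 := by ring
      _ ≤ _ := by gcongr
  refine ⟨fun x => (i1 x).trans (by gcongr), ?_, i3.trans (by gcongr), ?_, ?_, hstep, ?_, ?_⟩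
  · rcases eq_or_ne c 0 with h | h
    · rw [h]; simp only [norm_zero]; rw [zero_pow two_ne_zero, ← h]; positivity
    · exact (i2 h).trans (by gcongr)
  · intro x y
    rcases hc0.eq_or_lt with h | h
    · rw [norm_eq_zero.1 h.symm, L.δ_zero, L.δ_zero]; simp
    · refine (h₂ c (K₁ * ‖c‖) (by positivity) m4 i1 x y).trans ?_
      rw [mul_assoc K₁, ← mul_assoc K₂]
      gcongr
  · intro x
    rcases hc0.eq_or_lt with h | h
    · have : L.a c ≤ 0 := by simpa [← h] using i3
      rw [le_antisymm this hA, norm_eq_zero.1 h.symm, L.δ_zero]; simp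
    · refine (h₃ c (K₁ * ‖c‖) (by positivity) m5 i1 x).trans ?_
      calc _ = K₃ * (K₁ ^ 2 * Real.sqrt K₁) * (‖c‖ ^ 2 * Real.sqrt ‖c‖) := by
            rw [Real.sqrt_mul hK₁0.le]; ring
        _ ≤ _ := by gcongr
  · intro x
    refine (step_le i1 m1 m2 x).trans ?_
    rw [← mul_assoc]
    gcongr
  · intro x
    have := L.a_le_gain (c := c) (x := x) ((i1 x).trans m1) ((i1 x).trans m3)
    have : 0 ≤ L.κ / 4 * ‖L.δ c x‖ ^ 2 := by positivity
    linarith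

/-- A constant for which the basic estimates on small leaves hold. -/
def K : ℝ := L.estimates.choose

/-- Leaves with class of norm at most this radius satisfy the basic estimates. -/
def ρ : ℝ := L.estimates.choose_spec.2.choose

lemma one_le_K : 1 ≤ L.K := L.estimates.choose_spec.1
lemma K_pos : 0 < L.K := zero_lt_one.trans_le L.one_le_K
lemma ρ_pos : 0 < L.ρ := L.estimates.choose_spec.2.choose_spec.1

variable {L} {c : E n}

lemma est_δ (hc : ‖c‖ ≤ L.ρ) (x : E n) : ‖L.δ c x‖ ≤ L.K * ‖c‖ :=
  (L.estimates.choose_spec.2.choose_spec.2 c hc).1 x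
lemma est_le_a (hc : ‖c‖ ≤ L.ρ) : ‖c‖ ^ 2 ≤ L.K * L.a c :=
  (L.estimates.choose_spec.2.choose_spec.2 c hc).2.1
lemma est_a_le (hc : ‖c‖ ≤ L.ρ) : L.a c ≤ L.K * ‖c‖ ^ 2 :=
  (L.estimates.choose_spec.2.choose_spec.2 c hc).2.2.1
lemma est_holder (hc : ‖c‖ ≤ L.ρ) (x y : E n) :
    ‖L.δ c x - L.δ c y‖ ≤ L.K * (‖c‖ * Real.sqrt (‖x - y‖ + L.K * ‖c‖)) :=
  (L.estimates.choose_spec.2.choose_spec.2 c hc).2.2.2.1 x y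
lemma est_energy (hc : ‖c‖ ≤ L.ρ) (x : E n) :
    |L.δ c x ⬝ᵥ L.A x *ᵥ L.δ c x - 2 * L.a c| ≤ L.K * (‖c‖ ^ 2 * Real.sqrt ‖c‖) :=
  (L.estimates.choose_spec.2.choose_spec.2 c hc).2.2.2.2.1 x
lemma est_step (hc : ‖c‖ ≤ L.ρ) (x : E n) : ‖L.ψ c x - x - L.A x *ᵥ L.δ c x‖ ≤ L.K * ‖c‖ ^ 2 :=
  (L.estimates.choose_spec.2.choose_spec.2 c hc).2.2.2.2.2.1 x
lemma est_disp (hc : ‖c‖ ≤ L.ρ) (x : E n) : ‖L.ψ c x - x‖ ≤ L.K * ‖c‖ :=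
  (L.estimates.choose_spec.2.choose_spec.2 c hc).2.2.2.2.2.2.1 x
lemma est_gain (hc : ‖c‖ ≤ L.ρ) (x : E n) : L.a c ≤ L.D c (L.ψ c x) - L.D c x :=
  (L.estimates.choose_spec.2.choose_spec.2 c hc).2.2.2.2.2.2.2 x

end LocalModel

lemma exists_tendsto_of_bounded {G : Type*} [NormedAddCommGroup G] [ProperSpace G]
    (𝓤 : Ultrafilter ℝ) {f : ℝ → G} {M : ℝ} (h : ∀ᶠ s in (𝓤 : Filter ℝ), ‖f s‖ ≤ M) :
    ∃ y, Tendsto f 𝓤 (𝓝 y) := by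
  obtain ⟨y, -, hy⟩ := (isCompact_closedBall (0 : G) M).ultrafilter_le_nhds (𝓤.map f) (by
    exact le_principal_iff.2 (h.mono fun s hs => by simpa using hs : ∀ᶠ s in (𝓤 : Filter ℝ), _))
  exact ⟨y, hy⟩

lemma eventually_forall_of_seq {n : ℕ} (𝓤 : Ultrafilter ℝ) {P : ℝ → E n → Prop}
    (hper : ∀ s x (m : Fin n → ℤ), P s (x + intVec m) → P s x)
    (h : ∀ (x : ℝ → E n) (x₀ : E n), Tendsto x 𝓤 (𝓝 x₀) → ∀ᶠ s in (𝓤 : Filter ℝ), P s (x s)) :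
    ∀ᶠ s in (𝓤 : Filter ℝ), ∀ x, P s x := by
  have hx : ∀ s, ∃ x ∈ Set.Icc (0 : E n) 1, (∃ y, ¬ P s y) → ¬ P s x := by
    intro s
    by_cases hy : ∃ y, ¬ P s y
    · obtain ⟨y, hy⟩ := hy
      obtain ⟨m, hm⟩ := exists_intVec_sub_mem_Icc y
      refine ⟨_, hm, fun _ hP => hy (hper s y (-m) ?_)⟩
      rwa [intVec_neg, ← sub_eq_add_neg]
    · exact ⟨0, by simp, fun h' => absurd h' hy⟩
  choose x hx hP using hx
  obtain ⟨x₀, h0⟩ := exists_tendsto_of_bounded 𝓤 (f := x) (M := 1)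
    (Eventually.of_forall fun s => norm_le_one_of_mem_Icc (hx s))
  filter_upwards [h x x₀ h0] with s hs y
  by_contra hy
  exact hP s ⟨y, hy⟩ hs

namespace LocalModel

variable {n : ℕ} {L : LocalModel n}

lemma A_cont (L : LocalModel n) : Continuous L.A := by
  refine continuous_matrix fun i j => ?_
  have hb : ∀ x y, ‖L.A x i j - L.A y i j‖ ≤ L.C * ‖x - y‖ := by
    intro x y
    have h1 := L.A_lip x y (Pi.single j 1)
    have h2 := norm_le_pi_norm ((L.A x - L.A y) *ᵥ Pi.single j 1) i
    rw [Matrix.mulVec_single_one] at h1 h2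
    have h3 : ‖(Pi.single j 1 : E n)‖ = 1 := by rw [Pi.norm_single]; simp
    rw [h3, mul_one] at h1
    exact le_trans (by simpa [Matrix.col] using h2) h1
  exact (LipschitzWith.of_dist_le' (K := L.C)
    fun x y => by simpa only [dist_eq_norm] using hb x y).continuous

lemma tendsto_A_mulVec (L : LocalModel n) {l : Filter ℝ} {x v : ℝ → E n} {x₀ v₀ : E n}
    (hx : Tendsto x l (𝓝 x₀)) (hv : Tendsto v l (𝓝 v₀)) :
    Tendsto (fun s => L.A (x s) *ᵥ v s) l (𝓝 (L.A x₀ *ᵥ v₀)) := by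
  have hc : Continuous fun q : E n × E n => L.A q.1 *ᵥ q.2 :=
    (L.A_cont.comp continuous_fst).matrix_mulVec continuous_snd
  exact (hc.tendsto (x₀, v₀)).comp (hx.prodMk_nhds hv)

end LocalModel

lemma tendsto_dotProduct {n : ℕ} {l : Filter ℝ} {u v : ℝ → E n} {u₀ v₀ : E n}
    (hu : Tendsto u l (𝓝 u₀)) (hv : Tendsto v l (𝓝 v₀)) :
    Tendsto (fun s => u s ⬝ᵥ v s) l (𝓝 (u₀ ⬝ᵥ v₀)) := by
  have hc : Continuous fun q : E n × E n => q.1 ⬝ᵥ q.2 :=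
    continuous_fst.dotProduct continuous_snd
  exact (hc.tendsto (u₀, v₀)).comp (hu.prodMk_nhds hv)

namespace LocalModel

variable {n : ℕ} {L : LocalModel n}

/-- The family of leaves `c s`, rescaled by `s⁻¹`, converges along the ultrafilter `𝓤` to a leaf
with class `η`, momentum `p` and energy `e`. -/
structure IsLeaf (L : LocalModel n) (𝓤 : Ultrafilter ℝ) (c : ℝ → E n) (η : E n)
    (p : E n → E n) (e : ℝ) : Prop where
  small : (𝓤 : Filter ℝ) ≤ 𝓝[>] 0
  lim : Tendsto (fun s => s⁻¹ • c s) 𝓤 (𝓝 η)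
  conv : ∀ (x : ℝ → E n) (x₀ : E n), Tendsto x 𝓤 (𝓝 x₀) →
    Tendsto (fun s => s⁻¹ • L.δ (c s) (x s)) 𝓤 (𝓝 (p x₀))
  act : Tendsto (fun s => s⁻¹ ^ 2 * L.a (c s)) 𝓤 (𝓝 e)

lemma eventually_pos {𝓤 : Ultrafilter ℝ} (h : (𝓤 : Filter ℝ) ≤ 𝓝[>] 0) :
    ∀ᶠ s in (𝓤 : Filter ℝ), 0 < s := h self_mem_nhdsWithin

lemma tendsto_zero {𝓤 : Ultrafilter ℝ} (h : (𝓤 : Filter ℝ) ≤ 𝓝[>] 0) :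
    Tendsto (fun s : ℝ => s) 𝓤 (𝓝 0) := h.trans nhdsWithin_le_nhds

lemma eventually_norm_le_ρ {𝓤 : Ultrafilter ℝ} (h : (𝓤 : Filter ℝ) ≤ 𝓝[>] 0) {c : ℝ → E n}
    {R : ℝ} (hR : ∀ᶠ s in (𝓤 : Filter ℝ), ‖c s‖ ≤ R * s) :
    ∀ᶠ s in (𝓤 : Filter ℝ), ‖c s‖ ≤ L.ρ := by
  have : Tendsto (fun s : ℝ => R * s) 𝓤 (𝓝 0) := by
    simpa using (tendsto_zero h).const_mul R
  filter_upwards [hR, this.eventually (ge_mem_nhds L.ρ_pos)] with s h1 h2 using h1.trans h2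

lemma exists_isLeaf {𝓤 : Ultrafilter ℝ} (h : (𝓤 : Filter ℝ) ≤ 𝓝[>] 0) {c : ℝ → E n} {R : ℝ}
    (hR : ∀ᶠ s in (𝓤 : Filter ℝ), ‖c s‖ ≤ R * s) : ∃ η p e, IsLeaf L 𝓤 c η p e := by
  have hpos := eventually_pos h
  have hρ := eventually_norm_le_ρ (L := L) h hR
  have hK := L.K_pos
  obtain ⟨η, hη⟩ := exists_tendsto_of_bounded 𝓤 (f := fun s => s⁻¹ • c s) (M := R) (by
    filter_upwards [hR, hpos] with s h1 h2
    rw [norm_smul, norm_inv, Real.norm_of_nonneg h2.le, inv_mul_le_iff₀ h2]; linarith)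
  have hp : ∀ x, ∃ y, Tendsto (fun s => s⁻¹ • L.δ (c s) x) 𝓤 (𝓝 y) := fun x =>
    exists_tendsto_of_bounded 𝓤 (M := L.K * R) (by
      filter_upwards [hR, hpos, hρ] with s h1 h2 h3
      rw [norm_smul, norm_inv, Real.norm_of_nonneg h2.le, inv_mul_le_iff₀ h2]
      nlinarith [est_δ h3 x])
  choose p hp using hp
  obtain ⟨e, he⟩ := exists_tendsto_of_bounded 𝓤 (f := fun s => s⁻¹ ^ 2 * L.a (c s))
    (M := L.K * R ^ 2) (by
    filter_upwards [hR, hpos, hρ] with s h1 h2 h3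
    rw [inv_pow, Real.norm_of_nonneg (mul_nonneg (by positivity) (L.a_nonneg _)),
      inv_mul_le_iff₀ (by positivity)]
    have := pow_le_pow_left₀ (norm_nonneg _) h1 2
    nlinarith [est_a_le h3])
  refine ⟨η, p, e, h, hη, fun x x₀ hx => ?_, he⟩
  have h0 : Tendsto (fun s => s⁻¹ • L.δ (c s) (x s) - s⁻¹ • L.δ (c s) x₀) 𝓤 (𝓝 0) := by
    have hlim : Tendsto (fun s => L.K * (R * Real.sqrt (‖x s - x₀‖ + L.K * (R * s)))) 𝓤 (𝓝 0) := by
      have h1 : Tendsto (fun s => ‖x s - x₀‖ + L.K * (R * s)) 𝓤 (𝓝 0) := by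
        have := ((hx.sub_const x₀).norm).add (((tendsto_zero h).const_mul R).const_mul L.K)
        simpa using this
      have h2 := ((Real.continuous_sqrt.tendsto 0).comp h1).const_mul R |>.const_mul L.K
      simpa using h2
    refine squeeze_zero_norm' ?_ hlim
    filter_upwards [hR, hpos, hρ] with s h1 h2 h3
    rw [← smul_sub, norm_smul, norm_inv, Real.norm_of_nonneg h2.le, inv_mul_le_iff₀ h2]
    have hh := est_holder h3 (x s) x₀
    calc _ ≤ L.K * (‖c s‖ * Real.sqrt (‖x s - x₀‖ + L.K * ‖c s‖)) := hh
      _ ≤ L.K * ((R * s) * Real.sqrt (‖x s - x₀‖ + L.K * (R * s))) := by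
        have := (norm_nonneg _).trans h1
        gcongr
      _ = _ := by ring
  simpa using h0.add (hp x₀)

namespace IsLeaf

variable {𝓤 : Ultrafilter ℝ} {c : ℝ → E n} {η : E n} {p : E n → E n} {e : ℝ}

lemma eventually_le (h : IsLeaf L 𝓤 c η p e) :
    ∀ᶠ s in (𝓤 : Filter ℝ), ‖c s‖ ≤ (‖η‖ + 1) * s := by
  filter_upwards [eventually_pos h.small,
    h.lim.norm.eventually (ge_mem_nhds (lt_add_one ‖η‖))] with s h1 h2
  rwa [norm_smul, norm_inv, Real.norm_of_nonneg h1.le, inv_mul_le_iff₀ h1, mul_comm] at h2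

lemma eventually_ρ (h : IsLeaf L 𝓤 c η p e) : ∀ᶠ s in (𝓤 : Filter ℝ), ‖c s‖ ≤ L.ρ :=
  eventually_norm_le_ρ h.small h.eventually_le

lemma tendsto_norm (h : IsLeaf L 𝓤 c η p e) : Tendsto (fun s => ‖c s‖) 𝓤 (𝓝 0) := by
  refine squeeze_zero' (Eventually.of_forall fun s => norm_nonneg _) h.eventually_le ?_
  simpa using (tendsto_zero h.small).const_mul (‖η‖ + 1)

lemma tendsto_inv_norm (h : IsLeaf L 𝓤 c η p e) : Tendsto (fun s => s⁻¹ * ‖c s‖) 𝓤 (𝓝 ‖η‖) := by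
  refine h.lim.norm.congr' ?_
  filter_upwards [eventually_pos h.small] with s hs
  rw [norm_smul, norm_inv, Real.norm_of_nonneg hs.le]

lemma conv_const (h : IsLeaf L 𝓤 c η p e) (x : E n) :
    Tendsto (fun s => s⁻¹ • L.δ (c s) x) 𝓤 (𝓝 (p x)) := h.conv _ x tendsto_const_nhds

lemma norm_p_le (h : IsLeaf L 𝓤 c η p e) (x : E n) : ‖p x‖ ≤ L.K * ‖η‖ := by
  refine le_of_tendsto_of_tendsto (h.conv_const x).norm (h.tendsto_inv_norm.const_mul L.K) ?_
  filter_upwards [eventually_pos h.small, h.eventually_ρ] with s h1 h2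
  rw [norm_smul, norm_inv, Real.norm_of_nonneg h1.le, inv_mul_le_iff₀ h1]
  calc _ ≤ _ := est_δ h2 x
    _ = _ := by field_simp

lemma p_holder (h : IsLeaf L 𝓤 c η p e) (x y : E n) :
    ‖p x - p y‖ ≤ L.K * ‖η‖ * Real.sqrt ‖x - y‖ := by
  have h1 : Tendsto (fun s => L.K * (s⁻¹ * ‖c s‖) * Real.sqrt (‖x - y‖ + L.K * ‖c s‖)) 𝓤
      (𝓝 (L.K * ‖η‖ * Real.sqrt ‖x - y‖)) := by
    have := (Real.continuous_sqrt.tendsto _).comp ((h.tendsto_norm.const_mul L.K).const_add ‖x - y‖)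
    simpa using (h.tendsto_inv_norm.const_mul L.K).mul this
  refine le_of_tendsto_of_tendsto ((h.conv_const x).sub (h.conv_const y)).norm h1 ?_
  filter_upwards [eventually_pos h.small, h.eventually_ρ] with s h1 h2
  rw [← smul_sub, norm_smul, norm_inv, Real.norm_of_nonneg h1.le, inv_mul_le_iff₀ h1]
  calc _ ≤ _ := est_holder h2 x y
    _ = _ := by field_simp

lemma p_per (h : IsLeaf L 𝓤 c η p e) (x : E n) (m : Fin n → ℤ) : p (x + intVec m) = p x :=
  tendsto_nhds_unique (h.conv_const (x + intVec m)) (by simpa [L.δ_per] using h.conv_const x)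

lemma p_cont (h : IsLeaf L 𝓤 c η p e) : Continuous p := by
  refine continuous_iff_continuousAt.2 fun x => tendsto_iff_norm_sub_tendsto_zero.2 ?_
  have hc : Continuous fun y => L.K * ‖η‖ * Real.sqrt ‖y - x‖ := by fun_prop
  refine squeeze_zero (fun y => norm_nonneg _) (fun y => h.p_holder y x) ?_
  simpa using hc.tendsto x

lemma energy (h : IsLeaf L 𝓤 c η p e) (x : E n) : p x ⬝ᵥ L.A x *ᵥ p x = 2 * e := by
  have h1 := tendsto_dotProduct (h.conv_const x)
    (L.tendsto_A_mulVec (tendsto_const_nhds (x := x)) (h.conv_const x))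
  refine tendsto_nhds_unique h1 ?_
  have h2 : Tendsto (fun s => L.K * ((s⁻¹ * ‖c s‖) ^ 2 * Real.sqrt ‖c s‖)) 𝓤 (𝓝 0) := by
    have := (h.tendsto_inv_norm.pow 2).mul ((Real.continuous_sqrt.tendsto _).comp h.tendsto_norm)
    simpa using this.const_mul L.K
  have h3 : Tendsto (fun s => (s⁻¹ • L.δ (c s) x) ⬝ᵥ L.A x *ᵥ (s⁻¹ • L.δ (c s) x)
      - 2 * (s⁻¹ ^ 2 * L.a (c s))) 𝓤 (𝓝 0) := by
    refine squeeze_zero_norm' ?_ h2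
    filter_upwards [h.eventually_ρ] with s hs
    have h4 : (s⁻¹ • L.δ (c s) x) ⬝ᵥ L.A x *ᵥ (s⁻¹ • L.δ (c s) x) - 2 * (s⁻¹ ^ 2 * L.a (c s))
        = s⁻¹ ^ 2 * (L.δ (c s) x ⬝ᵥ L.A x *ᵥ L.δ (c s) x - 2 * L.a (c s)) := by
      rw [Matrix.mulVec_smul, smul_dotProduct, dotProduct_smul, smul_eq_mul, smul_eq_mul]; ring
    rw [h4, norm_mul, Real.norm_of_nonneg (sq_nonneg s⁻¹), Real.norm_eq_abs]
    calc _ ≤ s⁻¹ ^ 2 * (L.K * (‖c s‖ ^ 2 * Real.sqrt ‖c s‖)) := by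
          gcongr; exact est_energy hs x
      _ = _ := by ring
  simpa using h3.add (h.act.const_mul 2)

lemma sq_norm_le (h : IsLeaf L 𝓤 c η p e) : ‖η‖ ^ 2 ≤ L.K * e := by
  refine le_of_tendsto_of_tendsto (h.tendsto_inv_norm.pow 2) (h.act.const_mul L.K) ?_
  filter_upwards [h.eventually_ρ] with s hs
  have := mul_le_mul_of_nonneg_left (est_le_a hs) (sq_nonneg s⁻¹)
  linarith [mul_pow s⁻¹ ‖c s‖ 2, mul_left_comm L.K (s⁻¹ ^ 2) (L.a (c s))]

lemma le_sq_norm (h : IsLeaf L 𝓤 c η p e) : e ≤ L.K * ‖η‖ ^ 2 := by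
  refine le_of_tendsto_of_tendsto h.act ((h.tendsto_inv_norm.pow 2).const_mul L.K) ?_
  filter_upwards [h.eventually_ρ] with s hs
  have := mul_le_mul_of_nonneg_left (est_a_le hs) (sq_nonneg s⁻¹)
  linarith [mul_pow s⁻¹ ‖c s‖ 2, mul_left_comm L.K (s⁻¹ ^ 2) (‖c s‖ ^ 2)]

lemma step_conv (h : IsLeaf L 𝓤 c η p e) {x : ℝ → E n} {x₀ : E n} (hx : Tendsto x 𝓤 (𝓝 x₀)) :
    Tendsto (fun s => s⁻¹ • (L.ψ (c s) (x s) - x s)) 𝓤 (𝓝 (L.A x₀ *ᵥ p x₀)) := by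
  have h1 := L.tendsto_A_mulVec hx (h.conv x x₀ hx)
  have h2 : Tendsto (fun s => L.K * (s⁻¹ * ‖c s‖ * ‖c s‖)) 𝓤 (𝓝 0) := by
    simpa using (h.tendsto_inv_norm.mul h.tendsto_norm).const_mul L.K
  have h3 : Tendsto (fun s => s⁻¹ • (L.ψ (c s) (x s) - x s)
      - L.A (x s) *ᵥ (s⁻¹ • L.δ (c s) (x s))) 𝓤 (𝓝 0) := by
    refine squeeze_zero_norm' ?_ h2
    filter_upwards [eventually_pos h.small, h.eventually_ρ] with s h1 h2
    rw [Matrix.mulVec_smul, ← smul_sub, norm_smul, norm_inv, Real.norm_of_nonneg h1.le]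
    calc _ ≤ s⁻¹ * (L.K * ‖c s‖ ^ 2) := by gcongr; exact est_step h2 _
      _ = _ := by ring
  simpa using h3.add h1

lemma exists_primitive (h : IsLeaf L 𝓤 c η p e) : ∃ S : E n → ℝ,
    (∀ x, HasFDerivAt S (dotProductBilin ℝ ℝ (p x)).toContinuousLinearMap x) ∧
    (∀ x (m : Fin n → ℤ), S (x + intVec m) = S x + η ⬝ᵥ intVec m) ∧
    (∀ x y, |S y - S x - p x ⬝ᵥ (y - x)| ≤
      n * (L.K * ‖η‖ * Real.sqrt ‖y - x‖ * ‖y - x‖)) ∧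
    ∀ x y, Tendsto (fun s => s⁻¹ * (L.D (c s) y - L.D (c s) x)) 𝓤 (𝓝 (S y - S x)) := by
  have hS : ∀ x, ∃ y, Tendsto (fun s => s⁻¹ * (L.D (c s) x - L.D (c s) 0)) 𝓤 (𝓝 y) := fun x =>
    exists_tendsto_of_bounded 𝓤 (M := n * (L.K * (‖η‖ + 1) * ‖x‖)) (by
      filter_upwards [eventually_pos h.small, h.eventually_le, h.eventually_ρ] with s h1 h2 h3
      obtain ⟨t, -, ht⟩ := L.D_sub_eq_of_taylor (c s) 0 x
      rw [zero_add] at ht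
      rw [ht, norm_mul, norm_inv, Real.norm_of_nonneg h1.le, inv_mul_le_iff₀ h1]
      calc _ ≤ _ := abs_dotProduct_le _ _
        _ ≤ n * ((L.K * ((‖η‖ + 1) * s)) * ‖x‖) := by
          gcongr
          exact (est_δ h3 _).trans (mul_le_mul_of_nonneg_left h2 L.K_pos.le)
        _ = _ := by ring)
  choose S hS using hS
  have hD : ∀ x y, Tendsto (fun s => s⁻¹ * (L.D (c s) y - L.D (c s) x)) 𝓤 (𝓝 (S y - S x)) := by
    intro x y
    refine ((hS y).sub (hS x)).congr fun s => by ring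
  have hT : ∀ x y, |S y - S x - p x ⬝ᵥ (y - x)| ≤
      n * (L.K * ‖η‖ * Real.sqrt ‖y - x‖ * ‖y - x‖) := by
    intro x y
    have h1 : Tendsto (fun s => n * (L.K * (s⁻¹ * ‖c s‖) *
        Real.sqrt (‖y - x‖ + L.K * ‖c s‖) * ‖y - x‖)) 𝓤
        (𝓝 (n * (L.K * ‖η‖ * Real.sqrt ‖y - x‖ * ‖y - x‖))) := by
      have := (Real.continuous_sqrt.tendsto _).comp
        ((h.tendsto_norm.const_mul L.K).const_add ‖y - x‖)
      simpa using (((h.tendsto_inv_norm.const_mul L.K).mul this).mul_const ‖y - x‖).const_mul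
        (n : ℝ)
    refine le_of_tendsto_of_tendsto ((hD x y).sub (tendsto_dotProduct (h.conv_const x)
      (tendsto_const_nhds (x := y - x)))).abs h1 ?_
    filter_upwards [eventually_pos h.small, h.eventually_ρ] with s h1 h2
    obtain ⟨t, ht0, ht⟩ := L.D_sub_eq_of_taylor (c s) x (y - x)
    rw [add_sub_cancel] at ht
    rw [ht, smul_dotProduct, smul_eq_mul, ← mul_sub, ← sub_dotProduct, abs_mul, abs_inv,
      abs_of_pos h1, inv_mul_le_iff₀ h1]
    calc _ ≤ _ := abs_dotProduct_le _ _
      _ ≤ n * ((L.K * (‖c s‖ * Real.sqrt (‖y - x‖ + L.K * ‖c s‖))) * ‖y - x‖) := by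
        gcongr
        refine (est_holder h2 _ _).trans ?_
        have hK := L.K_pos
        gcongr
        rw [add_sub_cancel_left, norm_smul, Real.norm_of_nonneg ht0.1.le]
        exact mul_le_of_le_one_left (norm_nonneg _) ht0.2.le
      _ = _ := by field_simp
  refine ⟨S, fun x => ?_, fun x m => ?_, hT, hD⟩
  · rw [hasFDerivAt_iff_isLittleO]
    refine Asymptotics.IsLittleO.of_bound fun ε hε => ?_
    have hc : Continuous fun y => n * (L.K * ‖η‖ * Real.sqrt ‖y - x‖) := by fun_prop
    have h0 : Tendsto (fun y => n * (L.K * ‖η‖ * Real.sqrt ‖y - x‖)) (𝓝 x) (𝓝 0) := by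
      simpa using hc.tendsto x
    filter_upwards [h0.eventually (ge_mem_nhds hε)] with y hy
    have := hT x y
    calc _ ≤ n * (L.K * ‖η‖ * Real.sqrt ‖y - x‖) * ‖y - x‖ := by
          simpa [mul_assoc] using this
      _ ≤ _ := by gcongr
  · have h1 := hD x (x + intVec m)
    have h2 : Tendsto (fun s => s⁻¹ * (L.D (c s) (x + intVec m) - L.D (c s) x)) 𝓤
        (𝓝 (η ⬝ᵥ intVec m)) := by
      refine (tendsto_dotProduct h.lim (tendsto_const_nhds (x := intVec m))).congr fun s => ?_
      rw [L.D_per, smul_dotProduct, smul_eq_mul]; ring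
    linarith [tendsto_nhds_unique h1 h2]

end IsLeaf

end LocalModel

namespace LocalModel

variable {n : ℕ} {L : LocalModel n}

lemma ψ_per (L : LocalModel n) (c x : E n) (m : Fin n → ℤ) :
    L.ψ c (x + intVec m) = L.ψ c x + intVec m := by
  have h := L.Ψ_leaf c (x + intVec m)
  rw [L.δ_per, L.Ψ_per, L.Ψ_leaf] at h
  simpa using (congrArg Prod.fst h).symm

lemma iterate_disp_le {c : E n} (hc : ‖c‖ ≤ L.ρ) (x : E n) (N : ℕ) :
    ‖(L.ψ c)^[N] x - x‖ ≤ N * (L.K * ‖c‖) := by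
  induction N with
  | zero => simp
  | succ N ih =>
    rw [Function.iterate_succ_apply']
    have := norm_sub_le_norm_sub_add_norm_sub (L.ψ c ((L.ψ c)^[N] x)) ((L.ψ c)^[N] x) x
    push_cast
    linarith [est_disp hc ((L.ψ c)^[N] x)]

/-- The average of `f` over the first `N` points of the orbit of `x` on the leaf `c`. -/
def avg (L : LocalModel n) (c : E n) (N : ℕ) (f : E n → ℝ) (x : E n) : ℝ :=
  (∑ k ∈ Finset.range N, f ((L.ψ c)^[k] x)) / N

section avg

variable {c : E n} {N : ℕ} {f g : E n → ℝ}

lemma avg_mono (h : ∀ x, f x ≤ g x) (x : E n) : L.avg c N f x ≤ L.avg c N g x := by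
  unfold avg
  gcongr
  exact h _

lemma avg_const (hN : 0 < N) (a : ℝ) (x : E n) : L.avg c N (fun _ => a) x = a := by
  simp [avg, hN.ne']

lemma avg_add (x : E n) :
    L.avg c N (fun y => f y + g y) x = L.avg c N f x + L.avg c N g x := by
  simp [avg, Finset.sum_add_distrib, add_div]

lemma avg_mul (a : ℝ) (x : E n) : L.avg c N (fun y => a * f y) x = a * L.avg c N f x := by
  simp [avg, ← Finset.mul_sum, mul_div_assoc]

lemma avg_sum {ι : Type*} (t : Finset ι) (F : ι → E n → ℝ) (x : E n) :
    L.avg c N (fun y => ∑ i ∈ t, F i y) x = ∑ i ∈ t, L.avg c N (F i) x := by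
  simp only [avg, ← Finset.sum_div]
  rw [Finset.sum_comm]

lemma abs_avg_sub_le (hN : 0 < N) {ε : ℝ} (h : ∀ x, |f x - g x| ≤ ε) (x : E n) :
    |L.avg c N f x - L.avg c N g x| ≤ ε := by
  rw [avg, avg, ← sub_div, ← Finset.sum_sub_distrib, abs_div, Nat.abs_cast,
    div_le_iff₀ (by exact_mod_cast hN)]
  calc _ ≤ ∑ k ∈ Finset.range N, |f ((L.ψ c)^[k] x) - g ((L.ψ c)^[k] x)| :=
        Finset.abs_sum_le_sum_abs _ _
    _ ≤ ∑ _k ∈ Finset.range N, ε := Finset.sum_le_sum fun k _ => h _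
    _ = _ := by simp; ring

lemma avg_telescope (S : E n → ℝ) (x : E n) :
    L.avg c N (fun y => S (L.ψ c y) - S y) x = (S ((L.ψ c)^[N] x) - S x) / N := by
  have h := Finset.sum_range_sub (fun k => S ((L.ψ c)^[k] x)) N
  simp only [Function.iterate_succ_apply', Function.iterate_zero_apply] at h
  rw [avg, h]

end avg

/-- The number of steps over which averages are taken at scale `s`. -/
def steps (s : ℝ) : ℕ := ⌈s⁻¹ ^ 2⌉₊

lemma steps_pos {s : ℝ} (hs : 0 < s) : 0 < steps s := Nat.ceil_pos.2 (by positivity)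

lemma inv_steps_le {s : ℝ} (hs : 0 < s) : s⁻¹ / steps s ≤ s := by
  have h1 : s⁻¹ ^ 2 ≤ steps s := Nat.le_ceil _
  rw [div_le_iff₀ (by exact_mod_cast steps_pos hs)]
  calc s⁻¹ = s * s⁻¹ ^ 2 := by field_simp
    _ ≤ _ := by gcongr

namespace IsLeaf

variable {𝓤 : Ultrafilter ℝ} {c c' : ℝ → E n} {η η' : E n} {p p' : E n → E n} {e e' : ℝ}

lemma increment_conv (h : IsLeaf L 𝓤 c η p e) (h' : IsLeaf L 𝓤 c' η' p' e') {S : E n → ℝ}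
    (hT : ∀ x y, |S y - S x - p' x ⬝ᵥ (y - x)| ≤
      n * (L.K * ‖η'‖ * Real.sqrt ‖y - x‖ * ‖y - x‖))
    (hS : ∀ x (m : Fin n → ℤ), S (x + intVec m) = S x + η' ⬝ᵥ intVec m) {ε : ℝ} (hε : 0 < ε) :
    ∀ᶠ s in (𝓤 : Filter ℝ), ∀ x,
      |s⁻¹ * (S (L.ψ (c s) x) - S x) - p' x ⬝ᵥ L.A x *ᵥ p x| ≤ ε := by
  refine eventually_forall_of_seq 𝓤 (fun s x m hP => ?_) fun x x₀ hx => ?_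
  · rwa [L.ψ_per, hS, hS, h'.p_per, L.A_per, h.p_per, add_sub_add_right_eq_sub] at hP
  have hp' : Tendsto (fun s => p' (x s)) 𝓤 (𝓝 (p' x₀)) := (h'.p_cont.tendsto x₀).comp hx
  have hp : Tendsto (fun s => p (x s)) 𝓤 (𝓝 (p x₀)) := (h.p_cont.tendsto x₀).comp hx
  have h1 := tendsto_dotProduct hp' (h.step_conv hx)
  have h2 := tendsto_dotProduct hp' (L.tendsto_A_mulVec hx hp)
  have h3 : Tendsto (fun s => n * (L.K * ‖η'‖ * Real.sqrt (L.K * ‖c s‖) *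
      (L.K * (s⁻¹ * ‖c s‖)))) 𝓤 (𝓝 0) := by
    have := (((Real.continuous_sqrt.tendsto _).comp (h.tendsto_norm.const_mul L.K)).const_mul
      (L.K * ‖η'‖)).mul (h.tendsto_inv_norm.const_mul L.K)
    simpa using this.const_mul (n : ℝ)
  have h4 : Tendsto (fun s => s⁻¹ * (S (L.ψ (c s) (x s)) - S (x s)) -
      p' (x s) ⬝ᵥ (s⁻¹ • (L.ψ (c s) (x s) - x s))) 𝓤 (𝓝 0) := by
    refine squeeze_zero_norm' ?_ h3
    filter_upwards [eventually_pos h.small, h.eventually_ρ] with s h1 h2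
    rw [dotProduct_smul, smul_eq_mul, ← mul_sub, norm_mul, norm_inv, Real.norm_of_nonneg h1.le,
      inv_mul_le_iff₀ h1]
    have hK := L.K_pos
    calc _ ≤ _ := hT _ _
      _ ≤ n * (L.K * ‖η'‖ * Real.sqrt (L.K * ‖c s‖) * (L.K * ‖c s‖)) := by
        gcongr <;> exact est_disp h2 _
      _ = _ := by field_simp
  have h5 := (h4.add h1).sub h2
  simp only [sub_add_cancel, zero_add, sub_self] at h5
  exact (h5.abs.eventually (ge_mem_nhds (by simpa using hε))).mono fun s hs => hs

/-- Averages over long orbits of the pairing of a leaf with any test leaf are determined by the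
asymptotic displacement of the orbit. -/
lemma exists_tendsto_avg (h : IsLeaf L 𝓤 c η p e) (x : ℝ → E n) : ∃ r : E n,
    ∀ c' η' p' e', IsLeaf L 𝓤 c' η' p' e' →
      Tendsto (fun s => L.avg (c s) (steps s) (fun y => p' y ⬝ᵥ L.A y *ᵥ p y) (x s)) 𝓤
        (𝓝 (η' ⬝ᵥ r)) := by
  obtain ⟨r, hr⟩ := exists_tendsto_of_bounded 𝓤 (M := L.K * (‖η‖ + 1))
    (f := fun s => (s⁻¹ / steps s) • ((L.ψ (c s))^[steps s] (x s) - x s)) (by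
      filter_upwards [eventually_pos h.small, h.eventually_ρ, h.eventually_le] with s h1 h2 h3
      have hN : (0 : ℝ) < steps s := by exact_mod_cast steps_pos h1
      rw [norm_smul, Real.norm_of_nonneg (by positivity)]
      have hK := L.K_pos
      calc _ ≤ s⁻¹ / steps s * (steps s * (L.K * ((‖η‖ + 1) * s))) := by
            gcongr
            exact (iterate_disp_le h2 _ _).trans (by gcongr)
        _ = _ := by field_simp)
  refine ⟨r, fun c' η' p' e' h' => ?_⟩
  obtain ⟨S, hSd, hS, hT, -⟩ := h'.exists_primitive
  have hSc : Continuous S := continuous_iff_continuousAt.2 fun x => (hSd x).continuousAt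
  obtain ⟨M, hM⟩ := exists_abs_le_of_periodic (f := fun x => S x - η' ⬝ᵥ x)
    (hSc.sub (continuous_const.dotProduct continuous_id))
    (fun x m => by rw [hS, dotProduct_add]; ring)
  have h1 : Tendsto (fun s => L.avg (c s) (steps s)
      (fun y => s⁻¹ * (S (L.ψ (c s) y) - S y)) (x s)) 𝓤 (𝓝 (η' ⬝ᵥ r)) := by
    have h2 := tendsto_dotProduct (tendsto_const_nhds (x := η')) hr
    have h3 : Tendsto (fun s => L.avg (c s) (steps s)
        (fun y => s⁻¹ * (S (L.ψ (c s) y) - S y)) (x s) -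
        η' ⬝ᵥ ((s⁻¹ / steps s) • ((L.ψ (c s))^[steps s] (x s) - x s))) 𝓤 (𝓝 0) := by
      refine squeeze_zero_norm' ?_ (by simpa using (tendsto_zero h.small).mul_const (M + M))
      filter_upwards [eventually_pos h.small] with s h1
      have hN : (0 : ℝ) < steps s := by exact_mod_cast steps_pos h1
      rw [avg_mul, avg_telescope, dotProduct_smul, dotProduct_sub, smul_eq_mul]
      set y := (L.ψ (c s))^[steps s] (x s)
      have h4 : s⁻¹ * ((S y - S (x s)) / steps s) - s⁻¹ / steps s * (η' ⬝ᵥ y - η' ⬝ᵥ x s)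
          = s⁻¹ / steps s * ((S y - η' ⬝ᵥ y) - (S (x s) - η' ⬝ᵥ x s)) := by ring
      rw [h4, norm_mul, Real.norm_of_nonneg (by positivity)]
      refine mul_le_mul (inv_steps_le h1) ?_ (norm_nonneg _) h1.le
      exact (norm_sub_le _ _).trans (add_le_add (hM _) (hM _))
    simpa using h3.add h2
  refine (tendsto_iff_of_dist (Metric.tendsto_nhds.2 fun ε hε => ?_)).1 h1
  filter_upwards [h.increment_conv h' hT hS (half_pos hε), eventually_pos h.small] with s h2 h3
  rw [Real.dist_eq, sub_zero, Real.dist_eq, abs_abs]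
  exact (abs_avg_sub_le (steps_pos h3) h2 _).trans_lt (half_lt_self hε)

lemma pairing_le (h : IsLeaf L 𝓤 c η p e) (h' : IsLeaf L 𝓤 c' η' p' e') (x : E n) :
    p' x ⬝ᵥ L.A x *ᵥ p x ≤ e + e' := by
  have h1 := L.A_coer x (p x - p' x)
  have h2 := L.A_dot_comm x (p x) (p' x)
  simp only [Matrix.mulVec_sub, sub_dotProduct, dotProduct_sub] at h1
  linarith [h.energy x, h'.energy x, mul_nonneg L.κ_pos.le (sq_nonneg ‖p x - p' x‖)]

lemma dot_eq_of_tendsto_avg (h : IsLeaf L 𝓤 c η p e) {x : ℝ → E n} {b : ℝ}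
    (hr : Tendsto (fun s => L.avg (c s) (steps s) (fun y => p y ⬝ᵥ L.A y *ᵥ p y) (x s)) 𝓤
        (𝓝 b)) : b = 2 * e := by
  refine tendsto_nhds_unique hr (tendsto_const_nhds.congr' ?_)
  filter_upwards [eventually_pos h.small] with s hs
  simp only [h.energy]
  rw [avg_const (steps_pos hs)]

lemma exists_subgradient (h : IsLeaf L 𝓤 c η p e) : ∃ r : E n,
    ∀ c' η' p' e', IsLeaf L 𝓤 c' η' p' e' → e + (η' - η) ⬝ᵥ r ≤ e' := by
  obtain ⟨r, hr⟩ := h.exists_tendsto_avg (fun _ => 0)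
  refine ⟨r, fun c' η' p' e' h' => ?_⟩
  have h1 := h.dot_eq_of_tendsto_avg (hr _ _ _ _ h)
  have h2 : η' ⬝ᵥ r ≤ e + e' := by
    refine le_of_tendsto (hr _ _ _ _ h') ?_
    filter_upwards [eventually_pos h.small] with s hs
    rw [← avg_const (L := L) (c := c s) (steps_pos hs) (e + e') 0]
    exact avg_mono (fun y => h.pairing_le h' y) _
  rw [sub_dotProduct]; linarith

end IsLeaf

lemma exists_energy {𝓤 : Ultrafilter ℝ} (h𝓤 : (𝓤 : Filter ℝ) ≤ 𝓝[>] 0) : ∃ a₀ : E n → ℝ,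
    Continuous a₀ ∧ (∀ c η p e, IsLeaf L 𝓤 c η p e → e = a₀ η) ∧
    ∀ η, ∃ p, IsLeaf L 𝓤 (fun s => s • η) η p (a₀ η) := by
  have hex : ∀ η : E n, ∃ p e, IsLeaf L 𝓤 (fun s => s • η) η p e := by
    intro η
    obtain ⟨η', p, e, h⟩ := exists_isLeaf (L := L) h𝓤 (c := fun s => s • η) (R := ‖η‖) (by
      filter_upwards [eventually_pos h𝓤] with s hs
      rw [norm_smul, Real.norm_of_nonneg hs.le, mul_comm])
    have : η' = η := tendsto_nhds_unique h.lim (tendsto_const_nhds.congr' (by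
      filter_upwards [eventually_pos h𝓤] with s hs
      rw [smul_smul, inv_mul_cancel₀ hs.ne', one_smul]))
    exact ⟨p, e, this ▸ h⟩
  choose p a₀ h using hex
  have hu : ∀ c η p e, IsLeaf L 𝓤 c η p e → e = a₀ η := by
    intro c η p' e h'
    obtain ⟨r, hr⟩ := (h η).exists_subgradient
    obtain ⟨r', hr'⟩ := h'.exists_subgradient
    have h1 := hr _ _ _ _ h'
    have h2 := hr' _ _ _ _ (h η)
    simp only [sub_self, zero_dotProduct, add_zero] at h1 h2
    exact le_antisymm h2 h1
  refine ⟨a₀, ?_, hu, fun η => ⟨_, h η⟩⟩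
  refine ConvexOn.locallyLipschitz (f := a₀) ⟨convex_univ, ?_⟩ |>.continuous
  intro x _ y _ α β hα hβ hαβ
  obtain ⟨r, hr⟩ := (h (α • x + β • y)).exists_subgradient
  have h1 := mul_le_mul_of_nonneg_left (hr _ _ _ _ (h x)) hα
  have h2 := mul_le_mul_of_nonneg_left (hr _ _ _ _ (h y)) hβ
  simp only [sub_dotProduct, add_dotProduct, smul_dotProduct, smul_eq_mul] at h1 h2 ⊢
  obtain rfl : β = 1 - α := by linarith
  nlinarith

end LocalModel

open scoped Matrix.Norms.L2Operator MatrixOrder in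
lemma exists_eq_transpose_mul {n : ℕ} {M : Matrix (Fin n) (Fin n) ℝ} (hs : Mᵀ = M)
    (hp : ∀ v : Fin n → ℝ, 0 ≤ v ⬝ᵥ M *ᵥ v) : ∃ B : Matrix (Fin n) (Fin n) ℝ, M = Bᵀ * B := by
  have hM : M.PosSemidef := .of_dotProduct_mulVec_nonneg (by simpa [Matrix.IsHermitian] using hs)
    (by simpa using hp)
  obtain ⟨B, hB⟩ := CStarAlgebra.nonneg_iff_eq_star_mul_self.mp hM.nonneg
  exact ⟨B, by simpa [Matrix.star_eq_conjTranspose] using hB⟩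

lemma exists_rep_of_mem_convexHull {V : Type*} [AddCommGroup V] [Module ℝ V]
    [FiniteDimensional ℝ V] {s : Set V} {x : V} (hx : x ∈ convexHull ℝ s) :
    ∃ (w : Fin (Module.finrank ℝ V + 1) → ℝ) (z : Fin (Module.finrank ℝ V + 1) → V),
      (∀ i, 0 ≤ w i) ∧ ∑ i, w i = 1 ∧ (∀ i, z i ∈ s) ∧ ∑ i, w i • z i = x := by
  obtain ⟨ι, _, z, w, hz, hind, hw, hw1, hx⟩ := eq_pos_convex_span_of_mem_convexHull hx
  have hcard : Fintype.card ι ≤ Fintype.card (Fin (Module.finrank ℝ V + 1)) := by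
    rw [Fintype.card_fin]
    exact hind.card_le_finrank_succ.trans (Nat.succ_le_succ (Submodule.finrank_le _))
  obtain ⟨f⟩ := Function.Embedding.nonempty_of_card_le hcard
  have : Nonempty ι := by
    by_contra h
    rw [not_nonempty_iff] at h
    simp at hw1
  obtain ⟨i₀⟩ := this
  have hext : ∀ j, j ∉ Set.range f → Function.extend f w 0 j = 0 := fun j hj => by
    rw [Function.extend_apply' _ _ _ hj]; rfl
  refine ⟨Function.extend f w 0, Function.extend f z fun _ => z i₀, fun j => ?_, ?_,
    fun j => ?_, ?_⟩
  · by_cases hj : j ∈ Set.range f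
    · obtain ⟨i, rfl⟩ := hj
      rw [f.injective.extend_apply]; exact (hw i).le
    · rw [hext j hj]
  · rw [← hw1]
    exact (Fintype.sum_of_injective f f.injective _ _ hext
      (by simp [f.injective.extend_apply])).symm
  · by_cases hj : j ∈ Set.range f
    · obtain ⟨i, rfl⟩ := hj
      rw [f.injective.extend_apply]; exact hz ⟨i, rfl⟩
    · rw [Function.extend_apply' _ _ _ hj]; exact hz ⟨i₀, rfl⟩
  · rw [← hx]
    exact (Fintype.sum_of_injective f f.injective _ _
      (fun j hj => by rw [hext j hj, zero_smul]) (by simp [f.injective.extend_apply])).symm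

lemma det_smul_one_add_vecMulVec {n : ℕ} {t : ℝ} (ht : t < 1) (y : Fin n → ℝ) :
    ((1 - t) • (1 : Matrix (Fin n) (Fin n) ℝ) + t • Matrix.vecMulVec y y).det =
      (1 - t) ^ n * (1 + t / (1 - t) * (y ⬝ᵥ y)) := by
  have h0 : 1 - t ≠ 0 := by linarith
  have h1 : (1 - t) • (1 : Matrix (Fin n) (Fin n) ℝ) + t • Matrix.vecMulVec y y =
      (1 - t) •
        (1 + Matrix.replicateCol Unit y * Matrix.replicateRow Unit ((t / (1 - t)) • y)) := by
    ext i j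
    simp [Matrix.vecMulVec_apply, Matrix.mul_apply]
    field_simp
  rw [h1, Matrix.det_smul, Matrix.det_one_add_replicateCol_mul_replicateRow, smul_dotProduct]
  simp

/-- A finite-sum form of John's theorem on the ellipsoid of minimal volume containing `T`. -/
lemma exists_john {n : ℕ} (hn : 1 ≤ n) {T : Set (E n)} (hT : IsCompact T)
    (hspan : ∀ i, ∃ t : ℝ, t ≠ 0 ∧ Pi.single i t ∈ T) :
    ∃ (d : ℕ) (w : Fin d → ℝ) (v : Fin d → E n) (B : Matrix (Fin n) (Fin n) ℝ),
      (∀ i, 0 ≤ w i) ∧ ∑ i, w i = n ∧ (∀ i, v i ∈ T) ∧ B.det ≠ 0 ∧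
      (∀ r, ∑ i, w i * (v i ⬝ᵥ r) ^ 2 = (B *ᵥ r) ⬝ᵥ (B *ᵥ r)) ∧
      ∀ y, Bᵀ *ᵥ y ∈ T → y ⬝ᵥ y ≤ 1 := by
  set d := Module.finrank ℝ (Matrix (Fin n) (Fin n) ℝ) + 1
  set s : Set (Matrix (Fin n) (Fin n) ℝ) := (fun v => Matrix.vecMulVec v v) '' T with hs
  let M : (Fin d → ℝ) × (Fin d → E n) → Matrix (Fin n) (Fin n) ℝ :=
    fun q => ∑ i, q.1 i • Matrix.vecMulVec (q.2 i) (q.2 i)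
  have hMc : Continuous M := by
    refine continuous_finsetSum _ fun i _ => ((continuous_apply i).comp continuous_fst).smul ?_
    exact ((continuous_apply i).comp continuous_snd).matrix_vecMulVec
      ((continuous_apply i).comp continuous_snd)
  set X : Set ((Fin d → ℝ) × (Fin d → E n)) := stdSimplex ℝ (Fin d) ×ˢ Set.univ.pi fun _ => T
  have hX : IsCompact X := (isCompact_stdSimplex ℝ (Fin d)).prod (isCompact_univ_pi fun _ => hT)
  have hrep : ∀ N ∈ convexHull ℝ s, ∃ q ∈ X, M q = N := by
    intro N hN
    obtain ⟨w, z, hw, hw1, hz, hN⟩ := exists_rep_of_mem_convexHull hN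
    choose v hv hvz using hz
    exact ⟨(w, v), ⟨⟨hw, hw1⟩, fun i _ => hv i⟩, by simpa only [M, hvz] using hN⟩
  have hM : ∀ q ∈ X, M q ∈ convexHull ℝ s := fun q hq =>
    (convex_convexHull ℝ s).sum_mem (fun i _ => hq.1.1 i) hq.1.2
      fun i _ => subset_convexHull ℝ s ⟨_, hq.2 i trivial, rfl⟩
  have hn0 : (n : ℝ) ≠ 0 := by positivity
  choose t ht0 htT using hspan
  have hdiag : ∑ i, (n : ℝ)⁻¹ • Matrix.vecMulVec (Pi.single i (t i)) (Pi.single i (t i)) ∈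
      convexHull ℝ s :=
    (convex_convexHull ℝ s).sum_mem (fun i _ => by positivity) (by simp [hn0])
      fun i _ => subset_convexHull ℝ s ⟨_, htT i, rfl⟩
  obtain ⟨q₀, hq₀, hMq₀⟩ := hrep _ hdiag
  have hdet₀ : 0 < (M q₀).det := by
    have : M q₀ = Matrix.diagonal fun i => (n : ℝ)⁻¹ * t i ^ 2 := by
      rw [hMq₀]
      ext i j
      simp only [Matrix.sum_apply, Matrix.smul_apply, Matrix.vecMulVec_apply, smul_eq_mul,
        Pi.single_apply, Matrix.diagonal_apply]
      by_cases hij : i = j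
      · subst hij; simp [sq]
      · rw [if_neg hij]
        refine Finset.sum_eq_zero fun k _ => ?_
        by_cases h : i = k
        · subst h
          simp [Ne.symm hij]
        · simp [h]
    rw [this, Matrix.det_diagonal]
    exact Finset.prod_pos fun i _ => mul_pos (by positivity) (by have := ht0 i; positivity)
  obtain ⟨q, hq, hmax⟩ := hX.exists_isMaxOn ⟨q₀, hq₀⟩ (hMc.matrix_det.continuousOn)
  have hdet : 0 < (M q).det := hdet₀.trans_le (hmax hq₀)
  have hMr : ∀ r, r ⬝ᵥ M q *ᵥ r = ∑ i, q.1 i * (q.2 i ⬝ᵥ r) ^ 2 := by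
    intro r
    simp only [M, Matrix.sum_mulVec, dotProduct_sum, Matrix.smul_mulVec, dotProduct_smul,
      Matrix.vecMulVec_mulVec, smul_eq_mul]
    refine Finset.sum_congr rfl fun i _ => ?_
    simp [dotProduct_comm r, sq]
  obtain ⟨C, hC⟩ := exists_eq_transpose_mul (M := M q)
    (by simp [M, Matrix.transpose_sum, Matrix.transpose_smul, Matrix.transpose_vecMulVec])
    (fun r => by rw [hMr]; exact Finset.sum_nonneg fun i _ => mul_nonneg (hq.1.1 i) (sq_nonneg _))
  have hCdet : C.det ≠ 0 := fun h => by rw [hC] at hdet; simp [h] at hdet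
  have key : ∀ y, Cᵀ *ᵥ y ∈ T → y ⬝ᵥ y ≤ n := by
    intro y hy
    set u := y ⬝ᵥ y
    have hu : 0 ≤ u := by simpa [u] using dotProduct_self_star_nonneg y
    have h1 : ∀ τ : ℝ, 0 < τ → τ < 1 → (1 - τ) ^ n * (1 + τ / (1 - τ) * u) ≤ 1 := by
      intro τ h0 h1
      have hmem : (1 - τ) • M q + τ • Matrix.vecMulVec (Cᵀ *ᵥ y) (Cᵀ *ᵥ y) ∈ convexHull ℝ s :=
        (convex_convexHull ℝ s) (hM q hq) (subset_convexHull ℝ s ⟨_, hy, rfl⟩) (by linarith) h0.le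
          (by ring)
      obtain ⟨q', hq', h'⟩ := hrep _ hmem
      have h2 : (M q').det ≤ (M q).det := hmax hq'
      have h3 : (1 - τ) • M q + τ • Matrix.vecMulVec (Cᵀ *ᵥ y) (Cᵀ *ᵥ y) =
          Cᵀ * ((1 - τ) • (1 : Matrix (Fin n) (Fin n) ℝ) + τ • Matrix.vecMulVec y y) * C := by
        rw [hC, Matrix.mul_add, Matrix.add_mul, Matrix.mul_smul, Matrix.mul_one, Matrix.smul_mul,
          Matrix.mul_smul, Matrix.smul_mul, Matrix.mul_vecMulVec, Matrix.vecMulVec_mul,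
          Matrix.mulVec_transpose]
      rw [h', h3, Matrix.det_mul, Matrix.det_mul, det_smul_one_add_vecMulVec h1, hC,
        Matrix.det_mul, Matrix.det_transpose] at h2
      have : 0 < C.det * C.det := mul_self_pos.2 hCdet
      nlinarith
    obtain ⟨k, rfl⟩ : ∃ k, n = k + 1 := ⟨n - 1, by omega⟩
    have h2 : ∀ τ : ℝ, 0 < τ → τ < 1 → u - (k + 1) ≤ k * (u - 1) * τ := by
      intro τ h0 h1'
      have hb := one_add_mul_le_pow (a := -τ) (by linarith) k
      have h3 := h1 τ h0 h1'
      have h4 : (1 - τ) ^ (k + 1) * (1 + τ / (1 - τ) * u) = (1 - τ) ^ k * (1 + τ * (u - 1)) := by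
        have : 1 - τ ≠ 0 := by linarith
        rw [pow_succ]; field_simp; ring
      rw [h4] at h3
      have h5 : (1 + k * -τ) * (1 + τ * (u - 1)) ≤ 1 := by
        refine le_trans (mul_le_mul_of_nonneg_right hb (by nlinarith)) ?_
        simpa [sub_eq_add_neg] using h3
      have h6 : τ * (u - (k + 1)) ≤ τ * (k * (u - 1) * τ) := by nlinarith
      exact le_of_mul_le_mul_left h6 h0
    have h3 : Tendsto (fun τ : ℝ => k * (u - 1) * τ) (𝓝[>] 0) (𝓝 0) :=
      (Continuous.tendsto' (by fun_prop) _ _ (by simp)).mono_left nhdsWithin_le_nhds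
    have h4 : u - (k + 1) ≤ 0 := ge_of_tendsto h3 (by
      filter_upwards [Ioo_mem_nhdsGT (zero_lt_one (α := ℝ))] with τ hτ using h2 τ hτ.1 hτ.2)
    push_cast; linarith
  have hsn : 0 < Real.sqrt n := Real.sqrt_pos.2 (by positivity)
  refine ⟨d, fun i => n * q.1 i, q.2, Real.sqrt n • C, fun i => mul_nonneg (by positivity)
    (hq.1.1 i), by rw [← Finset.mul_sum, hq.1.2, mul_one], fun i => hq.2 i trivial, ?_,
    fun r => ?_, fun y hy => ?_⟩
  · rw [Matrix.det_smul]; positivity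
  · have h1 := hMr r
    rw [hC, ← Matrix.mulVec_mulVec, Matrix.dotProduct_mulVec, ← Matrix.mulVec_transpose,
      Matrix.transpose_transpose] at h1
    simp only [Matrix.smul_mulVec, smul_dotProduct, dotProduct_smul, smul_eq_mul, ← mul_assoc,
      Real.mul_self_sqrt (Nat.cast_nonneg n), h1, Finset.mul_sum]
  · have h1 := key (Real.sqrt n • y) (by
      rwa [Matrix.transpose_smul, Matrix.smul_mulVec, ← Matrix.mulVec_smul] at hy)
    rw [smul_dotProduct, dotProduct_smul, smul_eq_mul, smul_eq_mul, ← mul_assoc,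
      Real.mul_self_sqrt (Nat.cast_nonneg n)] at h1
    have : (0 : ℝ) < n := by positivity
    nlinarith

/-- A fundamental domain in `ℝⁿ × ℝⁿ` of the translations by `ℤⁿ × 0`. -/
def cell (n : ℕ) : Set (E n × E n) := (Set.univ.pi fun _ => Set.Ico (0 : ℝ) 1) ×ˢ Set.univ

lemma measurableSet_cell (n : ℕ) : MeasurableSet (cell n) :=
  (MeasurableSet.univ_pi fun _ => measurableSet_Ico).prod MeasurableSet.univ

lemma exists_unique_add_intVec_mem {n : ℕ} (x : E n) :
    ∃! m : Fin n → ℤ, intVec m + x ∈ Set.univ.pi fun _ : Fin n => Set.Ico (0 : ℝ) 1 := by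
  refine ⟨fun i => -⌊x i⌋, fun i _ => ?_, fun m hm => funext fun i => ?_⟩
  · have h1 := Int.floor_le (x i)
    have h2 := Int.lt_floor_add_one (x i)
    constructor <;> simp [intVec]
    linarith
  · have h := hm i trivial
    simp only [intVec, Pi.add_apply, Set.mem_Ico] at h
    have h3 : ⌊x i⌋ = -m i := Int.floor_eq_iff.2 ⟨by push_cast; linarith, by push_cast; linarith⟩
    simp [h3]

/-- The group of translations of `ℝⁿ × ℝⁿ` by `ℤⁿ × 0`. -/
def translations (n : ℕ) : AddSubgroup (E n × E n) :=
  AddMonoidHom.range (AddMonoidHom.mk' (fun m : Fin n → ℤ => ((intVec m, 0) : E n × E n))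
    fun a b => by simp [intVec_add])

instance (n : ℕ) : Countable (translations n) :=
  (Set.countable_range fun m : Fin n → ℤ => ((intVec m, 0) : E n × E n)).to_subtype

instance (n : ℕ) : VAddInvariantMeasure (translations n) (E n × E n) volume := by
  have : (volume : Measure (E n × E n)).IsAddLeftInvariant :=
    inferInstanceAs ((volume : Measure (E n)).prod (volume : Measure (E n))).IsAddLeftInvariant
  infer_instance

lemma isAddFundamentalDomain_preimage_cell {n : ℕ} {f : E n × E n → E n × E n} (hf : Measurable f)
    (hper : ∀ z (m : Fin n → ℤ), f (z + (intVec m, 0)) = f z + (intVec m, 0)) :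
    IsAddFundamentalDomain (translations n) (f ⁻¹' cell n) := by
  refine .mk' ((measurableSet_cell n).preimage hf).nullMeasurableSet fun z => ?_
  obtain ⟨m, hm, hu⟩ := exists_unique_add_intVec_mem (f z).1
  refine ⟨⟨(intVec m, 0), m, rfl⟩, ?_, ?_⟩
  · change f ((intVec m, 0) + z) ∈ cell n
    rw [add_comm, hper]
    exact ⟨by rw [Prod.fst_add, add_comm]; exact hm, trivial⟩
  · rintro ⟨_, k, rfl⟩ hk
    change f ((intVec k, 0) + z) ∈ cell n at hk
    rw [add_comm, hper] at hk
    have := hu k (by have := hk.1; rwa [Prod.fst_add, add_comm] at this)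
    subst this; rfl

lemma integrableOn_cell_comp {n : ℕ} {Ψ : E n × E n → E n × E n} (hΨ : MeasurePreserving Ψ)
    (hper : ∀ z (m : Fin n → ℤ), Ψ (z + (intVec m, 0)) = Ψ z + (intVec m, 0))
    {f : E n × E n → ℝ} (hf : Continuous f)
    (hfper : ∀ z (m : Fin n → ℤ), f (z + (intVec m, 0)) = f z)
    (hfi : IntegrableOn f (cell n)) :
    IntegrableOn (f ∘ Ψ) (cell n) ∧ ∫ z in cell n, f (Ψ z) = ∫ z in cell n, f z := by
  have h1 : IsAddFundamentalDomain (translations n) (cell n) := by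
    simpa using isAddFundamentalDomain_preimage_cell (n := n) measurable_id (fun z m => rfl)
  have h2 := isAddFundamentalDomain_preimage_cell hΨ.measurable hper
  have hinv : ∀ (g : translations n) z, (f ∘ Ψ) (g +ᵥ z) = (f ∘ Ψ) z := by
    rintro ⟨_, m, rfl⟩ z
    change f (Ψ ((intVec m, 0) + z)) = f (Ψ z)
    rw [add_comm, hper, hfper]
  have h3 := hΨ.restrict_preimage (measurableSet_cell n)
  refine ⟨(h1.integrableOn_iff h2 hinv).2 ((h3.integrable_comp hf.aestronglyMeasurable).2 hfi), ?_⟩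
  have h4 := h1.setIntegral_eq h2 (f := f ∘ Ψ) hinv
  simp only [Function.comp_def] at h4
  rw [h4, ← setIntegral_map (measurableSet_cell n)
      (by rw [hΨ.map_eq]; exact hf.aestronglyMeasurable)
    hΨ.measurable.aemeasurable, hΨ.map_eq]

lemma eqOn_cell_of_ae_eq {n : ℕ} {f g : E n × E n → ℝ} (hf : Continuous f) (hg : Continuous g)
    (h : f =ᵐ[volume.restrict (cell n)] g) : Set.EqOn f g (cell n) := by
  refine Measure.eqOn_of_ae_eq h hf.continuousOn hg.continuousOn ?_
  rw [cell, interior_prod_eq, interior_pi_set Set.finite_univ, closure_prod_eq, closure_pi_set]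
  simp only [interior_Ico, closure_Ioo (zero_ne_one (α := ℝ)), interior_univ, closure_univ]
  exact Set.prod_mono (Set.pi_mono fun i _ => Set.Ico_subset_Icc_self) le_rfl

lemma integral_comp_mulVec {n : ℕ} {B : Matrix (Fin n) (Fin n) ℝ} (hB : B.det ≠ 0) {f : E n → ℝ}
    (hf : Continuous f) : ∫ J, f (B *ᵥ J) = |B.det⁻¹| * ∫ y, f y := by
  have h := Real.map_matrix_volume_pi_eq_smul_volume_pi hB
  have h1 := integral_map (μ := (volume : Measure (E n))) (φ := fun J => B *ᵥ J) (f := f)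
    (by fun_prop) hf.aestronglyMeasurable
  rw [← h1]
  change ∫ y, f y ∂(volume.map (Matrix.toLin' B)) = _
  rw [h, integral_smul_measure, ENNReal.toReal_ofReal (abs_nonneg _), smul_eq_mul]

lemma integrable_of_continuous_of_bounded_support {n : ℕ} {f : E n → ℝ} (hf : Continuous f) {R : ℝ}
    (h : ∀ y, R < ‖y‖ → f y = 0) : Integrable f :=
  hf.integrable_of_hasCompactSupport (HasCompactSupport.intro (isCompact_closedBall 0 R)
    fun y hy => h y (by simpa using hy))

lemma integral_isotropic {n : ℕ} {χ : ℝ → ℝ} (hχ : Continuous χ) (h3 : ∀ t, 3 < t → χ t = 0)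
    (b : E n) : n * ∫ y : E n, χ (y ⬝ᵥ y) * (b ⬝ᵥ y) ^ 2 =
      (b ⬝ᵥ b) * ∫ y : E n, χ (y ⬝ᵥ y) * (y ⬝ᵥ y) := by
  have hdc : Continuous fun y : E n => y ⬝ᵥ y := continuous_id.dotProduct continuous_id
  have hzero : ∀ y : E n, 2 < ‖y‖ → χ (y ⬝ᵥ y) = 0 := by
    intro y hy
    refine h3 _ ?_
    obtain ⟨i, hi⟩ : ∃ i, 2 < ‖y i‖ := by
      by_contra! h
      exact absurd ((pi_norm_le_iff_of_nonneg (by norm_num)).2 h) (not_le.2 hy)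
    have h1 : y i * y i ≤ y ⬝ᵥ y :=
      Finset.single_le_sum (f := fun i => y i * y i) (fun j _ => mul_self_nonneg _)
        (Finset.mem_univ i)
    have h2 := sq_abs (y i)
    rw [Real.norm_eq_abs] at hi
    nlinarith
  set W : Fin n → Fin n → ℝ := fun i j => ∫ y : E n, χ (y ⬝ᵥ y) * (y i * y j)
  have hint : ∀ i j, Integrable fun y : E n => χ (y ⬝ᵥ y) * (y i * y j) := fun i j =>
    integrable_of_continuous_of_bounded_support
      ((hχ.comp hdc).mul (by fun_prop)) (fun y hy => by rw [hzero y hy, zero_mul])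
  have hoff : ∀ i j, i ≠ j → W i j = 0 := by
    intro i j hij
    have hmp : MeasurePreserving (fun (y : E n) (k : Fin n) => (if k = i then -y k else y k)) := by
      refine volume_preserving_pi (f := fun k t => if k = i then -t else t) fun k => ?_
      by_cases hk : k = i
      · simpa [hk] using Measure.measurePreserving_neg (volume : Measure ℝ)
      · simp only [if_neg hk]; exact MeasurePreserving.id (volume : Measure ℝ)
    have h1 := integral_map (μ := (volume : Measure (E n))) hmp.measurable.aemeasurable
      (f := fun y : E n => χ (y ⬝ᵥ y) * (y i * y j))
      (by rw [hmp.map_eq]; exact (hint i j).aestronglyMeasurable)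
    rw [hmp.map_eq] at h1
    have h2 : ∀ y : E n, (fun k => if k = i then -y k else y k) ⬝ᵥ
        (fun k => if k = i then -y k else y k) = y ⬝ᵥ y := fun y => by
      refine Finset.sum_congr rfl fun k _ => ?_
      dsimp only; split_ifs <;> ring
    simp only [h2, if_pos, if_neg hij.symm] at h1
    have h3 : W i j = -W i j := by
      rw [← integral_neg]
      refine h1.trans (integral_congr_ae (.of_forall fun y => ?_))
      dsimp only; ring
    linarith
  have hdiag : ∀ i j, W i i = W j j := by
    intro i j
    have hmp := volume_measurePreserving_piCongrLeft (fun _ : Fin n => ℝ) (Equiv.swap i j)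
    have h1 := integral_map (μ := (volume : Measure (E n))) hmp.measurable.aemeasurable
      (f := fun y : E n => χ (y ⬝ᵥ y) * (y i * y i))
      (by rw [hmp.map_eq]; exact (hint i i).aestronglyMeasurable)
    rw [hmp.map_eq] at h1
    have h0 : ∀ (y : E n) k, MeasurableEquiv.piCongrLeft (fun _ : Fin n => ℝ) (Equiv.swap i j) y k =
        y (Equiv.swap i j k) := fun y k => by
      have := Equiv.piCongrLeft_apply_apply (fun _ : Fin n => ℝ) (Equiv.swap i j) y
        (Equiv.swap i j k)
      rw [Equiv.swap_apply_self] at this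
      exact this
    have h2 : ∀ y : E n, MeasurableEquiv.piCongrLeft (fun _ : Fin n => ℝ) (Equiv.swap i j) y ⬝ᵥ
        MeasurableEquiv.piCongrLeft (fun _ : Fin n => ℝ) (Equiv.swap i j) y = y ⬝ᵥ y := fun y => by
      unfold dotProduct
      simp only [h0]
      exact Equiv.sum_comp (Equiv.swap i j) fun k => y k * y k
    simp only [h2, h0, Equiv.swap_apply_left] at h1
    exact h1
  have hsum : ∀ b : E n, ∫ y : E n, χ (y ⬝ᵥ y) * (b ⬝ᵥ y) ^ 2 = ∑ i, b i ^ 2 * W i i := by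
    intro b
    have h1 : ∀ y : E n, χ (y ⬝ᵥ y) * (b ⬝ᵥ y) ^ 2 =
        ∑ i, ∑ j, b i * b j * (χ (y ⬝ᵥ y) * (y i * y j)) := fun y => by
      have h2 : (b ⬝ᵥ y) ^ 2 = ∑ i, ∑ j, b i * y i * (b j * y j) := by
        rw [sq, dotProduct, Finset.sum_mul_sum]
      simp only [h2, Finset.mul_sum]
      exact Finset.sum_congr rfl fun i _ => Finset.sum_congr rfl fun j _ => by ring
    simp only [h1]
    rw [integral_finsetSum _ fun i _ => integrable_finsetSum _ fun j _ => (hint i j).const_mul _]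
    refine Finset.sum_congr rfl fun i _ => ?_
    rw [integral_finsetSum _ fun j _ => (hint i j).const_mul _, Finset.sum_eq_single i]
    · rw [integral_const_mul]; ring
    · intro j _ hj
      rw [integral_const_mul, show ∫ y : E n, χ (y ⬝ᵥ y) * (y i * y j) = 0 from hoff i j hj.symm,
        mul_zero]
    · simp
  have htr : ∫ y : E n, χ (y ⬝ᵥ y) * (y ⬝ᵥ y) = ∑ i, W i i := by
    rw [← integral_finsetSum _ fun i _ => hint i i]
    refine integral_congr_ae (.of_forall fun y => ?_)
    dsimp only
    rw [← Finset.mul_sum]; rfl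
  rw [hsum, htr, Finset.mul_sum, dotProduct, Finset.sum_mul_sum]
  refine Finset.sum_congr rfl fun i _ => ?_
  rw [Finset.sum_congr rfl fun j _ => by rw [hdiag j i]]
  rw [Finset.sum_const, Finset.card_univ, Fintype.card_fin, nsmul_eq_mul]; ring

lemma integral_isotropic_quadratic {n : ℕ} {χ : ℝ → ℝ} (hχ : Continuous χ)
    (h3 : ∀ t, 3 < t → χ t = 0) {A : Matrix (Fin n) (Fin n) ℝ} (hA : Aᵀ = A)
    (hp : ∀ v : E n, 0 ≤ v ⬝ᵥ A *ᵥ v) (hdet : A.det ≠ 0) (b : E n) :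
    n * ∫ J : E n, χ (J ⬝ᵥ A *ᵥ J) * (b ⬝ᵥ A *ᵥ J) ^ 2 =
      (b ⬝ᵥ A *ᵥ b) * ∫ J : E n, χ (J ⬝ᵥ A *ᵥ J) * (J ⬝ᵥ A *ᵥ J) := by
  obtain ⟨B, rfl⟩ := exists_eq_transpose_mul hA hp
  have hB : B.det ≠ 0 := fun h => hdet (by simp [h])
  have h1 : ∀ u v : E n, u ⬝ᵥ (Bᵀ * B) *ᵥ v = (B *ᵥ u) ⬝ᵥ (B *ᵥ v) := fun u v => by
    rw [← Matrix.mulVec_mulVec, Matrix.dotProduct_mulVec, ← Matrix.mulVec_transpose,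
      Matrix.transpose_transpose]
  have hdc : Continuous fun y : E n => y ⬝ᵥ y := continuous_id.dotProduct continuous_id
  simp only [h1]
  rw [integral_comp_mulVec hB (f := fun y => χ (y ⬝ᵥ y) * ((B *ᵥ b) ⬝ᵥ y) ^ 2)
    ((hχ.comp hdc).mul ((continuous_const.dotProduct continuous_id).pow 2)),
    integral_comp_mulVec hB (f := fun y => χ (y ⬝ᵥ y) * (y ⬝ᵥ y)) ((hχ.comp hdc).mul hdc)]
  linear_combination |B.det⁻¹| * integral_isotropic hχ h3 (B *ᵥ b)

namespace LocalModel

variable {n : ℕ} {L : LocalModel n} {𝓤 : Ultrafilter ℝ} {ι : Type} [Fintype ι]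

/-- The deviation of `∑ lam i • p i ⊗ p i` from the inverse of `A`, evaluated on `A J`. -/
def defect (L : LocalModel n) (lam : ι → ℝ) (p : ι → E n → E n) (z : E n × E n) : ℝ :=
  ∑ i, lam i * (p i z.1 ⬝ᵥ L.A z.1 *ᵥ z.2) ^ 2 - z.2 ⬝ᵥ L.A z.1 *ᵥ z.2

/-- Twice the kinetic energy. -/
def kin (L : LocalModel n) (z : E n × E n) : ℝ := z.2 ⬝ᵥ L.A z.1 *ᵥ z.2

/-- A weighted family of limit leaves whose classes are in John position with respect to the
energy. -/
structure IsFrame (L : LocalModel n) (𝓤 : Ultrafilter ℝ) (lam : ι → ℝ) (η : ι → E n)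
    (p : ι → E n → E n) (e : ι → ℝ) : Prop where
  isLeaf : ∀ i, ∃ c, IsLeaf L 𝓤 c (η i) (p i) (e i)
  nonneg : ∀ i, 0 ≤ lam i
  sum_eq : ∑ i, lam i * (2 * e i) = n
  dominates : ∀ c η' p' e', IsLeaf L 𝓤 c η' p' e' → 1 ≤ 2 * e' → 2 * e' ≤ 3 →
    ∀ r, (η' ⬝ᵥ r) ^ 2 ≤ 2 * e' * ∑ i, lam i * (η i ⬝ᵥ r) ^ 2

lemma exists_norm_class_le (L : LocalModel n) : ∃ K' > 0, ∃ σ > 0, ∀ c x, ‖L.δ c x‖ ≤ σ →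
    ‖c‖ ≤ L.ρ ∧ ‖c‖ ≤ K' * ‖L.δ c x‖ := by
  have hK := L.K_pos
  have hC := L.C_pos
  obtain ⟨σ, hσ, h⟩ := L.leaf_small (min L.ρ ((L.K ^ 2)⁻¹ ^ 2))
    (lt_min L.ρ_pos (by positivity))
  refine ⟨n * L.C * L.K + 1, by positivity, σ, hσ, fun c x hx => ?_⟩
  have h1 := (h x c hx).trans (min_le_left _ _)
  have h2 := (h x c hx).trans (min_le_right _ _)
  refine ⟨h1, ?_⟩
  have h3 : Real.sqrt ‖c‖ ≤ (L.K ^ 2)⁻¹ := Real.sqrt_le_iff.2 ⟨by positivity, h2⟩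
  have h4 := (abs_le.1 (est_energy h1 x)).1
  have h5 : L.K * (‖c‖ ^ 2 * Real.sqrt ‖c‖) ≤ ‖c‖ ^ 2 / L.K := by
    calc _ ≤ L.K * (‖c‖ ^ 2 * (L.K ^ 2)⁻¹) := by gcongr
      _ = _ := by field_simp
  have h6 : ‖c‖ ^ 2 / L.K ≤ L.a c := by rw [div_le_iff₀ hK]; linarith [est_le_a h1]
  have h7 : L.δ c x ⬝ᵥ L.A x *ᵥ L.δ c x ≤ n * (‖L.δ c x‖ * (L.C * ‖L.δ c x‖)) :=
    (dotProduct_le' _ _).trans (by gcongr; exact L.A_bdd _ _)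
  have h8 : ‖c‖ ^ 2 / L.K ≤ n * L.C * ‖L.δ c x‖ ^ 2 := by nlinarith
  rw [div_le_iff₀ hK] at h8
  refine abs_le_of_sq_le_sq' ?_ (by positivity) |>.2
  have h9 : n * L.C * ‖L.δ c x‖ ^ 2 * L.K = n * L.C * L.K * ‖L.δ c x‖ ^ 2 := by ring
  have h10 : 0 ≤ n * L.C * L.K := by positivity
  rw [mul_pow]
  refine h8.trans (h9.le.trans ?_)
  gcongr
  nlinarith

lemma continuous_pairing (L : LocalModel n) {p : E n → E n} (hp : Continuous p) :
    Continuous fun z : E n × E n => p z.1 ⬝ᵥ L.A z.1 *ᵥ z.2 :=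
  (hp.comp continuous_fst).dotProduct ((L.A_cont.comp continuous_fst).matrix_mulVec continuous_snd)

lemma kin_cont (L : LocalModel n) : Continuous L.kin :=
  continuous_snd.dotProduct ((L.A_cont.comp continuous_fst).matrix_mulVec continuous_snd)

lemma kin_per (L : LocalModel n) (z : E n × E n) (m : Fin n → ℤ) :
    L.kin (z + (intVec m, 0)) = L.kin z := by
  simp [kin, L.A_per]

lemma norm_sq_le_kin (L : LocalModel n) (z : E n × E n) : L.κ * ‖z.2‖ ^ 2 ≤ L.kin z :=
  L.A_coer _ _

namespace IsFrame

variable {lam : ι → ℝ} {η : ι → E n} {p : ι → E n → E n} {e : ι → ℝ}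

lemma defect_cont (F : IsFrame L 𝓤 lam η p e) : Continuous (L.defect lam p) := by
  refine Continuous.sub (continuous_finsetSum _ fun i _ => ?_) L.kin_cont
  obtain ⟨c, hc⟩ := F.isLeaf i
  exact continuous_const.mul ((L.continuous_pairing hc.p_cont).pow 2)

lemma defect_per (F : IsFrame L 𝓤 lam η p e) (z : E n × E n) (m : Fin n → ℤ) :
    L.defect lam p (z + (intVec m, 0)) = L.defect lam p z := by
  have h : ∀ i, p i (z.1 + intVec m) = p i z.1 := fun i => by
    obtain ⟨c, hc⟩ := F.isLeaf i
    exact hc.p_per _ _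
  simp [defect, L.A_per, h]

lemma avg_defect_le (F : IsFrame L 𝓤 lam η p e) {ε : ℝ} (hε : 0 < ε) : ∃ C : ℝ, 0 ≤ C ∧
    ∀ c η' p' e', IsLeaf L 𝓤 c η' p' e' → 1 ≤ 2 * e' → 2 * e' ≤ 3 → ∀ x : ℝ → E n,
      ∀ᶠ s in (𝓤 : Filter ℝ), L.avg (c s) (steps s) (fun y =>
        |L.defect lam p (y, p' y)| - C * L.defect lam p (y, p' y)) (x s) ≤ ε := by
  have hK := L.K_pos
  have hK1 := L.one_le_K
  have hC := L.C_pos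
  set M : ℝ := n * ((L.K * ∑ i, ‖η i‖) * (L.C * (L.K * (2 * L.K)))) with hM
  have hM0 : 0 ≤ M := by positivity
  set Λ : ℝ := ∑ i, lam i with hΛ
  have hΛ0 : 0 ≤ Λ := Finset.sum_nonneg fun i _ => F.nonneg i
  set C : ℝ := 1 + 2 * (Λ * M ^ 2) / ε with hCdef
  have hC1 : 1 ≤ C := by rw [hCdef, le_add_iff_nonneg_right]; positivity
  have hC0 : 0 < C := by linarith
  have hCε : Λ * (M ^ 2 / C) ≤ ε / 2 := by
    rw [← mul_div_assoc, div_le_iff₀ hC0, hCdef]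
    have : ε / 2 * (1 + 2 * (Λ * M ^ 2) / ε) = ε / 2 + Λ * M ^ 2 := by field_simp
    rw [this]; linarith
  refine ⟨C, hC0.le, fun c η' p' e' h he1 he3 x => ?_⟩
  have hη' : ‖η'‖ ≤ 2 * L.K := by
    refine abs_le_of_sq_le_sq' ?_ (by positivity) |>.2
    nlinarith [h.sq_norm_le]
  obtain ⟨r, hr⟩ := h.exists_tendsto_avg x
  have hr' : ∀ i, Tendsto (fun s => L.avg (c s) (steps s)
      (fun y => p i y ⬝ᵥ L.A y *ᵥ p' y) (x s)) 𝓤 (𝓝 (η i ⬝ᵥ r)) := fun i => by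
    obtain ⟨c₁, h₁⟩ := F.isLeaf i
    exact hr _ _ _ _ h₁
  have ht : ∀ i y, |p i y ⬝ᵥ L.A y *ᵥ p' y| ≤ M := by
    intro i y
    obtain ⟨c₁, h₁⟩ := F.isLeaf i
    refine (abs_dotProduct_le _ _).trans ?_
    have h1 : ‖p i y‖ ≤ L.K * ∑ i, ‖η i‖ := (h₁.norm_p_le y).trans (by
      gcongr
      exact Finset.single_le_sum (f := fun i => ‖η i‖) (fun j _ => norm_nonneg _)
        (Finset.mem_univ i))
    have h2 : ‖L.A y *ᵥ p' y‖ ≤ L.C * (L.K * (2 * L.K)) :=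
      (L.A_bdd _ _).trans (by gcongr; exact (h.norm_p_le y).trans (by gcongr))
    rw [hM]; gcongr
  have hT : ∀ i, |η i ⬝ᵥ r| ≤ M := by
    intro i
    refine le_of_tendsto (hr' i).abs ?_
    filter_upwards [eventually_pos h.small] with s hs
    refine abs_le.2 ⟨?_, ?_⟩
    · rw [← avg_const (L := L) (c := c s) (steps_pos hs) (-M) (x s)]
      exact avg_mono (fun y => (abs_le.1 (ht i y)).1) _
    · rw [← avg_const (L := L) (c := c s) (steps_pos hs) M (x s)]
      exact avg_mono (fun y => (abs_le.1 (ht i y)).2) _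
  set T : ι → ℝ := fun i => η i ⬝ᵥ r
  set Q : ℝ := ∑ i, lam i * T i ^ 2 with hQ
  have hQe : 2 * e' ≤ Q := by
    have h1 := F.dominates _ _ _ _ h he1 he3 r
    rw [h.dot_eq_of_tendsto_avg (hr _ _ _ _ h)] at h1
    exact le_of_mul_le_mul_left (by linarith) (by linarith : (0 : ℝ) < 2 * e')
  have hpt : ∀ y, |L.defect lam p (y, p' y)| - C * L.defect lam p (y, p' y) ≤
      ((C + 1) * Q + (C - 1) * (2 * e') + ε / 2) +
        ∑ i, (-2 * C * (lam i * T i)) * (p i y ⬝ᵥ L.A y *ᵥ p' y) := by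
    intro y
    set t : ι → ℝ := fun i => p i y ⬝ᵥ L.A y *ᵥ p' y with htd
    have hG : L.defect lam p (y, p' y) = ∑ i, lam i * t i ^ 2 - 2 * e' := by
      rw [defect, h.energy]
    have h1 : |∑ i, lam i * t i ^ 2 - Q| ≤ ∑ i, lam i * (C * (t i - T i) ^ 2 + M ^ 2 / C) := by
      rw [hQ, ← Finset.sum_sub_distrib]
      refine (Finset.abs_sum_le_sum_abs _ _).trans (Finset.sum_le_sum fun i _ => ?_)
      rw [← mul_sub, abs_mul, abs_of_nonneg (F.nonneg i)]
      refine mul_le_mul_of_nonneg_left ?_ (F.nonneg i)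
      have h2 : |t i ^ 2 - T i ^ 2| = |t i + T i| * |t i - T i| := by rw [← abs_mul]; ring_nf
      have h3 : |t i + T i| ≤ 2 * M := (abs_add_le _ _).trans (by linarith [ht i y, hT i])
      have h4 : 2 * M * |t i - T i| ≤ C * (t i - T i) ^ 2 + M ^ 2 / C := by
        have h5 : C * (t i - T i) ^ 2 + M ^ 2 / C - 2 * M * |t i - T i| =
            (C * |t i - T i| - M) ^ 2 / C := by
          rw [← sq_abs (t i - T i)]; field_simp; ring
        have : 0 ≤ (C * |t i - T i| - M) ^ 2 / C := by positivity
        linarith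
      rw [h2]
      exact (mul_le_mul_of_nonneg_right h3 (abs_nonneg _)).trans h4
    have h2 : ∑ i, lam i * (C * (t i - T i) ^ 2 + M ^ 2 / C) =
        C * ∑ i, lam i * t i ^ 2 + C * Q + ∑ i, (-2 * C * (lam i * T i)) * t i +
          Λ * (M ^ 2 / C) := by
      rw [hQ, hΛ, Finset.mul_sum, Finset.mul_sum, Finset.sum_mul, ← Finset.sum_add_distrib,
        ← Finset.sum_add_distrib, ← Finset.sum_add_distrib]
      exact Finset.sum_congr rfl fun i _ => by ring
    have h3 : |∑ i, lam i * t i ^ 2 - 2 * e'| ≤ |∑ i, lam i * t i ^ 2 - Q| + (Q - 2 * e') := by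
      rw [← abs_of_nonneg (sub_nonneg.2 hQe)]
      simpa using abs_add_le (∑ i, lam i * t i ^ 2 - Q) (Q - 2 * e')
    rw [hG]
    linarith
  have hlim : Tendsto (fun s => ((C + 1) * Q + (C - 1) * (2 * e') + ε / 2) +
        ∑ i, (-2 * C * (lam i * T i)) * L.avg (c s) (steps s)
          (fun y => p i y ⬝ᵥ L.A y *ᵥ p' y) (x s)) 𝓤
      (𝓝 (((C + 1) * Q + (C - 1) * (2 * e') + ε / 2) +
        ∑ i, (-2 * C * (lam i * T i)) * T i)) :=
    (tendsto_finsetSum _ fun i _ => (hr' i).const_mul _).const_add _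
  have hval : ∑ i, (-2 * C * (lam i * T i)) * T i = -2 * C * Q := by
    rw [hQ, Finset.mul_sum]
    exact Finset.sum_congr rfl fun i _ => by ring
  have hlt : ((C + 1) * Q + (C - 1) * (2 * e') + ε / 2) +
      ∑ i, (-2 * C * (lam i * T i)) * T i < ε := by
    rw [hval]
    nlinarith
  filter_upwards [hlim.eventually_lt_const hlt, eventually_pos h.small] with s h1 h2
  refine (avg_mono hpt _).trans (le_trans (le_of_eq ?_) h1.le)
  rw [avg_add, avg_const (steps_pos h2), avg_sum]
  simp only [avg_mul]

end IsFrame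

end LocalModel

/-- A tent function supported in `[1, 3]`. -/
def bump (t : ℝ) : ℝ := max 0 (1 - |t - 2|)

lemma continuous_bump : Continuous bump := by unfold bump; fun_prop

lemma bump_nonneg (t : ℝ) : 0 ≤ bump t := le_max_left _ _

lemma bump_two : bump 2 = 1 := by simp [bump]

lemma mem_Icc_of_bump_ne_zero {t : ℝ} (h : bump t ≠ 0) : t ∈ Set.Icc (1 : ℝ) 3 := by
  have h1 : |t - 2| ≤ 1 := by
    by_contra! h2
    exact h (max_eq_left (by linarith))
  constructor <;> linarith [(abs_le.1 h1).1, (abs_le.1 h1).2]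

lemma volume_restrict_cell (n : ℕ) : (volume : Measure (E n × E n)).restrict (cell n) =
    (volume.restrict (Set.univ.pi fun _ => Set.Ico (0 : ℝ) 1)).prod volume := by
  have := Measure.prod_restrict (μ := (volume : Measure (E n))) (ν := (volume : Measure (E n)))
    (Set.univ.pi fun _ => Set.Ico (0 : ℝ) 1) Set.univ
  rw [Measure.restrict_univ] at this
  exact this.symm

lemma integrableOn_cell {n : ℕ} {f : E n × E n → ℝ} (hf : Continuous f) {R : ℝ}
    (h : ∀ z, R < ‖z.2‖ → f z = 0) : IntegrableOn f (cell n) := by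
  have hK : IsCompact (Set.Icc (0 : E n) 1 ×ˢ Metric.closedBall (0 : E n) R) :=
    isCompact_Icc.prod (isCompact_closedBall _ _)
  have h1 : IntegrableOn f (Set.Icc (0 : E n) 1 ×ˢ Metric.closedBall (0 : E n) R) :=
    hf.continuousOn.integrableOn_compact hK
  refine h1.of_forall_sdiff_eq_zero (measurableSet_cell n) fun z hz => h z ?_
  by_contra! h2
  exact hz.2 ⟨⟨fun i => (hz.1.1 i trivial).1, fun i => (hz.1.1 i trivial).2.le⟩, by simpa using h2⟩

lemma integral_cell_scale {n : ℕ} {s : ℝ} (hs : 0 < s) {f : E n × E n → ℝ} (hf : Measurable f) :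
    ∫ z in cell n, f (z.1, s⁻¹ • z.2) = s ^ n * ∫ z in cell n, f z := by
  have h1 : (volume.restrict (cell n)).map (Prod.map id fun v : E n => s⁻¹ • v) =
      ENNReal.ofReal (s ^ n) • volume.restrict (cell n) := by
    rw [volume_restrict_cell, ← Measure.map_prod_map _ _ measurable_id (measurable_const_smul _),
      Measure.map_id, Measure.map_addHaar_smul _ (inv_ne_zero hs.ne'), Measure.prod_smul_right]
    simp [abs_of_pos hs]
  have h2 := integral_map (μ := volume.restrict (cell n))
    (φ := Prod.map id fun v : E n => s⁻¹ • v) (f := f) (by fun_prop) hf.aestronglyMeasurable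
  rw [h1, integral_smul_measure, ENNReal.toReal_ofReal (by positivity), smul_eq_mul] at h2
  exact h2.symm

namespace LocalModel

variable {n : ℕ} {L : LocalModel n} {𝓤 : Ultrafilter ℝ} {ι : Type} [Fintype ι]

lemma norm_sq_le_of_bump_ne_zero {z : E n × E n} (h : bump (L.kin z) ≠ 0) :
    ‖z.2‖ ≤ Real.sqrt (3 / L.κ) := by
  refine Real.le_sqrt_of_sq_le ?_
  rw [le_div_iff₀ L.κ_pos]
  linarith [L.norm_sq_le_kin z, (mem_Icc_of_bump_ne_zero h).2]

lemma iterate_leaf (L : LocalModel n) (c x : E n) (k : ℕ) :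
    L.Ψ^[k] (x, L.δ c x) = ((L.ψ c)^[k] x, L.δ c ((L.ψ c)^[k] x)) := by
  induction k with
  | zero => rfl
  | succ k ih => rw [Function.iterate_succ_apply', ih, L.Ψ_leaf, Function.iterate_succ_apply']

lemma iterate_per (L : LocalModel n) (k : ℕ) (z : E n × E n) (m : Fin n → ℤ) :
    L.Ψ^[k] (z + (intVec m, 0)) = L.Ψ^[k] z + (intVec m, 0) := by
  induction k with
  | zero => rfl
  | succ k ih =>
    rw [Function.iterate_succ_apply', ih, Function.iterate_succ_apply']
    have := L.Ψ_per (L.Ψ^[k] z).1 (L.Ψ^[k] z).2 m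
    rw [← this]; congr 1; ext i <;> simp

namespace IsFrame

variable {lam : ι → ℝ} {η : ι → E n} {p : ι → E n → E n} {e : ι → ℝ}

lemma orbit_avg_le (h𝓤 : (𝓤 : Filter ℝ) ≤ 𝓝[>] 0) (F : IsFrame L 𝓤 lam η p e) {ε : ℝ}
    (hε : 0 < ε) : ∃ C R : ℝ, ∀ ε' > 0, ∀ᶠ s in (𝓤 : Filter ℝ), ∀ c x,
      L.avg c (steps s) (fun y => bump (L.kin (y, s⁻¹ • L.δ c y)) *
        (|L.defect lam p (y, s⁻¹ • L.δ c y)| - C * L.defect lam p (y, s⁻¹ • L.δ c y) - ε)) x ≤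
      if ‖s⁻¹ • L.δ c x‖ ≤ R then ε' else 0 := by
  obtain ⟨C, hC, hav⟩ := F.avg_defect_le hε
  obtain ⟨K', hK', σ, hσ, hnorm⟩ := L.exists_norm_class_le
  set R₁ := Real.sqrt (3 / L.κ) with hR₁
  have hR₁0 : 0 < R₁ := Real.sqrt_pos.2 (div_pos (by norm_num) L.κ_pos)
  have hK := L.K_pos
  refine ⟨C, L.K * (K' * R₁), fun ε' hε' => ?_⟩
  set f : E n × E n → ℝ := fun z => bump (L.kin z) *
    (|L.defect lam p z| - C * L.defect lam p z - ε) with hf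
  have hfc : Continuous f := (continuous_bump.comp L.kin_cont).mul
    ((F.defect_cont.abs.sub (F.defect_cont.const_mul C)).sub continuous_const)
  have hfper : ∀ x v (m : Fin n → ℤ), f (x + intVec m, v) = f (x, v) := by
    intro x v m
    have h1 := L.kin_per (x, v) m
    have h2 := F.defect_per (x, v) m
    simp only [Prod.mk_add_mk, add_zero] at h1 h2
    simp only [hf, h1, h2]
  by_contra hcon
  rw [← Ultrafilter.eventually_not] at hcon
  have hch : ∀ s, ∃ c x, (¬ ∀ c x, L.avg c (steps s) (fun y => f (y, s⁻¹ • L.δ c y)) x ≤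
      if ‖s⁻¹ • L.δ c x‖ ≤ L.K * (K' * R₁) then ε' else 0) →
      (if ‖s⁻¹ • L.δ c x‖ ≤ L.K * (K' * R₁) then ε' else 0) <
        L.avg c (steps s) (fun y => f (y, s⁻¹ • L.δ c y)) x := by
    intro s
    by_cases h : ∀ c x, L.avg c (steps s) (fun y => f (y, s⁻¹ • L.δ c y)) x ≤
      if ‖s⁻¹ • L.δ c x‖ ≤ L.K * (K' * R₁) then ε' else 0
    · exact ⟨0, 0, fun h' => absurd h h'⟩
    · have h' := h
      push Not at h'
      obtain ⟨c, x, hcx⟩ := h'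
      exact ⟨c, x, fun _ => hcx⟩
  choose c x hbad using hch
  have hsmall : ∀ᶠ s in (𝓤 : Filter ℝ), R₁ * s < σ :=
    ((tendsto_zero h𝓤).const_mul R₁).eventually_lt_const (by simpa using hσ)
  have hev : ∀ᶠ s in (𝓤 : Filter ℝ), ‖c s‖ ≤ K' * R₁ * s ∧
      ε' < L.avg (c s) (steps s) (fun y => f (y, s⁻¹ • L.δ (c s) y)) (x s) := by
    filter_upwards [hcon, hsmall, eventually_pos h𝓤] with s h1 h2 h3
    have h4 := hbad s h1
    have h5 : 0 < L.avg (c s) (steps s) (fun y => f (y, s⁻¹ • L.δ (c s) y)) (x s) :=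
      lt_of_le_of_lt (by split_ifs <;> positivity) h4
    obtain ⟨y, hy⟩ : ∃ y, 0 < f (y, s⁻¹ • L.δ (c s) y) := by
      by_contra! h6
      exact h5.not_ge (div_nonpos_of_nonpos_of_nonneg (Finset.sum_nonpos fun k _ => h6 _)
        (Nat.cast_nonneg _))
    have h6 : ‖s⁻¹ • L.δ (c s) y‖ ≤ R₁ :=
      norm_sq_le_of_bump_ne_zero (L := L) (z := (y, s⁻¹ • L.δ (c s) y)) fun h7 => by
        simp [hf, h7] at hy
    rw [norm_smul, norm_inv, Real.norm_of_nonneg h3.le, inv_mul_le_iff₀ h3, mul_comm] at h6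
    obtain ⟨h7, h8⟩ := hnorm _ _ (h6.trans h2.le)
    have h9 : ‖c s‖ ≤ K' * R₁ * s := by rw [mul_assoc]; exact h8.trans (by gcongr)
    refine ⟨h9, ?_⟩
    rwa [if_pos] at h4
    rw [norm_smul, norm_inv, Real.norm_of_nonneg h3.le, inv_mul_le_iff₀ h3]
    refine (est_δ h7 _).trans ?_
    calc L.K * ‖c s‖ ≤ L.K * (K' * R₁ * s) := by gcongr
      _ = _ := by ring
  obtain ⟨η', p', e', h⟩ := exists_isLeaf (L := L) h𝓤 (hev.mono fun s hs => hs.1)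
  have happ : ∀ᶠ s in (𝓤 : Filter ℝ), ∀ y,
      |f (y, s⁻¹ • L.δ (c s) y) - f (y, p' y)| ≤ ε' / 4 := by
    refine eventually_forall_of_seq 𝓤 (fun s y m hP => ?_) fun y y₀ hy => ?_
    · rwa [hfper, hfper, L.δ_per, h.p_per] at hP
    · have h1 : Tendsto (fun s => f (y s, s⁻¹ • L.δ (c s) (y s))) 𝓤 (𝓝 (f (y₀, p' y₀))) :=
        (hfc.tendsto _).comp (hy.prodMk_nhds (h.conv y y₀ hy))
      have h2 : Tendsto (fun s => f (y s, p' (y s))) 𝓤 (𝓝 (f (y₀, p' y₀))) :=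
        (hfc.tendsto _).comp (hy.prodMk_nhds ((h.p_cont.tendsto _).comp hy))
      have h3 := (h1.sub h2).abs
      rw [sub_self, abs_zero] at h3
      exact h3.eventually_le_const (by positivity)
  have hfe : ∀ y, f (y, p' y) = bump (2 * e') *
      (|L.defect lam p (y, p' y)| - C * L.defect lam p (y, p' y) - ε) := fun y => by
    simp only [hf, kin, h.energy]
  have hle : ∀ᶠ s in (𝓤 : Filter ℝ),
      L.avg (c s) (steps s) (fun y => f (y, p' y)) (x s) ≤ 0 := by
    by_cases hb : bump (2 * e') = 0
    · refine .of_forall fun s => ?_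
      simp only [hfe, hb, zero_mul, avg, Finset.sum_const_zero, zero_div, le_refl]
    · have h1 := mem_Icc_of_bump_ne_zero hb
      filter_upwards [hav _ _ _ _ h h1.1 h1.2 x, eventually_pos h𝓤] with s h2 h3
      simp only [hfe, sub_eq_add_neg _ ε]
      rw [avg_mul, avg_add, avg_const (steps_pos h3)]
      exact mul_nonpos_of_nonneg_of_nonpos (bump_nonneg _) (by linarith)
  obtain ⟨s, h1, h2, h3, h4⟩ := (hev.and (happ.and (hle.and (eventually_pos h𝓤)))).exists
  have h5 := abs_le.1 (abs_avg_sub_le (L := L) (c := c s) (steps_pos h4) h2 (x s))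
  linarith [h1.2, h5.2]

lemma integral_bump_defect (hn : 1 ≤ n) (F : IsFrame L 𝓤 lam η p e) :
    ∫ z in cell n, bump (L.kin z) * L.defect lam p z = 0 := by
  have hc : Continuous fun z => bump (L.kin z) * L.defect lam p z :=
    (continuous_bump.comp L.kin_cont).mul F.defect_cont
  have hz : ∀ z : E n × E n, Real.sqrt (3 / L.κ) < ‖z.2‖ → bump (L.kin z) = 0 := fun z h => by
    by_contra h'
    exact absurd (norm_sq_le_of_bump_ne_zero h') (not_le.2 h)
  have hi := integrableOn_cell hc (R := Real.sqrt (3 / L.κ)) fun z h => by rw [hz z h, zero_mul]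
  rw [IntegrableOn, volume_restrict_cell] at hi
  rw [volume_restrict_cell, integral_prod _ hi]
  have key : ∀ x : E n, ∫ J, bump (L.kin (x, J)) * L.defect lam p (x, J) = 0 := by
    intro x
    have hcx : Continuous fun J => bump (L.kin (x, J)) :=
      continuous_bump.comp (L.kin_cont.comp (Continuous.prodMk_right x))
    have hI : ∀ g : E n → ℝ, Continuous g → Integrable fun J => bump (L.kin (x, J)) * g J :=
      fun g hg => integrable_of_continuous_of_bounded_support (hcx.mul hg)
        (R := Real.sqrt (3 / L.κ))
        fun J hJ => by rw [hz (x, J) hJ, zero_mul]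
    have h1 : ∀ i, Integrable fun J => lam i * (bump (L.kin (x, J)) *
        (p i x ⬝ᵥ L.A x *ᵥ J) ^ 2) := fun i =>
      (hI _ ((continuous_const.dotProduct (continuous_const.matrix_mulVec continuous_id)).pow
        2)).const_mul _
    have h2 : Integrable fun J => bump (L.kin (x, J)) * (J ⬝ᵥ L.A x *ᵥ J) :=
      hI _ (continuous_id.dotProduct (continuous_const.matrix_mulVec continuous_id))
    have h3 : ∀ J, bump (L.kin (x, J)) * L.defect lam p (x, J) =
        ∑ i, lam i * (bump (L.kin (x, J)) * (p i x ⬝ᵥ L.A x *ᵥ J) ^ 2) -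
          bump (L.kin (x, J)) * (J ⬝ᵥ L.A x *ᵥ J) := fun J => by
      rw [defect, mul_sub, Finset.mul_sum]
      congr 1
      exact Finset.sum_congr rfl fun i _ => by ring
    simp only [h3]
    rw [integral_sub (integrable_finsetSum _ fun i _ => h1 i) h2,
      integral_finsetSum _ fun i _ => h1 i]
    simp only [integral_const_mul]
    have hiso := integral_isotropic_quadratic continuous_bump
      (fun t ht => by by_contra h; linarith [(mem_Icc_of_bump_ne_zero h).2]) (L.A_symm x)
      (fun v => (mul_nonneg L.κ_pos.le (sq_nonneg _)).trans (L.A_coer x v))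
      (fun h => by have := congrArg Matrix.det (L.g_mul_A x); simp [h] at this)
    have hn0 : (n : ℝ) ≠ 0 := by positivity
    refine mul_left_cancel₀ hn0 ?_
    rw [mul_sub, Finset.mul_sum, mul_zero, sub_eq_zero]
    have h4 : ∀ i, (n : ℝ) * (lam i * ∫ J, bump (L.kin (x, J)) * (p i x ⬝ᵥ L.A x *ᵥ J) ^ 2) =
        lam i * (2 * e i) * ∫ J, bump (L.kin (x, J)) * (J ⬝ᵥ L.A x *ᵥ J) := fun i => by
      obtain ⟨c, h⟩ := F.isLeaf i
      have := hiso (p i x)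
      rw [h.energy] at this
      simp only [kin]
      linear_combination lam i * this
    simp only [h4, ← Finset.sum_mul, F.sum_eq]
  simp only [key, integral_zero]

/-- A frame of limit leaves is, pointwise, a tight frame for the metric. -/
lemma defect_eq_zero (h𝓤 : (𝓤 : Filter ℝ) ≤ 𝓝[>] 0) (hn : 1 ≤ n) (F : IsFrame L 𝓤 lam η p e)
    (z : E n × E n) : L.defect lam p z = 0 := by
  have hz : ∀ z : E n × E n, Real.sqrt (3 / L.κ) < ‖z.2‖ → bump (L.kin z) = 0 := fun z h => by
    by_contra h'
    exact absurd (norm_sq_le_of_bump_ne_zero h') (not_le.2 h)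
  have hbc : Continuous fun z => bump (L.kin z) := continuous_bump.comp L.kin_cont
  have hint : ∀ g : E n × E n → ℝ, Continuous g → IntegrableOn (fun z => bump (L.kin z) * g z)
      (cell n) := fun g hg => integrableOn_cell (hbc.mul hg) fun z h => by rw [hz z h, zero_mul]
  have hGc := F.defect_cont
  have hle : ∀ ε > 0, ∫ z in cell n, bump (L.kin z) * |L.defect lam p z| ≤
      ε * ∫ z in cell n, bump (L.kin z) * 1 := by
    intro ε hε
    obtain ⟨C, R, hCR⟩ := F.orbit_avg_le h𝓤 hε
    set f : E n × E n → ℝ := fun z => bump (L.kin z) *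
      (|L.defect lam p z| - C * L.defect lam p z - ε) with hf
    have hfc : Continuous f := hbc.mul ((hGc.abs.sub (hGc.const_mul C)).sub continuous_const)
    have hf0 : ∫ z in cell n, f z ≤ 0 := by
      set V := ∫ z in cell n, if ‖z.2‖ ≤ R then (1 : ℝ) else 0 with hV
      have hmeas : ∀ a : ℝ, Measurable fun z : E n × E n => if ‖z.2‖ ≤ R then a else 0 := fun a =>
        Measurable.ite (measurableSet_le (by fun_prop) (by fun_prop)) measurable_const
          measurable_const
      have hIntV : ∀ a s : ℝ, 0 < s → IntegrableOn (fun z : E n × E n =>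
          if ‖s⁻¹ • z.2‖ ≤ R then a else 0) (cell n) := by
        intro a s hs
        have hfin : volume (cell n ∩ {z : E n × E n | ‖s⁻¹ • z.2‖ ≤ R}) ≠ ⊤ := by
          refine ((measure_mono fun z hz => ?_).trans_lt ((isCompact_Icc (a := (0 : E n))
            (b := 1)).prod (isCompact_closedBall (0 : E n) (s * R))).measure_lt_top).ne
          refine ⟨⟨fun i => (hz.1.1 i trivial).1, fun i => (hz.1.1 i trivial).2.le⟩, ?_⟩
          have := hz.2
          rw [Set.mem_ofPred_eq, norm_smul, norm_inv, Real.norm_of_nonneg hs.le,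
            inv_mul_le_iff₀ hs] at this
          simpa using this
        have hms : MeasurableSet {z : E n × E n | ‖s⁻¹ • z.2‖ ≤ R} :=
          measurableSet_le (by fun_prop) (by fun_prop)
        have : (fun z : E n × E n => if ‖s⁻¹ • z.2‖ ≤ R then a else 0) =
            Set.indicator {z | ‖s⁻¹ • z.2‖ ≤ R} fun _ => a := by
          ext z; simp [Set.indicator_apply]
        rw [this, IntegrableOn, integrable_indicator_iff hms, IntegrableOn,
          Measure.restrict_restrict hms, Set.inter_comm]
        exact integrableOn_const hfin
      have hV' : ∀ ε' > 0, ∫ z in cell n, f z ≤ ε' * V := by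
        intro ε' hε'
        obtain ⟨s, hs, hs0⟩ := ((hCR ε' hε').and (eventually_pos h𝓤)).exists
        have hN : (0 : ℝ) < steps s := by exact_mod_cast steps_pos hs0
        set fs : E n × E n → ℝ := fun z => f (z.1, s⁻¹ • z.2) with hfs
        have hfsc : Continuous fs := hfc.comp (by fun_prop)
        have hfsper : ∀ z (m : Fin n → ℤ), fs (z + (intVec m, 0)) = fs z := by
          intro z m
          have h1 := L.kin_per (z.1, s⁻¹ • z.2) m
          have h2 := F.defect_per (z.1, s⁻¹ • z.2) m
          simp only [Prod.mk_add_mk, add_zero] at h1 h2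
          simp only [hfs, hf, Prod.fst_add, Prod.snd_add, add_zero, h1, h2]
        have hfsi : IntegrableOn fs (cell n) := by
          refine integrableOn_cell hfsc (R := s * Real.sqrt (3 / L.κ)) fun z h => ?_
          simp only [hfs, hf]
          rw [hz, zero_mul]
          rwa [norm_smul, norm_inv, Real.norm_of_nonneg hs0.le, lt_inv_mul_iff₀ hs0]
        have hk := fun k => integrableOn_cell_comp (L.Ψ_mp.iterate k) (L.iterate_per k) hfsc hfsper
          hfsi
        have hki : ∀ k, Integrable (fun z => fs (L.Ψ^[k] z)) (volume.restrict (cell n)) :=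
          fun k => (hk k).1
        have hke : ∀ k, ∫ z in cell n, fs (L.Ψ^[k] z) = ∫ z in cell n, fs z := fun k => (hk k).2
        have h1 : ∫ z in cell n, (∑ k ∈ Finset.range (steps s), fs (L.Ψ^[k] z)) / steps s =
            s ^ n * ∫ z in cell n, f z := by
          rw [integral_div, integral_finsetSum _ fun k _ => hki k,
            Finset.sum_congr rfl fun k _ => hke k, Finset.sum_const, Finset.card_range,
            nsmul_eq_mul, mul_div_cancel_left₀ _ hN.ne', integral_cell_scale hs0 hfc.measurable]
        have h2 : ∫ z in cell n, (∑ k ∈ Finset.range (steps s), fs (L.Ψ^[k] z)) / steps s ≤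
            ∫ z in cell n, if ‖s⁻¹ • z.2‖ ≤ R then ε' else 0 := by
          refine integral_mono ((integrable_finsetSum _ fun k _ => hki k).div_const _)
            (hIntV ε' s hs0) fun z => ?_
          obtain ⟨c, hc⟩ := L.leaf z.1 z.2
          have h3 := hs c z.1
          have h4 : z = (z.1, L.δ c z.1) := by rw [hc]
          rw [hc] at h3
          refine le_trans (le_of_eq ?_) h3
          rw [avg]
          congr 1
          refine Finset.sum_congr rfl fun k _ => ?_
          conv_lhs => rw [h4, iterate_leaf]
        rw [h1, integral_cell_scale hs0 (hmeas ε')] at h2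
        have h5 := le_of_mul_le_mul_left h2 (by positivity)
        refine h5.trans (le_of_eq ?_)
        rw [hV, ← integral_const_mul]
        exact integral_congr_ae (.of_forall fun z => by dsimp only; split_ifs <;> simp)
      refine le_of_forall_pos_le_add fun b hb => ?_
      have hV0 : 0 ≤ V := integral_nonneg fun z => by dsimp only; split_ifs <;> simp
      calc _ ≤ b / (V + 1) * V := hV' _ (by positivity)
        _ ≤ 0 + b := by
          rw [zero_add, div_mul_eq_mul_div, div_le_iff₀ (by positivity)]
          nlinarith
    have hsplit : ∀ z, f z = (bump (L.kin z) * |L.defect lam p z| -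
        C * (bump (L.kin z) * L.defect lam p z)) - ε * (bump (L.kin z) * 1) := fun z => by
      simp only [hf]; ring
    have i1 := hint _ hGc.abs
    have i2 := (hint _ hGc).const_mul C
    have i3 := (hint (fun _ => 1) continuous_const).const_mul ε
    have i12 : Integrable (fun z => bump (L.kin z) * |L.defect lam p z| -
        C * (bump (L.kin z) * L.defect lam p z)) (volume.restrict (cell n)) := i1.sub i2
    simp only [hsplit] at hf0
    rw [integral_sub i12 i3, integral_sub i1 i2, integral_const_mul, integral_const_mul,
      F.integral_bump_defect hn] at hf0
    linarith
  have hzero : ∫ z in cell n, bump (L.kin z) * |L.defect lam p z| ≤ 0 := by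
    set V := ∫ z in cell n, bump (L.kin z) * 1
    have hV0 : 0 ≤ V := integral_nonneg fun z => by simpa using bump_nonneg _
    refine le_of_forall_pos_le_add fun b hb => ?_
    calc _ ≤ b / (V + 1) * V := hle _ (by positivity)
      _ ≤ 0 + b := by
        rw [zero_add, div_mul_eq_mul_div, div_le_iff₀ (by positivity)]
        nlinarith
  have hnn : ∀ z, 0 ≤ bump (L.kin z) * |L.defect lam p z| := fun z =>
    mul_nonneg (bump_nonneg _) (abs_nonneg _)
  have hae := (integral_eq_zero_iff_of_nonneg hnn (hint _ hGc.abs)).1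
    (le_antisymm hzero (integral_nonneg hnn))
  have heq : Set.EqOn (fun z => bump (L.kin z) * |L.defect lam p z|) (fun _ => 0) (cell n) :=
    eqOn_cell_of_ae_eq (hbc.mul hGc.abs) continuous_const hae
  have hall : ∀ z, bump (L.kin z) * |L.defect lam p z| = 0 := by
    intro z
    obtain ⟨m, hm, -⟩ := exists_unique_add_intVec_mem z.1
    have h1 := heq (x := z + (intVec m, 0)) ⟨by rwa [Prod.fst_add, add_comm], trivial⟩
    simpa only [L.kin_per, F.defect_per] using h1
  obtain ⟨x, J⟩ := z
  by_cases hJ : J = 0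
  · simp [defect, hJ]
  have hτ : 0 < L.kin (x, J) := lt_of_lt_of_le
    (mul_pos L.κ_pos (pow_pos (norm_pos_iff.2 hJ) 2)) (L.norm_sq_le_kin (x, J))
  set t := Real.sqrt (2 / L.kin (x, J)) with ht
  have ht2 : t ^ 2 = 2 / L.kin (x, J) := Real.sq_sqrt (by positivity)
  have h1 : L.kin (x, t • J) = 2 := by
    have : L.kin (x, t • J) = t ^ 2 * L.kin (x, J) := by
      simp only [kin, Matrix.mulVec_smul, dotProduct_smul, smul_dotProduct, smul_eq_mul]; ring
    rw [this, ht2]; field_simp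
  have h2 : L.defect lam p (x, t • J) = t ^ 2 * L.defect lam p (x, J) := by
    simp only [defect, Matrix.mulVec_smul, dotProduct_smul, smul_dotProduct, smul_eq_mul, mul_sub,
      Finset.mul_sum]
    congr 1
    · exact Finset.sum_congr rfl fun i _ => by ring
    · ring
  have h3 := hall (x, t • J)
  rw [h1, bump_two, one_mul, abs_eq_zero, h2, ht2] at h3
  exact (mul_eq_zero.1 h3).resolve_left (by positivity)

end IsFrame

end LocalModel

namespace LocalModel

variable {n : ℕ} {L : LocalModel n} {𝓤 : Ultrafilter ℝ}

lemma sq_avg_le {c : E n} {N : ℕ} (hN : 0 < N) (f : E n → ℝ) (x : E n) :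
    (L.avg c N f x) ^ 2 ≤ L.avg c N (fun y => f y ^ 2) x := by
  have hN' : (0 : ℝ) < N := by exact_mod_cast hN
  have h := sq_sum_le_card_mul_sum_sq (s := Finset.range N) (f := fun k => f ((L.ψ c)^[k] x))
  rw [Finset.card_range] at h
  rw [avg, avg, div_pow, div_le_div_iff₀ (by positivity) hN']
  nlinarith

lemma sq_dotProduct_le {n : ℕ} (y z : E n) : (y ⬝ᵥ z) ^ 2 ≤ (y ⬝ᵥ y) * (z ⬝ᵥ z) := by
  simpa only [dotProduct, ← sq] using
    Finset.sum_mul_sq_le_sq_mul_sq Finset.univ y z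

/-- If a weighted family of leaves is a Parseval frame of the kinetic energy, its quadratic form is
at most twice the energy of any other leaf at the mean velocity of that leaf. -/
lemma IsLeaf.exists_rotation {ι : Type} [Fintype ι] {lam : ι → ℝ} {η : ι → E n}
    {p : ι → E n → E n} {e : ι → ℝ} (hl : ∀ i, ∃ c, IsLeaf L 𝓤 c (η i) (p i) (e i))
    (h0 : ∀ i, 0 ≤ lam i) (hz : ∀ z, L.defect lam p z = 0) {c : ℝ → E n} {η' : E n}
    {p' : E n → E n} {e' : ℝ} (h : IsLeaf L 𝓤 c η' p' e') :
    ∃ r, η' ⬝ᵥ r = 2 * e' ∧ ∑ i, lam i * (η i ⬝ᵥ r) ^ 2 ≤ 2 * e' := by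
  obtain ⟨r, hr⟩ := h.exists_tendsto_avg fun _ => 0
  refine ⟨r, h.dot_eq_of_tendsto_avg (hr _ _ _ _ h), ?_⟩
  choose c' hc' using hl
  have h1 := tendsto_finsetSum Finset.univ fun i _ =>
    ((hr _ _ _ _ (hc' i)).pow 2).const_mul (lam i)
  refine le_of_tendsto h1 ?_
  filter_upwards [eventually_pos h.small] with s hs
  have hN := steps_pos hs
  calc _ ≤ ∑ i, lam i * L.avg (c s) (steps s) (fun y => (p i y ⬝ᵥ L.A y *ᵥ p' y) ^ 2) 0 :=
        Finset.sum_le_sum fun i _ => mul_le_mul_of_nonneg_left (sq_avg_le hN _ _) (h0 i)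
    _ = L.avg (c s) (steps s) (fun y => ∑ i, lam i * (p i y ⬝ᵥ L.A y *ᵥ p' y) ^ 2) 0 := by
        rw [avg_sum]; simp only [avg_mul]
    _ = L.avg (c s) (steps s) (fun _ => 2 * e') 0 := by
        congr 1
        funext y
        rw [← h.energy y]
        exact sub_eq_zero.1 (hz (y, p' y))
    _ = _ := avg_const hN _ _

lemma exists_ray {a₀ : E n → ℝ} (hc : Continuous a₀) (h0 : ∀ η, ‖η‖ ^ 2 ≤ L.K * a₀ η)
    (h1 : ∀ η, a₀ η ≤ L.K * ‖η‖ ^ 2) {u : E n} (hu : u ≠ 0) :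
    ∃ t : ℝ, 0 < t ∧ 2 * a₀ (t • u) = 1 := by
  have hK := L.K_pos
  have hu' := norm_pos_iff.2 hu
  set R := (L.K + 1) / ‖u‖
  have hf : Continuous fun t : ℝ => 2 * a₀ (t • u) := by fun_prop
  have hz : 2 * a₀ ((0 : ℝ) • u) ≤ 0 := by
    have := h1 0
    rw [zero_smul]
    simp at this
    linarith
  have hR : 1 ≤ 2 * a₀ (R • u) := by
    have := h0 (R • u)
    rw [norm_smul, Real.norm_of_nonneg (by positivity), div_mul_cancel₀ _ hu'.ne'] at this
    nlinarith
  obtain ⟨t, ht, hte⟩ := intermediate_value_Icc (show (0 : ℝ) ≤ R by positivity) hf.continuousOn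
    (show (1 : ℝ) ∈ Set.Icc _ _ from ⟨by linarith, hR⟩)
  refine ⟨t, lt_of_le_of_ne ht.1 ?_, hte⟩
  rintro rfl
  simp only at hte
  linarith

/-- In suitable linear coordinates `B` on the classes, the energy of a limit leaf is half the
squared Euclidean norm of its class, and the leaves of the coordinate classes are orthonormal. -/
theorem exists_orthoframe (h𝓤 : (𝓤 : Filter ℝ) ≤ 𝓝[>] 0) (hn : 1 ≤ n) {σ₀ σ₁ : ℝ} (h0 : 0 < σ₀)
    (h01 : σ₀ ≤ 1) (h3 : 3 ≤ σ₁) : ∃ (B : Matrix (Fin n) (Fin n) ℝ) (p : Fin n → E n → E n),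
    B.det ≠ 0 ∧ (∀ i, ∃ c, IsLeaf L 𝓤 c (B i) (p i) (1 / 2)) ∧
    (∀ x J, ∑ i, (p i x ⬝ᵥ L.A x *ᵥ J) ^ 2 = J ⬝ᵥ L.A x *ᵥ J) ∧
    ∀ c y p' e', IsLeaf L 𝓤 c (Bᵀ *ᵥ y) p' e' → σ₀ ≤ 2 * e' → 2 * e' ≤ σ₁ → y ⬝ᵥ y = 2 * e' := by
  have hK := L.K_pos
  obtain ⟨a₀, hac, hae, hex⟩ := exists_energy (L := L) h𝓤
  choose q hq using hex
  have hlow : ∀ η, ‖η‖ ^ 2 ≤ L.K * a₀ η := fun η => (hq η).sq_norm_le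
  have hup : ∀ η, a₀ η ≤ L.K * ‖η‖ ^ 2 := fun η => (hq η).le_sq_norm
  set S : Set (E n) := {η | σ₀ ≤ 2 * a₀ η ∧ 2 * a₀ η ≤ σ₁} with hS
  have hac2 : Continuous fun η => 2 * a₀ η := continuous_const.mul hac
  have hSc : IsCompact S := by
    refine (isCompact_closedBall (0 : E n) (Real.sqrt (L.K * σ₁))).of_isClosed_subset
      ((isClosed_le continuous_const hac2).and (isClosed_le hac2 continuous_const)) fun η hη => ?_
    rw [mem_closedBall_zero_iff]
    refine Real.le_sqrt_of_sq_le ((hlow η).trans ?_)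
    nlinarith [hη.1, hη.2]
  have hSpos : ∀ η ∈ S, 0 < 2 * a₀ η := fun η hη => h0.trans_le hη.1
  set T : Set (E n) := (fun η => (Real.sqrt (2 * a₀ η))⁻¹ • η) '' S with hT
  have hTc : IsCompact T := by
    refine hSc.image_of_continuousOn (ContinuousOn.smul
      (ContinuousOn.inv₀ hac2.sqrt.continuousOn ?_)
      continuousOn_id)
    exact fun η hη => (Real.sqrt_pos.2 (hSpos η hη)).ne'
  have hunit : ∀ η, 2 * a₀ η = 1 → η ∈ S ∧ η ∈ T := by
    intro η h
    have h1 : η ∈ S := ⟨by linarith, by linarith⟩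
    exact ⟨h1, η, h1, by simp [h]⟩
  obtain ⟨d, w, v, B, hw, hwn, hvT, hB, hform, hjohn⟩ := exists_john hn hTc (by
    intro i
    obtain ⟨t, ht, hte⟩ := exists_ray hac hlow hup
      (show (Pi.single i 1 : E n) ≠ 0 by simp)
    exact ⟨t, ht.ne', by simpa [← Pi.single_smul] using (hunit _ hte).2⟩)
  have hy : ∀ y, Bᵀ *ᵥ y ∈ S → y ⬝ᵥ y ≤ 2 * a₀ (Bᵀ *ᵥ y) := by
    intro y hyS
    have h1 := hSpos _ hyS
    have h2 := hjohn ((Real.sqrt (2 * a₀ (Bᵀ *ᵥ y)))⁻¹ • y)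
      ⟨_, hyS, by simp only [Matrix.mulVec_smul]⟩
    rw [smul_dotProduct, dotProduct_smul, smul_eq_mul, smul_eq_mul, ← mul_assoc, ← mul_inv,
      Real.mul_self_sqrt h1.le, inv_mul_le_iff₀ h1] at h2
    linarith
  have hBu : IsUnit Bᵀ.det := by rw [Matrix.det_transpose]; exact hB.isUnit
  have hsolve : ∀ η, Bᵀ *ᵥ ((Bᵀ)⁻¹ *ᵥ η) = η := fun η => by
    rw [Matrix.mulVec_mulVec, Matrix.mul_nonsing_inv _ hBu, Matrix.one_mulVec]
  have hdotB : ∀ y r, (Bᵀ *ᵥ y) ⬝ᵥ r = y ⬝ᵥ (B *ᵥ r) := fun y r => by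
    rw [Matrix.mulVec_transpose, Matrix.dotProduct_mulVec]
  have hdom : ∀ c η' p' e', IsLeaf L 𝓤 c η' p' e' → 1 ≤ 2 * e' → 2 * e' ≤ 3 →
      ∀ r, (η' ⬝ᵥ r) ^ 2 ≤ 2 * e' * ((B *ᵥ r) ⬝ᵥ (B *ᵥ r)) := by
    intro c η' p' e' h h1 h2 r
    have he := hae _ _ _ _ h
    rw [← hsolve η'] at he ⊢
    have hyS : Bᵀ *ᵥ ((Bᵀ)⁻¹ *ᵥ η') ∈ S := ⟨by linarith, by linarith⟩
    rw [hdotB]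
    have h4 := hy _ hyS
    refine (sq_dotProduct_le _ _).trans (mul_le_mul_of_nonneg_right (by linarith) ?_)
    exact Finset.sum_nonneg fun i _ => mul_self_nonneg _
  choose θ hθS hθ using hvT
  have hF : IsFrame L 𝓤 (fun i => w i / (2 * a₀ (θ i))) θ (fun i => q (θ i))
      fun i => a₀ (θ i) := by
    refine ⟨fun i => ⟨_, hq _⟩, fun i => div_nonneg (hw i) (hSpos _ (hθS i)).le, ?_, ?_⟩
    · rw [← hwn]
      exact Finset.sum_congr rfl fun i _ => div_mul_cancel₀ _ (hSpos _ (hθS i)).ne'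
    · intro c η' p' e' h h1 h2 r
      refine (hdom c η' p' e' h h1 h2 r).trans (le_of_eq ?_)
      rw [← hform]
      congr 1
      refine Finset.sum_congr rfl fun i _ => ?_
      have h4 := hSpos _ (hθS i)
      rw [← hθ i]
      simp only [smul_dotProduct, smul_eq_mul, mul_pow, inv_pow, Real.sq_sqrt h4.le]
      field_simp
  have hrot : ∀ c y p' e', IsLeaf L 𝓤 c (Bᵀ *ᵥ y) p' e' → σ₀ ≤ 2 * e' → 2 * e' ≤ σ₁ →
      y ⬝ᵥ y = 2 * e' := by
    intro c y p' e' h h1 h2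
    have he := hae _ _ _ _ h
    have h4 := hy y ⟨by linarith, by linarith⟩
    refine le_antisymm (by linarith) ?_
    obtain ⟨r, hr1, hr2⟩ := h.exists_rotation hF.isLeaf hF.nonneg (hF.defect_eq_zero h𝓤 hn)
    have h5 : (B *ᵥ r) ⬝ᵥ (B *ᵥ r) ≤ 2 * e' := by
      refine (le_of_eq ?_).trans hr2
      rw [← hform]
      refine Finset.sum_congr rfl fun i _ => ?_
      have h4 := hSpos _ (hθS i)
      rw [← hθ i]
      simp only [smul_dotProduct, smul_eq_mul, mul_pow, inv_pow, Real.sq_sqrt h4.le]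
      field_simp
    rw [hdotB] at hr1
    have h6 := sq_dotProduct_le y (B *ᵥ r)
    have h7 : 0 ≤ y ⬝ᵥ y := Finset.sum_nonneg fun i _ => mul_self_nonneg _
    rw [hr1] at h6
    by_contra! h8
    nlinarith
  have hrow : ∀ i, Bᵀ *ᵥ Pi.single i 1 = B i := fun i => by simp [Matrix.col]
  have hunitB : ∀ i, 2 * a₀ (B i) = 1 := by
    intro i
    have hne : B i ≠ 0 := by
      intro h
      exact hB (Matrix.det_eq_zero_of_row_eq_zero i fun j => congrFun h j)
    obtain ⟨t, ht, hte⟩ := exists_ray hac hlow hup hne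
    have h1 := hrot (fun s => s • t • B i) (t • Pi.single i 1) (q (t • B i)) (a₀ (t • B i)) (by
      rw [Matrix.mulVec_smul, hrow]; exact hq _) (by linarith) (by linarith)
    rw [hte] at h1
    rw [smul_dotProduct, dotProduct_smul, single_dotProduct, Pi.single_eq_same] at h1
    simp only [smul_eq_mul, mul_one] at h1
    have h2 : t = 1 := by nlinarith
    rwa [h2, one_smul] at hte
  have hF' : IsFrame L 𝓤 (fun _ => 1) (fun i => B i) (fun i => q (B i)) fun _ => 1 / 2 := by
    refine ⟨fun i => ⟨fun s => s • B i, ?_⟩, fun i => zero_le_one, by simp, ?_⟩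
    · have := hq (B i)
      rwa [show a₀ (B i) = 1 / 2 by linarith [hunitB i]] at this
    · intro c η' p' e' h h1 h2 r
      refine (hdom c η' p' e' h h1 h2 r).trans (le_of_eq ?_)
      congr 1
      exact Finset.sum_congr rfl fun i _ => by rw [one_mul, sq]; rfl
  refine ⟨B, fun i => q (B i), hB, hF'.isLeaf, fun x J => ?_, hrot⟩
  simpa [defect, sub_eq_zero] using hF'.defect_eq_zero h𝓤 hn (x, J)

end LocalModel

/-- The half-open unit cube. -/
abbrev unitBox (n : ℕ) : Set (E n) := Set.univ.pi fun _ => Set.Ico (0 : ℝ) 1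

lemma measurableSet_unitBox (n : ℕ) : MeasurableSet (unitBox n) :=
  MeasurableSet.univ_pi fun _ => measurableSet_Ico

lemma volume_unitBox (n : ℕ) : volume (unitBox n) = 1 := by
  simp [unitBox, Real.volume_pi_Ico]

lemma integrableOn_unitBox {n : ℕ} {f : E n → ℝ} (hf : Continuous f) :
    IntegrableOn f (unitBox n) :=
  (hf.continuousOn.integrableOn_compact (isCompact_Icc (a := (0 : E n)) (b := 1))).mono_set
    fun _ hx => ⟨fun i => (hx i trivial).1, fun i => (hx i trivial).2.le⟩

/-- The integer translations of `ℝⁿ`. -/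
def intTranslations (n : ℕ) : AddSubgroup (E n) :=
  AddMonoidHom.range (AddMonoidHom.mk' (fun m : Fin n → ℤ => (intVec m : E n))
    fun a b => by simp [intVec_add])

instance (n : ℕ) : Countable (intTranslations n) :=
  (Set.countable_range fun m : Fin n → ℤ => (intVec m : E n)).to_subtype

lemma isAddFundamentalDomain_image_unitBox {n : ℕ} {f : E n → E n} (hf : Continuous f)
    (hbij : Function.Bijective f) (hper : ∀ x (m : Fin n → ℤ), f (x + intVec m) = f x + intVec m) :
    IsAddFundamentalDomain (intTranslations n) (f '' unitBox n) := by
  refine .mk' ((measurableSet_unitBox n).image_of_continuousOn_injOn hf.continuousOn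
    hbij.injective.injOn).nullMeasurableSet fun x => ?_
  obtain ⟨z, rfl⟩ := hbij.surjective x
  obtain ⟨m, hm, hu⟩ := exists_unique_add_intVec_mem z
  refine ⟨⟨intVec m, m, rfl⟩, ?_, ?_⟩
  · change intVec m + f z ∈ _
    rw [add_comm, ← hper]
    exact ⟨_, by rwa [add_comm], rfl⟩
  · rintro ⟨_, k, rfl⟩ hk
    change intVec k + f z ∈ _ at hk
    rw [add_comm, ← hper, hbij.injective.mem_set_image, add_comm] at hk
    have := hu k hk
    subst this; rfl

lemma volume_image_unitBox {n : ℕ} {f : E n → E n} (hf : Continuous f)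
    (hbij : Function.Bijective f) (hper : ∀ x (m : Fin n → ℤ), f (x + intVec m) = f x + intVec m) :
    volume (f '' unitBox n) = 1 := by
  have h1 := isAddFundamentalDomain_image_unitBox hf hbij hper
  have h2 := isAddFundamentalDomain_image_unitBox (n := n) continuous_id Function.bijective_id
    fun x m => rfl
  rw [Set.image_id] at h2
  rw [h1.measure_eq h2, volume_unitBox]

lemma integral_det_one_add_smul {n : ℕ} {u : E n → E n} {W : E n → Matrix (Fin n) (Fin n) ℝ}
    (hu : ∀ x, HasFDerivAt u (Matrix.toLin' (W x)).toContinuousLinearMap x) (hW : Continuous W)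
    (hper : ∀ x (m : Fin n → ℤ), u (x + intVec m) = u x) (hWper : ∀ x (m : Fin n → ℤ),
      W (x + intVec m) = W x) :
    ∃ t₀ : ℝ, 0 < t₀ ∧ ∀ t ∈ Set.Icc 0 t₀, ∫ x in unitBox n, (1 + t • W x).det = 1 := by
  have hW' : Continuous fun x => (Matrix.toLin' (W x)).toContinuousLinearMap :=
    ((LinearMap.toContinuousLinearMap.toLinearMap ∘ₗ
      (Matrix.toLin' (R := ℝ) (m := Fin n)
        (n := Fin n)).toLinearMap).continuous_of_finiteDimensional).comp
      hW
  obtain ⟨M, hM⟩ := exists_abs_le_of_periodic (f := fun x =>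
    ‖(Matrix.toLin' (W x)).toContinuousLinearMap‖) hW'.norm fun x m => by simp only [hWper]
  simp only [abs_norm] at hM
  have hM0 : 0 ≤ M := (norm_nonneg _).trans (hM 0)
  have hlip : ∀ x y, ‖u x - u y‖ ≤ M * ‖x - y‖ := fun x y =>
    Convex.norm_image_sub_le_of_norm_hasFDerivWithin_le (s := Set.univ)
      (fun z _ => (hu z).hasFDerivWithinAt) (fun z _ => hM z) convex_univ trivial trivial
  refine ⟨1 / (2 * (M + 1)), by positivity, fun t ht => ?_⟩
  have htM : t * M ≤ 1 / 2 := by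
    have h1 := ht.2
    rw [le_div_iff₀ (by positivity)] at h1
    nlinarith [ht.1]
  set f : E n → E n := fun x => x + t • u x with hf
  have hfd : ∀ x, HasFDerivAt f (Matrix.toLin' (1 + t • W x)).toContinuousLinearMap x := by
    intro x
    refine ((hasFDerivAt_id x).add ((hu x).const_smul t)).congr_fderiv ?_
    ext v : 1
    simp
  have hfc : Continuous f := continuous_iff_continuousAt.2 fun x => (hfd x).continuousAt
  have hinj : Function.Injective f := by
    intro x y hxy
    have h1 : x - y = t • (u y - u x) := by
      rw [smul_sub, sub_eq_sub_iff_add_eq_add]; exact hxy.trans (add_comm _ _)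
    have h2 := congrArg norm h1
    rw [norm_smul, Real.norm_of_nonneg ht.1, norm_sub_rev (u y)] at h2
    have h3 := mul_le_mul_of_nonneg_left (hlip x y) ht.1
    have h4 : ‖x - y‖ ≤ 1 / 2 * ‖x - y‖ := by
      have := mul_le_mul_of_nonneg_right htM (norm_nonneg (x - y))
      linarith
    exact sub_eq_zero.1 (norm_eq_zero.1 (by linarith [norm_nonneg (x - y)]))
  have hsurj : Function.Surjective f := by
    intro z
    have hcon : ContractingWith (1 / 2) fun x => z - t • u x := by
      refine ⟨by norm_num, LipschitzWith.of_dist_le_mul fun x y => ?_⟩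
      rw [dist_eq_norm, dist_eq_norm, sub_sub_sub_cancel_left, ← smul_sub, norm_smul,
        Real.norm_of_nonneg ht.1, norm_sub_rev (u y)]
      have h3 := mul_le_mul_of_nonneg_left (hlip x y) ht.1
      have := mul_le_mul_of_nonneg_right htM (norm_nonneg (x - y))
      push_cast
      linarith
    have h := hcon.fixedPoint_isFixedPt
    refine ⟨ContractingWith.fixedPoint _ hcon, ?_⟩
    have h' : z - t • u (ContractingWith.fixedPoint _ hcon) = ContractingWith.fixedPoint _ hcon := h
    simp only [hf]
    nth_rewrite 1 [← h']
    simp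
  have hdet : ∀ x, 0 < (1 + t • W x).det := by
    intro x
    have hne : ∀ τ ∈ Set.Icc 0 t, (1 + τ • W x).det ≠ 0 := by
      intro τ hτ h0
      obtain ⟨v, hv, hv0⟩ := Matrix.exists_mulVec_eq_zero_iff.2 h0
      rw [Matrix.add_mulVec, Matrix.one_mulVec, Matrix.smul_mulVec] at hv0
      have h1 : ‖v‖ = τ * ‖W x *ᵥ v‖ := by
        rw [← Real.norm_of_nonneg hτ.1, ← norm_smul, ← norm_neg (τ • W x *ᵥ v),
          ← eq_neg_of_add_eq_zero_left hv0]
      have h2 : ‖W x *ᵥ v‖ ≤ M * ‖v‖ :=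
        ((Matrix.toLin' (W x)).toContinuousLinearMap.le_opNorm v).trans
          (mul_le_mul_of_nonneg_right (hM x) (norm_nonneg v))
      have h3 := norm_pos_iff.2 hv
      have h4 := mul_le_mul_of_nonneg_left h2 hτ.1
      have h5 := mul_le_mul_of_nonneg_right hτ.2 (mul_nonneg hM0 h3.le)
      have h6 := mul_le_mul_of_nonneg_right htM h3.le
      linarith
    by_contra! hle
    have hc : Continuous fun τ : ℝ => (1 + τ • W x).det := by fun_prop
    obtain ⟨τ, hτ, h0⟩ := intermediate_value_Icc' ht.1 hc.continuousOn
      (show (0 : ℝ) ∈ Set.Icc _ _ from ⟨hle, by simp⟩)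
    exact hne τ hτ h0
  have h1 := lintegral_abs_det_fderiv_eq_addHaar_image volume (measurableSet_unitBox n)
    (fun x _ => (hfd x).hasFDerivWithinAt) hinj.injOn
  rw [volume_image_unitBox hfc ⟨hinj, hsurj⟩ fun x m => by
    simp only [hf, hper]; abel] at h1
  rw [integral_eq_lintegral_of_nonneg_ae (.of_forall fun x => (hdet x).le)
    (by fun_prop : Continuous fun x => (1 + t • W x).det).aestronglyMeasurable.restrict]
  simp only [LinearMap.det_toContinuousLinearMap, LinearMap.det_toLin', abs_of_pos (hdet _)] at h1
  rw [h1]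
  simp

lemma integral_det_one_add {n : ℕ} {u : E n → E n} {W : E n → Matrix (Fin n) (Fin n) ℝ}
    (hu : ∀ x, HasFDerivAt u (Matrix.toLin' (W x)).toContinuousLinearMap x) (hW : Continuous W)
    (hper : ∀ x (m : Fin n → ℤ), u (x + intVec m) = u x) (hWper : ∀ x (m : Fin n → ℤ),
      W (x + intVec m) = W x) : ∫ x in unitBox n, (1 + W x).det = 1 := by
  obtain ⟨t₀, ht₀, h⟩ := integral_det_one_add_smul hu hW hper hWper
  set v : Fin (n + 1) → ℝ := fun j => t₀ * (j / (n + 1)) with hv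
  have hvI : ∀ j, v j ∈ Set.Icc 0 t₀ := fun j => by
    refine ⟨by positivity, mul_le_of_le_one_right ht₀.le ?_⟩
    rw [div_le_one (by positivity)]
    have := j.2
    exact_mod_cast this.le
  have hinj : Set.InjOn v (Finset.univ : Finset (Fin (n + 1))) := by
    intro i _ j _ hij
    have h1 := mul_left_cancel₀ ht₀.ne' hij
    rw [div_left_inj' (by positivity)] at h1
    exact Fin.ext (by exact_mod_cast h1)
  have hinterp : ∀ q : Polynomial ℝ, q.natDegree ≤ n →
      q.eval 1 = ∑ j, q.eval (v j) * (Lagrange.basis Finset.univ v j).eval 1 := by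
    intro q hq
    have h1 := Lagrange.eq_interpolate hinj (f := q) (by
      rw [Finset.card_univ, Fintype.card_fin]
      exact lt_of_le_of_lt Polynomial.degree_le_natDegree (by exact_mod_cast Nat.lt_succ_of_le hq))
    conv_lhs => rw [h1]
    simp [Lagrange.interpolate_apply, Polynomial.eval_finsetSum]
  have hone := hinterp 1 (by simp)
  simp only [Polynomial.eval_one, one_mul] at hone
  have hdet : ∀ x, (1 + W x).det =
      ∑ j, (1 + v j • W x).det * (Lagrange.basis Finset.univ v j).eval 1 := by
    intro x
    have hq : ∀ t : ℝ, (1 + t • W x).det =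
        (((Polynomial.X : Polynomial ℝ) • (W x).map Polynomial.C +
        (1 : Matrix (Fin n) (Fin n) ℝ).map Polynomial.C).det).eval t := by
      intro t
      rw [← Polynomial.coe_evalRingHom, RingHom.map_det]
      congr 1
      ext i j
      simp [Matrix.one_apply, add_comm]
      split_ifs <;> simp [mul_comm]
    have h1 := hinterp _ ((Polynomial.natDegree_det_X_add_C_le (W x) 1).trans (by simp))
    simp only [← hq] at h1
    rwa [one_smul] at h1
  simp only [hdet]
  rw [integral_finsetSum _ fun j _ => (integrableOn_unitBox (by fun_prop)).mul_const _]
  simp only [integral_mul_const, h _ (hvI _), one_mul]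
  exact hone.symm

/-- The Jacobian determinant is a null Lagrangian. -/
lemma integral_det_eq {n : ℕ} {f : E n → E n} {M : E n → Matrix (Fin n) (Fin n) ℝ}
    {B : Matrix (Fin n) (Fin n) ℝ} (hB : B.det ≠ 0)
    (hf : ∀ x, HasFDerivAt f (Matrix.toLin' (M x)).toContinuousLinearMap x) (hM : Continuous M)
    (hper : ∀ x (m : Fin n → ℤ), f (x + intVec m) = f x + B *ᵥ intVec m)
    (hMper : ∀ x (m : Fin n → ℤ), M (x + intVec m) = M x) :
    ∫ x in unitBox n, (M x).det = B.det := by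
  have hBu : IsUnit B.det := hB.isUnit
  have h := integral_det_one_add (u := fun x => B⁻¹ *ᵥ f x - x) (W := fun x => B⁻¹ * M x - 1)
    (fun x => by
      have h1 := ((Matrix.toLin' B⁻¹).toContinuousLinearMap.hasFDerivAt.comp x (hf x)).sub
        (hasFDerivAt_id x)
      refine h1.congr_fderiv ?_
      ext v : 1
      simp) (by fun_prop) (fun x m => by
      rw [hper, Matrix.mulVec_add, Matrix.mulVec_mulVec, Matrix.nonsing_inv_mul _ hBu,
        Matrix.one_mulVec, add_sub_add_right_eq_sub]) fun x m => by rw [hMper]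
  simp only [add_sub_cancel, Matrix.det_mul, Matrix.det_nonsing_inv, Ring.inverse_eq_inv'] at h
  rw [integral_const_mul, inv_mul_eq_iff_eq_mul₀ hB, mul_one] at h
  exact h

namespace LocalModel

variable {n : ℕ} {L : LocalModel n} {𝓤 : Ultrafilter ℝ}

/-- In an orthonormal frame of limit leaves, a leaf whose class has matching length has constant
coordinates. -/
theorem IsLeaf.eq_mulVec_of_frame {B : Matrix (Fin n) (Fin n) ℝ} {p : Fin n → E n → E n}
    (hB : B.det ≠ 0) (hl : ∀ i, ∃ c, IsLeaf L 𝓤 c (B i) (p i) (1 / 2))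
    (hpars : ∀ x J, ∑ i, (p i x ⬝ᵥ L.A x *ᵥ J) ^ 2 = J ⬝ᵥ L.A x *ᵥ J)
    {c : ℝ → E n} {y : E n} {p' : E n → E n} {e' : ℝ} (h : IsLeaf L 𝓤 c (Bᵀ *ᵥ y) p' e')
    (hy : y ⬝ᵥ y = 2 * e') (x : E n) :
    (∀ i, p i x ⬝ᵥ L.A x *ᵥ p' x = y i) ∧ p' x = (Matrix.of fun i => p i x)ᵀ *ᵥ y := by
  choose c' hc' using hl
  set P : E n → Matrix (Fin n) (Fin n) ℝ := fun x => Matrix.of fun i => p i x with hP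
  have hPc : Continuous P := continuous_matrix fun i j =>
    (continuous_apply j).comp (hc' i).p_cont
  have hPper : ∀ x (m : Fin n → ℤ), P (x + intVec m) = P x := fun x m => by
    simp only [hP, (hc' _).p_per]
  have hsq : ∀ x J, (P x *ᵥ L.A x *ᵥ J) ⬝ᵥ (P x *ᵥ L.A x *ᵥ J) = J ⬝ᵥ L.A x *ᵥ J := fun x J => by
    rw [← hpars x J]
    exact Finset.sum_congr rfl fun i _ => by rw [sq]; rfl
  have hpol : ∀ x J J', (P x *ᵥ L.A x *ᵥ J) ⬝ᵥ (P x *ᵥ L.A x *ᵥ J') = J ⬝ᵥ L.A x *ᵥ J' := by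
    intro x J J'
    have h1 := hsq x (J + J')
    have h2 := L.A_dot_comm x J J'
    have h3 := dotProduct_comm (P x *ᵥ L.A x *ᵥ J) (P x *ᵥ L.A x *ᵥ J')
    simp only [Matrix.mulVec_add, add_dotProduct, dotProduct_add, hsq] at h1
    linarith
  have hPPA : ∀ x, (P x)ᵀ * (P x * L.A x) = 1 := by
    intro x
    have h1 : L.A x * ((P x)ᵀ * (P x * L.A x)) = L.A x := by
      refine Matrix.ext_of_mulVec_single fun j => ?_
      refine dotProduct_eq _ _ fun v => ?_
      rw [dotProduct_comm, dotProduct_comm _ v, ← hpol x v, ← Matrix.mulVec_mulVec,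
        ← Matrix.mulVec_mulVec, ← Matrix.mulVec_mulVec, L.A_dot_comm, Matrix.mulVec_transpose,
        ← Matrix.dotProduct_mulVec, dotProduct_comm]
    have h2 := congrArg (L.g x * ·) h1
    simpa only [← Matrix.mul_assoc, L.g_mul_A, Matrix.one_mul] using h2
  have hdet : ∀ x, (P x).det ≠ 0 := fun x h0 => by
    have := congrArg Matrix.det (hPPA x)
    simp [h0] at this
  set τ : E n → E n := fun x => P x *ᵥ L.A x *ᵥ p' x with hτ
  have hτc : Continuous τ := hPc.matrix_mulVec (L.A_cont.matrix_mulVec h.p_cont)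
  have hτper : ∀ x (m : Fin n → ℤ), τ (x + intVec m) = τ x := fun x m => by
    simp only [hτ, hPper, L.A_per, h.p_per]
  have hp' : ∀ x, p' x = (P x)ᵀ *ᵥ τ x := fun x => by
    simp only [hτ, Matrix.mulVec_mulVec, hPPA, Matrix.one_mulVec]
  have hττ : ∀ x, τ x ⬝ᵥ τ x = y ⬝ᵥ y := fun x => by rw [hsq, h.energy, hy]
  have hsum : ∀ (M : Matrix (Fin n) (Fin n) ℝ) (v : E n) i (l : ℝ),
      (M.updateRow i (Mᵀ *ᵥ v + l • M i)).det = (v i + l) * M.det := by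
    intro M v i l
    have h1 : Mᵀ *ᵥ v + l • M i = ∑ k, (v + Pi.single i l : E n) k • M k := by
      simp only [Pi.add_apply, add_smul, Finset.sum_add_distrib]
      congr 1
      · ext j; simp [Matrix.mulVec, dotProduct, mul_comm]
      · rw [Finset.sum_eq_single i] <;> simp +contextual
    rw [h1, Matrix.det_updateRow_sum]
    simp
  obtain ⟨S', hS', hS'm, -, -⟩ := h.exists_primitive
  choose S hS hSm _ _ using fun i => (hc' i).exists_primitive
  have hint0 : ∫ x in unitBox n, (P x).det = B.det := by
    refine integral_det_eq (f := fun x i => S i x) hB (fun x => ?_) hPc (fun x m => ?_) hPper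
    · refine (hasFDerivAt_pi.2 fun i => hS i x).congr_fderiv ?_
      ext v i
      simp [hP, Matrix.mulVec]
    · ext i
      simp [hSm, Matrix.mulVec]
  have hint1 : ∀ i, ∫ x in unitBox n, (P x).det * (τ x i - y i) = 0 := by
    intro i
    set l := 1 - y i with hldef
    have h1 := integral_det_eq (f := fun x => Function.update (fun j => S j x) i (S' x + l * S i x))
      (M := fun x => (P x).updateRow i (p' x + l • p i x))
      (B := B.updateRow i (Bᵀ *ᵥ y + l • B i)) (by rw [hsum]; simp [hldef, hB])
      (fun x => by
        rw [hasFDerivAt_pi']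
        intro j
        by_cases hj : j = i
        · subst hj
          simp only [Function.update_self]
          refine ((hS' x).add ((hS j x).const_mul l)).congr_fderiv ?_
          ext v
          change p' x ⬝ᵥ v + l * (p j x ⬝ᵥ v) = ((P x).updateRow j (p' x + l • p j x) j) ⬝ᵥ v
          rw [Matrix.updateRow_self, add_dotProduct, smul_dotProduct, smul_eq_mul]
        · simp only [Function.update_of_ne hj]
          refine (hS j x).congr_fderiv ?_
          ext v
          simp [Matrix.mulVec, Matrix.updateRow_ne hj, hP])
      (continuous_matrix fun j k => by
        by_cases hj : j = i
        · subst hj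
          simp only [Matrix.updateRow_self]
          exact (continuous_apply k).comp (h.p_cont.add ((hc' j).p_cont.const_smul l))
        · simp only [Matrix.updateRow_ne hj]
          exact (hPc.matrix_elem j k))
      (fun x m => by
        ext j
        by_cases hj : j = i
        · subst hj
          change _ = _ + (B.updateRow j (Bᵀ *ᵥ y + l • B j) j) ⬝ᵥ intVec m
          simp only [Matrix.updateRow_self, add_dotProduct, smul_dotProduct, smul_eq_mul,
            Function.update_self, hS'm, hSm]
          ring
        · simp [Function.update_of_ne hj, hSm, Matrix.mulVec, Matrix.updateRow_ne hj])
      (fun x m => by simp only [hPper, h.p_per, (hc' i).p_per])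
    have h2 : ∀ x, ((P x).updateRow i (p' x + l • p i x)).det = (τ x i + l) * (P x).det := by
      intro x
      rw [hp' x]
      exact hsum (P x) (τ x) i l
    simp only [h2, hsum] at h1
    have h3 : ∀ x, (P x).det * (τ x i - y i) = (τ x i + l) * (P x).det - (P x).det := fun x => by
      rw [hldef]; ring
    simp only [h3]
    have hτi : Continuous fun x => τ x i := (continuous_apply i).comp hτc
    rw [integral_sub (integrableOn_unitBox (by fun_prop)) (integrableOn_unitBox (by fun_prop)), h1,
      hint0, hldef]
    ring
  have hsign : ∀ x, 0 < (P x).det * (P 0).det := by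
    intro x
    by_contra! hle
    have hc : Continuous fun x => (P x).det * (P 0).det := by fun_prop
    obtain ⟨z, -, hz⟩ := isPreconnected_univ.intermediate_value (Set.mem_univ x) (Set.mem_univ 0)
      hc.continuousOn (show (0 : ℝ) ∈ Set.Icc _ _ from ⟨hle, mul_self_nonneg _⟩)
    exact (mul_ne_zero (hdet z) (hdet 0)) hz
  have hnn : ∀ v : E n, 0 ≤ v ⬝ᵥ v := fun v => Finset.sum_nonneg fun i _ => mul_self_nonneg _
  have hfc : Continuous fun x => (P x).det * (P 0).det * ((τ x - y) ⬝ᵥ (τ x - y)) :=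
    (by fun_prop : Continuous fun x => (P x).det * (P 0).det).mul
      ((hτc.sub continuous_const).dotProduct (hτc.sub continuous_const))
  have hint2 : ∫ x in unitBox n, (P x).det * (P 0).det * ((τ x - y) ⬝ᵥ (τ x - y)) = 0 := by
    have h1 : ∀ x, (P x).det * (P 0).det * ((τ x - y) ⬝ᵥ (τ x - y)) =
        ∑ i, -2 * (P 0).det * y i * ((P x).det * (τ x i - y i)) := by
      intro x
      have h2 : (τ x - y) ⬝ᵥ (τ x - y) = ∑ i, -2 * (y i * (τ x i - y i)) := by
        rw [← Finset.mul_sum]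
        change _ = -2 * (y ⬝ᵥ (τ x - y))
        simp only [sub_dotProduct, dotProduct_sub, hττ, dotProduct_comm (τ x) y]
        ring
      rw [h2, Finset.mul_sum]
      exact Finset.sum_congr rfl fun i _ => by ring
    simp only [h1]
    rw [integral_finsetSum _ fun i _ => by
      have hτi : Continuous fun x => τ x i := (continuous_apply i).comp hτc
      exact integrableOn_unitBox (by fun_prop)]
    simp only [integral_const_mul, hint1, mul_zero, Finset.sum_const_zero]
  have hae := (integral_eq_zero_iff_of_nonneg (fun x => mul_nonneg (hsign x).le (hnn _))
    (integrableOn_unitBox hfc)).1 hint2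
  have heq : Set.EqOn (fun x => (P x).det * (P 0).det * ((τ x - y) ⬝ᵥ (τ x - y))) (fun _ => 0)
      (unitBox n) := by
    refine Measure.eqOn_of_ae_eq hae hfc.continuousOn continuousOn_const ?_
    rw [interior_pi_set Set.finite_univ, closure_pi_set]
    simp only [interior_Ico, closure_Ioo (zero_ne_one (α := ℝ))]
    exact Set.pi_mono fun i _ => Set.Ico_subset_Icc_self
  have hτy : τ x = y := by
    obtain ⟨m, hm, -⟩ := exists_unique_add_intVec_mem x
    rw [add_comm] at hm
    have h1 := heq hm
    simp only at h1
    rw [← hτper x m]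
    exact sub_eq_zero.1 (dotProduct_self_eq_zero.1 ((mul_eq_zero.1 h1).resolve_left (hsign _).ne'))
  exact ⟨fun i => congrFun hτy i, by rw [hp', hτy]⟩

end LocalModel

namespace LocalModel

variable {n : ℕ} {L : LocalModel n} {𝓤 : Ultrafilter ℝ}

lemma D_sub_le {c : E n} (hc : ‖c‖ ≤ L.ρ) (x y : E n) :
    L.D c y - L.D c x ≤ n * (L.K * ‖c‖ * ‖x - y‖) := by
  have h := Convex.norm_image_sub_le_of_norm_hasFDerivWithin_le (s := Set.univ) (f := L.D c)
    (C := n * (L.K * ‖c‖)) (fun z _ => (L.D_deriv c z).hasFDerivWithinAt) (fun z _ => by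
      refine ContinuousLinearMap.opNorm_le_bound _ ?_ fun v => ?_
      · have := L.K_pos; positivity
      · refine (abs_dotProduct_le _ _).trans ?_
        rw [mul_assoc]
        gcongr
        exact est_δ hc z) convex_univ (Set.mem_univ x) (Set.mem_univ y)
  rw [norm_sub_rev x y, ← mul_assoc]
  exact (le_abs_self _).trans h

lemma norm_joining_class_le {c x y : E n} {N : ℕ} {s : ℝ} (hs : 0 < s) (hc : ‖c‖ ≤ L.ρ)
    (h : (L.ψ c)^[N] x = y) (hxy : x ≠ y) (hN : ‖x - y‖ / s ≤ N) (hN' : N ≤ 2 * (‖x - y‖ / s)) :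
    ‖c‖ ≤ n * L.K ^ 2 * s ∧ s / (2 * L.K) ≤ ‖c‖ ∧ ‖x - y‖ / s * L.a c ≤ L.D c y - L.D c x := by
  have hd : 0 < ‖x - y‖ := norm_pos_iff.2 (sub_ne_zero.2 hxy)
  have hK := L.K_pos
  have h1 : ‖x - y‖ / s * L.a c ≤ L.D c y - L.D c x := by
    refine (mul_le_mul_of_nonneg_right hN (L.a_nonneg c)).trans ?_
    rw [← h]
    exact L.iterate_D_ge x N fun k _ => est_gain hc _
  have h2 := iterate_disp_le hc x N
  rw [h, norm_sub_rev] at h2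
  have h3 : s / (2 * L.K) ≤ ‖c‖ := by
    have h4 : ‖x - y‖ ≤ 2 * (‖x - y‖ / s) * (L.K * ‖c‖) :=
      h2.trans (by gcongr)
    rw [div_le_iff₀ (by positivity)]
    have h5 : 2 * (‖x - y‖ / s) * (L.K * ‖c‖) = ‖x - y‖ * (‖c‖ * (2 * L.K) / s) := by ring
    rw [h5] at h4
    have h6 := le_of_mul_le_mul_left ((mul_one _).trans_le h4) hd
    rwa [one_le_div hs] at h6
  refine ⟨?_, h3, h1⟩
  have hcpos : 0 < ‖c‖ := lt_of_lt_of_le (by positivity) h3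
  have h4 : ‖x - y‖ / s * ‖c‖ ^ 2 ≤ L.K * (n * (L.K * ‖c‖ * ‖x - y‖)) := by
    calc ‖x - y‖ / s * ‖c‖ ^ 2 ≤ ‖x - y‖ / s * (L.K * L.a c) := by
          gcongr; exact est_le_a hc
      _ = L.K * (‖x - y‖ / s * L.a c) := by ring
      _ ≤ _ := mul_le_mul_of_nonneg_left (h1.trans (D_sub_le hc x y)) hK.le
  have h5 : ‖x - y‖ * ‖c‖ * (‖c‖ / s) ≤ ‖x - y‖ * ‖c‖ * (n * L.K ^ 2) := by
    calc _ = ‖x - y‖ / s * ‖c‖ ^ 2 := by ring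
      _ ≤ _ := h4
      _ = _ := by ring
  have h6 := le_of_mul_le_mul_left h5 (by positivity)
  rwa [div_le_iff₀ hs] at h6

lemma exists_joining_leaf (h𝓤 : (𝓤 : Filter ℝ) ≤ 𝓝[>] 0) {x y : E n} (hxy : x ≠ y) :
    ∃ c η p e, IsLeaf L 𝓤 c η p e ∧ ‖η‖ ≤ n * L.K ^ 2 ∧ 1 / (2 * L.K) ≤ ‖η‖ ∧
      ∀ S : E n → ℝ, Tendsto (fun s => s⁻¹ * (L.D (c s) y - L.D (c s) x)) 𝓤 (𝓝 (S y - S x)) →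
        S x ≠ S y := by
  have hd : 0 < ‖x - y‖ := norm_pos_iff.2 (sub_ne_zero.2 hxy)
  have hK := L.K_pos
  obtain ⟨N₀, hN₀⟩ := L.join L.ρ L.ρ_pos ‖x - y‖
  have hex : ∀ s : ℝ, ∃ c, N₀ ≤ ⌈‖x - y‖ / s⌉₊ →
      ‖c‖ ≤ L.ρ ∧ (L.ψ c)^[⌈‖x - y‖ / s⌉₊] x = y := fun s => by
    by_cases h : N₀ ≤ ⌈‖x - y‖ / s⌉₊
    · obtain ⟨c, hc⟩ := hN₀ _ h x y le_rfl
      exact ⟨c, fun _ => hc⟩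
    · exact ⟨0, fun h' => absurd h' h⟩
  choose c hc using hex
  have hpos := eventually_pos h𝓤
  have hlim : Tendsto (fun s : ℝ => ‖x - y‖ / s) 𝓤 atTop :=
    (tendsto_inv_nhdsGT_zero.const_mul_atTop hd).mono_left h𝓤
  have hb : ∀ᶠ s in (𝓤 : Filter ℝ), ‖c s‖ ≤ n * L.K ^ 2 * s ∧ s / (2 * L.K) ≤ ‖c s‖ ∧
      ‖x - y‖ / s * L.a (c s) ≤ L.D (c s) y - L.D (c s) x := by
    filter_upwards [hpos, hlim.eventually_ge_atTop (N₀ : ℝ), hlim.eventually_ge_atTop 1]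
      with s hs h1 h2
    obtain ⟨h3, h4⟩ := hc s (by exact_mod_cast h1.trans (Nat.le_ceil _))
    exact norm_joining_class_le hs h3 h4 hxy (Nat.le_ceil _)
      (by linarith [Nat.ceil_lt_add_one (show 0 ≤ ‖x - y‖ / s by positivity)])
  obtain ⟨η, p, e, hl⟩ := exists_isLeaf (L := L) h𝓤 (hb.mono fun s h => h.1)
  have hη : 1 / (2 * L.K) ≤ ‖η‖ := by
    refine ge_of_tendsto hl.tendsto_inv_norm ?_
    filter_upwards [hb, hpos] with s h hs
    rw [← div_eq_inv_mul, le_div_iff₀ hs]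
    exact le_trans (le_of_eq (by ring)) h.2.1
  refine ⟨c, η, p, e, hl, ?_, hη, fun S hS h0 => ?_⟩
  · refine le_of_tendsto hl.tendsto_inv_norm ?_
    filter_upwards [hb, hpos] with s h hs
    rw [← div_eq_inv_mul, div_le_iff₀ hs]
    exact h.1
  · have h1 : ‖x - y‖ * e ≤ S y - S x := by
      refine le_of_tendsto_of_tendsto (hl.act.const_mul ‖x - y‖) hS ?_
      filter_upwards [hb, hpos] with s h hs
      calc ‖x - y‖ * (s⁻¹ ^ 2 * L.a (c s)) = s⁻¹ * (‖x - y‖ / s * L.a (c s)) := by ring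
        _ ≤ _ := by gcongr; exact h.2.2
    have h2 : 0 < e := by
      have h3 := hl.sq_norm_le
      have h4 : 0 < ‖η‖ := lt_of_lt_of_le (by positivity) hη
      have h5 : 0 < L.K * e := lt_of_lt_of_le (by positivity) h3
      exact (mul_pos_iff_of_pos_left hK).1 h5
    have h3 : 0 < ‖x - y‖ * e := by positivity
    rw [h0] at h1
    linarith

/-- A continuous change of coordinates which asymptotically conjugates the leaves near the
zero section to translations. -/
theorem linearization (L : LocalModel n) (hn : 1 ≤ n) : ∃ X : E n → E n, Continuous X ∧
    (∀ x (m : Fin n → ℤ), X (x + intVec m) = X x + intVec m) ∧ Function.Injective X ∧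
    ∀ ω : E n, ω ≠ 0 → ∀ ε > 0, ∀ ρ > 0, ∃ (c : E n) (s : ℝ), ‖c‖ ≤ ρ ∧ 0 < s ∧ s ≤ ρ ∧
      ∀ x, ‖X (L.ψ c x) - X x - s • ω‖ ≤ ε * s := by
  obtain ⟨𝓤, h𝓤⟩ : ∃ 𝓤 : Ultrafilter ℝ, (𝓤 : Filter ℝ) ≤ 𝓝[>] 0 :=
    ⟨Ultrafilter.of (𝓝[>] 0), Ultrafilter.of_le _⟩
  have hK := L.K_pos
  set σ₀ : ℝ := min 1 (2 * ((1 / (2 * L.K)) ^ 2 / L.K)) with hσ₀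
  set σ₁ : ℝ := max 3 (2 * (L.K * (n * L.K ^ 2) ^ 2)) with hσ₁
  obtain ⟨B, p, hB, hl, hpars, hshell⟩ := exists_orthoframe (L := L) h𝓤 hn (σ₀ := σ₀) (σ₁ := σ₁)
    (lt_min one_pos (by positivity)) (min_le_left _ _) (le_max_left _ _)
  have hBu : IsUnit B.det := isUnit_iff_ne_zero.2 hB
  choose cB hlB using hl
  choose S hSd hSm hST hSlim using fun i => (hlB i).exists_primitive
  have hSc : Continuous fun x i => S i x :=
    continuous_pi fun i => continuous_iff_continuousAt.2 fun x => (hSd i x).continuousAt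
  refine ⟨fun x => B⁻¹ *ᵥ fun i => S i x, continuous_const.matrix_mulVec hSc, fun x m => ?_,
    fun x y hxy => ?_, fun ω hω ε hε ρ hρ => ?_⟩
  · have h1 : (fun i => S i (x + intVec m)) = (fun i => S i x) + B *ᵥ intVec m := by
      ext i; exact hSm i x m
    simp only [h1, Matrix.mulVec_add, Matrix.mulVec_mulVec, Matrix.nonsing_inv_mul B hBu,
      Matrix.one_mulVec]
  · by_contra hne
    obtain ⟨c, η, p', e, h, hη1, hη2, hS⟩ := exists_joining_leaf (L := L) h𝓤 hne
    obtain ⟨y₀, rfl⟩ : ∃ y₀, Bᵀ *ᵥ y₀ = η := ⟨Bᵀ⁻¹ *ᵥ η, by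
      rw [Matrix.mulVec_mulVec, Matrix.mul_nonsing_inv _ (by rwa [Matrix.det_transpose]),
        Matrix.one_mulVec]⟩
    have he1 := h.sq_norm_le
    have he2 := h.le_sq_norm
    have hy := hshell c y₀ p' e h
      ((min_le_right _ _).trans (by
        have : (1 / (2 * L.K)) ^ 2 ≤ ‖Bᵀ *ᵥ y₀‖ ^ 2 := by gcongr
        have h3 : (1 / (2 * L.K)) ^ 2 / L.K ≤ e := by
          rw [div_le_iff₀ hK]; linarith
        linarith))
      (le_trans (by
        have : L.K * ‖Bᵀ *ᵥ y₀‖ ^ 2 ≤ L.K * (n * L.K ^ 2) ^ 2 := by gcongr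
        linarith) (le_max_right _ _))
    obtain ⟨S', hS'd, -, -, hS'lim⟩ := h.exists_primitive
    refine hS S' (hS'lim x y) ?_
    have hT : ∀ z, HasFDerivAt (fun z => S' z - ∑ i, y₀ i * S i z) (0 : E n →L[ℝ] ℝ) z := by
      intro z
      refine ((hS'd z).sub (HasFDerivAt.fun_sum fun i _ =>
        (hSd i z).const_mul (y₀ i))).congr_fderiv ?_
      ext v
      have h1 := (h.eq_mulVec_of_frame hB (fun i => ⟨_, hlB i⟩) hpars hy z).2
      have h2 : p' z ⬝ᵥ v = ∑ i, y₀ i * (p i z ⬝ᵥ v) := by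
        rw [h1, Matrix.mulVec_transpose, ← Matrix.dotProduct_mulVec]
        rfl
      simp [h2]
    have h1 := is_const_of_fderiv_eq_zero (fun z => (hT z).differentiableAt)
      (fun z => (hT z).fderiv) x y
    have h2 : (fun i => S i x) = fun i => S i y := by
      have := congrArg (B *ᵥ ·) hxy
      simpa only [Matrix.mulVec_mulVec, Matrix.mul_nonsing_inv B hBu, Matrix.one_mulVec] using this
    have h3 : ∀ i, S i x = S i y := congrFun h2
    simp only [h3] at h1
    linarith
  · obtain ⟨a₀, ha₀c, -, ha₀⟩ := exists_energy (L := L) h𝓤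
    have hu : Bᵀ *ᵥ B *ᵥ ω ≠ 0 := fun h0 => hω <| by
      have h1 := Matrix.eq_zero_of_mulVec_eq_zero (by rwa [Matrix.det_transpose]) h0
      exact Matrix.eq_zero_of_mulVec_eq_zero hB h1
    obtain ⟨t, ht, hta⟩ := exists_ray (L := L) ha₀c
      (fun η => (ha₀ η).choose_spec.sq_norm_le) (fun η => (ha₀ η).choose_spec.le_sq_norm) hu
    obtain ⟨p', h⟩ := ha₀ (t • Bᵀ *ᵥ B *ᵥ ω)
    set y₀ := t • B *ᵥ ω with hy₀
    have hη : t • Bᵀ *ᵥ B *ᵥ ω = Bᵀ *ᵥ y₀ := by rw [hy₀, Matrix.mulVec_smul]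
    rw [hη] at h hta
    have hy := hshell _ y₀ p' _ h (by rw [hta]; exact min_le_left _ _)
      (by rw [hta]; exact le_trans (by norm_num) (le_max_left _ _))
    set T := (Matrix.mulVecLin B⁻¹).toContinuousLinearMap with hTdef
    set ε' := ε * t / (‖T‖ + 1) with hε'
    have hε'pos : 0 < ε' := by positivity
    have hinc : ∀ᶠ s in (𝓤 : Filter ℝ), ∀ i x,
        |s⁻¹ * (S i (L.ψ (s • Bᵀ *ᵥ y₀) x) - S i x) - p i x ⬝ᵥ L.A x *ᵥ p' x| ≤ ε' :=
      eventually_all.2 fun i => h.increment_conv (hlB i) (hST i) (hSm i) hε'pos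
    have hsmall : ∀ᶠ s in (𝓤 : Filter ℝ), ‖s • Bᵀ *ᵥ y₀‖ < ρ := by
      have : Tendsto (fun s : ℝ => ‖s • Bᵀ *ᵥ y₀‖) 𝓤 (𝓝 ‖(0 : ℝ) • Bᵀ *ᵥ y₀‖) :=
        ((tendsto_zero h𝓤).smul_const _).norm
      exact this.eventually (gt_mem_nhds (by simpa using hρ))
    have hs2 : ∀ᶠ s in (𝓤 : Filter ℝ), s < ρ / t :=
      (tendsto_zero h𝓤).eventually (gt_mem_nhds (by positivity))
    obtain ⟨s, h1, h2, h3, hs⟩ :=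
      (hinc.and (hsmall.and (hs2.and (eventually_pos h𝓤)))).exists
    refine ⟨s • Bᵀ *ᵥ y₀, s * t, h2.le, by positivity, ?_, fun x => ?_⟩
    · rw [lt_div_iff₀ ht] at h3; exact h3.le
    · have h4 : ∀ i, |S i (L.ψ (s • Bᵀ *ᵥ y₀) x) - S i x - s * y₀ i| ≤ s * ε' := fun i => by
        have h5 := h1 i x
        rw [(h.eq_mulVec_of_frame hB (fun i => ⟨_, hlB i⟩) hpars hy x).1 i] at h5
        calc _ = |s * (s⁻¹ * (S i (L.ψ (s • Bᵀ *ᵥ y₀) x) - S i x) - y₀ i)| := by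
              congr 1; field_simp
          _ ≤ _ := by rw [abs_mul, abs_of_pos hs]; gcongr
      set V : E n := fun i => S i (L.ψ (s • Bᵀ *ᵥ y₀) x) - S i x - s * y₀ i with hV
      have hVn : ‖V‖ ≤ s * ε' := (pi_norm_le_iff_of_nonneg (by positivity)).2 h4
      have h6 : B⁻¹ *ᵥ (fun i => S i (L.ψ (s • Bᵀ *ᵥ y₀) x)) - B⁻¹ *ᵥ (fun i => S i x) -
          (s * t) • ω = T V := by
        change _ = B⁻¹ *ᵥ V
        have h7 : V = (fun i => S i (L.ψ (s • Bᵀ *ᵥ y₀) x)) - (fun i => S i x) - s • y₀ := rfl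
        have h8 : B⁻¹ *ᵥ y₀ = t • ω := by
          rw [hy₀, Matrix.mulVec_smul, Matrix.mulVec_mulVec, Matrix.nonsing_inv_mul B hBu,
            Matrix.one_mulVec]
        have h9 : B⁻¹ *ᵥ (s • y₀) = (s * t) • ω := by rw [Matrix.mulVec_smul, h8, smul_smul]
        rw [h7, Matrix.mulVec_sub, Matrix.mulVec_sub, h9]
      rw [h6]
      calc ‖T V‖ ≤ ‖T‖ * ‖V‖ := T.le_opNorm V
        _ ≤ (‖T‖ + 1) * (s * ε') := by gcongr; linarith
        _ = ε * (s * t) := by rw [hε']; field_simp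

end LocalModel

/-- There are lines in `ℝⁿ / ℤⁿ` of which a finite piece is as dense as desired. -/
lemma exists_dense_line {n : ℕ} (hn : 1 ≤ n) {δ : ℝ} (hδ : 0 < δ) :
    ∃ ω : E n, ω ≠ 0 ∧ ∃ R : ℝ, ∀ z : E n, ∃ t : ℝ, 0 ≤ t ∧ t ≤ R ∧
      ∃ m : Fin n → ℤ, ‖t • ω - z - intVec m‖ ≤ δ := by
  obtain ⟨q, hq2, hqδ⟩ : ∃ q : ℝ, 2 ≤ q ∧ 2 / q ≤ δ := by
    refine ⟨max 2 (2 / δ), le_max_left _ _, ?_⟩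
    rw [div_le_iff₀ (lt_of_lt_of_le two_pos (le_max_left _ _)), ← div_le_iff₀' hδ]
    exact le_max_right _ _
  have hq : 0 < q := by linarith
  have key : ∀ (z : ℕ → ℝ) (j : ℕ), ∃ t : ℝ, 0 ≤ t ∧ t ≤ j + 1 ∧ ∀ i ≤ j, ∃ m : ℤ,
      0 ≤ q ^ i * t - z i - m ∧ q ^ i * t - z i - m ≤ 2 / q * (1 - q ^ i / q ^ j) := by
    intro z j
    induction j with
    | zero =>
      refine ⟨Int.fract (z 0), Int.fract_nonneg _, by simpa using (Int.fract_lt_one _).le,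
        fun i hi => ⟨-⌊z 0⌋, ?_⟩⟩
      obtain rfl : i = 0 := by omega
      have h1 : q ^ 0 * Int.fract (z 0) - z 0 - (-⌊z 0⌋ : ℤ) = 0 := by
        push_cast
        linarith [Int.floor_add_fract (z 0)]
      rw [h1]
      simp
    | succ j ih =>
      obtain ⟨t, h0, h1, h2⟩ := ih
      have hqj : 0 < q ^ (j + 1) := by positivity
      set k : ℤ := ⌈q ^ (j + 1) * t - z (j + 1)⌉ with hk
      have hk1 := Int.le_ceil (q ^ (j + 1) * t - z (j + 1))
      have hk2 := Int.ceil_lt_add_one (q ^ (j + 1) * t - z (j + 1))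
      rw [← hk] at hk1 hk2
      set t' := (z (j + 1) + k) / q ^ (j + 1) with ht'
      have h3 : t ≤ t' := by rw [ht', le_div_iff₀ hqj]; linarith
      have h4 : t' ≤ t + 1 / q ^ (j + 1) := by
        rw [ht', div_le_iff₀ hqj, add_mul, one_div_mul_cancel hqj.ne']
        linarith
      have h5 : 1 / q ^ (j + 1) ≤ 1 := by
        rw [div_le_one hqj]; exact one_le_pow₀ (by linarith)
      refine ⟨t', h0.trans h3, by push_cast; linarith, fun i hi => ?_⟩
      rcases Nat.lt_or_ge j i with hij | hij
      · obtain rfl : i = j + 1 := by omega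
        have h6 : q ^ (j + 1) * t' - z (j + 1) - k = 0 := by
          rw [ht', mul_div_cancel₀ _ hqj.ne']
          ring
        exact ⟨k, h6.ge, by rw [h6, div_self hqj.ne', sub_self, mul_zero]⟩
      · obtain ⟨m, h6, h7⟩ := h2 i hij
        have hqi : 0 < q ^ i := by positivity
        have h8 : q ^ i * t ≤ q ^ i * t' := by gcongr
        have h9 : q ^ i * t' ≤ q ^ i * t + q ^ i / q ^ (j + 1) := by
          calc _ ≤ q ^ i * (t + 1 / q ^ (j + 1)) := by gcongr
            _ = _ := by ring
        refine ⟨m, by linarith, ?_⟩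
        have h10 : q ^ i / q ^ j = q * (q ^ i / q ^ (j + 1)) := by
          rw [pow_succ]; field_simp
        have h11 : 2 / q * (1 - q ^ i / q ^ j) + q ^ i / q ^ (j + 1) ≤
            2 / q * (1 - q ^ i / q ^ (j + 1)) := by
          rw [h10]
          have h12 : 2 / q ≤ 1 := by rwa [div_le_one hq]
          have h13 : 0 < q ^ i / q ^ (j + 1) := by positivity
          have h14 : 2 / q * (q * (q ^ i / q ^ (j + 1))) = 2 * (q ^ i / q ^ (j + 1)) := by
            field_simp
          nlinarith
        linarith
  refine ⟨fun i => q ^ (i : ℕ), fun h => ?_, n, fun z => ?_⟩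
  · have := congrFun h ⟨0, hn⟩
    simp at this
  · obtain ⟨t, h0, h1, h2⟩ := key (fun i => if h : i < n then z ⟨i, h⟩ else 0) (n - 1)
    refine ⟨t, h0, ?_, ?_⟩
    · rwa [Nat.cast_sub hn, Nat.cast_one, sub_add_cancel] at h1
    · choose m hm using fun i : Fin n => h2 i (by omega)
      refine ⟨m, (pi_norm_le_iff_of_nonneg hδ.le).2 fun i => ?_⟩
      obtain ⟨h3, h4⟩ := hm i
      simp only [Fin.is_lt, dite_true, Fin.eta] at h3 h4
      have h5 : 2 / q * (1 - q ^ (i : ℕ) / q ^ (n - 1)) ≤ 2 / q := by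
        have : 0 ≤ q ^ (i : ℕ) / q ^ (n - 1) := by positivity
        exact mul_le_of_le_one_right (by positivity) (by linarith)
      have h6 : (t • (fun i : Fin n => q ^ (i : ℕ)) - z - intVec m : E n) i =
          q ^ (i : ℕ) * t - z i - m i := by
        simp [intVec, mul_comm]
      rw [h6, Real.norm_eq_abs, abs_of_nonneg h3]
      linarith

/-- A continuous injective map of `ℝⁿ` commuting with integer translations has a uniform
injectivity modulus. -/
lemma exists_injectivity_modulus {n : ℕ} {X : E n → E n} (hc : Continuous X)
    (hper : ∀ x (m : Fin n → ℤ), X (x + intVec m) = X x + intVec m) (hinj : Function.Injective X)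
    {ε : ℝ} (hε : 0 < ε) : ∃ δ > 0, ∀ x y, ‖X x - X y‖ < δ → ‖x - y‖ < ε := by
  obtain ⟨M, hM⟩ := exists_abs_le_of_periodic (f := fun x => ‖X x - x‖) (by fun_prop)
    (fun x m => by rw [hper, add_sub_add_right_eq_sub])
  have hM' : ∀ x, ‖X x - x‖ ≤ M := fun x => (le_abs_self _).trans (hM x)
  set k : Set (E n × E n) := (Set.Icc 0 1 ×ˢ Metric.closedBall 0 (2 + 2 * M)) ∩
    {z | ε ≤ ‖z.1 - z.2‖} with hk
  have hkc : IsCompact k := (isCompact_Icc.prod (isCompact_closedBall _ _)).inter_right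
    (isClosed_le continuous_const (by fun_prop))
  obtain ⟨δ, hδ, hδk⟩ : ∃ δ > 0, ∀ z ∈ k, δ ≤ ‖X z.1 - X z.2‖ := by
    rcases k.eq_empty_or_nonempty with h0 | h0
    · exact ⟨1, one_pos, by simp [h0]⟩
    · obtain ⟨z, hz, hmin⟩ := hkc.exists_isMinOn h0
        (f := fun z : E n × E n => ‖X z.1 - X z.2‖) (by fun_prop)
      refine ⟨‖X z.1 - X z.2‖, norm_pos_iff.2 (sub_ne_zero.2 fun h => ?_), fun w hw => hmin hw⟩
      have h1 : ε ≤ ‖z.1 - z.2‖ := hz.2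
      rw [hinj h, sub_self, norm_zero] at h1
      linarith
  refine ⟨min δ 1, by positivity, fun x y h => ?_⟩
  by_contra! hlt
  obtain ⟨m, hm⟩ := exists_intVec_sub_mem_Icc x
  have h1 : ∀ z, X (z - intVec m) = X z - intVec m := fun z => by
    rw [sub_eq_add_neg, ← intVec_neg, hper, intVec_neg, sub_eq_add_neg]
  have h2 : ‖x - y‖ ≤ 1 + 2 * M := by
    have h3 : x - y = (X x - X y) - (X x - x) + (X y - y) := by abel
    rw [h3]
    refine (norm_add_le _ _).trans ?_
    linarith [norm_sub_le (X x - X y) (X x - x), hM' x, hM' y, h.le.trans (min_le_right δ 1)]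
  have h3 : ‖y - intVec m‖ ≤ 2 + 2 * M := by
    have h4 : y - intVec m = (x - intVec m) - (x - y) := by abel
    rw [h4]
    linarith [norm_sub_le (x - intVec m) (x - y), norm_le_one_of_mem_Icc hm]
  have h4 := hδk (x - intVec m, y - intVec m)
    ⟨⟨hm, by simpa using h3⟩, by simpa using hlt⟩
  simp only [h1, sub_sub_sub_cancel_right] at h4
  linarith [min_le_left δ 1]

namespace LocalModel

variable {n : ℕ}

/-- Arbitrarily near the zero section there are leaves on which any two orbits are close, up to
a relatively small time shift, during a long time. -/
theorem exists_shadowing (L : LocalModel n) (hn : 1 ≤ n) {ε ρ : ℝ} (hε : 0 < ε) (hρ : 0 < ρ) :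
    ∃ c, ‖c‖ ≤ ρ ∧ ∃ N : ℕ, 1 ≤ N ∧ ∀ x y, ∃ k₀ : ℕ, k₀ ≤ ε * N ∧ ∀ k < N, ∃ m : Fin n → ℤ,
      ‖(L.ψ c)^[k + k₀] x - (L.ψ c)^[k] y - intVec m‖ < ε := by
  obtain ⟨X, hXc, hXper, hXinj, hX⟩ := L.linearization hn
  obtain ⟨δ, hδ, hmod⟩ := exists_injectivity_modulus hXc hXper hXinj hε
  obtain ⟨ω, hω, R', hline⟩ := exists_dense_line hn (δ := δ / 4) (by positivity)
  set R := max R' 0 with hR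
  have hR0 : 0 ≤ R := le_max_right _ _
  set Λ := 2 * (R / ε + 2) + R with hΛ
  have hΛ0 : 0 < Λ := by positivity
  obtain ⟨c, s, hc, hs, hsρ, hstep⟩ := hX ω hω (δ / (4 * Λ)) (by positivity)
    (min ρ (min 1 (δ / (4 * (‖ω‖ + 1))))) (by positivity)
  have hs1 : s ≤ 1 := hsρ.trans ((min_le_right _ _).trans (min_le_left _ _))
  have hs2 : s ≤ δ / (4 * (‖ω‖ + 1)) := hsρ.trans ((min_le_right _ _).trans (min_le_right _ _))
  have hit : ∀ (k : ℕ) x, ‖X ((L.ψ c)^[k] x) - X x - (k * s) • ω‖ ≤ k * s * (δ / (4 * Λ)) := by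
    intro k
    induction k with
    | zero => simp
    | succ k ih =>
      intro x
      rw [Function.iterate_succ_apply']
      have h1 : X (L.ψ c ((L.ψ c)^[k] x)) - X x - ((k + 1 : ℕ) * s) • ω =
          (X (L.ψ c ((L.ψ c)^[k] x)) - X ((L.ψ c)^[k] x) - s • ω) +
          (X ((L.ψ c)^[k] x) - X x - (k * s) • ω) := by
        push_cast
        rw [add_mul, add_smul, one_mul]
        abel
      rw [h1]
      refine (norm_add_le _ _).trans ((add_le_add (hstep _) (ih x)).trans (le_of_eq ?_))
      push_cast
      ring
  refine ⟨c, hc.trans (min_le_left _ _), ⌈R / (ε * s)⌉₊ + 1, by omega, fun x y => ?_⟩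
  obtain ⟨t, ht0, htR, m, hm⟩ := hline (X y - X x)
  replace htR : t ≤ R := htR.trans (le_max_left _ _)
  have hk₀ := Nat.floor_le (show 0 ≤ t / s by positivity)
  have hk₁ := Nat.lt_floor_add_one (t / s)
  set k₀ := ⌊t / s⌋₊ with hk₀def
  have hk₀s : k₀ * s ≤ t := by rwa [le_div_iff₀ hs] at hk₀
  have hk₁s : t ≤ (k₀ + 1) * s := by rw [div_lt_iff₀ hs] at hk₁; exact hk₁.le
  refine ⟨k₀, ?_, fun k hk => ⟨m, ?_⟩⟩
  · calc (k₀ : ℝ) ≤ R / s := hk₀.trans (by gcongr)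
      _ = ε * (R / (ε * s)) := by field_simp
      _ ≤ ε * (⌈R / (ε * s)⌉₊ + 1 : ℕ) := by
        push_cast
        gcongr
        linarith [Nat.le_ceil (R / (ε * s))]
  · have hkN : (k : ℝ) * s ≤ R / ε + 2 := by
      have h1 : (k : ℝ) ≤ ⌈R / (ε * s)⌉₊ := by exact_mod_cast Nat.lt_succ_iff.1 hk
      have h2 := Nat.ceil_lt_add_one (show 0 ≤ R / (ε * s) by positivity)
      calc (k : ℝ) * s ≤ (R / (ε * s) + 1) * s := by gcongr; linarith
        _ = R / ε + s := by field_simp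
        _ ≤ _ := by linarith
    rw [sub_sub]
    refine hmod _ _ ?_
    rw [hXper]
    have h1 : X ((L.ψ c)^[k + k₀] x) - (X ((L.ψ c)^[k] y) + intVec m) =
        (X ((L.ψ c)^[k + k₀] x) - X x - ((k + k₀ : ℕ) * s) • ω) -
        (X ((L.ψ c)^[k] y) - X y - (k * s) • ω) + (t • ω - (X y - X x) - intVec m) -
        (t - k₀ * s) • ω := by
      push_cast
      module
    have h2 : ‖(t - k₀ * s) • ω‖ ≤ δ / 4 := by
      rw [norm_smul, Real.norm_eq_abs, abs_of_nonneg (by linarith)]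
      calc (t - k₀ * s) * ‖ω‖ ≤ δ / (4 * (‖ω‖ + 1)) * (‖ω‖ + 1) := by
            gcongr
            · linarith
            · linarith
        _ = δ / 4 := by field_simp
    have h3 : ((k + k₀ : ℕ) * s) * (δ / (4 * Λ)) + k * s * (δ / (4 * Λ)) ≤ δ / 4 := by
      calc _ = (2 * (k * s) + k₀ * s) * (δ / (4 * Λ)) := by push_cast; ring
        _ ≤ Λ * (δ / (4 * Λ)) := by gcongr; rw [hΛ]; linarith
        _ = δ / 4 := by field_simp
    rw [h1]
    refine (norm_sub_le _ _).trans_lt ?_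
    have h4 := norm_add_le ((X ((L.ψ c)^[k + k₀] x) - X x - ((k + k₀ : ℕ) * s) • ω) -
        (X ((L.ψ c)^[k] y) - X y - (k * s) • ω)) (t • ω - (X y - X x) - intVec m)
    have h5 := norm_sub_le (X ((L.ψ c)^[k + k₀] x) - X x - ((k + k₀ : ℕ) * s) • ω)
        (X ((L.ψ c)^[k] y) - X y - (k * s) • ω)
    linarith [hit (k + k₀) x, hit k y]

end LocalModel

open scoped BoundedContinuousFunction

lemma exists_invariant_probabilityMeasure {Y : Type*} [TopologicalSpace Y] [CompactSpace Y]
    [T2Space Y] [HasOuterApproxClosed Y] [MeasurableSpace Y] [BorelSpace Y] [Nonempty Y]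
    {f : Y → Y} (hf : Continuous f) : ∃ μ : Measure Y, IsProbabilityMeasure μ ∧ μ.map f = μ := by
  obtain ⟨y⟩ := ‹Nonempty Y›
  set μ' : ℕ → Measure Y := fun N =>
    ((N + 1 : ℕ) : ENNReal)⁻¹ • ∑ k ∈ Finset.range (N + 1), Measure.dirac (f^[k] y) with hμ'
  have hprob : ∀ N, IsProbabilityMeasure (μ' N) := fun N => ⟨by
    simp only [hμ', Measure.smul_apply, Measure.finsetSum_apply, measure_univ, Finset.sum_const,
      Finset.card_range, nsmul_eq_mul, mul_one, smul_eq_mul]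
    exact ENNReal.inv_mul_cancel (by simp) (ENNReal.natCast_ne_top _)⟩
  have hint : ∀ N (g : Y →ᵇ ℝ), ∫ z, g z ∂μ' N =
      ((N : ℝ) + 1)⁻¹ * ∑ k ∈ Finset.range (N + 1), g (f^[k] y) := fun N g => by
    rw [hμ', integral_smul_measure, integral_finsetSum_measure fun i _ =>
      g.integrable _]
    simp only [integral_dirac, ENNReal.toReal_inv, ENNReal.toReal_natCast, smul_eq_mul]
    push_cast
    rfl
  set M : ℕ → ProbabilityMeasure Y := fun N => ⟨μ' N, hprob N⟩ with hM
  obtain ⟨μ, -, hμ⟩ := isCompact_univ.ultrafilter_le_nhds ((Ultrafilter.of atTop).map M) (by simp)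
  have hlim : Tendsto M ((Ultrafilter.of atTop : Ultrafilter ℕ) : Filter ℕ) (𝓝 μ) := hμ
  rw [ProbabilityMeasure.tendsto_iff_forall_integral_tendsto] at hlim
  refine ⟨μ, inferInstance, ?_⟩
  have : IsProbabilityMeasure ((μ : Measure Y).map f) :=
    Measure.isProbabilityMeasure_map hf.measurable.aemeasurable
  refine ext_of_forall_integral_eq_of_IsFiniteMeasure fun g => ?_
  rw [integral_map hf.measurable.aemeasurable g.continuous.aestronglyMeasurable]
  have h1 := hlim (g.compContinuous ⟨f, hf⟩)
  have h2 := hlim g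
  have h3 : Tendsto (fun N : ℕ => ((N : ℝ) + 1)⁻¹ * (2 * ‖g‖))
      (Ultrafilter.of atTop : Ultrafilter ℕ)
      (𝓝 0) := by
    refine Tendsto.mono_left ?_ (Ultrafilter.of_le _)
    simpa using (tendsto_one_div_add_atTop_nhds_zero_nat (𝕜 := ℝ)).mul_const (2 * ‖g‖)
  have h4 : Tendsto (fun N : ℕ => ∫ z, g.compContinuous ⟨f, hf⟩ z ∂(M N : Measure Y) -
      ∫ z, g z ∂(M N : Measure Y)) (Ultrafilter.of atTop : Ultrafilter ℕ) (𝓝 0) := by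
    refine squeeze_zero_norm (fun N => ?_) h3
    change ‖∫ z, g.compContinuous ⟨f, hf⟩ z ∂μ' N - ∫ z, g z ∂μ' N‖ ≤ _
    rw [hint, hint, ← mul_sub, ← Finset.sum_sub_distrib]
    have h5 : ∑ k ∈ Finset.range (N + 1), (g.compContinuous ⟨f, hf⟩ (f^[k] y) - g (f^[k] y)) =
        g (f^[N + 1] y) - g y := by
      refine Eq.trans ?_ (Finset.sum_range_sub (fun k => g (f^[k] y)) (N + 1))
      refine Finset.sum_congr rfl fun k _ => ?_
      rw [Function.iterate_succ_apply']
      rfl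
    rw [h5, norm_mul, norm_inv, Real.norm_eq_abs, abs_of_pos (by positivity : (0 : ℝ) < N + 1)]
    gcongr
    linarith [norm_sub_le (g (f^[N + 1] y)) (g y), g.norm_coe_le_norm (f^[N + 1] y),
      g.norm_coe_le_norm y]
  exact sub_eq_zero.1 (tendsto_nhds_unique (h1.sub h2) h4)

lemma exists_close_of_periodic {n : ℕ} {h : E n → ℝ} (hc : Continuous h)
    (hper : ∀ x (m : Fin n → ℤ), h (x + intVec m) = h x) {η : ℝ} (hη : 0 < η) :
    ∃ ε > 0, ∀ x y (m : Fin n → ℤ), ‖x - y - intVec m‖ < ε → |h x - h y| ≤ η := by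
  have huc := (isCompact_closedBall (0 : E n) 2).uniformContinuousOn_of_continuous
    hc.continuousOn
  rw [Metric.uniformContinuousOn_iff] at huc
  obtain ⟨ε, hε, h1⟩ := huc η hη
  refine ⟨min ε 1, by positivity, fun x y m hm => ?_⟩
  obtain ⟨k, hk⟩ := exists_intVec_sub_mem_Icc y
  have h2 := norm_le_one_of_mem_Icc hk
  have h3 : x - intVec m - intVec k - (y - intVec k) = x - y - intVec m := by abel
  have h4 : ‖x - intVec m - intVec k‖ ≤ 2 := by
    have h5 : x - intVec m - intVec k = (x - y - intVec m) + (y - intVec k) := by abel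
    rw [h5]
    linarith [norm_add_le (x - y - intVec m) (y - intVec k), min_le_right ε 1]
  have h6 : ∀ z (l : Fin n → ℤ), h (z - intVec l) = h z := fun z l => by
    rw [← hper _ l, sub_add_cancel]
  have h7 := h1 (x - intVec m - intVec k) (by simpa using h4) (y - intVec k)
    (by simpa using h2.trans one_le_two)
    (by rw [dist_eq_norm, h3]; exact hm.trans_le (min_le_left _ _))
  rw [h6, h6, h6, Real.dist_eq] at h7
  exact h7.le

/-- Any two orbits of some power of `f` are `ε`-close modulo `ℤⁿ` during a long time, after a time
shift which is small compared to that time. -/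
def Shadowing {n : ℕ} (f : E n → E n) (ε : ℝ) (T N : ℕ) : Prop :=
  ∀ x y, ∃ k₀ : ℕ, k₀ ≤ ε * N ∧ ∀ k < N, ∃ m : Fin n → ℤ,
    ‖(f^[T])^[k + k₀] x - (f^[T])^[k] y - intVec m‖ < ε

lemma Shadowing.abs_sum_sub_sum_le {n : ℕ} {f : E n → E n} {ε : ℝ} {T N : ℕ}
    (hS : Shadowing f ε T N) {h : E n → ℝ} {M η : ℝ} (hM : ∀ x, |h x| ≤ M)
    (hclose : ∀ x y (m : Fin n → ℤ), ‖x - y - intVec m‖ < ε → |h x - h y| ≤ η) (x y : E n) :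
    |∑ k ∈ Finset.range N, h ((f^[T])^[k] x) - ∑ k ∈ Finset.range N, h ((f^[T])^[k] y)| ≤
      N * (η + 2 * ε * M) := by
  obtain ⟨k₀, hk₀, hk⟩ := hS x y
  have hM0 : 0 ≤ M := (abs_nonneg _).trans (hM x)
  set u : ℕ → ℝ := fun k => h ((f^[T])^[k] x) with hu
  have h1 : |∑ k ∈ Finset.range N, u (k + k₀) - ∑ k ∈ Finset.range N, h ((f^[T])^[k] y)| ≤
      N * η := by
    rw [← Finset.sum_sub_distrib]
    refine (Finset.abs_sum_le_sum_abs _ _).trans ?_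
    calc _ ≤ ∑ _k ∈ Finset.range N, η := Finset.sum_le_sum fun k hkN => by
          obtain ⟨m, hm⟩ := hk k (Finset.mem_range.1 hkN)
          exact hclose _ _ m hm
      _ = N * η := by simp
  have h2 : ∑ k ∈ Finset.range N, u (k + k₀) - ∑ k ∈ Finset.range N, u k =
      ∑ k ∈ Finset.range k₀, u (N + k) - ∑ k ∈ Finset.range k₀, u k := by
    have h3 := Finset.sum_range_add u k₀ N
    have h4 := Finset.sum_range_add u N k₀
    rw [add_comm N k₀] at h4
    simp only [add_comm _ k₀]
    linarith
  have h3 : |∑ k ∈ Finset.range N, u (k + k₀) - ∑ k ∈ Finset.range N, u k| ≤ N * (2 * ε * M) := by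
    have h4 : ∀ v : ℕ → ℝ, (∀ k, |v k| ≤ M) → |∑ k ∈ Finset.range k₀, v k| ≤ k₀ * M := by
      intro v hv
      refine (Finset.abs_sum_le_sum_abs _ _).trans ?_
      calc _ ≤ ∑ _k ∈ Finset.range k₀, M := Finset.sum_le_sum fun k _ => hv k
        _ = k₀ * M := by simp
    rw [h2]
    refine (abs_sub _ _).trans ?_
    have h5 := h4 (fun k => u (N + k)) fun k => hM _
    have h6 := h4 u fun k => hM _
    have h7 : k₀ * M ≤ ε * N * M := by gcongr
    linarith
  rw [abs_le] at h1 h3 ⊢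
  constructor <;> linarith [h1.1, h1.2, h3.1, h3.2]

section

variable {n : ℕ} {Y : Type*} {Φ : Y → Y} {ι : E n → Y} {f : E n → E n}

lemma iterate_semiconj (hΦι : ∀ x, Φ (ι x) = ι (f x)) (k : ℕ) (x : E n) :
    Φ^[k] (ι x) = ι (f^[k] x) :=
  (Function.Semiconj.iterate_right (f := ι) (ga := f) (gb := Φ) (fun x => (hΦι x).symm) k x).symm

variable [TopologicalSpace Y] [MeasurableSpace Y] [BorelSpace Y]

lemma abs_integral_sub_le_of_shadowing (hΦ : Continuous Φ) (hΦι : ∀ x, Φ (ι x) = ι (f x))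
    {ε M η : ℝ} {T N : ℕ} (hN : 1 ≤ N) (hS : Shadowing f ε T N) (g : Y →ᵇ ℝ)
    (hM : ∀ x, |g (ι x)| ≤ M)
    (hclose : ∀ x y (m : Fin n → ℤ), ‖x - y - intVec m‖ < ε → |g (ι x) - g (ι y)| ≤ η)
    {μ : Measure Y} [IsProbabilityMeasure μ] (hμ : μ.map Φ = μ) (hμι : μ (Set.range ι)ᶜ = 0) :
    |∫ y, g y ∂μ - (N : ℝ)⁻¹ * ∑ k ∈ Finset.range N, g (ι ((f^[T])^[k] 0))| ≤ η + 2 * ε * M := by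
  have hN0 : (0 : ℝ) < N := by exact_mod_cast hN
  have hmp : MeasurePreserving Φ μ μ := ⟨hΦ.measurable, hμ⟩
  have hk : ∀ k, ∫ y, g ((Φ^[T])^[k] y) ∂μ = ∫ y, g y ∂μ := fun k => by
    have h1 := (hmp.iterate T).iterate k
    have h2 := integral_map (μ := μ) h1.measurable.aemeasurable
      (f := g) (by rw [h1.map_eq]; exact g.continuous.aestronglyMeasurable)
    rw [h1.map_eq] at h2
    exact h2.symm
  have hi : ∀ k, Integrable (fun y => g ((Φ^[T])^[k] y)) μ := fun k =>
    (g.compContinuous ⟨(Φ^[T])^[k], (hΦ.iterate T).iterate k⟩).integrable μ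
  set a := (N : ℝ)⁻¹ * ∑ k ∈ Finset.range N, g (ι ((f^[T])^[k] 0)) with ha
  have h1 : ∫ y, g y ∂μ - a =
      ∫ y, ((N : ℝ)⁻¹ * ∑ k ∈ Finset.range N, g ((Φ^[T])^[k] y) - a) ∂μ := by
    rw [integral_sub ((integrable_finsetSum _ fun k _ => hi k).const_mul _) (integrable_const a),
      integral_const_mul, integral_finsetSum _ fun k _ => hi k]
    simp only [hk, Finset.sum_const, Finset.card_range, nsmul_eq_mul, integral_const,
      measureReal_def,
      measure_univ, ENNReal.toReal_one, one_smul]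
    rw [inv_mul_cancel_left₀ hN0.ne']
  rw [h1]
  have h2 := norm_integral_le_of_norm_le_const (μ := μ) (C := η + 2 * ε * M)
    (f := fun y => (N : ℝ)⁻¹ * ∑ k ∈ Finset.range N, g ((Φ^[T])^[k] y) - a) (by
      have hae : ∀ᵐ y ∂μ, y ∈ Set.range ι := by
        rw [ae_iff]; exact hμι
      filter_upwards [hae] with y hy
      obtain ⟨x, rfl⟩ := hy
      have h3 : ∀ k, (Φ^[T])^[k] (ι x) = ι ((f^[T])^[k] x) := fun k =>
        iterate_semiconj (iterate_semiconj hΦι T) k x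
      simp only [h3]
      rw [ha, ← mul_sub, norm_mul, norm_inv, Real.norm_eq_abs, abs_of_pos hN0,
        inv_mul_le_iff₀ hN0]
      exact hS.abs_sum_sub_sum_le (h := fun x => g (ι x)) hM hclose x 0)
  simpa using h2

lemma ext_of_shadowing [TopologicalSpace.MetrizableSpace Y] (hΦ : Continuous Φ)
    (hΦι : ∀ x, Φ (ι x) = ι (f x)) (hι : Continuous ι)
    (hιper : ∀ x (m : Fin n → ℤ), ι (x + intVec m) = ι x)
    (hS : ∀ ε > 0, ∃ T N : ℕ, 1 ≤ N ∧ Shadowing f ε T N)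
    {μ ν : Measure Y} [IsProbabilityMeasure μ] [IsProbabilityMeasure ν] (hμ : μ.map Φ = μ)
    (hμι : μ (Set.range ι)ᶜ = 0) (hν : ν.map Φ = ν) (hνι : ν (Set.range ι)ᶜ = 0) : μ = ν := by
  refine ext_of_forall_integral_eq_of_IsFiniteMeasure fun g => ?_
  refine eq_of_abs_sub_nonpos (le_of_forall_pos_le_add fun r hr => ?_)
  obtain ⟨ε₀, hε₀, hclose⟩ := exists_close_of_periodic (h := fun x => g (ι x))
    (g.continuous.comp hι) (fun x m => by rw [hιper]) (show 0 < r / 4 by positivity)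
  set ε := min ε₀ (r / (8 * (‖g‖ + 1))) with hε
  have hεpos : 0 < ε := by positivity
  obtain ⟨T, N, hN, hTN⟩ := hS ε hεpos
  have hM : ∀ x, |g (ι x)| ≤ ‖g‖ := fun x => g.norm_coe_le_norm _
  have hcl : ∀ x y (m : Fin n → ℤ), ‖x - y - intVec m‖ < ε → |g (ι x) - g (ι y)| ≤ r / 4 :=
    fun x y m h => hclose x y m (h.trans_le (min_le_left _ _))
  have h1 := abs_integral_sub_le_of_shadowing hΦ hΦι hN hTN g hM hcl hμ hμι
  have h2 := abs_integral_sub_le_of_shadowing hΦ hΦι hN hTN g hM hcl hν hνι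
  have h3 : 2 * ε * ‖g‖ ≤ r / 4 := by
    have : ε * (8 * (‖g‖ + 1)) ≤ r := by
      rw [← le_div_iff₀ (by positivity)]; exact min_le_right _ _
    nlinarith
  rw [abs_le] at h1 h2 ⊢
  constructor <;> linarith [h1.1, h1.2, h2.1, h2.2]

lemma measure_pos_of_shadowing (hΦ : Continuous Φ) (hΦι : ∀ x, Φ (ι x) = ι (f x))
    (hι : Continuous ι) (hιper : ∀ x (m : Fin n → ℤ), ι (x + intVec m) = ι x)
    (hS : ∀ ε > 0, ∃ T N : ℕ, 1 ≤ N ∧ Shadowing f ε T N)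
    {μ : Measure Y} [IsProbabilityMeasure μ] (hμ : μ.map Φ = μ)
    (hμι : μ (Set.range ι)ᶜ = 0) {U : Set Y} (hU : IsOpen U) (hUι : (U ∩ Set.range ι).Nonempty) :
    0 < μ U := by
  obtain ⟨-, hyU, y, rfl⟩ := hUι
  obtain ⟨ε, hε, hball⟩ := Metric.isOpen_iff.1 (hU.preimage hι) y hyU
  obtain ⟨T, N, hN, hTN⟩ := hS ε hε
  by_contra! h0
  have h0' : μ U = 0 := le_antisymm h0 bot_le
  have hmp : MeasurePreserving Φ μ μ := ⟨hΦ.measurable, hμ⟩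
  have h1 : μ (⋃ k : ℕ, (Φ^[T])^[k] ⁻¹' U) = 0 := measure_iUnion_null fun k => by
    rw [((hmp.iterate T).iterate k).measure_preimage hU.measurableSet.nullMeasurableSet, h0']
  have h2 : Set.univ ⊆ (Set.range ι)ᶜ ∪ ⋃ k : ℕ, (Φ^[T])^[k] ⁻¹' U := by
    intro z _
    by_cases hz : z ∈ Set.range ι
    · obtain ⟨x, rfl⟩ := hz
      refine Or.inr (Set.mem_iUnion.2 ?_)
      obtain ⟨k₀, -, hk⟩ := hTN x y
      obtain ⟨m, hm⟩ := hk 0 hN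
      refine ⟨k₀, ?_⟩
      rw [Set.mem_preimage, iterate_semiconj (iterate_semiconj hΦι T)]
      have h3 : (f^[T])^[k₀] x - intVec m ∈ Metric.ball y ε := by
        rw [mem_ball_iff_norm]
        simpa [sub_right_comm] using hm
      have h4 := hball h3
      rwa [Set.mem_preimage, ← hιper _ m, sub_add_cancel] at h4
    · exact Or.inl hz
  have h3 := measure_mono_null h2 (measure_union_null hμι h1)
  simp at h3

lemma exists_invariant_of_semiconj [TopologicalSpace.MetrizableSpace Y] (hΦ : Continuous Φ)
    (hΦι : ∀ x, Φ (ι x) = ι (f x))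
    (hι : Continuous ι) (hιper : ∀ x (m : Fin n → ℤ), ι (x + intVec m) = ι x) :
    ∃ μ : Measure Y, IsProbabilityMeasure μ ∧ μ.map Φ = μ ∧ μ (Set.range ι)ᶜ = 0 := by
  have hK : IsCompact (Set.range ι) := by
    have h1 : Set.range ι = ι '' Set.Icc 0 1 := by
      refine Set.Subset.antisymm ?_ (Set.image_subset_range _ _)
      rintro _ ⟨x, rfl⟩
      obtain ⟨m, hm⟩ := exists_intVec_sub_mem_Icc x
      exact ⟨_, hm, by rw [← hιper _ m, sub_add_cancel]⟩
    rw [h1]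
    exact isCompact_Icc.image hι
  have hmaps : Set.MapsTo Φ (Set.range ι) (Set.range ι) := by
    rintro _ ⟨x, rfl⟩
    exact ⟨f x, (hΦι x).symm⟩
  have : CompactSpace (Set.range ι) := isCompact_iff_compactSpace.1 hK
  have : Nonempty (Set.range ι) := ⟨⟨ι 0, 0, rfl⟩⟩
  have hemb : Topology.IsClosedEmbedding ((↑) : Set.range ι → Y) :=
    hK.isClosed.isClosedEmbedding_subtypeVal
  obtain ⟨ν, hν, hνΦ⟩ := exists_invariant_probabilityMeasure (hΦ.restrict hmaps)
  have hval : Measurable ((↑) : Set.range ι → Y) := continuous_subtype_val.measurable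
  refine ⟨ν.map (↑), Measure.isProbabilityMeasure_map hval.aemeasurable, ?_, ?_⟩
  · conv_rhs => rw [← hνΦ]
    rw [Measure.map_map hΦ.measurable hval, Measure.map_map hval (hΦ.restrict hmaps).measurable]
    rfl
  · rw [Measure.map_apply hval hK.isClosed.isOpen_compl.measurableSet]
    convert measure_empty (μ := ν)
    ext z
    simp

end

lemma iterate_add_intVec {n : ℕ} {f : E n → E n}
    (hf : ∀ x (m : Fin n → ℤ), f (x + intVec m) = f x + intVec m) (k : ℕ) (x : E n)
    (m : Fin n → ℤ) : f^[k] (x + intVec m) = f^[k] x + intVec m := by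
  induction k generalizing x with
  | zero => rfl
  | succ k ih => rw [Function.iterate_succ_apply, Function.iterate_succ_apply, hf, ih]

lemma iterate_sub_intVec {n : ℕ} {f : E n → E n}
    (hf : ∀ x (m : Fin n → ℤ), f (x + intVec m) = f x + intVec m) (k : ℕ) (x : E n)
    (m : Fin n → ℤ) : f^[k] (x - intVec m) = f^[k] x - intVec m := by
  rw [sub_eq_add_neg, ← intVec_neg, iterate_add_intVec hf, intVec_neg, ← sub_eq_add_neg]

lemma iterate_of_eq_sub_intVec {n : ℕ} {f g : E n → E n}
    (hf : ∀ x (m : Fin n → ℤ), f (x + intVec m) = f x + intVec m) {T : ℕ} {m : Fin n → ℤ}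
    (hg : ∀ x, g x = f^[T] x - intVec m) (k : ℕ) (x : E n) :
    g^[k] x = (f^[T])^[k] x - intVec (k • m) := by
  have hF := iterate_sub_intVec (f := f^[T]) (iterate_add_intVec hf T)
  induction k with
  | zero => ext i; simp [intVec]
  | succ k ih =>
    rw [Function.iterate_succ_apply', ih, hg, iterate_sub_intVec hf T,
      Function.iterate_succ_apply' (f^[T]), succ_nsmul, intVec_add, sub_sub]

lemma Shadowing.mono {n : ℕ} {f : E n → E n} {ε ε' : ℝ} {T N : ℕ} (h : Shadowing f ε T N)
    (hε : ε ≤ ε') : Shadowing f ε' T N := by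
  intro x y
  obtain ⟨k₀, hk₀, h⟩ := h x y
  refine ⟨k₀, hk₀.trans (by gcongr), fun k hk => ?_⟩
  obtain ⟨m, hm⟩ := h k hk
  exact ⟨m, hm.trans_le hε⟩

lemma continuous_iterate_param {n : ℕ} {f : E n → E n → E n}
    (hf : Continuous fun p : E n × E n => f p.1 p.2) (k : ℕ) :
    Continuous fun p : E n × E n => (f p.1)^[k] p.2 := by
  induction k with
  | zero => exact continuous_snd
  | succ k ih =>
    simp only [Function.iterate_succ_apply']
    exact hf.comp (continuous_fst.prodMk ih)

lemma isOpen_shadowing {n : ℕ} {f : E n → E n → E n}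
    (hf : Continuous fun p : E n × E n => f p.1 p.2)
    (hper : ∀ c x (m : Fin n → ℤ), f c (x + intVec m) = f c x + intVec m) (ε : ℝ) (T N : ℕ) :
    IsOpen {c | Shadowing (f c) ε T N} := by
  rw [isOpen_iff_eventually]
  intro c hc
  have hK : IsCompact (Set.Icc (0 : E n) 1 ×ˢ Set.Icc (0 : E n) 1) :=
    isCompact_Icc.prod isCompact_Icc
  have hTcont : Continuous fun p : E n × E n => (f p.1)^[T] p.2 := continuous_iterate_param hf T
  have hcont : ∀ k, Continuous fun p : E n × E n => ((f p.1)^[T])^[k] p.2 := fun k =>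
    continuous_iterate_param (f := fun c => (f c)^[T]) hTcont k
  have key : ∀ᶠ c' in 𝓝 c, ∀ z ∈ Set.Icc (0 : E n) 1 ×ˢ Set.Icc (0 : E n) 1,
      ∃ k₀ : ℕ, k₀ ≤ ε * N ∧ ∀ k < N, ∃ m : Fin n → ℤ,
        ‖((f c')^[T])^[k + k₀] z.1 - ((f c')^[T])^[k] z.2 - intVec m‖ < ε := by
    refine hK.eventually_forall_of_forall_eventually fun z _ => ?_
    obtain ⟨k₀, hk₀, h⟩ := hc z.1 z.2
    choose! m hm using h
    have : ∀ᶠ q : E n × E n × E n in 𝓝 (c, z), ∀ k ∈ Finset.range N,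
        ‖((f q.1)^[T])^[k + k₀] q.2.1 - ((f q.1)^[T])^[k] q.2.2 - intVec (m k)‖ < ε := by
      rw [Filter.eventually_all_finset]
      intro k hk
      have hc1 : Continuous fun q : E n × E n × E n => ((f q.1)^[T])^[k + k₀] q.2.1 :=
        (hcont (k + k₀)).comp (continuous_fst.prodMk (continuous_fst.comp continuous_snd))
      have hc2 : Continuous fun q : E n × E n × E n => ((f q.1)^[T])^[k] q.2.2 :=
        (hcont k).comp (continuous_fst.prodMk (continuous_snd.comp continuous_snd))
      have hc3 : Continuous fun q : E n × E n × E n =>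
          ‖((f q.1)^[T])^[k + k₀] q.2.1 - ((f q.1)^[T])^[k] q.2.2 - intVec (m k)‖ :=
        ((hc1.sub hc2).sub continuous_const).norm
      exact hc3.continuousAt.eventually_lt continuousAt_const (hm k (Finset.mem_range.1 hk))
    filter_upwards [this] with q hq
    exact ⟨k₀, hk₀, fun k hk => ⟨m k, hq k (Finset.mem_range.2 hk)⟩⟩
  filter_upwards [key] with c' hc' x y
  obtain ⟨a, ha⟩ := exists_intVec_sub_mem_Icc x
  obtain ⟨b, hb⟩ := exists_intVec_sub_mem_Icc y
  obtain ⟨k₀, hk₀, h⟩ := hc' (x - intVec a, y - intVec b) ⟨ha, hb⟩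
  refine ⟨k₀, hk₀, fun k hk => ?_⟩
  obtain ⟨m, hm⟩ := h k hk
  refine ⟨m + a + -b, ?_⟩
  have hF := iterate_sub_intVec (f := (f c')^[T]) (iterate_add_intVec (hper c') T)
  simp only [hF] at hm
  rw [intVec_add, intVec_add, intVec_neg]
  convert hm using 2
  abel

/-- Density of the shadowing property for each `ε` upgrades to a residual set of parameters. -/
theorem exists_dense_isGδ_shadowing {n : ℕ} {f : E n → E n → E n}
    (hf : Continuous fun p : E n × E n => f p.1 p.2)
    (hper : ∀ c x (m : Fin n → ℤ), f c (x + intVec m) = f c x + intVec m)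
    (hdense : ∀ ε > 0, Dense {c | ∃ T N : ℕ, 1 ≤ N ∧ Shadowing (f c) ε T N}) :
    ∃ G : Set (E n), Dense G ∧ IsGδ G ∧
      ∀ c ∈ G, ∀ ε > 0, ∃ T N : ℕ, 1 ≤ N ∧ Shadowing (f c) ε T N := by
  have hopen : ∀ ε, IsOpen {c | ∃ T N : ℕ, 1 ≤ N ∧ Shadowing (f c) ε T N} := by
    intro ε
    have : {c | ∃ T N : ℕ, 1 ≤ N ∧ Shadowing (f c) ε T N} =
        ⋃ T : ℕ, ⋃ N : ℕ, ⋃ _ : 1 ≤ N, {c | Shadowing (f c) ε T N} := by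
      ext c; simp
    rw [this]
    exact isOpen_iUnion fun T => isOpen_iUnion fun N => isOpen_iUnion fun _ =>
      isOpen_shadowing hf hper ε T N
  refine ⟨⋂ j : ℕ, {c | ∃ T N : ℕ, 1 ≤ N ∧ Shadowing (f c) (1 / ((j : ℝ) + 1)) T N},
    dense_iInter_of_isOpen (fun j => hopen _) (fun j => hdense _ (by positivity)),
    IsGδ.iInter_of_isOpen fun j => hopen _, fun c hc ε hε => ?_⟩
  obtain ⟨j, hj⟩ := exists_nat_one_div_lt hε
  obtain ⟨T, N, hN, h⟩ := Set.mem_iInter.1 hc j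
  exact ⟨T, N, hN, h.mono hj.le⟩

theorem dense_shadowing_of_localModel {n : ℕ} (hn : 1 ≤ n) {f : E n → E n → E n}
    (hper : ∀ c x (m : Fin n → ℤ), f c (x + intVec m) = f c x + intVec m)
    (hmodel : Dense {c₀ | ∃ (T : ℕ) (m : Fin n → ℤ) (L : LocalModel n),
      ∀ c x, L.ψ c x = (f (c₀ + c))^[T] x - intVec m}) {ε : ℝ} (hε : 0 < ε) :
    Dense {c | ∃ T N : ℕ, 1 ≤ N ∧ Shadowing (f c) ε T N} := by
  rw [Metric.dense_iff]
  intro c r hr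
  obtain ⟨c₀, hc₀, T, m, L, hL⟩ := Metric.dense_iff.1 hmodel c (r / 2) (by positivity)
  obtain ⟨c₁, hc₁, N, hN, hS⟩ := L.exists_shadowing hn hε (ρ := r / 4) (by positivity)
  refine ⟨c₀ + c₁, ?_, T, N, hN, fun x y => ?_⟩
  · rw [Metric.mem_ball, dist_eq_norm] at hc₀ ⊢
    calc ‖c₀ + c₁ - c‖ = ‖(c₀ - c) + c₁‖ := by congr 1; abel
      _ ≤ ‖c₀ - c‖ + ‖c₁‖ := norm_add_le _ _
      _ < r := by linarith
  · obtain ⟨k₀, hk₀, h⟩ := hS x y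
    refine ⟨k₀, hk₀, fun k hk => ?_⟩
    obtain ⟨m', hm'⟩ := h k hk
    refine ⟨m' + ((k + k₀) • m + -(k • m)), ?_⟩
    have hit := iterate_of_eq_sub_intVec (hper (c₀ + c₁)) (hL c₁)
    rw [hit, hit] at hm'
    rw [intVec_add, intVec_add, intVec_neg]
    convert hm' using 2
    abel

/-- The strip `{‖p‖ ≤ R}` in phase space. -/
def strip (n : ℕ) (R : ℝ) : Set (E n × E n) := {z | ‖z.2‖ ≤ R}

lemma strip_mono {n : ℕ} {R R' : ℝ} (h : R ≤ R') : strip n R ⊆ strip n R' :=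
  fun _ hz => le_trans (Set.mem_ofPred.1 hz) h

lemma convex_strip {n : ℕ} (R : ℝ) : Convex ℝ (strip n R) := by
  have : strip n R = LinearMap.snd ℝ (E n) (E n) ⁻¹' Metric.closedBall 0 R := by
    ext z; simp [strip]
  rw [this]
  exact (convex_closedBall _ _).linear_preimage _

lemma omega0_eq {n : ℕ} (w w' : E n × E n) : omega0 n w w' = w.2 ⬝ᵥ w'.1 - w.1 ⬝ᵥ w'.2 := rfl

lemma exists_norm_le_on_strip {n : ℕ} {Y : Type*} [NormedAddCommGroup Y] {G : E n × E n → Y}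
    (hG : Continuous G) (hper : ∀ x p (m : Fin n → ℤ), G (x + intVec m, p) = G (x, p)) (R : ℝ) :
    ∃ M, 0 ≤ M ∧ ∀ z ∈ strip n R, ‖G z‖ ≤ M := by
  obtain ⟨M, hM⟩ := ((isCompact_Icc (a := (0 : E n)) (b := 1)).prod
    (isCompact_closedBall (0 : E n) R)).exists_bound_of_continuousOn hG.continuousOn
  refine ⟨max M 0, le_max_right _ _, fun z hz => ?_⟩
  obtain ⟨m, hm⟩ := exists_intVec_sub_mem_Icc z.1
  have h := hper (z.1 - intVec m) z.2 m
  rw [sub_add_cancel] at h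
  change ‖G (z.1, z.2)‖ ≤ _
  rw [h]
  exact (hM _ ⟨hm, by simpa [strip] using hz⟩).trans (le_max_left _ _)

lemma fderiv_periodic {n : ℕ} {Y : Type*} [NormedAddCommGroup Y] [NormedSpace ℝ Y]
    {G : E n × E n → Y} (hper : ∀ x p (m : Fin n → ℤ), G (x + intVec m, p) = G (x, p))
    (x p : E n) (m : Fin n → ℤ) : fderiv ℝ G (x + intVec m, p) = fderiv ℝ G (x, p) := by
  have h : (fun z : E n × E n => G (z + (intVec m, 0))) = G := by
    ext z; obtain ⟨x, p⟩ := z; simpa using hper x p m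
  have h2 := fderiv_comp_add_right (𝕜 := ℝ) (f := G) (x := (x, p)) ((intVec m, 0) : E n × E n)
  rw [h] at h2
  simpa using h2.symm

lemma exists_quadratic_remainder_on_strip {n : ℕ} {Y : Type*} [NormedAddCommGroup Y]
    [NormedSpace ℝ Y] {G : E n × E n → Y} (hG : ContDiff ℝ 2 G)
    (hper : ∀ x p (m : Fin n → ℤ), G (x + intVec m, p) = G (x, p)) (R : ℝ) :
    ∃ C, 0 ≤ C ∧ ∀ z ∈ strip n R, ∀ z' ∈ strip n R,
      ‖G z' - G z - fderiv ℝ G z (z' - z)‖ ≤ C * ‖z' - z‖ ^ 2 := by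
  have hd : ContDiff ℝ 1 (fderiv ℝ G) := hG.fderiv_right (by norm_num)
  have hdd : Continuous (fderiv ℝ (fderiv ℝ G)) := hd.continuous_fderiv one_ne_zero
  obtain ⟨C, hC0, hC⟩ := exists_norm_le_on_strip hdd
    (fderiv_periodic (fderiv_periodic hper)) R
  refine ⟨C, hC0, fun z hz z' hz' => ?_⟩
  have hlip : ∀ y ∈ strip n R, ‖fderiv ℝ G y - fderiv ℝ G z‖ ≤ C * ‖y - z‖ := fun y hy =>
    (convex_strip R).norm_image_sub_le_of_norm_fderiv_le
      (fun w _ => (hd.differentiable one_ne_zero) w) hC hz hy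
  have hs : Convex ℝ (strip n R ∩ Metric.closedBall z ‖z' - z‖) :=
    (convex_strip R).inter (convex_closedBall _ _)
  have := hs.norm_image_sub_le_of_norm_fderiv_le' (f := G) (φ := fderiv ℝ G z) (C := C * ‖z' - z‖)
    (fun w _ => (hG.differentiable two_ne_zero) w) (fun w hw => ?_)
    (x := z) (y := z') ⟨hz, Metric.mem_closedBall_self (norm_nonneg _)⟩
    ⟨hz', by simp [dist_eq_norm]⟩
  · rwa [mul_assoc, ← sq] at this
  · refine (hlip w hw.1).trans ?_
    gcongr
    simpa [dist_eq_norm] using hw.2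

lemma clm_apply_eq_sum {n : ℕ} (ℓ : E n →L[ℝ] ℝ) (v : E n) :
    ℓ v = (fun i => ℓ (Pi.single i 1)) ⬝ᵥ v := by
  conv_lhs => rw [pi_eq_sum_univ' v]
  simp [dotProduct, mul_comm]

section Hamiltonian

variable {n : ℕ} {H : E n × E n → ℝ}

lemma gradP_apply_eq (hH : Differentiable ℝ H) (x p : E n) (i : Fin n) :
    gradP n H x p i = fderiv ℝ H (x, p) (0, Pi.single i 1) := by
  have h : HasFDerivAt (fun p' => H (x, p')) ((fderiv ℝ H (x, p)).comp (.inr ℝ (E n) (E n))) p :=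
    (hH (x, p)).hasFDerivAt.comp p (hasFDerivAt_prodMk_right x p)
  simp [gradP, h.fderiv]

lemma gradX_apply_eq (hH : Differentiable ℝ H) (x p : E n) (i : Fin n) :
    gradX n H x p i = fderiv ℝ H (x, p) (Pi.single i 1, 0) := by
  have h : HasFDerivAt (fun x' => H (x', p)) ((fderiv ℝ H (x, p)).comp (.inl ℝ (E n) (E n))) x :=
    (hH (x, p)).hasFDerivAt.comp x (hasFDerivAt_prodMk_left x p)
  simp [gradX, h.fderiv]

lemma fderiv_eq_grad (hH : Differentiable ℝ H) (z w : E n × E n) :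
    fderiv ℝ H z w = gradX n H z.1 z.2 ⬝ᵥ w.1 + gradP n H z.1 z.2 ⬝ᵥ w.2 := by
  have h1 := clm_apply_eq_sum ((fderiv ℝ H z).comp (.inl ℝ (E n) (E n))) w.1
  have h2 := clm_apply_eq_sum ((fderiv ℝ H z).comp (.inr ℝ (E n) (E n))) w.2
  have e1 : gradX n H z.1 z.2 =
      fun i => ((fderiv ℝ H z).comp (.inl ℝ (E n) (E n))) (Pi.single i 1) := by
    ext i; rw [gradX_apply_eq hH]; rfl
  have e2 : gradP n H z.1 z.2 =
      fun i => ((fderiv ℝ H z).comp (.inr ℝ (E n) (E n))) (Pi.single i 1) := by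
    ext i; rw [gradP_apply_eq hH]; rfl
  rw [e1, e2, ← h1, ← h2]
  simp [← map_add]

lemma omega0_hamVF (hH : Differentiable ℝ H) (z w : E n × E n) :
    omega0 n (hamVF n H z) w = -fderiv ℝ H z w := by
  rw [fderiv_eq_grad hH, omega0_eq]
  simp [hamVF]
  ring

namespace IsTonelliHamiltonian

lemma contDiff (hH : IsTonelliHamiltonian n ⊤ H) (k : ℕ) : ContDiff ℝ k H :=
  hH.smooth.of_le (by exact_mod_cast le_top)

lemma differentiable (hH : IsTonelliHamiltonian n ⊤ H) : Differentiable ℝ H :=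
  (hH.contDiff 1).differentiable (by norm_num)

lemma contDiff_hamVF (hH : IsTonelliHamiltonian n ⊤ H) : ContDiff ℝ 2 (hamVF n H) := by
  have hd : ContDiff ℝ 2 (fderiv ℝ H) := (hH.contDiff 3).fderiv_right (by norm_num)
  refine ContDiff.prodMk (contDiff_pi.2 fun i => ?_) (ContDiff.neg (contDiff_pi.2 fun i => ?_))
  · simp only [gradP_apply_eq hH.differentiable]
    exact hd.clm_apply contDiff_const
  · simp only [gradX_apply_eq hH.differentiable]
    exact hd.clm_apply contDiff_const

lemma hamVF_periodic (hH : IsTonelliHamiltonian n ⊤ H) (x p : E n) (m : Fin n → ℤ) :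
    hamVF n H (x + intVec m, p) = hamVF n H (x, p) := by
  have h := fderiv_periodic hH.periodic x p m
  ext i
  · simp [hamVF, gradP_apply_eq hH.differentiable, h]
  · simp [hamVF, gradX_apply_eq hH.differentiable, h]

lemma omega0_fderiv_hamVF (hH : IsTonelliHamiltonian n ⊤ H) (z u v : E n × E n) :
    omega0 n (fderiv ℝ (hamVF n H) z u) v + omega0 n u (fderiv ℝ (hamVF n H) z v) = 0 := by
  have hV : HasFDerivAt (hamVF n H) (fderiv ℝ (hamVF n H) z) z :=
    (hH.contDiff_hamVF.differentiable two_ne_zero z).hasFDerivAt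
  have hd : ContDiff ℝ 1 (fderiv ℝ H) := (hH.contDiff 2).fderiv_right (by norm_num)
  have hD : HasFDerivAt (fderiv ℝ H) (fderiv ℝ (fderiv ℝ H) z) z :=
    (hd.differentiable one_ne_zero z).hasFDerivAt
  have key : ∀ u v, omega0 n (fderiv ℝ (hamVF n H) z u) v = -fderiv ℝ (fderiv ℝ H) z u v := by
    intro u v
    have h1 : HasDerivAt (fun t : ℝ => hamVF n H (z + t • u)) (fderiv ℝ (hamVF n H) z u) 0 :=
      hV.hasLineDerivAt u
    have h2' : HasDerivAt (fun t : ℝ => fderiv ℝ H (z + t • u) v) _ 0 :=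
      (hD.clm_apply (hasFDerivAt_const v z)).hasLineDerivAt u
    have h2 := h2'.congr_deriv (g' := fderiv ℝ (fderiv ℝ H) z u v) (by simp)
    have h3 : HasDerivAt (fun t : ℝ => omega0 n (hamVF n H (z + t • u)) v)
        (omega0 n (fderiv ℝ (hamVF n H) z u) v) 0 := by
      simp only [omega0, dotP]
      refine HasDerivAt.sub ?_ ?_
      · exact HasDerivAt.fun_sum fun i _ => ((hasDerivAt_pi.1 h1.snd i).mul_const _)
      · exact HasDerivAt.fun_sum fun i _ => ((hasDerivAt_pi.1 h1.fst i).mul_const _)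
    simp only [omega0_hamVF hH.differentiable] at h3
    exact h3.unique h2.neg
  have hsymm : fderiv ℝ (fderiv ℝ H) z u v = fderiv ℝ (fderiv ℝ H) z v u :=
    second_derivative_symmetric (fun y => (hH.differentiable y).hasFDerivAt) hD u v
  have hanti : omega0 n u (fderiv ℝ (hamVF n H) z v) = -omega0 n (fderiv ℝ (hamVF n H) z v) u := by
    simp only [omega0_eq, dotProduct_comm]
    ring
  rw [hanti, key, key, hsymm]
  ring

/-- Energy sublevels are contained in strips, and strips have bounded energy. -/
lemma exists_le_of_mem_strip (hH : IsTonelliHamiltonian n ⊤ H) (R : ℝ) :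
    ∃ B, ∀ z ∈ strip n R, H z ≤ B := by
  obtain ⟨M, -, hM⟩ := exists_norm_le_on_strip hH.smooth.continuous hH.periodic R
  exact ⟨M, fun z hz => (le_abs_self _).trans (hM z hz)⟩

lemma exists_mem_strip_of_le (hH : IsTonelliHamiltonian n ⊤ H) (B : ℝ) :
    ∃ R, ∀ z, H z ≤ B → z ∈ strip n R := by
  obtain ⟨R, hR⟩ := hH.superlinear 1
  refine ⟨max R B, fun z hz => ?_⟩
  change ‖z.2‖ ≤ max R B
  by_cases h : R ≤ ‖z.2‖
  · have : _ ≤ H z := hR z.1 z.2 h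
    exact le_max_of_le_right (by linarith)
  · exact le_max_of_le_left (not_le.1 h).le

lemma exists_linear_lower_bound (hH : IsTonelliHamiltonian n ⊤ H) (C : ℝ) :
    ∃ C', ∀ z, C * ‖z.2‖ - C' ≤ H z := by
  obtain ⟨R, hR⟩ := hH.superlinear C
  obtain ⟨M, hM0, hM⟩ := exists_norm_le_on_strip hH.smooth.continuous hH.periodic R
  refine ⟨M + |C| * |R|, fun z => ?_⟩
  by_cases h : R ≤ ‖z.2‖
  · have : _ ≤ H z := hR z.1 z.2 h
    have h2 : 0 ≤ |C| * |R| := by positivity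
    linarith
  · have h1 : ‖z.2‖ ≤ R := (not_le.1 h).le
    have h2 := abs_le.1 (hM z h1)
    have h3 : C * ‖z.2‖ ≤ |C| * |R| := by
      gcongr
      · exact le_abs_self _
      · exact h1.trans (le_abs_self _)
    linarith [h2.1]

end IsTonelliHamiltonian

end Hamiltonian

lemma abs_omega0_le {n : ℕ} (u v : E n × E n) : |omega0 n u v| ≤ 2 * n * (‖u‖ * ‖v‖) := by
  rw [omega0_eq]
  have h1 := abs_dotProduct_le u.2 v.1
  have h2 := abs_dotProduct_le u.1 v.2
  have h3 : ‖u.2‖ * ‖v.1‖ ≤ ‖u‖ * ‖v‖ := by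
    gcongr
    exacts [norm_snd_le u, norm_fst_le v]
  have h4 : ‖u.1‖ * ‖v.2‖ ≤ ‖u‖ * ‖v‖ := by
    gcongr
    exacts [norm_fst_le u, norm_snd_le v]
  have hn : (0 : ℝ) ≤ n := n.cast_nonneg
  calc _ ≤ |u.2 ⬝ᵥ v.1| + |u.1 ⬝ᵥ v.2| := abs_sub _ _
    _ ≤ _ := by nlinarith

lemma hasDerivAt_omega0 {n : ℕ} {f g : ℝ → E n × E n} {f' g' : E n × E n} {t : ℝ}
    (hf : HasDerivAt f f' t) (hg : HasDerivAt g g' t) :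
    HasDerivAt (fun t => omega0 n (f t) (g t)) (omega0 n f' (g t) + omega0 n (f t) g') t := by
  have h1 : HasDerivAt (fun t => omega0 n (f t) (g t))
      ((∑ i, (f'.2 i * (g t).1 i + (f t).2 i * g'.1 i)) -
        ∑ i, (f'.1 i * (g t).2 i + (f t).1 i * g'.2 i)) t := by
    simp only [omega0, dotP]
    exact (HasDerivAt.fun_sum fun i _ =>
        (hasDerivAt_pi.1 hf.snd i).fun_mul (hasDerivAt_pi.1 hg.fst i)).fun_sub
      (HasDerivAt.fun_sum fun i _ =>
        (hasDerivAt_pi.1 hf.fst i).fun_mul (hasDerivAt_pi.1 hg.snd i))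
  refine h1.congr_deriv ?_
  simp only [omega0, dotP, Finset.sum_add_distrib]
  ring

lemma omega0_smul_smul {n : ℕ} (a b : ℝ) (u v : E n × E n) :
    omega0 n (a • u) (b • v) = a * b * omega0 n u v := by
  simp [omega0_eq]
  ring

lemma omega0_add_left {n : ℕ} (u u' v : E n × E n) :
    omega0 n (u + u') v = omega0 n u v + omega0 n u' v := by
  simp [omega0_eq]
  ring

lemma omega0_add_right {n : ℕ} (u v v' : E n × E n) :
    omega0 n u (v + v') = omega0 n u v + omega0 n u v' := by
  simp [omega0_eq]
  ring

lemma continuous_omega0 {n : ℕ} :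
    Continuous fun p : (E n × E n) × (E n × E n) => omega0 n p.1 p.2 := by
  simp only [omega0, dotP]
  fun_prop

section Flow

variable {n : ℕ} {H : E n × E n → ℝ} {φ : ℝ → E n × E n → E n × E n}

namespace IsTonelliHamiltonian

lemma energy_const (hH : IsTonelliHamiltonian n ⊤ H) {f : ℝ → E n × E n}
    (hf : ∀ t, HasDerivAt f (hamVF n H (f t)) t) (t : ℝ) : H (f t) = H (f 0) := by
  have h : ∀ t, HasDerivAt (fun t => H (f t)) 0 t := fun t => by
    refine ((hH.differentiable (f t)).hasFDerivAt.comp_hasDerivAt t (hf t)).congr_deriv ?_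
    have := omega0_hamVF hH.differentiable (f t) (hamVF n H (f t))
    rw [omega0_eq, dotProduct_comm, sub_self] at this
    linarith
  exact is_const_of_deriv_eq_zero (fun t => (h t).differentiableAt) (fun t => (h t).deriv) _ _

lemma exists_strip_invariant (hH : IsTonelliHamiltonian n ⊤ H) (R : ℝ) :
    ∃ R', ∀ f : ℝ → E n × E n, (∀ t, HasDerivAt f (hamVF n H (f t)) t) → f 0 ∈ strip n R →
      ∀ t, f t ∈ strip n R' := by
  obtain ⟨B, hB⟩ := hH.exists_le_of_mem_strip R
  obtain ⟨R', hR'⟩ := hH.exists_mem_strip_of_le B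
  exact ⟨R', fun f hf h0 t => hR' _ ((hH.energy_const hf t).trans_le (hB _ h0))⟩

lemma exists_norm_fderiv_hamVF_le (hH : IsTonelliHamiltonian n ⊤ H) (R : ℝ) :
    ∃ K : ℝ≥0, ∀ z ∈ strip n R, ‖fderiv ℝ (hamVF n H) z‖ ≤ K := by
  obtain ⟨M, hM0, hM⟩ := exists_norm_le_on_strip
    (hH.contDiff_hamVF.continuous_fderiv two_ne_zero) (fderiv_periodic hH.hamVF_periodic) R
  exact ⟨⟨M, hM0⟩, hM⟩

lemma exists_lipschitzOnWith_hamVF (hH : IsTonelliHamiltonian n ⊤ H) (R : ℝ) :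
    ∃ K : ℝ≥0, LipschitzOnWith K (hamVF n H) (strip n R) := by
  obtain ⟨K, hK⟩ := hH.exists_norm_fderiv_hamVF_le R
  exact ⟨K, (convex_strip R).lipschitzOnWith_of_nnnorm_fderiv_le
    (fun z _ => hH.contDiff_hamVF.differentiable two_ne_zero z) hK⟩

lemma eq_of_integralCurve (hH : IsTonelliHamiltonian n ⊤ H) {f g : ℝ → E n × E n}
    (hf : ∀ t, HasDerivAt f (hamVF n H (f t)) t) (hg : ∀ t, HasDerivAt g (hamVF n H (g t)) t)
    (h0 : f 0 = g 0) : f = g := by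
  obtain ⟨R', hR'⟩ := hH.exists_strip_invariant ‖(f 0).2‖
  obtain ⟨K, hK⟩ := hH.exists_lipschitzOnWith_hamVF R'
  have hfs := hR' f hf (show ‖(f 0).2‖ ≤ _ from le_rfl)
  have hgs := hR' g hg (by rw [← h0]; exact (show ‖(f 0).2‖ ≤ _ from le_rfl))
  exact ODE_solution_unique_univ (v := fun _ => hamVF n H) (s := fun _ => strip n R')
    (fun _ => hK) (fun t => ⟨hf t, hfs t⟩) (fun t => ⟨hg t, hgs t⟩) h0

end IsTonelliHamiltonian

namespace IsHamFlow

lemma exists_strip (hφ : IsHamFlow n H φ) (hH : IsTonelliHamiltonian n ⊤ H) (R : ℝ) :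
    ∃ R', ∀ z ∈ strip n R, ∀ t, φ t z ∈ strip n R' := by
  obtain ⟨R', hR'⟩ := hH.exists_strip_invariant R
  exact ⟨R', fun z hz => hR' _ (hφ.2 z) (by rwa [hφ.1])⟩

lemma add (hφ : IsHamFlow n H φ) (hH : IsTonelliHamiltonian n ⊤ H) (s t : ℝ) (z : E n × E n) :
    φ (s + t) z = φ s (φ t z) := by
  refine congrFun (hH.eq_of_integralCurve (f := fun s => φ (s + t) z)
    (g := fun s => φ s (φ t z)) (fun s => ?_) (hφ.2 _) (by simp [hφ.1])) s
  exact (hφ.2 z (s + t)).comp_add_const s t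

lemma neg_apply_apply (hφ : IsHamFlow n H φ) (hH : IsTonelliHamiltonian n ⊤ H) (t : ℝ)
    (z : E n × E n) : φ (-t) (φ t z) = z := by
  rw [← hφ.add hH, neg_add_cancel, hφ.1]

lemma apply_neg_apply (hφ : IsHamFlow n H φ) (hH : IsTonelliHamiltonian n ⊤ H) (t : ℝ)
    (z : E n × E n) : φ t (φ (-t) z) = z := by
  rw [← hφ.add hH, add_neg_cancel, hφ.1]

lemma add_intVec (hφ : IsHamFlow n H φ) (hH : IsTonelliHamiltonian n ⊤ H) (t : ℝ)
    (x p : E n) (m : Fin n → ℤ) : φ t (x + intVec m, p) = φ t (x, p) + (intVec m, 0) := by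
  refine congrFun (hH.eq_of_integralCurve (f := fun t => φ t (x + intVec m, p))
    (g := fun t => φ t (x, p) + (intVec m, 0)) (hφ.2 _) (fun t => ?_) (by simp [hφ.1])) t
  refine ((hφ.2 (x, p) t).add_const _).congr_deriv ?_
  have := hH.hamVF_periodic (φ t (x, p)).1 (φ t (x, p)).2 m
  rw [show φ t (x, p) + (intVec m, 0) = ((φ t (x, p)).1 + intVec m, (φ t (x, p)).2) by
    ext <;> simp, this]

lemma exists_lipschitz (hφ : IsHamFlow n H φ) (hH : IsTonelliHamiltonian n ⊤ H) (R t : ℝ) :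
    ∃ C, 0 ≤ C ∧ ∀ z ∈ strip n R, ∀ z' ∈ strip n R, ∀ s ∈ Set.Icc 0 t,
      ‖φ s z' - φ s z‖ ≤ C * ‖z' - z‖ := by
  obtain ⟨R', hR'⟩ := hφ.exists_strip hH R
  obtain ⟨K, hK⟩ := hH.exists_lipschitzOnWith_hamVF R'
  refine ⟨Real.exp (K * t), (Real.exp_pos _).le, fun z hz z' hz' s hs => ?_⟩
  have hc : ∀ z, ContinuousOn (fun s => φ s z) (Set.Icc 0 t) := fun z s _ =>
    (hφ.2 z s).continuousAt.continuousWithinAt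
  have := dist_le_of_trajectories_ODE_of_mem (v := fun _ => hamVF n H) (s := fun _ => strip n R')
    (f := fun s => φ s z') (g := fun s => φ s z) (a := 0) (b := t) (δ := ‖z' - z‖)
    (fun _ _ => hK) (hc z') (fun s _ => (hφ.2 z' s).hasDerivWithinAt) (fun s _ => hR' z' hz' s)
    (hc z) (fun s _ => (hφ.2 z s).hasDerivWithinAt) (fun s _ => hR' z hz s)
    (by simp [hφ.1, dist_eq_norm]) s hs
  rw [dist_eq_norm, sub_zero, mul_comm] at this
  refine this.trans ?_
  gcongr
  exact hs.2

lemma continuous (hφ : IsHamFlow n H φ) (hH : IsTonelliHamiltonian n ⊤ H) {t : ℝ} (ht : 0 ≤ t) :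
    Continuous (φ t) := by
  rw [continuous_iff_continuousAt]
  intro z
  obtain ⟨C, hC0, hC⟩ := hφ.exists_lipschitz hH (‖z.2‖ + 1) t
  have h1 : ∀ᶠ z' in 𝓝 z, z' ∈ strip n (‖z.2‖ + 1) :=
    (continuous_snd.norm.continuousAt.eventually_lt continuousAt_const
      (show ‖z.2‖ < ‖z.2‖ + 1 by linarith)).mono fun z' h => le_of_lt h
  refine tendsto_iff_norm_sub_tendsto_zero.2 (squeeze_zero' (.of_forall fun _ => norm_nonneg _)
    (h1.mono fun z' hz' => hC z (show ‖z.2‖ ≤ ‖z.2‖ + 1 by linarith) z' hz' t ⟨ht, le_rfl⟩) ?_)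
  have : Tendsto (fun z' => C * ‖z' - z‖) (𝓝 z) (𝓝 (C * ‖z - z‖)) := by
    apply Continuous.tendsto; fun_prop
  simpa using this

/-- The difference quotients of the flow approximately solve the linearized equation. -/
lemma exists_linearized_bounds (hφ : IsHamFlow n H φ) (hH : IsTonelliHamiltonian n ⊤ H) (R t : ℝ) :
    ∃ (C : ℝ) (K : ℝ≥0), 0 ≤ C ∧ ∀ z ∈ strip n R,
      (∀ s, ‖fderiv ℝ (hamVF n H) (φ s z)‖ ≤ K) ∧
      ∀ w : E n × E n, ‖w‖ ≤ 1 → ∀ ε ∈ Set.Ioc (0 : ℝ) 1, ∃ Δ' : ℝ → E n × E n,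
        ∀ s ∈ Set.Icc 0 t,
          HasDerivAt (fun s => ε⁻¹ • (φ s (z + ε • w) - φ s z)) (Δ' s) s ∧
          ‖Δ' s - fderiv ℝ (hamVF n H) (φ s z) (ε⁻¹ • (φ s (z + ε • w) - φ s z))‖
            ≤ C * ε * ‖w‖ ^ 2 ∧
          ‖ε⁻¹ • (φ s (z + ε • w) - φ s z)‖ ≤ C * ‖w‖ := by
  obtain ⟨R', hR'⟩ := hφ.exists_strip hH (R + 1)
  obtain ⟨K, hK⟩ := hH.exists_norm_fderiv_hamVF_le R'
  obtain ⟨C₁, hC₁0, hC₁⟩ := hφ.exists_lipschitz hH (R + 1) t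
  obtain ⟨C₂, hC₂0, hC₂⟩ := exists_quadratic_remainder_on_strip hH.contDiff_hamVF
    hH.hamVF_periodic R'
  refine ⟨max C₁ (C₂ * C₁ ^ 2), K, le_max_of_le_left hC₁0, fun z hz => ?_⟩
  have hz1 : z ∈ strip n (R + 1) := strip_mono (by linarith) hz
  refine ⟨fun s => hK _ (hR' z hz1 s), fun w hw ε hε => ?_⟩
  have hzw : z + ε • w ∈ strip n (R + 1) := by
    change ‖z.2 + ε • w.2‖ ≤ R + 1
    have h1 : ‖z.2‖ ≤ R := hz
    have h2 : ‖ε • w.2‖ ≤ 1 := by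
      rw [norm_smul, Real.norm_of_nonneg hε.1.le]
      exact mul_le_one₀ hε.2 (norm_nonneg _) ((norm_snd_le w).trans hw)
    exact (norm_add_le _ _).trans (add_le_add h1 h2)
  refine ⟨fun s => ε⁻¹ • (hamVF n H (φ s (z + ε • w)) - hamVF n H (φ s z)), fun s hs => ?_⟩
  have hlip := hC₁ z hz1 _ hzw s hs
  rw [add_sub_cancel_left, norm_smul, Real.norm_of_nonneg hε.1.le] at hlip
  refine ⟨((hφ.2 _ s).fun_sub (hφ.2 z s)).fun_const_smul _, ?_, ?_⟩
  · rw [map_smul, ← smul_sub, norm_smul, norm_inv, Real.norm_of_nonneg hε.1.le,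
      inv_mul_le_iff₀ hε.1]
    calc _ ≤ C₂ * ‖φ s (z + ε • w) - φ s z‖ ^ 2 := hC₂ _ (hR' z hz1 s) _ (hR' _ hzw s)
      _ ≤ C₂ * (C₁ * (ε * ‖w‖)) ^ 2 := by gcongr
      _ = ε * ((C₂ * C₁ ^ 2) * ε * ‖w‖ ^ 2) := by ring
      _ ≤ _ := by
        have := hε.1.le
        gcongr
        exact le_max_right _ _
  · rw [norm_smul, norm_inv, Real.norm_of_nonneg hε.1.le, inv_mul_le_iff₀ hε.1]
    calc _ ≤ C₁ * (ε * ‖w‖) := hlip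
      _ = ε * (C₁ * ‖w‖) := by ring
      _ ≤ _ := by
        have := hε.1.le
        gcongr
        exact le_max_left _ _

lemma tendsto_diffQuot {z : E n × E n} {t : ℝ} (hd : DifferentiableAt ℝ (φ t) z) (w : E n × E n) :
    Tendsto (fun ε : ℝ => ε⁻¹ • (φ t (z + ε • w) - φ t z)) (𝓝[>] 0)
      (𝓝 (fderiv ℝ (φ t) z w)) :=
  (hd.hasFDerivAt.hasLineDerivAt w).tendsto_slope_zero_right

lemma differentiableAt (hnc : NoConjugatePoints n φ) (hn : 1 ≤ n) {t : ℝ} (ht : t ≠ 0)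
    (z : E n × E n) : DifferentiableAt ℝ (φ t) z := by
  by_contra h
  have h2 := hnc z t ht (Pi.single ⟨0, hn⟩ 1) (by rw [fderiv_zero_of_not_differentiableAt h]; rfl)
  simpa using congrFun h2 ⟨0, hn⟩

lemma exists_quadratic_remainder (hφ : IsHamFlow n H φ) (hH : IsTonelliHamiltonian n ⊤ H)
    {t : ℝ} (ht : 0 ≤ t) (hd : Differentiable ℝ (φ t)) (R : ℝ) :
    ∃ C, 0 ≤ C ∧ ∀ z ∈ strip n R, ∀ w, ‖w‖ ≤ 1 →
      ‖φ t (z + w) - φ t z - fderiv ℝ (φ t) z w‖ ≤ C * ‖w‖ ^ 2 := by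
  obtain ⟨C, K, hC0, h⟩ := hφ.exists_linearized_bounds hH R t
  have hG : ∀ ε ≥ 0, gronwallBound 0 K ε t = gronwallBound 0 K 1 t * ε := by
    intro ε hε
    by_cases hK : (K : ℝ) = 0
    · simp [hK, gronwallBound_K0, mul_comm]
    · simp [gronwallBound_of_K_ne_0 hK]; ring
  have hG0 : 0 ≤ gronwallBound 0 K 1 t := by
    by_cases hK : (K : ℝ) = 0
    · simpa [hK, gronwallBound_K0] using ht
    · rw [gronwallBound_of_K_ne_0 hK]
      have : 1 ≤ Real.exp (K * t) := Real.one_le_exp (by positivity)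
      have h2 : 0 ≤ Real.exp (K * t) - 1 := by linarith
      positivity
  refine ⟨gronwallBound 0 K 1 t * (C + C), by positivity, fun z hz w hw => ?_⟩
  obtain ⟨hKz, hΔ⟩ := h z hz
  have key : ∀ ε ∈ Set.Ioc (0 : ℝ) 1,
      ‖φ t (z + w) - φ t z - ε⁻¹ • (φ t (z + ε • w) - φ t z)‖
        ≤ gronwallBound 0 K 1 t * (C + C) * ‖w‖ ^ 2 := by
    intro ε hε
    obtain ⟨f', hf'⟩ := hΔ w hw 1 ⟨one_pos, le_rfl⟩
    obtain ⟨g', hg'⟩ := hΔ w hw ε hε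
    have := dist_le_of_approx_trajectories_ODE (a := 0) (b := t) (K := K) (δ := 0)
      (v := fun s => fderiv ℝ (hamVF n H) (φ s z))
      (f := fun s => (1 : ℝ)⁻¹ • (φ s (z + (1 : ℝ) • w) - φ s z)) (f' := f')
      (g := fun s => ε⁻¹ • (φ s (z + ε • w) - φ s z)) (g' := g')
      (εf := C * ‖w‖ ^ 2) (εg := C * ‖w‖ ^ 2)
      (fun s => (fderiv ℝ (hamVF n H) (φ s z)).lipschitz.weaken (hKz s))
      (fun s hs => (hf' s hs).1.continuousAt.continuousWithinAt)
      (fun s hs => (hf' s (Set.Ico_subset_Icc_self hs)).1.hasDerivWithinAt)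
      (fun s hs => by
        rw [dist_eq_norm]
        simpa using (hf' s (Set.Ico_subset_Icc_self hs)).2.1)
      (fun s hs => (hg' s hs).1.continuousAt.continuousWithinAt)
      (fun s hs => (hg' s (Set.Ico_subset_Icc_self hs)).1.hasDerivWithinAt)
      (fun s hs => by
        rw [dist_eq_norm]
        refine (hg' s (Set.Ico_subset_Icc_self hs)).2.1.trans ?_
        have := hε.2
        gcongr
        nlinarith)
      (by simp [hφ.1, smul_smul, inv_mul_cancel₀ hε.1.ne']) t ⟨ht, le_rfl⟩
    rw [sub_zero, hG _ (by positivity), dist_eq_norm] at this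
    simp only [inv_one, one_smul] at this
    refine this.trans (le_of_eq (by ring))
  refine le_of_tendsto ((tendsto_const_nhds.sub (tendsto_diffQuot (hd z) w)).norm) ?_
  filter_upwards [Ioc_mem_nhdsGT (zero_lt_one' ℝ)] with ε hε using key ε hε

lemma symplectic (hφ : IsHamFlow n H φ) (hH : IsTonelliHamiltonian n ⊤ H)
    {t : ℝ} (ht : 0 ≤ t) (hd : Differentiable ℝ (φ t)) (z u v : E n × E n) :
    omega0 n (fderiv ℝ (φ t) z u) (fderiv ℝ (φ t) z v) = omega0 n u v := by
  suffices key : ∀ u v : E n × E n, ‖u‖ ≤ 1 → ‖v‖ ≤ 1 →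
      omega0 n (fderiv ℝ (φ t) z u) (fderiv ℝ (φ t) z v) = omega0 n u v by
    have hr : ∀ u : E n × E n, ‖(‖u‖ + 1)⁻¹ • u‖ ≤ 1 := by
      intro u
      have : 0 < ‖u‖ + 1 := by positivity
      rw [norm_smul, norm_inv, Real.norm_of_nonneg this.le, inv_mul_le_iff₀ this]
      linarith
    have e := key _ _ (hr u) (hr v)
    rw [map_smul, map_smul, omega0_smul_smul, omega0_smul_smul] at e
    exact mul_left_cancel₀ (by positivity) e
  intro u v hu hv
  obtain ⟨C, K, hC0, h⟩ := hφ.exists_linearized_bounds hH ‖z.2‖ t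
  obtain ⟨-, hΔ⟩ := h z (show ‖z.2‖ ≤ _ from le_rfl)
  have hbd : ∀ ε ∈ Set.Ioc (0 : ℝ) 1,
      |omega0 n (ε⁻¹ • (φ t (z + ε • u) - φ t z)) (ε⁻¹ • (φ t (z + ε • v) - φ t z))
        - omega0 n u v| ≤ 4 * n * C ^ 2 * t * ε := by
    intro ε hε
    obtain ⟨f', hf'⟩ := hΔ u hu ε hε
    obtain ⟨g', hg'⟩ := hΔ v hv ε hε
    have := norm_image_sub_le_of_norm_deriv_le_segment' (a := 0) (b := t)
      (f := fun s => omega0 n (ε⁻¹ • (φ s (z + ε • u) - φ s z)) (ε⁻¹ • (φ s (z + ε • v) - φ s z)))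
      (C := 4 * n * C ^ 2 * ε)
      (fun s hs => (hasDerivAt_omega0 (hf' s hs).1 (hg' s hs).1).hasDerivWithinAt)
      (fun s hs => ?_) t ⟨ht, le_rfl⟩
    · simp only [hφ.1, add_sub_cancel_left, smul_smul, inv_mul_cancel₀ hε.1.ne', one_smul] at this
      rw [← Real.norm_eq_abs]
      exact this.trans (le_of_eq (by ring))
    · obtain ⟨-, hf1, hf2⟩ := hf' s (Set.Ico_subset_Icc_self hs)
      obtain ⟨-, hg1, hg2⟩ := hg' s (Set.Ico_subset_Icc_self hs)
      set Δu := ε⁻¹ • (φ s (z + ε • u) - φ s z)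
      set Δv := ε⁻¹ • (φ s (z + ε • v) - φ s z)
      set L := fderiv ℝ (hamVF n H) (φ s z)
      have hε0 := hε.1.le
      have e1 : omega0 n (f' s) Δv + omega0 n Δu (g' s) =
          omega0 n (f' s - L Δu) Δv + omega0 n Δu (g' s - L Δv) := by
        have h0 := hH.omega0_fderiv_hamVF (φ s z) Δu Δv
        have h1 := omega0_add_left (f' s - L Δu) (L Δu) Δv
        have h2 := omega0_add_right Δu (g' s - L Δv) (L Δv)
        rw [sub_add_cancel] at h1 h2
        linarith
      have hu2 : ‖u‖ ^ 2 ≤ 1 := pow_le_one₀ (norm_nonneg _) hu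
      have hv2 : ‖v‖ ^ 2 ≤ 1 := pow_le_one₀ (norm_nonneg _) hv
      have a1 : ‖f' s - L Δu‖ ≤ C * ε := hf1.trans (mul_le_of_le_one_right (by positivity) hu2)
      have a2 : ‖g' s - L Δv‖ ≤ C * ε := hg1.trans (mul_le_of_le_one_right (by positivity) hv2)
      have a3 : ‖Δu‖ ≤ C := hf2.trans (mul_le_of_le_one_right hC0 hu)
      have a4 : ‖Δv‖ ≤ C := hg2.trans (mul_le_of_le_one_right hC0 hv)
      rw [e1, Real.norm_eq_abs]
      calc _ ≤ _ := abs_add_le _ _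
        _ ≤ 2 * n * (‖f' s - L Δu‖ * ‖Δv‖) + 2 * n * (‖Δu‖ * ‖g' s - L Δv‖) :=
          add_le_add (abs_omega0_le _ _) (abs_omega0_le _ _)
        _ ≤ 2 * n * ((C * ε) * C) + 2 * n * (C * (C * ε)) := by gcongr
        _ = 4 * n * C ^ 2 * ε := by ring
  have hlim : Tendsto (fun ε : ℝ => |omega0 n (ε⁻¹ • (φ t (z + ε • u) - φ t z))
      (ε⁻¹ • (φ t (z + ε • v) - φ t z)) - omega0 n u v|) (𝓝[>] 0)
      (𝓝 |omega0 n (fderiv ℝ (φ t) z u) (fderiv ℝ (φ t) z v) - omega0 n u v|) :=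
    (((continuous_omega0.tendsto (_, _)).comp
      ((tendsto_diffQuot (hd z) u).prodMk_nhds (tendsto_diffQuot (hd z) v))).sub_const _).abs
  have h0 : Tendsto (fun ε : ℝ => 4 * n * C ^ 2 * t * ε) (𝓝[>] 0) (𝓝 0) := by
    have : Tendsto (fun ε : ℝ => 4 * n * C ^ 2 * t * ε) (𝓝 0) (𝓝 (4 * n * C ^ 2 * t * 0)) :=
      Continuous.tendsto (by fun_prop) _
    rw [mul_zero] at this
    exact this.mono_left nhdsWithin_le_nhds
  have := le_of_tendsto_of_tendsto hlim h0 (by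
    filter_upwards [Ioc_mem_nhdsGT (zero_lt_one' ℝ)] with ε hε using hbd ε hε)
  exact sub_eq_zero.1 (abs_nonpos_iff.1 this)

end IsHamFlow

end Flow

lemma abs_det_eq_one_of_omega0 {n : ℕ} (M : (E n × E n) →L[ℝ] (E n × E n))
    (hM : ∀ u v, omega0 n (M u) (M v) = omega0 n u v) : |M.det| = 1 := by
  have hsm1 : ∀ (a : ℝ) (u v : E n × E n), omega0 n (a • u) v = a • omega0 n u v := fun a u v => by
    simp only [omega0_eq, Prod.smul_fst, Prod.smul_snd, smul_dotProduct, smul_eq_mul]; ring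
  have hsm2 : ∀ (a : ℝ) (u v : E n × E n), omega0 n u (a • v) = a • omega0 n u v := fun a u v => by
    simp only [omega0_eq, Prod.smul_fst, Prod.smul_snd, dotProduct_smul, smul_eq_mul]; ring
  let B : (E n × E n) →ₗ[ℝ] (E n × E n) →ₗ[ℝ] ℝ :=
    LinearMap.mk₂ ℝ (omega0 n) omega0_add_left hsm1 omega0_add_right hsm2
  have hBs : B.SeparatingLeft := by
    intro x hx
    have h : omega0 n x (x.2, -x.1) = 0 := hx _
    rw [omega0_eq, dotProduct_neg, sub_neg_eq_add] at h
    have h1 : 0 ≤ x.1 ⬝ᵥ x.1 := Finset.sum_nonneg fun i _ => mul_self_nonneg _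
    have h2 : 0 ≤ x.2 ⬝ᵥ x.2 := Finset.sum_nonneg fun i _ => mul_self_nonneg _
    exact Prod.ext (dotProduct_self_eq_zero.1 (by linarith))
      (dotProduct_self_eq_zero.1 (by linarith))
  let b := Module.finBasis ℝ (E n × E n)
  have hdet := (LinearMap.separatingLeft_iff_det_ne_zero b).1 hBs
  have hcomp : B.compl₁₂ (M : (E n × E n) →ₗ[ℝ] _) (M : (E n × E n) →ₗ[ℝ] _) = B := by
    exact LinearMap.ext₂ hM
  have e := congrArg Matrix.det (LinearMap.toMatrix₂_compl₁₂ b b b b B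
    (M : (E n × E n) →ₗ[ℝ] _) (M : (E n × E n) →ₗ[ℝ] _))
  rw [hcomp, Matrix.det_mul, Matrix.det_mul, Matrix.det_transpose, LinearMap.det_toMatrix] at e
  have e2 : M.det * M.det = 1 := by
    have : M.det = LinearMap.det (M : (E n × E n) →ₗ[ℝ] _) := rfl
    rw [this]
    apply mul_left_cancel₀ hdet
    linarith
  rcases mul_self_eq_one_iff.1 e2 with h | h <;> simp [h]

namespace IsHamFlow

variable {n : ℕ} {H : E n × E n → ℝ} {φ : ℝ → E n × E n → E n × E n}

lemma exists_norm_fderiv_le (hφ : IsHamFlow n H φ) (hH : IsTonelliHamiltonian n ⊤ H)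
    {t : ℝ} (ht : 0 ≤ t) (R : ℝ) : ∃ C, 0 ≤ C ∧ ∀ z ∈ strip n R, ‖fderiv ℝ (φ t) z‖ ≤ C := by
  obtain ⟨C, hC0, hC⟩ := hφ.exists_lipschitz hH (R + 1) t
  refine ⟨C, hC0, fun z hz => norm_fderiv_le_of_lip' ℝ hC0 ?_⟩
  have hz' : ‖z.2‖ < R + 1 := lt_of_le_of_lt (show ‖z.2‖ ≤ R from hz) (by linarith)
  filter_upwards [continuous_snd.norm.continuousAt.eventually_lt continuousAt_const hz'] with w hw
  exact hC z hz'.le w (le_of_lt hw) t ⟨ht, le_rfl⟩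

lemma exists_lipschitz_fderiv (hφ : IsHamFlow n H φ) (hH : IsTonelliHamiltonian n ⊤ H)
    {t : ℝ} (ht : 0 ≤ t) (hd : Differentiable ℝ (φ t)) (R : ℝ) :
    ∃ C, 0 ≤ C ∧ ∀ z ∈ strip n R, ∀ z' ∈ strip n R,
      ‖fderiv ℝ (φ t) z' - fderiv ℝ (φ t) z‖ ≤ C * ‖z' - z‖ := by
  obtain ⟨M, hM0, hM⟩ := hφ.exists_norm_fderiv_le hH ht R
  obtain ⟨C, hC0, hC⟩ := hφ.exists_quadratic_remainder hH ht hd R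
  refine ⟨6 * C + 4 * M, by positivity, fun z hz z' hz' => ?_⟩
  set h := ‖z' - z‖ with hh
  have hh0 : 0 ≤ h := norm_nonneg _
  rcases le_or_gt h (1 / 2) with h1 | h1
  · refine ContinuousLinearMap.opNorm_le_bound _ (by positivity) fun v => ?_
    rcases hh0.eq_or_lt with h0 | h0
    · have : z' = z := sub_eq_zero.1 (norm_eq_zero.1 (by rw [← hh, ← h0]))
      simp [this, ← h0]
    rcases eq_or_ne v 0 with rfl | hv
    · simp
    have hv0 : 0 < ‖v‖ := norm_pos_iff.2 hv
    have key : ∀ v : E n × E n, ‖v‖ = h →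
        ‖(fderiv ℝ (φ t) z' - fderiv ℝ (φ t) z) v‖ ≤ 6 * C * h ^ 2 := by
      intro v hv
      have a1 := hC z' hz' v (by linarith)
      have n2 : ‖(z' - z) + v‖ ≤ 2 * h := (norm_add_le _ _).trans (by linarith)
      have a2 := hC z hz ((z' - z) + v) (by linarith)
      have a3 := hC z hz (z' - z) (by linarith)
      rw [show z + (z' - z + v) = z' + v by abel, map_add] at a2
      rw [show z + (z' - z) = z' by abel] at a3
      rw [hv] at a1
      have e : (fderiv ℝ (φ t) z' - fderiv ℝ (φ t) z) v =
          (φ t (z' + v) - φ t z - (fderiv ℝ (φ t) z (z' - z) + fderiv ℝ (φ t) z v))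
          - (φ t (z' + v) - φ t z' - fderiv ℝ (φ t) z' v)
          - (φ t z' - φ t z - fderiv ℝ (φ t) z (z' - z)) := by
        rw [_root_.sub_apply]; abel
      have a4 : C * ‖z' - z + v‖ ^ 2 ≤ C * (2 * h) ^ 2 := by gcongr
      rw [e]
      refine (norm_sub_le _ _).trans ((add_le_add_left (norm_sub_le _ _) _).trans ?_)
      nlinarith
    have k := key ((h / ‖v‖) • v) (by
      rw [norm_smul, Real.norm_of_nonneg (by positivity)]; field_simp)
    rw [map_smul, norm_smul, Real.norm_of_nonneg (by positivity), div_mul_eq_mul_div,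
      div_le_iff₀ hv0] at k
    have : ‖(fderiv ℝ (φ t) z' - fderiv ℝ (φ t) z) v‖ ≤ 6 * C * h * ‖v‖ := by
      refine le_of_mul_le_mul_left (k.trans (le_of_eq ?_)) h0
      ring
    refine this.trans ?_
    gcongr
    linarith
  · have := (norm_sub_le (fderiv ℝ (φ t) z') (fderiv ℝ (φ t) z)).trans
      (add_le_add (hM z' hz') (hM z hz))
    nlinarith

lemma injective (hφ : IsHamFlow n H φ) (hH : IsTonelliHamiltonian n ⊤ H) (t : ℝ) :
    Function.Injective (φ t) :=
  Function.LeftInverse.injective (g := φ (-t)) fun z => hφ.neg_apply_apply hH t z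

lemma measurePreserving (hφ : IsHamFlow n H φ) (hH : IsTonelliHamiltonian n ⊤ H)
    {t : ℝ} (ht : 0 ≤ t) (hd : Differentiable ℝ (φ t)) :
    MeasurePreserving (φ t) volume volume := by
  refine ⟨(hφ.continuous hH ht).measurable, Measure.ext fun s hs => ?_⟩
  rw [Measure.map_apply (hφ.continuous hH ht).measurable hs]
  have hs' := (hφ.continuous hH ht).measurable hs
  have : (volume : Measure (E n)).IsAddHaarMeasure := isAddHaarMeasure_volume_pi _
  have : (volume : Measure (E n × E n)).IsAddHaarMeasure :=
    Measure.prod.instIsAddHaarMeasure _ _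
  have h := lintegral_abs_det_fderiv_eq_addHaar_image (volume : Measure (E n × E n)) hs'
    (fun x _ => (hd x).hasFDerivAt.hasFDerivWithinAt) (hφ.injective hH t).injOn
  rw [Set.image_preimage_eq _ fun z => ⟨φ (-t) z, hφ.apply_neg_apply hH t z⟩] at h
  rw [← h]
  simp [abs_det_eq_one_of_omega0 _ (hφ.symplectic hH ht hd _)]

end IsHamFlow

lemma eq_of_lipschitz_of_ae_hasFDerivAt_zero {n : ℕ} {f : E n → ℝ} {K : ℝ≥0}
    (hf : LipschitzWith K f) (h : ∀ᵐ z, HasFDerivAt f (0 : E n →L[ℝ] ℝ) z) (x y : E n) :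
    f x = f y := by
  set v := x - y with hv
  obtain ⟨S, hS, hSm, hS0⟩ := exists_measurable_superset_of_null (ae_iff.1 h)
  have hSd : ∀ z ∉ S, HasFDerivAt f (0 : E n →L[ℝ] ℝ) z := fun z hz => by
    by_contra h; exact hz (hS h)
  have hm : Measurable fun q : ℝ × E n => y + q.2 + q.1 • v :=
    (by fun_prop : Continuous fun q : ℝ × E n => y + q.2 + q.1 • v).measurable
  have h1 : ∀ᵐ t : ℝ, ∀ᵐ w : E n, y + w + t • v ∉ S := by
    refine .of_forall fun t => ?_
    have : ∀ᵐ w : E n, w + (y + t • v) ∉ S :=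
      (measurePreserving_add_right volume (y + t • v)).quasiMeasurePreserving.ae
        (measure_eq_zero_iff_ae_notMem.1 hS0)
    filter_upwards [this] with w hw
    rwa [show y + w + t • v = w + (y + t • v) by abel]
  have h2 := (Measure.ae_ae_comm (p := fun (t : ℝ) (w : E n) => y + w + t • v ∉ S)
    (hm hSm).compl).1 h1
  have h3 : ∀ᵐ w : E n, f (x + w) = f (y + w) := by
    filter_upwards [h2] with w hw
    have hl : LipschitzWith (K * ‖v‖₊) fun t : ℝ => f (y + w + t • v) := by
      refine hf.comp (LipschitzWith.of_dist_le_mul fun s t => ?_)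
      simp [dist_eq_norm, ← sub_smul, norm_smul, mul_comm]
    have hac : AbsolutelyContinuousOnInterval (fun t : ℝ => f (y + w + t • v)) 0 1 :=
      (hl.lipschitzOnWith (s := Set.uIcc 0 1)).absolutelyContinuousOnInterval
    have e := hac.integral_deriv_eq_sub
    have hd : ∀ᵐ t : ℝ, deriv (fun t : ℝ => f (y + w + t • v)) t = 0 := by
      filter_upwards [hw] with t ht
      have hline : HasDerivAt (fun t : ℝ => y + w + t • v) v t := by
        simpa using ((hasDerivAt_id t).smul_const v).const_add (y + w)
      have := (hSd _ ht).comp_hasDerivAt t hline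
      exact this.deriv
    rw [intervalIntegral.integral_congr_ae (g := fun _ => 0)
      (hd.mono fun t ht _ => ht)] at e
    simp only [intervalIntegral.integral_zero, one_smul, zero_smul, add_zero] at e
    rw [show y + w + v = x + w by rw [hv]; abel] at e
    linarith
  have := Continuous.ext_on (Measure.dense_of_ae h3) (by have := hf.continuous; fun_prop)
    (by have := hf.continuous; fun_prop)
    (fun w (hw : f (x + w) = f (y + w)) => hw)
  simpa using congrFun this 0

lemma hasFDerivAt_dotProductBilin {n : ℕ} {f : E n → ℝ} {f' : E n →L[ℝ] ℝ} {x v : E n}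
    (h : HasFDerivAt f f' x) (hv : ∀ w, f' w = v ⬝ᵥ w) :
    HasFDerivAt f (dotProductBilin ℝ ℝ v).toContinuousLinearMap x := by
  convert h using 1
  ext w
  simp [hv]

namespace IsTonelliHamiltonian

variable {n : ℕ} {H : E n × E n → ℝ}

lemma continuous_gradP (hH : IsTonelliHamiltonian n ⊤ H) :
    Continuous fun z : E n × E n => gradP n H z.1 z.2 :=
  continuous_fst.comp hH.contDiff_hamVF.continuous

lemma gradP_periodic (hH : IsTonelliHamiltonian n ⊤ H) (x p : E n) (m : Fin n → ℤ) :
    gradP n H (x + intVec m) p = gradP n H x p :=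
  congrArg Prod.fst (hH.hamVF_periodic x p m)

lemma convex_gap (hH : IsTonelliHamiltonian n ⊤ H) (x : E n) {p q : E n} (hpq : p ≠ q) :
    0 < H (x, q) - H (x, p) - gradP n H x p ⬝ᵥ (q - p) := by
  have hpq' : q - p ≠ 0 := sub_ne_zero.2 hpq.symm
  set w := q - p with hw
  have hs : ContDiff ℝ 2 fun p' => H (x, p') :=
    (hH.contDiff 2).comp (contDiff_const.prodMk contDiff_id)
  have hs' : ContDiff ℝ 1 fun p' => fderiv ℝ (fun p'' => H (x, p'')) p' w :=
    (hs.fderiv_right (by norm_num)).clm_apply contDiff_const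
  have hline : ∀ θ : ℝ, HasDerivAt (fun θ : ℝ => p + θ • w) w θ := fun θ => by
    simpa using ((hasDerivAt_id θ).smul_const w).const_add p
  have h1 : ∀ θ : ℝ, HasDerivAt (fun θ : ℝ => H (x, p + θ • w))
      (fderiv ℝ (fun p'' => H (x, p'')) (p + θ • w) w) θ := fun θ =>
    (hs.differentiable two_ne_zero _).hasFDerivAt.comp_hasDerivAt θ (hline θ)
  have h2 : ∀ θ : ℝ, HasDerivAt
      (fun θ : ℝ => fderiv ℝ (fun p'' => H (x, p'')) (p + θ • w) w)
      (fderiv ℝ (fun p' => fderiv ℝ (fun p'' => H (x, p'')) p' w) (p + θ • w) w) θ := fun θ =>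
    (hs'.differentiable one_ne_zero _).hasFDerivAt.comp_hasDerivAt θ (hline θ)
  have hmono : StrictMono fun θ : ℝ => fderiv ℝ (fun p'' => H (x, p'')) (p + θ • w) w :=
    strictMono_of_hasDerivAt_pos h2 fun θ => hH.posdef x _ w hpq'
  obtain ⟨ξ, hξ, e⟩ := exists_hasDerivAt_eq_slope (fun θ : ℝ => H (x, p + θ • w)) _ one_pos
    (fun θ _ => (h1 θ).continuousAt.continuousWithinAt) fun θ _ => h1 θ
  have h0 := hmono hξ.1
  simp only [zero_smul, add_zero, one_smul, sub_zero, div_one] at h0 e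
  rw [show p + w = q by rw [hw]; abel] at e
  have : fderiv ℝ (fun p'' => H (x, p'')) p w = gradP n H x p ⬝ᵥ w := clm_apply_eq_sum _ w
  linarith

end IsTonelliHamiltonian

/-- A continuous foliation of `T*𝕋ⁿ` by Lipschitz Lagrangian graphs invariant under the flow of
a Tonelli Hamiltonian without conjugate points. -/
structure Foliation (n : ℕ) (H : E n × E n → ℝ) (φ : ℝ → E n × E n → E n × E n)
    (F : E n × E n → E n) : Prop where
  one_le : 1 ≤ n
  tonelli : IsTonelliHamiltonian n ⊤ H
  flow : IsHamFlow n H φ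
  noConj : NoConjugatePoints n φ
  cont : Continuous F
  per : ∀ (x c : E n) (m : Fin n → ℤ), F (x + intVec m, c) = F (x, c)
  lag : ∀ c : E n,
    (∃ K : ℝ≥0, LipschitzWith K fun x => F (x, c)) ∧
    ∃ u : E n → ℝ, ContDiff ℝ 1 u ∧
      (∀ (x : E n) (m : Fin n → ℤ), u (x + intVec m) = u x) ∧
      ∀ x : E n, F (x, c) = c + gradF n u x
  inv : ∀ (c : E n) (t : ℝ) (x : E n),
    (φ t (x, F (x, c))).2 = F ((φ t (x, F (x, c))).1, c)
  homeo : ∀ x : E n, ∃ h : E n ≃ₜ E n, ∀ c : E n, h c = F (x, c)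

namespace Foliation

variable {n : ℕ} {H : E n × E n → ℝ} {φ : ℝ → E n × E n → E n × E n} {F : E n × E n → E n}

/-- A primitive of the leaf `x ↦ F (x, c)`. -/
def S (h : Foliation n H φ F) (c x : E n) : ℝ := c ⬝ᵥ x + (h.lag c).2.choose x

lemma hasFDerivAt_S (h : Foliation n H φ F) (c x : E n) :
    HasFDerivAt (h.S c) (dotProductBilin ℝ ℝ (F (x, c))).toContinuousLinearMap x := by
  obtain ⟨hu, -, hF⟩ := (h.lag c).2.choose_spec
  refine hasFDerivAt_dotProductBilin
    (((dotProductBilin ℝ ℝ c).toContinuousLinearMap.hasFDerivAt).add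
    (hu.differentiable one_ne_zero x).hasFDerivAt) fun w => ?_
  rw [hF, add_dotProduct, _root_.add_apply, clm_apply_eq_sum (fderiv ℝ _ x) w]
  rfl

lemma S_add_intVec (h : Foliation n H φ F) (c x : E n) (m : Fin n → ℤ) :
    h.S c (x + intVec m) = h.S c x + c ⬝ᵥ intVec m := by
  obtain ⟨-, hu, -⟩ := (h.lag c).2.choose_spec
  rw [S, S, hu, dotProduct_add]
  ring

lemma cont_leaf (h : Foliation n H φ F) (c : E n) : Continuous fun x => F (x, c) :=
  h.cont.comp (by fun_prop)

lemma injective (h : Foliation n H φ F) (x : E n) {c c' : E n} (e : F (x, c) = F (x, c')) :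
    c = c' := by
  obtain ⟨k, hk⟩ := h.homeo x
  exact k.injective (by rw [hk, hk, e])

lemma surjective (h : Foliation n H φ F) (x p : E n) : ∃ c, F (x, c) = p := by
  obtain ⟨k, hk⟩ := h.homeo x
  exact ⟨k.symm p, by rw [← hk, k.apply_symm_apply]⟩

lemma isCompact_leaves (h : Foliation n H φ F) (x : E n) (R : ℝ) :
    IsCompact {c | ‖F (x, c)‖ ≤ R} := by
  obtain ⟨k, hk⟩ := h.homeo x
  have : {c | ‖F (x, c)‖ ≤ R} = k ⁻¹' Metric.closedBall 0 R := by
    ext c; simp [hk]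
  rw [this]
  exact k.isCompact_preimage.2 (isCompact_closedBall _ _)

lemma bound_compact (h : Foliation n H φ F) {K : Set (E n)} (hK : IsCompact K) :
    ∃ R, 0 ≤ R ∧ ∀ c ∈ K, ∀ x, ‖F (x, c)‖ ≤ R := by
  obtain ⟨R, hR⟩ := ((isCompact_Icc (a := (0 : E n)) (b := 1)).prod hK).exists_bound_of_continuousOn
    h.cont.continuousOn
  refine ⟨|R|, abs_nonneg _, fun c hc x => ?_⟩
  obtain ⟨m, hm⟩ := exists_intVec_sub_mem_Icc x
  have := hR (x - intVec m, c) ⟨hm, hc⟩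
  have e := h.per (x - intVec m) c m
  rw [sub_add_cancel] at e
  rw [e]
  exact this.trans (le_abs_self _)

/-- The flow on the leaf `c`, projected to the base. -/
def f (_ : Foliation n H φ F) (c : E n) (t : ℝ) (x : E n) : E n := (φ t (x, F (x, c))).1

lemma flow_eq (h : Foliation n H φ F) (c : E n) (t : ℝ) (x : E n) :
    φ t (x, F (x, c)) = (h.f c t x, F (h.f c t x, c)) := Prod.ext rfl (h.inv c t x)

lemma f_zero (h : Foliation n H φ F) (c x : E n) : h.f c 0 x = x := by
  simp [f, h.flow.1]

lemma f_add (h : Foliation n H φ F) (c : E n) (s t : ℝ) (x : E n) :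
    h.f c (s + t) x = h.f c s (h.f c t x) := by
  conv_lhs => rw [f, h.flow.add h.tonelli, h.flow_eq]
  rfl

lemma f_add_intVec (h : Foliation n H φ F) (c : E n) (t : ℝ) (x : E n) (m : Fin n → ℤ) :
    h.f c t (x + intVec m) = h.f c t x + intVec m := by
  rw [f, h.per, h.flow.add_intVec h.tonelli]
  rfl

lemma iterate_f (h : Foliation n H φ F) (c : E n) (t : ℝ) (k : ℕ) (x : E n) :
    (h.f c t)^[k] x = h.f c (k * t) x := by
  induction k generalizing x with
  | zero => simp [f_zero]
  | succ k ih =>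
    rw [Function.iterate_succ_apply', ih, ← h.f_add]
    push_cast
    ring_nf

lemma hasDerivAt_f (h : Foliation n H φ F) (c x : E n) (t : ℝ) :
    HasDerivAt (fun t => h.f c t x)
      (gradP n H (h.f c t x) (F (h.f c t x, c))) t := by
  have := h.flow.2 (x, F (x, c)) t
  rw [h.flow_eq] at this
  exact (hasFDerivAt_fst.comp_hasDerivAt t this)

lemma continuous_f (h : Foliation n H φ F) {t : ℝ} (ht : 0 ≤ t) :
    Continuous fun q : E n × E n => h.f q.1 t q.2 :=
  continuous_fst.comp ((h.flow.continuous h.tonelli ht).comp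
    (continuous_snd.prodMk (h.cont.comp (continuous_snd.prodMk continuous_fst))))

lemma energy_leaf (h : Foliation n H φ F) (c x y : E n) :
    H (x, F (x, c)) = H (y, F (y, c)) := by
  obtain ⟨K, hK⟩ := (h.lag c).1
  obtain ⟨R, hR0, hR⟩ := h.bound_compact (isCompact_singleton (x := c))
  have hR' : ∀ x, (x, F (x, c)) ∈ strip n R := fun x => hR c rfl x
  obtain ⟨M, hM0, hM⟩ := exists_norm_le_on_strip
    (((h.tonelli.contDiff 1).continuous_fderiv one_ne_zero))
    (fun x p m => fderiv_periodic h.tonelli.periodic x p m) R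
  have hHl : ∀ x y, ‖H (x, F (x, c)) - H (y, F (y, c))‖ ≤
      M * ‖(x, F (x, c)) - (y, F (y, c))‖ := fun x y =>
    (convex_strip R).norm_image_sub_le_of_norm_fderiv_le
      (fun z _ => h.tonelli.differentiable z) hM (hR' y) (hR' x)
  have hl : LipschitzWith (M.toNNReal * max 1 K) fun x => H (x, F (x, c)) := by
    refine LipschitzWith.of_dist_le_mul fun x y => ?_
    rw [dist_eq_norm]
    refine (hHl x y).trans ?_
    rw [NNReal.coe_mul, Real.coe_toNNReal _ hM0, mul_assoc]
    gcongr
    exact ((LipschitzWith.id.prodMk hK).dist_le_mul x y).trans_eq' (dist_eq_norm _ _)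
  refine eq_of_lipschitz_of_ae_hasFDerivAt_zero hl ?_ x y
  filter_upwards [hK.ae_differentiableAt] with z hz
  set N := fderiv ℝ (fun x => F (x, c)) z with hN
  have hz' : HasFDerivAt (fun x => F (x, c)) N z := hz.hasFDerivAt
  have hsymm : ∀ v w, N v ⬝ᵥ w = N w ⬝ᵥ v := by
    let J : E n →L[ℝ] E n →L[ℝ] ℝ := LinearMap.toContinuousLinearMap
      ((LinearMap.toContinuousLinearMap (𝕜 := ℝ) (E := E n) (F' := ℝ)).toLinearMap.comp
        (dotProductBilin ℝ ℝ))
    exact fun v w => second_derivative_symmetric (f := h.S c) (f' := fun x => J (F (x, c)))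
      (f'' := J.comp N) (fun y => h.hasFDerivAt_S c y) (J.hasFDerivAt.comp z hz') v w
  have hinv : -gradX n H z (F (z, c)) = N (gradP n H z (F (z, c))) := by
    have h1 := h.flow.2 (z, F (z, c)) 0
    have h2 : HasDerivAt (fun s => (φ s (z, F (z, c))).2) (-gradX n H z (F (z, c))) 0 := by
      have := hasFDerivAt_snd.comp_hasDerivAt (0 : ℝ) h1
      rw [h.flow.1] at this
      exact this
    have h3 := h.hasDerivAt_f c z 0
    rw [h.f_zero] at h3
    have h4 : HasDerivAt (fun s => F (h.f c s z, c)) (N (gradP n H z (F (z, c)))) 0 :=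
      HasFDerivAt.comp_hasDerivAt (l := fun x => F (x, c)) (f := fun s => h.f c s z) (0 : ℝ)
        (by rw [h.f_zero]; exact hz') h3
    have e : (fun s => (φ s (z, F (z, c))).2) = fun s => F (h.f c s z, c) :=
      funext fun s => h.inv c s z
    rw [e] at h2
    exact h2.unique h4
  have hG : HasFDerivAt (fun x => H (x, F (x, c)))
      ((fderiv ℝ H (z, F (z, c))).comp ((ContinuousLinearMap.id ℝ (E n)).prod N)) z :=
    HasFDerivAt.comp z (h.tonelli.differentiable _).hasFDerivAt ((hasFDerivAt_id z).prodMk hz')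
  convert hG using 1
  ext1 v
  have e := hsymm (gradP n H z (F (z, c))) v
  rw [← hinv, neg_dotProduct, dotProduct_comm (N v)] at e
  simp [fderiv_eq_grad h.tonelli.differentiable]
  linarith

end Foliation

lemma sub_le_mul_of_hasDerivAt_le {f f' : ℝ → ℝ} {C t : ℝ} (ht : 0 ≤ t)
    (hf : ∀ s, HasDerivAt f (f' s) s) (hC : ∀ s, f' s ≤ C) : f t - f 0 ≤ t * C := by
  have := image_sub_le_mul_sub_of_deriv_le (f := f) (fun s => (hf s).differentiableAt)
    (fun s => by rw [(hf s).deriv]; exact hC s) ht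
  linarith

namespace Foliation

variable {n : ℕ} {H : E n × E n → ℝ} {φ : ℝ → E n × E n → E n × E n} {F : E n × E n → E n}

/-- The energy of the leaf `c`. -/
def α (_ : Foliation n H φ F) (c : E n) : ℝ := H (0, F (0, c))

lemma energy_eq (h : Foliation n H φ F) (c x : E n) : H (x, F (x, c)) = h.α c :=
  h.energy_leaf c x 0

lemma continuous_α (h : Foliation n H φ F) : Continuous h.α :=
  h.tonelli.smooth.continuous.comp
    (continuous_const.prodMk (h.cont.comp (continuous_const.prodMk continuous_id)))

/-- The excess of the leaf `c'` over the leaf `c` at `x`. -/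
def exc (h : Foliation n H φ F) (c c' x : E n) : ℝ :=
  h.α c' - h.α c - gradP n H x (F (x, c)) ⬝ᵥ (F (x, c') - F (x, c))

lemma exc_pos (h : Foliation n H φ F) {c c' : E n} (hc : c ≠ c') (x : E n) : 0 < h.exc c c' x := by
  rw [exc, ← h.energy_eq c x, ← h.energy_eq c' x]
  exact h.tonelli.convex_gap x fun e => hc (h.injective x e)

lemma exc_nonneg (h : Foliation n H φ F) (c c' x : E n) : 0 ≤ h.exc c c' x := by
  rcases eq_or_ne c c' with rfl | hc
  · simp [exc]
  · exact (h.exc_pos hc x).le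

lemma continuous_exc (h : Foliation n H φ F) :
    Continuous fun q : E n × E n × E n => h.exc q.1 q.2.1 q.2.2 := by
  have h1 := h.continuous_α
  have h2 := h.cont
  have h3 : Continuous fun q : E n × E n × E n => gradP n H q.2.2 (F (q.2.2, q.1)) :=
    h.tonelli.continuous_gradP.comp
      (g := fun z : E n × E n => gradP n H z.1 z.2)
      (f := fun q : E n × E n × E n => (q.2.2, F (q.2.2, q.1))) (by fun_prop)
  unfold exc
  exact (by fun_prop : Continuous fun q : E n × E n × E n => h.α q.2.1 - h.α q.1).sub
    (h3.dotProduct (by fun_prop))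

lemma exc_periodic (h : Foliation n H φ F) (c c' x : E n) (m : Fin n → ℤ) :
    h.exc c c' (x + intVec m) = h.exc c c' x := by
  simp only [exc, h.per, h.tonelli.gradP_periodic]

/-- The difference of the primitives of two leaves. -/
def diff (h : Foliation n H φ F) (c c' x : E n) : ℝ := h.S c' x - h.S c x

lemma hasFDerivAt_diff (h : Foliation n H φ F) (c c' x : E n) :
    HasFDerivAt (h.diff c c')
      (dotProductBilin ℝ ℝ (F (x, c') - F (x, c))).toContinuousLinearMap x :=
  hasFDerivAt_dotProductBilin ((h.hasFDerivAt_S c' x).sub (h.hasFDerivAt_S c x)) fun w => by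
    rw [sub_dotProduct]; rfl

lemma diff_swap (h : Foliation n H φ F) (c c' x : E n) : h.diff c' c x = -h.diff c c' x := by
  simp [diff]

lemma diff_add_intVec (h : Foliation n H φ F) (c c' x : E n) (m : Fin n → ℤ) :
    h.diff c c' (x + intVec m) = h.diff c c' x + (c' - c) ⬝ᵥ intVec m := by
  simp only [diff, h.S_add_intVec, sub_dotProduct]
  ring

lemma abs_diff_sub_le (h : Foliation n H φ F) {c c' : E n} {M : ℝ}
    (hM : ∀ z, ‖F (z, c') - F (z, c)‖ ≤ M) (x y : E n) :
    |h.diff c c' y - h.diff c c' x| ≤ n * M * ‖y - x‖ := by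
  have hM0 : 0 ≤ M := (norm_nonneg _).trans (hM 0)
  refine convex_univ.norm_image_sub_le_of_norm_hasFDerivWithin_le
    (fun z _ => (h.hasFDerivAt_diff c c' z).hasFDerivWithinAt) (fun z _ => ?_)
    (Set.mem_univ x) (Set.mem_univ y)
  refine ContinuousLinearMap.opNorm_le_bound _ (by positivity) fun v => ?_
  refine (abs_dotProduct_le _ _).trans ?_
  rw [mul_assoc]
  gcongr
  exact hM z

lemma hasDerivAt_diff_f (h : Foliation n H φ F) (c c' x : E n) (t : ℝ) :
    HasDerivAt (fun t => h.diff c c' (h.f c t x))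
      (h.α c' - h.α c - h.exc c c' (h.f c t x)) t := by
  have := (h.hasFDerivAt_diff c c' (h.f c t x)).comp_hasDerivAt t (h.hasDerivAt_f c x t)
  refine this.congr_deriv ?_
  rw [exc]
  simp [dotProduct_comm]

/-- Upper bound for the growth of `diff` along the leaf where it starts. -/
lemma diff_f_le (h : Foliation n H φ F) {c c' : E n} {K t : ℝ} (ht : 0 ≤ t)
    (hK : ∀ x, K ≤ h.exc c c' x) (x : E n) :
    h.diff c c' (h.f c t x) - h.diff c c' x ≤ t * (h.α c' - h.α c - K) := by
  have := sub_le_mul_of_hasDerivAt_le ht (fun s => h.hasDerivAt_diff_f c c' x s)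
    (C := h.α c' - h.α c - K) fun s => by linarith [hK (h.f c s x)]
  rwa [h.f_zero] at this

lemma le_diff_f (h : Foliation n H φ F) {c c' : E n} {t : ℝ} (ht : 0 ≤ t) (x : E n) :
    t * (h.α c' - h.α c) ≤ h.diff c c' (h.f c' t x) - h.diff c c' x := by
  have := h.diff_f_le ht (fun x => h.exc_nonneg c' c x) x
  rw [diff_swap, h.diff_swap c c'] at this
  linarith

lemma exists_exc_lower (h : Foliation n H φ F) {K : Set (E n)} (hK : IsCompact K) {c₀ : E n}
    (hc : c₀ ∉ K) : ∃ e : ℝ, 0 < e ∧ ∀ c ∈ K, ∀ x, e ≤ h.exc c₀ c x := by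
  rcases K.eq_empty_or_nonempty with rfl | hne
  · exact ⟨1, one_pos, by simp⟩
  have hne' : (Set.Icc (0 : E n) 1 ×ˢ K).Nonempty :=
    (Set.nonempty_Icc.2 zero_le_one).prod hne
  obtain ⟨q, hq, hmin⟩ := (isCompact_Icc.prod hK).exists_isMinOn hne'
    (h.continuous_exc.comp (g := fun q : E n × E n × E n => h.exc q.1 q.2.1 q.2.2)
      (f := fun q : E n × E n => (c₀, q.2, q.1)) (by fun_prop)).continuousOn
  refine ⟨h.exc c₀ q.2 q.1, h.exc_pos (fun e : c₀ = q.2 => hc (by rw [e]; exact hq.2)) _,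
    fun c hc x => ?_⟩
  obtain ⟨m, hm⟩ := exists_intVec_sub_mem_Icc x
  have := hmin (show (x - intVec m, c) ∈ Set.Icc (0 : E n) 1 ×ˢ K from ⟨hm, hc⟩)
  have e := h.exc_periodic c₀ c (x - intVec m) m
  rw [sub_add_cancel] at e
  rw [e]
  exact this

lemma exists_exc_ge_of_energy (h : Foliation n H φ F) (c₀ : E n) {L : ℝ} (hL : 0 ≤ L) :
    ∃ B, ∀ c, B < h.α c → ∀ x x', L * ‖F (x', c) - F (x', c₀)‖ ≤ h.exc c₀ c x := by
  obtain ⟨P, hP0, hP⟩ := h.bound_compact (isCompact_singleton (x := c₀))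
  obtain ⟨Q, hQ0, hQ⟩ := exists_norm_le_on_strip h.tonelli.continuous_gradP
    (fun x p m => h.tonelli.gradP_periodic x p m) P
  set C := 2 * (n * Q + L) + 1 with hC
  have hC0 : 0 < C := by positivity
  obtain ⟨C', hC'⟩ := h.tonelli.exists_linear_lower_bound C
  refine ⟨2 * (h.α c₀ + (n * Q + L) * (|C'| / C + P)) + |C'|, fun c hc x x' => ?_⟩
  have hF : ∀ x, ‖F (x, c) - F (x, c₀)‖ ≤ (h.α c + |C'|) / C + P := fun x => by
    have h1 := hC' (x, F (x, c))
    rw [h.energy_eq] at h1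
    refine (norm_sub_le _ _).trans (add_le_add ?_ (hP c₀ rfl x))
    rw [le_div_iff₀ hC0]
    linarith [le_abs_self C']
  have h1 : gradP n H x (F (x, c₀)) ⬝ᵥ (F (x, c) - F (x, c₀)) ≤
      n * Q * ((h.α c + |C'|) / C + P) := by
    refine (dotProduct_le' _ _).trans ?_
    rw [mul_assoc]
    gcongr
    · exact hQ (x, F (x, c₀)) (hP c₀ rfl x)
    · exact hF x
  have h2 : L * ‖F (x', c) - F (x', c₀)‖ ≤ L * ((h.α c + |C'|) / C + P) := by
    gcongr; exact hF x'
  rw [exc]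
  have hα : 0 ≤ h.α c + |C'| := by
    have h1 := hC' (0, F (0, c))
    rw [h.energy_eq] at h1
    have : 0 ≤ C * ‖F (0, c)‖ := by positivity
    linarith [le_abs_self C']
  have h3 : (n * Q + L) * ((h.α c + |C'|) / C) ≤ (h.α c + |C'|) / 2 := by
    rw [mul_div_assoc', div_le_div_iff₀ hC0 two_pos]
    nlinarith
  have h4 : 0 ≤ (n * Q + L) * (|C'| / C) := by positivity
  nlinarith

/-- Linear lower bound for the excess away from the leaf `c₀`. -/
lemma exists_exc_ge (h : Foliation n H φ F) (c₀ : E n) {ρ : ℝ} (hρ : 0 < ρ) :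
    ∃ κ, 0 < κ ∧ ∀ c, ρ ≤ ‖c - c₀‖ → ∀ x x', κ * ‖F (x', c) - F (x', c₀)‖ ≤ h.exc c₀ c x := by
  obtain ⟨B, hB⟩ := h.exists_exc_ge_of_energy c₀ zero_le_one
  obtain ⟨R, hR⟩ := h.tonelli.exists_mem_strip_of_le B
  have hK : IsCompact ({c | ‖F (0, c)‖ ≤ R} ∩ {c | ρ ≤ ‖c - c₀‖}) :=
    (h.isCompact_leaves 0 R).inter_right (isClosed_le continuous_const (by fun_prop))
  obtain ⟨e, he0, he⟩ := h.exists_exc_lower hK (c₀ := c₀) fun hc => by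
    have : ρ ≤ ‖c₀ - c₀‖ := hc.2
    rw [sub_self, norm_zero] at this
    linarith
  obtain ⟨P, hP0, hP⟩ := h.bound_compact (isCompact_singleton (x := c₀))
  obtain ⟨Q, hQ0, hQ⟩ := h.bound_compact hK
  refine ⟨min 1 (e / (Q + P + 1)), lt_min one_pos (by positivity), fun c hc x x' => ?_⟩
  by_cases hα : B < h.α c
  · refine le_trans ?_ (hB c hα x x')
    gcongr
    exact min_le_left _ _
  · have hcK : c ∈ {c | ‖F (0, c)‖ ≤ R} ∩ {c | ρ ≤ ‖c - c₀‖} :=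
      ⟨hR (0, F (0, c)) (not_lt.1 hα), hc⟩
    have h1 : ‖F (x', c) - F (x', c₀)‖ ≤ Q + P + 1 :=
      (norm_sub_le _ _).trans (by linarith [hQ c hcK x', hP c₀ rfl x'])
    refine le_trans ?_ (he c hcK x)
    calc _ ≤ e / (Q + P + 1) * (Q + P + 1) := by
            gcongr
            exact min_le_right _ _
      _ = e := by field_simp

/-- Leaves with large excess separate linearly in time. -/
lemma mul_le_of_f_eq (h : Foliation n H φ F) {c₀ c : E n} (hc : c ≠ c₀) {κ t : ℝ} (ht : 0 ≤ t)
    (hκ : ∀ x x', κ * ‖F (x', c) - F (x', c₀)‖ ≤ h.exc c₀ c x) (x : E n) :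
    t * κ ≤ n * ‖h.f c t x - h.f c₀ t x‖ := by
  have hcont := (h.cont_leaf c).sub (h.cont_leaf c₀)
  obtain ⟨z, hz⟩ := exists_forall_le_of_periodic
    (f := fun z => ‖F (z, c) - F (z, c₀)‖) hcont.norm (fun x m => by simp only [h.per])
  set σ := ‖F (z, c) - F (z, c₀)‖ with hσ
  have hσ0 : 0 < σ := norm_pos_iff.2 (sub_ne_zero.2 fun e => hc (h.injective z e))
  have h1 := h.diff_f_le ht (fun x => hκ x z) x
  have h2 := h.le_diff_f (c := c₀) (c' := c) ht x
  have h3 := (le_abs_self _).trans (h.abs_diff_sub_le hz (h.f c₀ t x) (h.f c t x))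
  have h4 : σ * (t * κ) ≤ σ * (n * ‖h.f c t x - h.f c₀ t x‖) := by
    rw [← hσ] at h1
    nlinarith
  exact le_of_mul_le_mul_left h4 hσ0

end Foliation

namespace Foliation

variable {n : ℕ} {H : E n × E n → ℝ} {φ : ℝ → E n × E n → E n × E n} {F : E n × E n → E n}

lemma differentiable_flow (h : Foliation n H φ F) {t : ℝ} (ht : t ≠ 0) :
    Differentiable ℝ (φ t) :=
  IsHamFlow.differentiableAt h.noConj h.one_le ht

/-- The derivative of the base component of the flow in the vertical direction. -/
def vert (_ : Foliation n H φ F) (t : ℝ) (z : E n × E n) : E n →L[ℝ] E n :=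
  (ContinuousLinearMap.fst ℝ (E n) (E n)).comp
    ((fderiv ℝ (φ t) z).comp (ContinuousLinearMap.inr ℝ (E n) (E n)))

lemma vert_injective (h : Foliation n H φ F) {t : ℝ} (ht : t ≠ 0) (z : E n × E n) :
    Function.Injective (h.vert t z) :=
  (injective_iff_map_eq_zero _).2 fun w hw => h.noConj z t ht w hw

lemma vert_surjective (h : Foliation n H φ F) {t : ℝ} (ht : t ≠ 0) (z : E n × E n) :
    Function.Surjective (h.vert t z) :=
  LinearMap.surjective_of_injective (f := (h.vert t z : E n →ₗ[ℝ] E n)) (h.vert_injective ht z)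

lemma exists_minimum (h : Foliation n H φ F) {t : ℝ} (ht : 0 < t) (x y : E n) :
    ∃ p, ∀ p', ((φ t (x, p)).1 - y) ⬝ᵥ ((φ t (x, p)).1 - y) ≤
      ((φ t (x, p')).1 - y) ⬝ᵥ ((φ t (x, p')).1 - y) := by
  have hc : Continuous fun p => (φ t (x, p)).1 - y :=
    (continuous_fst.comp ((h.flow.continuous h.tonelli ht.le).comp
      (by fun_prop : Continuous fun p => (x, p)))).sub continuous_const
  refine (hc.dotProduct hc).exists_forall_le' (F (x, 0)) ?_
  set a := ‖h.f 0 t x - y‖ with ha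
  have ha0 : 0 ≤ a := norm_nonneg _
  obtain ⟨B, hB⟩ := h.exists_exc_ge_of_energy 0 (L := n * ((n + 2) * a) / t) (by positivity)
  obtain ⟨C', hC'⟩ := h.tonelli.exists_linear_lower_bound 1
  filter_upwards [(isCompact_closedBall (0 : E n) (max B (h.α 0) + C')).compl_mem_cocompact]
    with p hp
  obtain ⟨c, rfl⟩ := h.surjective x p
  have hp' : max B (h.α 0) + C' < ‖F (x, c)‖ := by simpa using hp
  have h1 := hC' (x, F (x, c))
  rw [h.energy_eq, one_mul] at h1
  have h2 : max B (h.α 0) < h.α c := by linarith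
  have h3 := h.mul_le_of_f_eq (c₀ := 0) (c := c) (fun e => by
    rw [e] at h2; exact absurd (le_max_right B (h.α 0)) (not_le.2 h2)) ht.le
    (hB c ((le_max_left _ _).trans_lt h2)) x
  have hn : (0 : ℝ) < n := by exact_mod_cast h.one_le
  rw [mul_div_cancel₀ _ ht.ne'] at h3
  have h4 := le_of_mul_le_mul_left h3 hn
  have h5 : (n + 1) * a ≤ ‖h.f c t x - y‖ := by
    have := norm_sub_le (h.f c t x - y) (h.f 0 t x - y)
    rw [sub_sub_sub_cancel_right] at this
    linarith
  have up : ∀ v : E n, v ⬝ᵥ v ≤ n * ‖v‖ ^ 2 := fun v => by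
    rw [sq]; exact dotProduct_le' v v
  have low : ∀ v : E n, ‖v‖ ^ 2 ≤ v ⬝ᵥ v := fun v => by
    have : ‖v‖ ≤ Real.sqrt (v ⬝ᵥ v) := (pi_norm_le_iff_of_nonneg (Real.sqrt_nonneg _)).2 fun i => by
      refine Real.le_sqrt_of_sq_le ?_
      rw [Real.norm_eq_abs, sq_abs, sq]
      exact Finset.single_le_sum (f := fun i => v i * v i) (fun j _ => mul_self_nonneg _)
        (Finset.mem_univ i)
    calc _ ≤ Real.sqrt (v ⬝ᵥ v) ^ 2 := by gcongr
      _ = _ := Real.sq_sqrt (Finset.sum_nonneg fun j _ => mul_self_nonneg _)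
  refine (up _).trans (le_trans ?_ (low _))
  change n * a ^ 2 ≤ ‖h.f c t x - y‖ ^ 2
  calc n * a ^ 2 ≤ ((n + 1) * a) ^ 2 := by
        have : (n : ℝ) ≤ (n + 1) ^ 2 := by nlinarith
        rw [mul_pow]
        gcongr
    _ ≤ _ := by gcongr

lemma exists_vertical_eq (h : Foliation n H φ F) {t : ℝ} (ht : 0 < t) (x y : E n) :
    ∃ p, (φ t (x, p)).1 = y := by
  obtain ⟨p, hp⟩ := h.exists_minimum ht x y
  refine ⟨p, sub_eq_zero.1 ?_⟩
  set r := (φ t (x, p)).1 - y with hr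
  obtain ⟨w, hw⟩ := h.vert_surjective ht.ne' (x, p) r
  have hd : HasDerivAt (fun s : ℝ => (φ t (x, p + s • w)).1 - y) r 0 := by
    have h1 := (h.differentiable_flow ht.ne' (x, p)).hasFDerivAt.hasLineDerivAt (0, w)
    have h2 : HasDerivAt (fun s : ℝ => φ t ((x, p) + s • (0, w))) _ 0 := h1
    have h3 := (hasFDerivAt_fst.comp_hasDerivAt (0 : ℝ) h2).sub_const y
    rw [← hw]
    simpa [Function.comp_def, vert] using h3
  have hd2 : HasDerivAt (fun s : ℝ => ((φ t (x, p + s • w)).1 - y) ⬝ᵥ ((φ t (x, p + s • w)).1 - y))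
      (r ⬝ᵥ r + r ⬝ᵥ r) 0 := by
    have h1 := HasDerivAt.fun_sum (u := Finset.univ) fun i _ =>
      (hasDerivAt_pi.1 hd i).fun_mul (hasDerivAt_pi.1 hd i)
    simp only [zero_smul, add_zero, ← hr, Finset.sum_add_distrib] at h1
    exact h1
  have hmin : IsLocalMin
      (fun s : ℝ => ((φ t (x, p + s • w)).1 - y) ⬝ᵥ ((φ t (x, p + s • w)).1 - y)) 0 :=
    .of_forall fun s => by
      simp only [zero_smul, add_zero]
      exact hp (p + s • w)
  have e := hmin.hasDerivAt_eq_zero hd2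
  exact dotProduct_self_eq_zero.1 (by linarith)

/-- Any two points are joined in any positive time along some leaf. -/
lemma exists_f_eq (h : Foliation n H φ F) {t : ℝ} (ht : 0 < t) (x y : E n) :
    ∃ c, h.f c t x = y := by
  obtain ⟨p, hp⟩ := h.exists_vertical_eq ht x y
  obtain ⟨c, rfl⟩ := h.surjective x p
  exact ⟨c, hp⟩

lemma diff_f_lt (h : Foliation n H φ F) {c c' : E n} (hc : c ≠ c') {t : ℝ} (ht : 0 < t)
    (x : E n) : h.diff c c' (h.f c t x) - h.diff c c' x < t * (h.α c' - h.α c) := by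
  obtain ⟨e, he0, he⟩ := h.exists_exc_lower (isCompact_singleton (x := c')) (c₀ := c) hc
  have := h.diff_f_le ht.le (he c' rfl) x
  have : 0 < t * e := by positivity
  nlinarith

lemma exists_periodic_leaf (h : Foliation n H φ F) {t : ℝ} (ht : 0 < t) (m : Fin n → ℤ) :
    ∃ c, ∀ x, h.f c t x = x + intVec m := by
  obtain ⟨c, hc⟩ := h.exists_f_eq ht 0 (0 + intVec m)
  refine ⟨c, fun x => ?_⟩
  obtain ⟨c', hc'⟩ := h.exists_f_eq ht x (x + intVec m)
  rcases eq_or_ne c c' with rfl | hne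
  · exact hc'
  have h1 := h.diff_f_lt hne ht 0
  have h2 := h.le_diff_f (c := c) (c' := c') ht.le x
  rw [hc, h.diff_add_intVec] at h1
  rw [hc', h.diff_add_intVec] at h2
  linarith

lemma dense_periodic_leaves (h : Foliation n H φ F) :
    Dense {c | ∃ T : ℕ, 1 ≤ T ∧ ∃ m : Fin n → ℤ, ∀ x, h.f c T x = x + intVec m} := by
  refine Metric.dense_iff.2 fun c₀ ε hε => ?_
  obtain ⟨κ, hκ0, hκ⟩ := h.exists_exc_ge c₀ hε
  obtain ⟨T, hT⟩ := exists_nat_gt (n / κ)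
  have hT0 : (0 : ℝ) < T := lt_of_le_of_lt (by positivity) hT
  obtain ⟨c, hc⟩ := h.exists_periodic_leaf hT0 (fun i => round (h.f c₀ T 0 i))
  refine ⟨c, ?_, T, by exact_mod_cast hT0, _, hc⟩
  rw [mem_ball_iff_norm]
  by_contra hcε
  have hcε := not_lt.1 hcε
  have hne : c ≠ c₀ := by
    rintro rfl
    rw [sub_self, norm_zero] at hcε
    linarith
  have h1 := h.mul_le_of_f_eq hne hT0.le (hκ c hcε) 0
  rw [hc, zero_add] at h1
  have h2 : ‖intVec (fun i => round (h.f c₀ T 0 i)) - h.f c₀ T 0‖ ≤ 1 := by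
    refine (pi_norm_le_iff_of_nonneg zero_le_one).2 fun i => ?_
    rw [Pi.sub_apply, Real.norm_eq_abs, abs_sub_comm]
    exact (abs_sub_round _).trans (by norm_num)
  rw [div_lt_iff₀ hκ0] at hT
  have h3 : (n : ℝ) * ‖intVec (fun i => round (h.f c₀ T 0 i)) - h.f c₀ T 0‖ ≤ n * 1 := by gcongr
  linarith

end Foliation

lemma exists_pos_le_of_periodic {n : ℕ} {q : E n × E n → ℝ} (hq : Continuous q)
    (hper : ∀ x v (m : Fin n → ℤ), q (x + intVec m, v) = q (x, v))
    (hpos : ∀ x v, v ≠ 0 → 0 < q (x, v)) :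
    ∃ e : ℝ, 0 < e ∧ ∀ x v, ‖v‖ = 1 → e ≤ q (x, v) := by
  rcases (Metric.sphere (0 : E n) 1).eq_empty_or_nonempty with he | hne
  · refine ⟨1, one_pos, fun x v hv => ?_⟩
    have : v ∈ Metric.sphere (0 : E n) 1 := by simpa using hv
    simp [he] at this
  obtain ⟨p, hp, hmin⟩ := ((isCompact_Icc (a := (0 : E n)) (b := 1)).prod
    (isCompact_sphere (0 : E n) 1)).exists_isMinOn
    ((Set.nonempty_Icc.2 zero_le_one).prod hne) hq.continuousOn
  refine ⟨q p, hpos p.1 p.2 fun e => ?_, fun x v hv => ?_⟩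
  · have : ‖p.2‖ = 1 := by simpa using hp.2
    rw [e, norm_zero] at this
    exact zero_ne_one this
  · obtain ⟨m, hm⟩ := exists_intVec_sub_mem_Icc x
    have e := hper (x - intVec m) v m
    rw [sub_add_cancel] at e
    rw [e]
    exact hmin ⟨hm, by simpa using hv⟩

namespace Foliation

variable {n : ℕ} {H : E n × E n → ℝ} {φ : ℝ → E n × E n → E n × E n} {F : E n × E n → E n}

lemma fderiv_flow_add_intVec (h : Foliation n H φ F) (t : ℝ) (x p : E n) (m : Fin n → ℤ) :
    fderiv ℝ (φ t) (x + intVec m, p) = fderiv ℝ (φ t) (x, p) := by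
  have e : (fun z : E n × E n => φ t (z + (intVec m, 0))) = fun z => φ t z + (intVec m, 0) := by
    ext1 z
    rw [← h.flow.add_intVec h.tonelli]
    simp [Prod.add_def]
  have h2 := fderiv_comp_add_right (𝕜 := ℝ) (f := φ t) (x := (x, p)) ((intVec m, 0) : E n × E n)
  rw [e, fderiv_add_const] at h2
  simpa using h2.symm

lemma continuous_fderiv_flow (h : Foliation n H φ F) {t : ℝ} (ht : 0 < t) :
    Continuous (fderiv ℝ (φ t)) := by
  rw [continuous_iff_continuousAt]
  intro z
  obtain ⟨C, hC0, hC⟩ := h.flow.exists_lipschitz_fderiv h.tonelli ht.le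
    (h.differentiable_flow ht.ne') (‖z.2‖ + 1)
  have h1 : ∀ᶠ z' in 𝓝 z, z' ∈ strip n (‖z.2‖ + 1) :=
    (continuous_snd.norm.continuousAt.eventually_lt continuousAt_const
      (by linarith)).mono fun z' hz' => le_of_lt hz'
  have h0 : Tendsto (fun z' => C * ‖z' - z‖) (𝓝 z) (𝓝 0) := by
    have : Continuous fun z' => C * ‖z' - z‖ := by fun_prop
    simpa using this.tendsto z
  refine tendsto_iff_norm_sub_tendsto_zero.2 (squeeze_zero' (Eventually.of_forall fun _ =>
    norm_nonneg _) (h1.mono fun z' hz' => hC z (by change ‖z.2‖ ≤ _; linarith) z' hz') h0)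

/-- The vertical derivative of the base component of the flow along the leaf `c`. -/
def A (h : Foliation n H φ F) (c : E n) (t : ℝ) (x : E n) : Matrix (Fin n) (Fin n) ℝ :=
  LinearMap.toMatrix' (h.vert t (x, F (x, c)) : E n →ₗ[ℝ] E n)

lemma A_mulVec (h : Foliation n H φ F) (c : E n) (t : ℝ) (x v : E n) :
    h.A c t x *ᵥ v = (fderiv ℝ (φ t) (x, F (x, c)) (0, v)).1 := by
  rw [A, LinearMap.toMatrix'_mulVec]
  rfl

lemma A_add_intVec (h : Foliation n H φ F) (c : E n) (t : ℝ) (x : E n) (m : Fin n → ℤ) :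
    h.A c t (x + intVec m) = h.A c t x := by
  rw [A, A, vert, vert, h.per, h.fderiv_flow_add_intVec]

lemma continuous_A_mulVec (h : Foliation n H φ F) {t : ℝ} (ht : 0 < t) (c : E n) :
    Continuous fun q : E n × E n => h.A c t q.1 *ᵥ q.2 := by
  simp only [A_mulVec]
  have h1 := h.continuous_fderiv_flow ht
  have h2 := h.cont
  exact continuous_fst.comp ((h1.comp (continuous_fst.prodMk
    (h2.comp (continuous_fst.prodMk continuous_const)))).clm_apply
    (continuous_const.prodMk continuous_snd))

lemma exists_norm_A_mulVec_le (h : Foliation n H φ F) {t : ℝ} (ht : 0 < t) (c : E n) :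
    ∃ C, 0 ≤ C ∧ ∀ x v, ‖h.A c t x *ᵥ v‖ ≤ C * ‖v‖ := by
  obtain ⟨R, -, hR⟩ := h.bound_compact (isCompact_singleton (x := c))
  obtain ⟨C, hC0, hC⟩ := h.flow.exists_norm_fderiv_le h.tonelli ht.le R
  refine ⟨C, hC0, fun x v => ?_⟩
  rw [A_mulVec]
  refine (norm_fst_le _).trans ((ContinuousLinearMap.le_of_opNorm_le _
    (hC (x, F (x, c)) (hR c rfl x)) _).trans_eq ?_)
  rw [Prod.norm_mk, norm_zero, max_eq_right (norm_nonneg _)]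

lemma exists_norm_A_sub_mulVec_le (h : Foliation n H φ F) {t : ℝ} (ht : 0 < t) (c : E n) :
    ∃ C, 0 ≤ C ∧ ∀ x y v, ‖(h.A c t x - h.A c t y) *ᵥ v‖ ≤ C * ‖x - y‖ * ‖v‖ := by
  obtain ⟨R, -, hR⟩ := h.bound_compact (isCompact_singleton (x := c))
  obtain ⟨K, hK⟩ := (h.lag c).1
  obtain ⟨C, hC0, hC⟩ := h.flow.exists_lipschitz_fderiv h.tonelli ht.le
    (h.differentiable_flow ht.ne') R
  refine ⟨C * max 1 K, by positivity, fun x y v => ?_⟩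
  rw [Matrix.sub_mulVec, A_mulVec, A_mulVec, ← Prod.fst_sub, ← _root_.sub_apply]
  refine (norm_fst_le _).trans ((ContinuousLinearMap.le_of_opNorm_le _
    (hC (y, F (y, c)) (hR c rfl y) (x, F (x, c)) (hR c rfl x)) _).trans ?_)
  have h1 : ‖(x, F (x, c)) - (y, F (y, c))‖ ≤ max 1 K * ‖x - y‖ := by
    have := (LipschitzWith.id.prodMk hK).dist_le_mul x y
    rwa [dist_eq_norm, dist_eq_norm] at this
  rw [Prod.norm_mk (0 : E n), norm_zero, max_eq_right (norm_nonneg _)]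
  refine mul_le_mul_of_nonneg_right ?_ (norm_nonneg _)
  rw [mul_assoc]
  exact mul_le_mul_of_nonneg_left h1 hC0

lemma exists_le_norm_A_mulVec (h : Foliation n H φ F) {t : ℝ} (ht : 0 < t) (c : E n) :
    ∃ e, 0 < e ∧ ∀ x v, e * ‖v‖ ≤ ‖h.A c t x *ᵥ v‖ := by
  obtain ⟨e, he, h1⟩ := exists_pos_le_of_periodic (h.continuous_A_mulVec ht c).norm
    (fun x v m => by rw [A_add_intVec]) fun x v hv => norm_pos_iff.2 fun e => hv <| by
      rw [A_mulVec] at e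
      exact h.noConj _ t ht.ne' v e
  refine ⟨e, he, fun x v => ?_⟩
  rcases eq_or_ne v 0 with rfl | hv
  · simp
  have hv' : 0 < ‖v‖ := norm_pos_iff.2 hv
  have := h1 x (‖v‖⁻¹ • v) (by rw [norm_smul, norm_inv, norm_norm, inv_mul_cancel₀ hv'.ne'])
  rw [Matrix.mulVec_smul, norm_smul, norm_inv, norm_norm] at this
  rwa [inv_mul_eq_div, le_div_iff₀ hv'] at this

lemma inv_A_mul_A (h : Foliation n H φ F) {t : ℝ} (ht : 0 < t) (c x : E n) :
    (h.A c t x)⁻¹ * h.A c t x = 1 := by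
  refine Matrix.nonsing_inv_mul _ ((Matrix.isUnit_iff_isUnit_det _).1
    (Matrix.mulVec_injective_iff_isUnit.1 fun v w e => ?_))
  refine h.vert_injective ht.ne' (x, F (x, c)) ?_
  rwa [A_mulVec, A_mulVec] at e

lemma A_mulVec_inv (h : Foliation n H φ F) {t : ℝ} (ht : 0 < t) (c x v : E n) :
    h.A c t x *ᵥ ((h.A c t x)⁻¹ *ᵥ v) = v := by
  rw [Matrix.mulVec_mulVec, mul_eq_one_comm.1 (h.inv_A_mul_A ht c x), Matrix.one_mulVec]

lemma exists_norm_inv_A_mulVec_le (h : Foliation n H φ F) {t : ℝ} (ht : 0 < t) (c : E n) :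
    ∃ C, 0 < C ∧ ∀ x v, ‖(h.A c t x)⁻¹ *ᵥ v‖ ≤ C * ‖v‖ := by
  obtain ⟨e, he, h1⟩ := h.exists_le_norm_A_mulVec ht c
  refine ⟨e⁻¹, inv_pos.2 he, fun x v => ?_⟩
  have := h1 x ((h.A c t x)⁻¹ *ᵥ v)
  rw [h.A_mulVec_inv ht] at this
  rwa [inv_mul_eq_div, le_div_iff₀' he]

end Foliation

lemma hasFDerivAt_of_norm_sub_le_sq {V W : Type*} [NormedAddCommGroup V] [NormedSpace ℝ V]
    [NormedAddCommGroup W] [NormedSpace ℝ W] {f : V → W} {N : V →L[ℝ] W} {x : V} {C r : ℝ}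
    (hr : 0 < r) (hf : ∀ ξ, ‖ξ‖ ≤ r → ‖f (x + ξ) - f x - N ξ‖ ≤ C * ‖ξ‖ ^ 2) :
    HasFDerivAt f N x := by
  rw [hasFDerivAt_iff_isLittleO_nhds_zero]
  refine Asymptotics.IsBigO.trans_isLittleO (g := fun ξ : V => ‖ξ‖ ^ 2) ?_
    (Asymptotics.isLittleO_norm_pow_id one_lt_two)
  refine Asymptotics.IsBigO.of_bound C ?_
  filter_upwards [Metric.closedBall_mem_nhds (0 : V) hr] with ξ hξ
  rw [Real.norm_of_nonneg (by positivity)]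
  exact hf ξ (by simpa using hξ)

namespace Foliation

variable {n : ℕ} {H : E n × E n → ℝ} {φ : ℝ → E n × E n → E n × E n} {F : E n × E n → E n}

section Periodic

variable {c : E n} {t : ℝ} {m : Fin n → ℤ}

lemma flow_periodic_leaf (h : Foliation n H φ F) (hP : ∀ x, h.f c t x = x + intVec m) (x : E n) :
    φ t (x, F (x, c)) = (x + intVec m, F (x, c)) := by
  rw [h.flow_eq, hP, h.per]

lemma exists_leaf_remainder (h : Foliation n H φ F) (ht : 0 < t)
    (hP : ∀ x, h.f c t x = x + intVec m) :
    ∃ C r : ℝ, 0 ≤ C ∧ 0 < r ∧ ∀ x, ∃ N : E n →L[ℝ] E n, ∀ ξ, ‖ξ‖ ≤ r →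
      ‖F (x + ξ, c) - F (x, c) - N ξ‖ ≤ C * ‖ξ‖ ^ 2 := by
  obtain ⟨R, -, hR⟩ := h.bound_compact (isCompact_singleton (x := c))
  obtain ⟨K, hK⟩ := (h.lag c).1
  obtain ⟨C, hC0, hC⟩ := h.flow.exists_quadratic_remainder h.tonelli ht.le
    (h.differentiable_flow ht.ne') R
  obtain ⟨G, hG0, hG⟩ := h.exists_norm_inv_A_mulVec_le ht c
  obtain ⟨L, hL, hKL⟩ : ∃ L : ℝ, 0 < L ∧ ∀ x y,
      ‖((x, F (x, c)) - (y, F (y, c)) : E n × E n)‖ ≤ L * ‖x - y‖ :=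
    ⟨(max 1 K : ℝ≥0), lt_max_of_lt_left one_pos, fun x y => by
      have := (LipschitzWith.id.prodMk hK).dist_le_mul x y
      rwa [dist_eq_norm, dist_eq_norm] at this⟩
  refine ⟨G * (C * L ^ 2), L⁻¹, by positivity, by positivity, fun x => ?_⟩
  set M := fderiv ℝ (φ t) (x, F (x, c))
  refine ⟨((h.A c t x)⁻¹.mulVecLin.toContinuousLinearMap).comp (ContinuousLinearMap.id ℝ (E n) -
    (ContinuousLinearMap.fst ℝ (E n) (E n)).comp (M.comp (ContinuousLinearMap.inl ℝ (E n) (E n)))),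
    fun ξ hξ => ?_⟩
  set Δ := F (x + ξ, c) - F (x, c) with hΔ
  have hw : ‖((ξ, Δ) : E n × E n)‖ ≤ L * ‖ξ‖ := by
    have := hKL (x + ξ) x
    rwa [Prod.mk_sub_mk, add_sub_cancel_left] at this
  have h1 := hC (x, F (x, c)) (hR c rfl x) (ξ, Δ) (hw.trans (by
    calc _ ≤ L * L⁻¹ := by gcongr
      _ = 1 := mul_inv_cancel₀ hL.ne'))
  have e : ((x, F (x, c)) + (ξ, Δ) : E n × E n) = (x + ξ, F (x + ξ, c)) := by simp [hΔ]
  rw [e, h.flow_periodic_leaf hP, h.flow_periodic_leaf hP] at h1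
  have h2 : ‖ξ - (M (ξ, 0)).1 - h.A c t x *ᵥ Δ‖ ≤ C * (L * ‖ξ‖) ^ 2 := by
    refine (le_of_eq ?_).trans ((norm_fst_le _).trans (h1.trans (by gcongr)))
    congr 1
    rw [A_mulVec, Prod.fst_sub, Prod.fst_sub, show (ξ, Δ) = ((ξ, 0) + (0, Δ) : E n × E n) by simp,
      map_add, Prod.fst_add]
    simp only [M]
    abel
  have h3 := (hG x _).trans (mul_le_mul_of_nonneg_left h2 hG0.le)
  rw [Matrix.mulVec_sub, Matrix.mulVec_mulVec, h.inv_A_mul_A ht, Matrix.one_mulVec,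
    norm_sub_rev] at h3
  refine (le_of_eq ?_).trans (h3.trans_eq (by ring))
  rfl

lemma differentiable_leaf (h : Foliation n H φ F) (ht : 0 < t)
    (hP : ∀ x, h.f c t x = x + intVec m) : Differentiable ℝ fun x => F (x, c) := fun x => by
  obtain ⟨C, r, -, hr, hC⟩ := h.exists_leaf_remainder ht hP
  obtain ⟨N, hN⟩ := hC x
  exact (hasFDerivAt_of_norm_sub_le_sq (f := fun x => F (x, c)) hr hN).differentiableAt

lemma exists_leaf_remainder' (h : Foliation n H φ F) (ht : 0 < t)
    (hP : ∀ x, h.f c t x = x + intVec m) :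
    ∃ C r : ℝ, 0 ≤ C ∧ 0 < r ∧ ∀ x, ∀ ξ, ‖ξ‖ ≤ r →
      ‖F (x + ξ, c) - F (x, c) - fderiv ℝ (fun x => F (x, c)) x ξ‖ ≤ C * ‖ξ‖ ^ 2 := by
  obtain ⟨C, r, hC0, hr, hC⟩ := h.exists_leaf_remainder ht hP
  refine ⟨C, r, hC0, hr, fun x ξ hξ => ?_⟩
  obtain ⟨N, hN⟩ := hC x
  rw [(hasFDerivAt_of_norm_sub_le_sq (f := fun x => F (x, c)) hr hN).fderiv]
  exact hN ξ hξ

lemma fderiv_leaf_symm (h : Foliation n H φ F) (ht : 0 < t)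
    (hP : ∀ x, h.f c t x = x + intVec m) (x v w : E n) :
    fderiv ℝ (fun x => F (x, c)) x v ⬝ᵥ w = v ⬝ᵥ fderiv ℝ (fun x => F (x, c)) x w := by
  have hz := (h.differentiable_leaf ht hP x).hasFDerivAt
  set N := fderiv ℝ (fun x => F (x, c)) x
  let J : E n →L[ℝ] E n →L[ℝ] ℝ := LinearMap.toContinuousLinearMap
    ((LinearMap.toContinuousLinearMap (𝕜 := ℝ) (E := E n) (F' := ℝ)).toLinearMap.comp
      (dotProductBilin ℝ ℝ))
  rw [dotProduct_comm v]
  exact second_derivative_symmetric (f := h.S c) (f' := fun x => J (F (x, c)))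
    (f'' := J.comp N) (fun y => h.hasFDerivAt_S c y) (J.hasFDerivAt.comp x hz) v w

lemma fderiv_flow_tangent (h : Foliation n H φ F) (ht : 0 < t)
    (hP : ∀ x, h.f c t x = x + intVec m) (x ξ : E n) :
    fderiv ℝ (φ t) (x, F (x, c)) (ξ, fderiv ℝ (fun x => F (x, c)) x ξ) =
      (ξ, fderiv ℝ (fun x => F (x, c)) x ξ) := by
  have hz := (h.differentiable_leaf ht hP x).hasFDerivAt
  set N := fderiv ℝ (fun x => F (x, c)) x
  have h1 : HasFDerivAt (fun x => φ t (x, F (x, c)))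
      ((fderiv ℝ (φ t) (x, F (x, c))).comp ((ContinuousLinearMap.id ℝ (E n)).prod N)) x :=
    HasFDerivAt.comp x (h.differentiable_flow ht.ne' _).hasFDerivAt ((hasFDerivAt_id x).prodMk hz)
  have h2 : HasFDerivAt (fun x => φ t (x, F (x, c)))
      ((ContinuousLinearMap.id ℝ (E n)).prod N) x := by
    simp only [h.flow_periodic_leaf hP]
    exact ((hasFDerivAt_id x).add_const _).prodMk hz
  exact congrArg (fun T : E n →L[ℝ] E n × E n => T ξ) (h1.unique h2)

lemma fderiv_flow_vert (h : Foliation n H φ F) (ht : 0 < t)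
    (hP : ∀ x, h.f c t x = x + intVec m) (x w : E n) :
    fderiv ℝ (φ t) (x, F (x, c)) (0, w) =
      (h.A c t x *ᵥ w, w + fderiv ℝ (fun x => F (x, c)) x (h.A c t x *ᵥ w)) := by
  refine Prod.ext (h.A_mulVec c t x w).symm (dotProduct_eq _ _ fun ξ => ?_)
  have h1 := h.flow.symplectic h.tonelli ht.le (h.differentiable_flow ht.ne') (x, F (x, c))
    (0, w) (ξ, fderiv ℝ (fun x => F (x, c)) x ξ)
  rw [h.fderiv_flow_tangent ht hP, omega0_eq, omega0_eq, ← h.A_mulVec,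
    ← h.fderiv_leaf_symm ht hP, zero_dotProduct] at h1
  rw [add_dotProduct]
  dsimp only at h1 ⊢
  linarith

lemma A_dot_comm (h : Foliation n H φ F) (ht : 0 < t)
    (hP : ∀ x, h.f c t x = x + intVec m) (x v w : E n) :
    v ⬝ᵥ h.A c t x *ᵥ w = w ⬝ᵥ h.A c t x *ᵥ v := by
  have h1 := h.flow.symplectic h.tonelli ht.le (h.differentiable_flow ht.ne') (x, F (x, c))
    (0, v) (0, w)
  rw [h.fderiv_flow_vert ht hP, h.fderiv_flow_vert ht hP, omega0_eq, omega0_eq] at h1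
  simp only [zero_dotProduct, dotProduct_zero, sub_zero, add_dotProduct, dotProduct_add] at h1
  rw [h.fderiv_leaf_symm ht hP, dotProduct_comm _ w] at h1
  linarith

lemma A_transpose (h : Foliation n H φ F) (ht : 0 < t)
    (hP : ∀ x, h.f c t x = x + intVec m) (x : E n) : (h.A c t x)ᵀ = h.A c t x := by
  ext i j
  have := h.A_dot_comm ht hP x (Pi.single j 1) (Pi.single i 1)
  simpa using this

end Periodic

end Foliation

namespace Foliation

variable {n : ℕ} {H : E n × E n → ℝ} {φ : ℝ → E n × E n → E n × E n} {F : E n × E n → E n}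

/-- The leaf `c₀ + c`, relative to the leaf `c₀`. -/
def δ (_ : Foliation n H φ F) (c₀ c x : E n) : E n := F (x, c₀ + c) - F (x, c₀)

/-- The time-`t` map on the leaf `c₀ + c`, up to a translation. -/
def ψ (h : Foliation n H φ F) (c₀ : E n) (t : ℝ) (m : Fin n → ℤ) (c x : E n) : E n :=
  h.f (c₀ + c) t x - intVec m

/-- The time-`t` map, up to a translation, in coordinates in which the leaf `c₀` is the zero
section. -/
def Ψ (_ : Foliation n H φ F) (c₀ : E n) (t : ℝ) (m : Fin n → ℤ) (q : E n × E n) : E n × E n :=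
  ((φ t (q.1, F (q.1, c₀) + q.2)).1 - intVec m,
    (φ t (q.1, F (q.1, c₀) + q.2)).2 - F ((φ t (q.1, F (q.1, c₀) + q.2)).1, c₀))

lemma δ_add_intVec (h : Foliation n H φ F) (c₀ c x : E n) (m : Fin n → ℤ) :
    h.δ c₀ c (x + intVec m) = h.δ c₀ c x := by
  simp [δ, h.per]

lemma δ_sub_intVec (h : Foliation n H φ F) (c₀ c x : E n) (m : Fin n → ℤ) :
    h.δ c₀ c (x - intVec m) = h.δ c₀ c x := by
  have := h.δ_add_intVec c₀ c (x - intVec m) m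
  rwa [sub_add_cancel, eq_comm] at this

lemma Ψ_leaf (h : Foliation n H φ F) (c₀ : E n) (t : ℝ) (m : Fin n → ℤ) (c x : E n) :
    h.Ψ c₀ t m (x, h.δ c₀ c x) = (h.ψ c₀ t m c x, h.δ c₀ c (h.ψ c₀ t m c x)) := by
  have e : F (x, c₀) + h.δ c₀ c x = F (x, c₀ + c) := by simp [δ]
  rw [ψ, δ_sub_intVec]
  simp only [Ψ, e, h.flow_eq]
  rfl

lemma exists_δ_eq (h : Foliation n H φ F) (c₀ x I : E n) : ∃ c, h.δ c₀ c x = I := by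
  obtain ⟨c, hc⟩ := h.surjective x (F (x, c₀) + I)
  exact ⟨c - c₀, by simp [δ, hc]⟩

section Periodic

variable {c₀ : E n} {t : ℝ} {m : Fin n → ℤ}

lemma exists_Ψ_remainder (h : Foliation n H φ F) (ht : 0 < t)
    (hP : ∀ x, h.f c₀ t x = x + intVec m) :
    ∃ C r : ℝ, 1 ≤ C ∧ 0 < r ∧ ∀ x I, ‖I‖ ≤ r →
      ‖(h.Ψ c₀ t m (x, I)).1 - x - h.A c₀ t x *ᵥ I‖ ≤ C * ‖I‖ ^ 2 ∧
      ‖(h.Ψ c₀ t m (x, I)).2 - I‖ ≤ C * ‖I‖ ^ 2 := by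
  obtain ⟨R, -, hR⟩ := h.bound_compact (isCompact_singleton (x := c₀))
  obtain ⟨K, hK⟩ := (h.lag c₀).1
  obtain ⟨C₁, hC₁0, hC₁⟩ := h.flow.exists_quadratic_remainder h.tonelli ht.le
    (h.differentiable_flow ht.ne') R
  obtain ⟨C₂, r₂, hC₂0, hr₂, hC₂⟩ := h.exists_leaf_remainder' ht hP
  obtain ⟨a, ha0, ha⟩ := h.exists_norm_A_mulVec_le ht c₀
  have hN : ∀ x, ‖fderiv ℝ (fun x => F (x, c₀)) x‖ ≤ K := fun x => norm_fderiv_le_of_lipschitz ℝ hK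
  have hK0 : (0 : ℝ) ≤ K := K.2
  refine ⟨1 + C₁ + C₂ * (a + C₁) ^ 2 + K * C₁, min 1 (r₂ / (a + C₁ + 1)),
    by nlinarith [mul_nonneg hC₂0 (sq_nonneg (a + C₁)), mul_nonneg hK0 hC₁0],
    lt_min one_pos (by positivity), fun x I hI => ?_⟩
  have hI1 : ‖I‖ ≤ 1 := hI.trans (min_le_left _ _)
  have hI2 : ‖I‖ * (a + C₁ + 1) ≤ r₂ :=
    (le_div_iff₀ (by positivity)).1 (hI.trans (min_le_right _ _))
  set N := fderiv ℝ (fun x => F (x, c₀)) x with hNdef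
  set z := φ t (x, F (x, c₀) + I) with hz
  set ξ := z.1 - intVec m - x with hξ
  have hw : ‖((0, I) : E n × E n)‖ = ‖I‖ := by
    rw [Prod.norm_mk, norm_zero, max_eq_right (norm_nonneg _)]
  have h1 := hC₁ (x, F (x, c₀)) (hR c₀ rfl x) (0, I) (hw.trans_le hI1)
  rw [Prod.mk_add_mk, add_zero, h.flow_periodic_leaf hP, h.fderiv_flow_vert ht hP, hw, ← hz] at h1
  have h2 : ‖ξ - h.A c₀ t x *ᵥ I‖ ≤ C₁ * ‖I‖ ^ 2 := by
    refine (le_of_eq ?_).trans ((norm_fst_le _).trans h1)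
    congr 1
    simp only [Prod.fst_sub, hξ]
    abel
  have h3 : ‖z.2 - F (x, c₀) - (I + N (h.A c₀ t x *ᵥ I))‖ ≤ C₁ * ‖I‖ ^ 2 :=
    (norm_snd_le _).trans h1
  have hξn : ‖ξ‖ ≤ (a + C₁) * ‖I‖ := by
    have e1 := norm_le_norm_add_norm_sub' ξ (h.A c₀ t x *ᵥ I)
    have e2 : C₁ * ‖I‖ ^ 2 ≤ C₁ * ‖I‖ := by
      refine mul_le_mul_of_nonneg_left ?_ hC₁0
      nlinarith [norm_nonneg I]
    linarith [ha x I]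
  have h4 := hC₂ x ξ (by nlinarith [norm_nonneg I])
  have h5 : ‖N (ξ - h.A c₀ t x *ᵥ I)‖ ≤ K * (C₁ * ‖I‖ ^ 2) :=
    ((N.le_of_opNorm_le (hN x) _)).trans (by gcongr)
  have e : F (z.1, c₀) = F (x + ξ, c₀) := by
    rw [← h.per (x + ξ) c₀ m, hξ]
    congr 2
    abel
  have hq : (C₂ * ‖ξ‖ ^ 2) ≤ C₂ * ((a + C₁) * ‖I‖) ^ 2 := by gcongr
  constructor
  · refine h2.trans (mul_le_mul_of_nonneg_right ?_ (sq_nonneg _))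
    nlinarith [mul_nonneg hC₂0 (sq_nonneg (a + C₁)), mul_nonneg hK0 hC₁0]
  · have e2 : z.2 - F (z.1, c₀) - I = (z.2 - F (x, c₀) - (I + N (h.A c₀ t x *ᵥ I))) -
        (F (x + ξ, c₀) - F (x, c₀) - N ξ) - N (ξ - h.A c₀ t x *ᵥ I) := by
      rw [e, map_sub N ξ]
      abel
    change ‖z.2 - F (z.1, c₀) - I‖ ≤ _
    rw [e2]
    refine (norm_sub_le _ _).trans ((add_le_add (norm_sub_le _ _) le_rfl).trans ?_)
    nlinarith [sq_nonneg ‖I‖]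

end Periodic

end Foliation

lemma norm_dotProductBilin_sub_le {n : ℕ} (u v : E n) :
    ‖(dotProductBilin ℝ ℝ u).toContinuousLinearMap -
      (dotProductBilin ℝ ℝ v).toContinuousLinearMap‖ ≤ n * ‖u - v‖ := by
  refine ContinuousLinearMap.opNorm_le_bound _ (by positivity) fun w => ?_
  have : ((dotProductBilin ℝ ℝ u).toContinuousLinearMap -
      (dotProductBilin ℝ ℝ v).toContinuousLinearMap) w = (u - v) ⬝ᵥ w := by
    rw [sub_dotProduct]; rfl
  rw [this, mul_assoc]
  exact abs_dotProduct_le _ _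

lemma hasDerivAt_of_sandwich {n : ℕ} {y : ℝ → E n} {y' : E n} {D : ℝ → E n → ℝ}
    {J : ℝ → E n → E n} {h : ℝ → ℝ} {θ : ℝ} (hy : HasDerivAt y y' θ)
    (hD : ∀ s z, HasFDerivAt (D s) (dotProductBilin ℝ ℝ (J s z)).toContinuousLinearMap z)
    (hJ : Continuous fun q : ℝ × E n => J q.1 q.2)
    (hlow : ∀ s, D θ (y s) - D θ (y θ) ≤ h s - h θ)
    (hup : ∀ s, h s - h θ ≤ D s (y s) - D s (y θ)) :
    HasDerivAt h (J θ (y θ) ⬝ᵥ y') θ := by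
  have hJy : HasDerivAt (fun s => J θ (y θ) ⬝ᵥ y s) (J θ (y θ) ⬝ᵥ y') θ :=
    ((dotProductBilin ℝ ℝ (J θ (y θ))).toContinuousLinearMap.hasFDerivAt).comp_hasDerivAt θ hy
  have hO : (fun s => h s - h θ - J θ (y θ) ⬝ᵥ (y s - y θ)) =o[𝓝 θ] fun s => y s - y θ := by
    refine Asymptotics.isLittleO_iff.2 fun e he => ?_
    obtain ⟨d, hd, hd'⟩ := Metric.continuous_iff.1 hJ (θ, y θ) (e / (n + 1)) (by positivity)
    filter_upwards [Metric.ball_mem_nhds θ hd,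
      hy.continuousAt.preimage_mem_nhds (Metric.ball_mem_nhds (y θ) hd)] with s hs hys
    have key : ∀ s' ∈ Metric.ball θ d,
        |D s' (y s) - D s' (y θ) - J θ (y θ) ⬝ᵥ (y s - y θ)| ≤ e * ‖y s - y θ‖ := by
      intro s' hs'
      refine ((convex_ball (y θ) d).norm_image_sub_le_of_norm_hasFDerivWithin_le'
        (φ := (dotProductBilin ℝ ℝ (J θ (y θ))).toContinuousLinearMap) (C := e)
        (fun z _ => (hD s' z).hasFDerivWithinAt) (fun z hz => ?_)
        (Metric.mem_ball_self hd) hys)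
      refine (norm_dotProductBilin_sub_le _ _).trans ?_
      have h1 := hd' (s', z) (max_lt hs' hz)
      rw [dist_eq_norm] at h1
      calc (n : ℝ) * ‖J s' z - J θ (y θ)‖ ≤ n * (e / (n + 1)) := by gcongr
        _ ≤ (n + 1) * (e / (n + 1)) := by gcongr; linarith
        _ = e := by field_simp
    have k1 := abs_le.1 (key s hs)
    have k2 := abs_le.1 (key θ (Metric.mem_ball_self hd))
    rw [Real.norm_eq_abs, abs_le]
    constructor
    · linarith [hlow s]
    · linarith [hup s]
  have hO' := hO.trans_isBigO hy.hasFDerivAt.isBigO_sub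
  have h0 : HasDerivAt (fun s => h s - J θ (y θ) ⬝ᵥ y s) 0 θ := by
    rw [hasDerivAt_iff_isLittleO]
    refine hO'.congr_left fun s => ?_
    rw [dotProduct_sub, smul_zero]
    ring
  simpa using h0.fun_add hJy

namespace Foliation

variable {n : ℕ} {H : E n × E n → ℝ} {φ : ℝ → E n × E n → E n × E n} {F : E n × E n → E n}

/-- The normalized energy of the leaf `c₀ + c`. -/
def energyGap (h : Foliation n H φ F) (c₀ : E n) (t : ℝ) (m : Fin n → ℤ) (c : E n) : ℝ :=
  t * (h.α (c₀ + c) - h.α c₀) - c ⬝ᵥ intVec m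

lemma diff_ψ (h : Foliation n H φ F) (c₀ : E n) (t : ℝ) (m : Fin n → ℤ) (c c' c'' x : E n) :
    h.diff c' c'' (h.ψ c₀ t m c x) =
      h.diff c' c'' (h.f (c₀ + c) t x) - (c'' - c') ⬝ᵥ intVec m := by
  have := h.diff_add_intVec c' c'' (h.ψ c₀ t m c x) m
  rw [ψ, sub_add_cancel] at this
  rw [ψ]
  linarith

/-- The excess of the action of the leaf `c₀ + c` over one step. -/
def action (h : Foliation n H φ F) (c₀ : E n) (t : ℝ) (m : Fin n → ℤ) (c x : E n) : ℝ :=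
  h.diff c₀ (c₀ + c) (h.ψ c₀ t m c x) - h.diff c₀ (c₀ + c) x - h.energyGap c₀ t m c

lemma diff_sub_le_action (h : Foliation n H φ F) (c₀ : E n) {t : ℝ} (ht : 0 ≤ t)
    (m : Fin n → ℤ) (c c' x : E n) :
    h.diff c₀ (c₀ + c') (h.ψ c₀ t m c x) - h.diff c₀ (c₀ + c') x - h.energyGap c₀ t m c' ≤
      h.action c₀ t m c x := by
  have h1 := h.diff_f_le ht (h.exc_nonneg (c₀ + c) (c₀ + c')) x
  have e1 := h.diff_ψ c₀ t m c (c₀ + c) (c₀ + c') x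
  have e2 : (c₀ + c' - (c₀ + c)) ⬝ᵥ intVec m = c' ⬝ᵥ intVec m - c ⬝ᵥ intVec m := by
    rw [add_sub_add_left_eq_sub, sub_dotProduct]
  rw [e2] at e1
  simp only [action, energyGap]
  simp only [diff] at h1 e1 ⊢
  linarith

lemma action_zero (h : Foliation n H φ F) (c₀ : E n) (t : ℝ) (m : Fin n → ℤ) (x : E n) :
    h.action c₀ t m 0 x = 0 := by
  simp [action, energyGap, diff]

end Foliation

namespace Foliation

variable {n : ℕ} {H : E n × E n → ℝ} {φ : ℝ → E n × E n → E n × E n} {F : E n × E n → E n}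
  {c₀ : E n} {t : ℝ} {m : Fin n → ℤ}

lemma continuous_δ (h : Foliation n H φ F) (c₀ : E n) :
    Continuous fun q : E n × E n => h.δ c₀ q.1 q.2 := by
  have := h.cont
  unfold δ
  fun_prop

lemma hasDerivAt_Ψ (h : Foliation n H φ F) (ht : 0 < t) (x I : E n) (θ : ℝ) :
    HasDerivAt (fun θ : ℝ => (h.Ψ c₀ t m (x, θ • I)).1)
      (fderiv ℝ (φ t) (x, F (x, c₀) + θ • I) (0, I)).1 θ := by
  have h1 : HasDerivAt (fun θ : ℝ => ((x, F (x, c₀) + θ • I) : E n × E n)) (0, I) θ :=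
    (hasDerivAt_const θ x).prodMk (by
      simpa using ((hasDerivAt_id θ).smul_const I).const_add (F (x, c₀)))
  have h2 := (h.differentiable_flow ht.ne' (x, F (x, c₀) + θ • I)).hasFDerivAt.comp_hasDerivAt θ h1
  exact (hasFDerivAt_fst.comp_hasDerivAt θ h2).sub_const (intVec m)

lemma exists_hasDerivAt_action (h : Foliation n H φ F) (ht : 0 < t) (x c : E n) :
    ∃ G : ℝ → ℝ, G 0 = 0 ∧ G 1 = h.action c₀ t m c x ∧ ∀ θ, HasDerivAt G
      ((h.Ψ c₀ t m (x, θ • h.δ c₀ c x)).2 ⬝ᵥ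
        (fderiv ℝ (φ t) (x, F (x, c₀) + θ • h.δ c₀ c x) (0, h.δ c₀ c x)).1) θ := by
  set I := h.δ c₀ c x with hI
  obtain ⟨k, hk⟩ := h.homeo x
  set γ : ℝ → E n := fun θ => k.symm (F (x, c₀) + θ • I) - c₀ with hγ
  have hγc : Continuous γ := by
    have := k.symm.continuous
    fun_prop
  have hγδ : ∀ θ, h.δ c₀ (γ θ) x = θ • I := fun θ => by
    rw [δ, add_sub_cancel, ← hk, k.apply_symm_apply, add_sub_cancel_left]
  have hinj : ∀ {c c'}, h.δ c₀ c x = h.δ c₀ c' x → c = c' := fun e =>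
    add_left_cancel (h.injective x (sub_left_injective e))
  have hγ0 : γ 0 = 0 := hinj (by rw [hγδ]; simp [δ])
  have hγ1 : γ 1 = c := hinj (by rw [hγδ, one_smul])
  have hΨ : ∀ θ, h.Ψ c₀ t m (x, θ • I) =
      (h.ψ c₀ t m (γ θ) x, h.δ c₀ (γ θ) (h.ψ c₀ t m (γ θ) x)) := fun θ => by
    rw [← hγδ, h.Ψ_leaf]
  refine ⟨fun θ => h.action c₀ t m (γ θ) x, by simp only [hγ0, action_zero], by simp only [hγ1],
    fun θ => ?_⟩
  have hy := h.hasDerivAt_Ψ (c₀ := c₀) (m := m) ht x I θ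
  rw [hΨ]
  simp only [hΨ] at hy
  refine hasDerivAt_of_sandwich (y := fun θ => h.ψ c₀ t m (γ θ) x)
    (D := fun s => h.diff c₀ (c₀ + γ s)) (J := fun s => h.δ c₀ (γ s)) hy
    (fun s z => h.hasFDerivAt_diff c₀ (c₀ + γ s) z)
    ((h.continuous_δ c₀).comp ((hγc.comp continuous_fst).prodMk continuous_snd))
    (fun s => ?_) fun s => ?_
  · have := h.diff_sub_le_action c₀ ht.le m (γ s) (γ θ) x
    change _ ≤ _ - h.action c₀ t m (γ θ) x
    rw [action.eq_1 h c₀ t m (γ θ)]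
    linarith
  · have := h.diff_sub_le_action c₀ ht.le m (γ θ) (γ s) x
    change h.action c₀ t m (γ s) x - _ ≤ _
    rw [action.eq_1 h c₀ t m (γ s)]
    linarith

lemma exists_action_remainder (h : Foliation n H φ F) (ht : 0 < t)
    (hP : ∀ x, h.f c₀ t x = x + intVec m) :
    ∃ C r : ℝ, 0 ≤ C ∧ 0 < r ∧ ∀ c x, ‖h.δ c₀ c x‖ ≤ r →
      |h.action c₀ t m c x - (h.δ c₀ c x ⬝ᵥ h.A c₀ t x *ᵥ h.δ c₀ c x) / 2| ≤
        C * ‖h.δ c₀ c x‖ ^ 3 := by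
  obtain ⟨R, -, hR⟩ := h.bound_compact (isCompact_singleton (x := c₀))
  obtain ⟨C, r, hC1, hr, hC⟩ := h.exists_Ψ_remainder ht hP
  obtain ⟨L, hL0, hL⟩ := h.flow.exists_lipschitz_fderiv h.tonelli ht.le
    (h.differentiable_flow ht.ne') (R + 1)
  obtain ⟨a, ha0, ha⟩ := h.exists_norm_A_mulVec_le ht c₀
  have hC0 : 0 ≤ C := zero_le_one.trans hC1
  refine ⟨n * (C * (a + L)) + n * L, min 1 r, by positivity, lt_min one_pos hr, fun c x hI => ?_⟩
  obtain ⟨G, hG0, hG1, hG⟩ := h.exists_hasDerivAt_action (c₀ := c₀) (m := m) ht x c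
  set I := h.δ c₀ c x
  have hI1 : ‖I‖ ≤ 1 := hI.trans (min_le_left _ _)
  have hI2 : ‖I‖ ≤ r := hI.trans (min_le_right _ _)
  have hI0 := norm_nonneg I
  have hder : ∀ θ, HasDerivAt (fun θ => G θ - θ ^ 2 / 2 * (I ⬝ᵥ h.A c₀ t x *ᵥ I))
      ((h.Ψ c₀ t m (x, θ • I)).2 ⬝ᵥ (fderiv ℝ (φ t) (x, F (x, c₀) + θ • I) (0, I)).1 -
        θ * (I ⬝ᵥ h.A c₀ t x *ᵥ I)) θ := fun θ =>
    (hG θ).fun_sub ((((hasDerivAt_id θ).fun_pow 2).div_const 2).mul_const _ |>.congr_deriv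
      (by simp))
  have hb : ∀ θ ∈ Set.Icc (0 : ℝ) 1, ‖θ • I‖ ≤ ‖I‖ := fun θ hθ => by
    rw [norm_smul, Real.norm_of_nonneg hθ.1]
    exact mul_le_of_le_one_left hI0 hθ.2
  have key := norm_image_sub_le_of_norm_deriv_le_segment_01'
    (f := fun θ => G θ - θ ^ 2 / 2 * (I ⬝ᵥ h.A c₀ t x *ᵥ I))
    (C := (n * (C * (a + L)) + n * L) * ‖I‖ ^ 3)
    (fun θ _ => (hder θ).hasDerivWithinAt) fun θ hθ => ?_
  · simp only [hG0, hG1, Real.norm_eq_abs] at key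
    convert key using 2
    ring
  · have hθI := hb θ ⟨hθ.1, hθ.2.le⟩
    set J := (h.Ψ c₀ t m (x, θ • I)).2
    set y' := (fderiv ℝ (φ t) (x, F (x, c₀) + θ • I) (0, I)).1
    have e1 : ‖J - θ • I‖ ≤ C * ‖I‖ ^ 2 :=
      (hC x (θ • I) (hθI.trans hI2)).2.trans (by gcongr)
    have e2 : ‖y' - h.A c₀ t x *ᵥ I‖ ≤ L * ‖I‖ ^ 2 := by
      have hx := hR c₀ rfl x
      have := hL (x, F (x, c₀)) (by change ‖F (x, c₀)‖ ≤ _; linarith) (x, F (x, c₀) + θ • I)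
        (by change ‖F (x, c₀) + θ • I‖ ≤ _; linarith [norm_add_le (F (x, c₀)) (θ • I)])
      rw [A_mulVec, ← Prod.fst_sub, ← _root_.sub_apply]
      refine (norm_fst_le _).trans ((ContinuousLinearMap.le_of_opNorm_le _ this _).trans ?_)
      rw [Prod.mk_sub_mk, sub_self, add_sub_cancel_left, Prod.norm_mk, Prod.norm_mk, norm_zero,
        max_eq_right (norm_nonneg _), max_eq_right (norm_nonneg _)]
      calc L * ‖θ • I‖ * ‖I‖ ≤ L * ‖I‖ * ‖I‖ := by gcongr
        _ = L * ‖I‖ ^ 2 := by ring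
    have e3 : ‖y'‖ ≤ (a + L) * ‖I‖ := by
      have := norm_le_norm_add_norm_sub' y' (h.A c₀ t x *ᵥ I)
      have e : L * ‖I‖ ^ 2 ≤ L * ‖I‖ := by
        refine mul_le_mul_of_nonneg_left ?_ hL0
        nlinarith
      linarith [ha x I]
    have e4 : J ⬝ᵥ y' - θ * (I ⬝ᵥ h.A c₀ t x *ᵥ I) =
        (J - θ • I) ⬝ᵥ y' + (θ • I) ⬝ᵥ (y' - h.A c₀ t x *ᵥ I) := by
      rw [sub_dotProduct, dotProduct_sub, smul_dotProduct, smul_dotProduct, smul_eq_mul,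
        smul_eq_mul]
      ring
    rw [e4]
    refine (norm_add_le _ _).trans ((add_le_add (abs_dotProduct_le _ _)
      (abs_dotProduct_le _ _)).trans ?_)
    calc (n : ℝ) * (‖J - θ • I‖ * ‖y'‖) + n * (‖θ • I‖ * ‖y' - h.A c₀ t x *ᵥ I‖)
        ≤ n * ((C * ‖I‖ ^ 2) * ((a + L) * ‖I‖)) + n * (‖I‖ * (L * ‖I‖ ^ 2)) := by gcongr
      _ = _ := by ring

end Foliation

namespace Foliation

variable {n : ℕ} {H : E n × E n → ℝ} {φ : ℝ → E n × E n → E n × E n} {F : E n × E n → E n}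
  {c₀ : E n} {t : ℝ} {m : Fin n → ℤ}

lemma action_nonneg (h : Foliation n H φ F) (ht : 0 ≤ t) (c x : E n) :
    0 ≤ h.action c₀ t m c x := by
  have := h.diff_sub_le_action c₀ ht m c 0 x
  simpa [diff, energyGap] using this

lemma A_nonneg (h : Foliation n H φ F) (ht : 0 < t) (hP : ∀ x, h.f c₀ t x = x + intVec m)
    (x v : E n) : 0 ≤ v ⬝ᵥ h.A c₀ t x *ᵥ v := by
  obtain ⟨C, r, hC0, hr, hC⟩ := h.exists_action_remainder ht hP
  have h1 : ∀ᶠ θ : ℝ in 𝓝[>] 0, 0 ≤ (v ⬝ᵥ h.A c₀ t x *ᵥ v) / 2 + C * θ * ‖v‖ ^ 3 := by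
    have hc : Continuous fun θ : ℝ => ‖θ • v‖ := by fun_prop
    have := hc.tendsto 0
    rw [zero_smul, norm_zero] at this
    filter_upwards [nhdsWithin_le_nhds (this.eventually_le_const hr), self_mem_nhdsWithin]
      with θ hθ hθ0
    obtain ⟨c, hc⟩ := h.exists_δ_eq c₀ x (θ • v)
    rw [Set.mem_Ioi] at hθ0
    have h2 := hC c x (by rwa [hc])
    rw [hc, Matrix.mulVec_smul, dotProduct_smul, smul_dotProduct, norm_smul,
      Real.norm_of_nonneg hθ0.le, smul_eq_mul, smul_eq_mul] at h2
    have h3 := h.action_nonneg (c₀ := c₀) (m := m) ht.le c x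
    have h4 := (abs_le.1 h2).2
    have h5 : 0 ≤ θ ^ 2 * ((v ⬝ᵥ h.A c₀ t x *ᵥ v) / 2 + C * θ * ‖v‖ ^ 3) := by linarith
    exact nonneg_of_mul_nonneg_right h5 (by positivity)
  have hc : Continuous fun θ : ℝ => (v ⬝ᵥ h.A c₀ t x *ᵥ v) / 2 + C * θ * ‖v‖ ^ 3 := by fun_prop
  have h2 := ge_of_tendsto ((hc.tendsto 0).mono_left (nhdsWithin_le_nhds (s := Set.Ioi 0))) h1
  simp only [mul_zero, zero_mul, add_zero] at h2
  linarith

lemma A_pos (h : Foliation n H φ F) (ht : 0 < t) (hP : ∀ x, h.f c₀ t x = x + intVec m)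
    (x : E n) {v : E n} (hv : v ≠ 0) : 0 < v ⬝ᵥ h.A c₀ t x *ᵥ v := by
  refine lt_of_le_of_ne (h.A_nonneg ht hP x v) fun e => hv ?_
  set w := h.A c₀ t x *ᵥ v with hw
  have h1 : ∀ s : ℝ, 0 ≤ (w ⬝ᵥ h.A c₀ t x *ᵥ w) * (s * s) + (2 * (w ⬝ᵥ w)) * s + 0 := fun s => by
    have := h.A_nonneg ht hP x (v + s • w)
    rw [Matrix.mulVec_add, Matrix.mulVec_smul, add_dotProduct, dotProduct_add, dotProduct_add,
      dotProduct_smul, smul_dotProduct, smul_dotProduct, dotProduct_smul, ← hw, ← e,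
      h.A_dot_comm ht hP x v w, ← hw] at this
    simp only [smul_eq_mul] at this
    linarith
  have h2 := discrim_le_zero h1
  rw [discrim] at h2
  have h3 : w ⬝ᵥ w = 0 := by nlinarith [sq_nonneg (w ⬝ᵥ w)]
  have h4 : w = 0 := dotProduct_self_eq_zero.1 h3
  rw [hw, A_mulVec] at h4
  exact h.noConj _ t ht.ne' v h4

lemma exists_A_coercive (h : Foliation n H φ F) (ht : 0 < t)
    (hP : ∀ x, h.f c₀ t x = x + intVec m) :
    ∃ κ, 0 < κ ∧ ∀ x v, κ * ‖v‖ ^ 2 ≤ v ⬝ᵥ h.A c₀ t x *ᵥ v := by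
  obtain ⟨κ, hκ, h1⟩ := exists_pos_le_of_periodic
    (continuous_snd.dotProduct (h.continuous_A_mulVec ht c₀))
    (fun x v m => by rw [A_add_intVec]) fun x v hv => h.A_pos ht hP x hv
  refine ⟨κ, hκ, fun x v => ?_⟩
  rcases eq_or_ne v 0 with rfl | hv
  · simp
  have hv' : 0 < ‖v‖ := norm_pos_iff.2 hv
  have := h1 x (‖v‖⁻¹ • v) (by rw [norm_smul, norm_inv, norm_norm, inv_mul_cancel₀ hv'.ne'])
  rw [Matrix.mulVec_smul, smul_dotProduct, dotProduct_smul, smul_eq_mul, smul_eq_mul] at this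
  calc κ * ‖v‖ ^ 2 ≤ (‖v‖⁻¹ * (‖v‖⁻¹ * (v ⬝ᵥ h.A c₀ t x *ᵥ v))) * ‖v‖ ^ 2 := by gcongr
    _ = _ := by field_simp

lemma exists_δ_le (h : Foliation n H φ F) (c₀ : E n) {σ : ℝ} (hσ : 0 < σ) :
    ∃ ρ : ℝ, 0 < ρ ∧ ∀ c, ‖c‖ ≤ ρ → ∀ x, ‖h.δ c₀ c x‖ ≤ σ := by
  have h1 : ∀ᶠ c in 𝓝 (0 : E n), ∀ x ∈ Set.Icc (0 : E n) 1, ‖h.δ c₀ c x‖ < σ := by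
    refine isCompact_Icc.eventually_forall_of_forall_eventually fun x _ => ?_
    refine (h.continuous_δ c₀).norm.continuousAt.eventually_lt continuousAt_const ?_
    simpa [δ] using hσ
  obtain ⟨ρ, hρ, h2⟩ := Metric.nhds_basis_closedBall.mem_iff.1 h1
  refine ⟨ρ, hρ, fun c hc x => ?_⟩
  obtain ⟨k, hk⟩ := exists_intVec_sub_mem_Icc x
  rw [← h.δ_sub_intVec c₀ c x k]
  exact (h2 (mem_closedBall_zero_iff.2 hc) _ hk).le

lemma exists_norm_le_of_δ_le (h : Foliation n H φ F) (c₀ : E n) {ρ : ℝ} (hρ : 0 < ρ) :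
    ∃ σ : ℝ, 0 < σ ∧ ∀ x c, ‖h.δ c₀ c x‖ ≤ σ → ‖c‖ ≤ ρ := by
  obtain ⟨R, -, hR⟩ := h.bound_compact (isCompact_singleton (x := c₀))
  obtain ⟨B, hB⟩ := h.tonelli.exists_le_of_mem_strip (R + 1)
  obtain ⟨R', hR'⟩ := h.tonelli.exists_mem_strip_of_le B
  have hK : IsCompact ({c | ‖F (0, c)‖ ≤ R'} ∩ {c | ρ ≤ ‖c - c₀‖}) :=
    (h.isCompact_leaves 0 R').inter_right (isClosed_le continuous_const (by fun_prop))
  have hmem : ∀ x c, ‖h.δ c₀ c x‖ ≤ 1 → ρ ≤ ‖c‖ →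
      c₀ + c ∈ {c | ‖F (0, c)‖ ≤ R'} ∩ {c | ρ ≤ ‖c - c₀‖} := fun x c h1 h2 => by
    refine ⟨hR' (0, F (0, c₀ + c)) ?_, by simpa using h2⟩
    have h3 := h.energy_leaf (c₀ + c) 0 x
    rw [h3]
    refine hB _ ?_
    change ‖F (x, c₀ + c)‖ ≤ _
    have e : F (x, c₀ + c) = F (x, c₀) + h.δ c₀ c x := by simp [δ]
    rw [e]
    exact (norm_add_le _ _).trans (add_le_add (hR c₀ rfl x) h1)
  rcases (({c | ‖F (0, c)‖ ≤ R'} ∩ {c | ρ ≤ ‖c - c₀‖}) : Set (E n)).eq_empty_or_nonempty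
    with he | hne
  · refine ⟨1, one_pos, fun x c h1 => ?_⟩
    by_contra! h2
    have := hmem x c h1 h2.le
    rw [he] at this
    exact this
  · obtain ⟨p, hp, hmin⟩ := ((isCompact_Icc (a := (0 : E n)) (b := 1)).prod hK).exists_isMinOn
      ((Set.nonempty_Icc.2 zero_le_one).prod hne)
      (f := fun q : E n × E n => ‖F (q.1, q.2) - F (q.1, c₀)‖)
      (by have := h.cont; fun_prop)
    have hpos : 0 < ‖F (p.1, p.2) - F (p.1, c₀)‖ := norm_pos_iff.2 fun e => by
      have h1 := hp.2.2
      rw [Set.mem_ofPred, h.injective p.1 (sub_eq_zero.1 e), sub_self, norm_zero] at h1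
      exact absurd hρ (not_lt.2 h1)
    refine ⟨min 1 (‖F (p.1, p.2) - F (p.1, c₀)‖ / 2), lt_min one_pos (half_pos hpos),
      fun x c h1 => ?_⟩
    by_contra! h2
    obtain ⟨k, hk⟩ := exists_intVec_sub_mem_Icc x
    have h3 : ‖F (p.1, p.2) - F (p.1, c₀)‖ ≤ ‖h.δ c₀ c (x - intVec k)‖ :=
      hmin (a := (x - intVec k, c₀ + c)) ⟨hk, hmem x c (h1.trans (min_le_left _ _)) h2.le⟩
    rw [h.δ_sub_intVec] at h3
    linarith [h1.trans (min_le_right _ _)]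

lemma exists_mul_le_norm_f_sub (h : Foliation n H φ F) (c₀ : E n) {ρ : ℝ} (hρ : 0 < ρ) :
    ∃ κ : ℝ, 0 < κ ∧ ∀ c, ρ ≤ ‖c‖ → ∀ s, 0 ≤ s → ∀ x,
      s * κ ≤ n * ‖h.f (c₀ + c) s x - h.f c₀ s x‖ := by
  obtain ⟨κ, hκ, h1⟩ := h.exists_exc_ge c₀ hρ
  refine ⟨κ, hκ, fun c hc s hs x => h.mul_le_of_f_eq (fun e => ?_) hs
    (h1 (c₀ + c) (by simpa using hc)) x⟩
  rw [add_eq_left.1 e, norm_zero] at hc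
  exact absurd hρ (not_lt.2 hc)

lemma energyGap_pos (h : Foliation n H φ F) (ht : 0 < t) (hP : ∀ x, h.f c₀ t x = x + intVec m)
    {c : E n} (hc : c ≠ 0) : 0 < h.energyGap c₀ t m c := by
  have := h.diff_f_lt (c := c₀) (c' := c₀ + c) (fun e => hc (add_eq_left.1 e.symm)) ht 0
  rw [hP, h.diff_add_intVec, add_sub_cancel_left, add_sub_cancel_left] at this
  rw [energyGap]
  linarith

lemma ψ_surjective (h : Foliation n H φ F) (c : E n) : Function.Surjective (h.ψ c₀ t m c) :=
  fun y => ⟨h.f (c₀ + c) (-t) (y + intVec m), by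
    rw [ψ, ← h.f_add, add_neg_cancel, h.f_zero, add_sub_cancel_right]⟩

lemma Ψ_add_intVec (h : Foliation n H φ F) (x I : E n) (k : Fin n → ℤ) :
    h.Ψ c₀ t m (x + intVec k, I) = h.Ψ c₀ t m (x, I) + (intVec k, 0) := by
  simp only [Ψ, h.per, h.flow.add_intVec h.tonelli, Prod.fst_add, Prod.snd_add, Prod.mk_add_mk,
    add_zero]
  rw [add_sub_right_comm]

lemma measurePreserving_Ψ (h : Foliation n H φ F) (ht : 0 < t) :
    MeasurePreserving (h.Ψ c₀ t m) volume volume := by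
  have : (volume : Measure (E n)).IsAddHaarMeasure := isAddHaarMeasure_volume_pi _
  have hF := (h.cont_leaf c₀).measurable
  have h1 : MeasurePreserving (fun q : E n × E n => (q.1, F (q.1, c₀) + q.2)) volume volume :=
    (MeasurePreserving.id volume).skew_product (g := fun x I => F (x, c₀) + I)
      ((hF.comp measurable_fst).add measurable_snd)
      (Eventually.of_forall fun x => (measurePreserving_add_left volume (F (x, c₀))).map_eq)
  have h2 : MeasurePreserving (fun q : E n × E n => (q.1 - intVec m, q.2 - F (q.1, c₀)))
      volume volume :=
    (measurePreserving_sub_right volume (intVec m)).skew_product (g := fun x I => I - F (x, c₀))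
      (measurable_snd.sub (hF.comp measurable_fst))
      (Eventually.of_forall fun x => (measurePreserving_sub_right volume (F (x, c₀))).map_eq)
  exact h2.comp ((h.flow.measurePreserving h.tonelli ht.le (h.differentiable_flow ht.ne')).comp h1)

lemma iterate_ψ (h : Foliation n H φ F) (c : E n) (N : ℕ) (x : E n) :
    (h.ψ c₀ t m c)^[N] x = h.f (c₀ + c) (N * t) x - intVec (N • m) := by
  rw [iterate_of_eq_sub_intVec (f := h.f (c₀ + c) t) (g := h.ψ c₀ t m c) (T := 1) (m := m)
    (fun x k => h.f_add_intVec (c₀ + c) t x k) (fun x => rfl), Function.iterate_one, h.iterate_f]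

lemma exists_join (h : Foliation n H φ F) (ht : 0 < t) (hP : ∀ x, h.f c₀ t x = x + intVec m)
    {ρ : ℝ} (hρ : 0 < ρ) (R : ℝ) : ∃ N₀ : ℕ, ∀ N ≥ N₀, ∀ x y, ‖x - y‖ ≤ R →
      ∃ c, ‖c‖ ≤ ρ ∧ (h.ψ c₀ t m c)^[N] x = y := by
  obtain ⟨κ, hκ, h1⟩ := h.exists_mul_le_norm_f_sub c₀ hρ
  obtain ⟨N₀, hN₀⟩ := exists_nat_gt (n * R / (t * κ))
  refine ⟨N₀ + 1, fun N hN x y hxy => ?_⟩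
  have hN0 : (N₀ : ℝ) + 1 ≤ N := by exact_mod_cast hN
  have hNpos : 0 < (N : ℝ) * t := mul_pos (by linarith [(N₀.cast_nonneg : (0 : ℝ) ≤ N₀)]) ht
  obtain ⟨c, hc⟩ := h.exists_f_eq hNpos x (y + intVec (N • m))
  have e1 : h.f c₀ (N * t) x = x + intVec (N • m) := by
    have e2 := h.iterate_ψ (c₀ := c₀) (t := t) (m := m) 0 N x
    have e3 : h.ψ c₀ t m 0 = id := by
      ext1 z
      rw [ψ, add_zero, hP, add_sub_cancel_right, id]
    rw [e3, Function.iterate_id, add_zero, id] at e2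
    exact eq_add_of_sub_eq e2.symm
  have e4 : c₀ + (c - c₀) = c := add_sub_cancel _ _
  refine ⟨c - c₀, ?_, by rw [iterate_ψ, e4, hc, add_sub_cancel_right]⟩
  by_contra! h2
  have h3 := h1 (c - c₀) h2.le (N * t) hNpos.le x
  rw [e4, hc, e1, add_sub_add_right_eq_sub, norm_sub_rev] at h3
  rw [div_lt_iff₀ (by positivity)] at hN₀
  have h4 : (n : ℝ) * ‖x - y‖ ≤ n * R := by gcongr
  nlinarith [mul_pos ht hκ]

end Foliation

namespace Foliation

variable {n : ℕ} {H : E n × E n → ℝ} {φ : ℝ → E n × E n → E n × E n} {F : E n × E n → E n}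
  {c₀ : E n} {t : ℝ} {m : Fin n → ℤ}

lemma exists_ψ_eq (h : Foliation n H φ F) (ht : 0 < t) (hP : ∀ x, h.f c₀ t x = x + intVec m)
    {σ : ℝ} (hσ : 0 < σ) : ∃ r : ℝ, 0 < r ∧ ∀ x ξ, ‖ξ‖ ≤ r →
      ∃ c, ‖h.δ c₀ c x‖ ≤ σ ∧ h.ψ c₀ t m c x = x + ξ := by
  obtain ⟨ρ, hρ, h1⟩ := h.exists_δ_le c₀ hσ
  obtain ⟨κ, hκ, h2⟩ := h.exists_mul_le_norm_f_sub c₀ hρ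
  refine ⟨t * κ / (n + 1), by positivity, fun x ξ hξ => ?_⟩
  obtain ⟨c, hc⟩ := h.exists_f_eq ht x (x + ξ + intVec m)
  have e1 : c₀ + (c - c₀) = c := add_sub_cancel _ _
  refine ⟨c - c₀, h1 _ ?_ x, by rw [ψ, e1, hc, add_sub_cancel_right]⟩
  by_contra! h3
  have h4 := h2 (c - c₀) h3.le t ht.le x
  rw [e1, hc, hP, add_sub_add_right_eq_sub, add_sub_cancel_left] at h4
  rw [le_div_iff₀ (by positivity)] at hξ
  rcases (norm_nonneg ξ).eq_or_lt with h0 | h0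
  · rw [← h0, mul_zero] at h4
    exact absurd h4 (not_le.2 (by positivity))
  · linarith

lemma exists_diff_add_le (h : Foliation n H φ F) (ht : 0 < t)
    (hP : ∀ x, h.f c₀ t x = x + intVec m) :
    ∃ C r : ℝ, 0 ≤ C ∧ 0 < r ∧ ∀ c x ξ, ‖ξ‖ ≤ r →
      h.diff c₀ (c₀ + c) (x + ξ) - h.diff c₀ (c₀ + c) x ≤
        h.energyGap c₀ t m c + (ξ ⬝ᵥ (h.A c₀ t x)⁻¹ *ᵥ ξ) / 2 + C * ‖ξ‖ ^ 3 := by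
  obtain ⟨C₁, r₁, hC₁, hr₁, h1⟩ := h.exists_Ψ_remainder ht hP
  obtain ⟨C₂, r₂, hC₂, hr₂, h2⟩ := h.exists_action_remainder ht hP
  obtain ⟨e, he, h3⟩ := h.exists_le_norm_A_mulVec ht c₀
  obtain ⟨G, hG, h4⟩ := h.exists_norm_inv_A_mulVec_le ht c₀
  obtain ⟨r, hr, h5⟩ := h.exists_ψ_eq ht hP
    (σ := min (min r₁ r₂) (e / (2 * C₁))) (by positivity)
  set b := 2 / e with hb
  have hb0 : 0 < b := by positivity
  refine ⟨n * (C₁ * b ^ 3 + G * (C₁ * b ^ 2)) / 2 + C₂ * b ^ 3, r, by positivity, hr,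
    fun c x ξ hξ => ?_⟩
  obtain ⟨c', hc', e1⟩ := h5 x ξ hξ
  obtain ⟨hc₁, hc₃⟩ := le_min_iff.1 hc'
  obtain ⟨hc₁, hc₂⟩ := le_min_iff.1 hc₁
  have k1 := (h1 x _ hc₁).1
  have k2 := (abs_le.1 (h2 c' x hc₂)).2
  have k3 := h.diff_sub_le_action c₀ ht.le m c' c x
  rw [e1] at k3
  rw [h.Ψ_leaf, e1, add_sub_cancel_left] at k1
  set I := h.δ c₀ c' x
  set s := ξ - h.A c₀ t x *ᵥ I with hs
  have eξ : ξ = h.A c₀ t x *ᵥ I + s := by rw [hs, add_sub_cancel]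
  have k4 : ‖I‖ ≤ b * ‖ξ‖ := by
    have l1 : ‖h.A c₀ t x *ᵥ I‖ ≤ ‖ξ‖ + ‖s‖ := by
      have : h.A c₀ t x *ᵥ I = ξ - s := by rw [hs, sub_sub_cancel]
      rw [this]
      exact norm_sub_le _ _
    have l2 : C₁ * ‖I‖ ^ 2 ≤ e / 2 * ‖I‖ := by
      rw [le_div_iff₀ (by positivity)] at hc₃
      nlinarith [norm_nonneg I]
    have l3 := h3 x I
    rw [hb, div_mul_eq_mul_div, le_div_iff₀ he]
    linarith
  have k5 : ‖s‖ ≤ C₁ * b ^ 2 * ‖ξ‖ ^ 2 := by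
    refine k1.trans ?_
    rw [mul_assoc, ← mul_pow]
    gcongr
  have e2 : (h.A c₀ t x)⁻¹ *ᵥ ξ = I + (h.A c₀ t x)⁻¹ *ᵥ s := by
    conv_lhs => rw [eξ]
    rw [Matrix.mulVec_add, Matrix.mulVec_mulVec, h.inv_A_mul_A ht, Matrix.one_mulVec]
  have e3 : ξ ⬝ᵥ (h.A c₀ t x)⁻¹ *ᵥ ξ =
      I ⬝ᵥ h.A c₀ t x *ᵥ I + s ⬝ᵥ I + ξ ⬝ᵥ (h.A c₀ t x)⁻¹ *ᵥ s := by
    rw [e2, dotProduct_add]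
    conv_lhs => rw [eξ]
    rw [add_dotProduct (_ *ᵥ I) s I, ← eξ, dotProduct_comm (_ *ᵥ I) I]
  have k6 : -(s ⬝ᵥ I) ≤ n * (C₁ * b ^ 2 * ‖ξ‖ ^ 2 * (b * ‖ξ‖)) := by
    refine (neg_le_abs _).trans ((abs_dotProduct_le s I).trans ?_)
    gcongr
  have k7 : -(ξ ⬝ᵥ (h.A c₀ t x)⁻¹ *ᵥ s) ≤ n * (‖ξ‖ * (G * (C₁ * b ^ 2 * ‖ξ‖ ^ 2))) := by
    refine (neg_le_abs _).trans ((abs_dotProduct_le _ _).trans ?_)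
    gcongr
    exact (h4 x s).trans (by gcongr)
  have k8 : C₂ * ‖I‖ ^ 3 ≤ C₂ * (b * ‖ξ‖) ^ 3 := by gcongr
  rw [e3]
  linear_combination k3 + k2 + k8 + (k6 + k7) / 2

lemma exists_localModel (h : Foliation n H φ F) (ht : 0 < t)
    (hP : ∀ x, h.f c₀ t x = x + intVec m) :
    ∃ L : LocalModel n, ∀ c x, L.ψ c x = h.f (c₀ + c) t x - intVec m := by
  obtain ⟨κ, hκ, A_coer⟩ := h.exists_A_coercive ht hP
  obtain ⟨C₁, hC₁, A_bdd⟩ := h.exists_norm_A_mulVec_le ht c₀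
  obtain ⟨C₂, hC₂, g_bdd⟩ := h.exists_norm_inv_A_mulVec_le ht c₀
  obtain ⟨C₃, hC₃, A_lip⟩ := h.exists_norm_A_sub_mulVec_le ht c₀
  obtain ⟨C₄, r₄, hC₄, hr₄, rem⟩ := h.exists_Ψ_remainder ht hP
  obtain ⟨C₅, r₅, hC₅, hr₅, gain⟩ := h.exists_action_remainder ht hP
  obtain ⟨C₆, r₆, hC₆, hr₆, dom⟩ := h.exists_diff_add_le ht hP
  have h4 : r₄ ⊓ (r₅ ⊓ r₆) ≤ r₄ := inf_le_left
  have h5 : r₄ ⊓ (r₅ ⊓ r₆) ≤ r₅ := inf_le_right.trans inf_le_left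
  have h6 : r₄ ⊓ (r₅ ⊓ r₆) ≤ r₆ := inf_le_right.trans inf_le_right
  set C := C₁ + C₂ + C₃ + C₄ + C₅ + C₆ with hC
  refine ⟨{
    A := h.A c₀ t
    g := fun x => (h.A c₀ t x)⁻¹
    δ := h.δ c₀
    D := fun c => h.diff c₀ (c₀ + c)
    ψ := h.ψ c₀ t m
    a := h.energyGap c₀ t m
    Ψ := h.Ψ c₀ t m
    C := C
    κ := κ
    r₀ := r₄ ⊓ (r₅ ⊓ r₆)
    one_le_C := by linarith
    κ_pos := hκ
    r₀_pos := lt_inf_iff.2 ⟨hr₄, lt_inf_iff.2 ⟨hr₅, hr₆⟩⟩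
    A_symm := h.A_transpose ht hP
    A_coer := A_coer
    A_bdd := fun x v => (A_bdd x v).trans (by gcongr; linarith)
    g_bdd := fun x v => (g_bdd x v).trans (by gcongr; linarith)
    g_mul_A := fun x => h.inv_A_mul_A ht c₀ x
    A_lip := fun x y v => (A_lip x y v).trans (by gcongr; linarith)
    A_per := fun x k => h.A_add_intVec c₀ t x k
    δ_cont := fun c => (h.continuous_δ c₀).comp (continuous_const.prodMk continuous_id)
    δ_per := h.δ_add_intVec c₀
    D_deriv := fun c x => h.hasFDerivAt_diff c₀ (c₀ + c) x
    D_per := fun c x k => by rw [h.diff_add_intVec, add_sub_cancel_left]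
    leaf := h.exists_δ_eq c₀
    leaf_small := fun ρ hρ => h.exists_norm_le_of_δ_le c₀ hρ
    δ_small := fun σ hσ => h.exists_δ_le c₀ hσ
    ψ_surj := h.ψ_surjective
    Ψ_leaf := h.Ψ_leaf c₀ t m
    Ψ_per := h.Ψ_add_intVec
    Ψ_mp := h.measurePreserving_Ψ ht
    step := fun c x hx => by
      have := (rem x _ (hx.trans h4)).1
      rw [h.Ψ_leaf] at this
      exact this.trans (by gcongr; linarith)
    mom := fun c x hx => by
      have := (rem x _ (hx.trans h4)).2
      rw [h.Ψ_leaf] at this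
      exact this.trans (by gcongr; linarith)
    gain := fun c x hx => by
      have k1 := (abs_le.1 (gain c x (hx.trans h5))).1
      have k2 : C₅ * ‖h.δ c₀ c x‖ ^ 3 ≤ C * ‖h.δ c₀ c x‖ ^ 3 := by gcongr; linarith
      rw [action] at k1
      linarith
    dom := fun c x r hr => by
      have k1 := dom c x r (hr.trans h6)
      have k2 : C₆ * ‖r‖ ^ 3 ≤ C * ‖r‖ ^ 3 := by gcongr; linarith
      linarith
    a_pos := fun c hc => h.energyGap_pos ht hP hc
    join := fun ρ hρ R => h.exists_join ht hP hρ R }, fun c x => rfl⟩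

/-- For a dense `Gδ` set of classes `c`, any two orbits on the leaf `c` shadow each other. -/
theorem exists_isGδ_shadowing (h : Foliation n H φ F) :
    ∃ G : Set (E n), Dense G ∧ IsGδ G ∧
      ∀ c ∈ G, ∀ ε > 0, ∃ T N : ℕ, 1 ≤ N ∧ Shadowing (h.f c 1) ε T N := by
  have hper : ∀ c x (m : Fin n → ℤ), h.f c 1 (x + intVec m) = h.f c 1 x + intVec m :=
    fun c x m => h.f_add_intVec c 1 x m
  refine exists_dense_isGδ_shadowing (h.continuous_f zero_le_one) hper fun ε hε =>
    dense_shadowing_of_localModel h.one_le hper (h.dense_periodic_leaves.mono ?_) hε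
  rintro c₀ ⟨T, hT, m, hm⟩
  obtain ⟨L, hL⟩ := h.exists_localModel (Nat.cast_pos.2 hT) hm
  exact ⟨T, m, L, fun c x => by rw [hL, h.iterate_f, mul_one]⟩

end Foliation

/-- Generic strict ergodicity: given the continuous foliation of
`T*𝕋ⁿ` by invariant Lipschitz Lagrangian graphs `𝒯_c` of a smooth Tonelli Hamiltonian
without conjugate points, there is a dense `G_δ` set of cohomology classes `c` such
that the time-one map restricted to `𝒯_c` is strictly ergodic: it has exactly one
invariant Borel probability measure carried by `𝒯_c`, and the support of this measure
is all of `𝒯_c`. -/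
theorem generic_strict_ergodicity (n : ℕ) (hn : 1 ≤ n)
    (H : E n × E n → ℝ) (hH : IsTonelliHamiltonian n ⊤ H)
    (φ : ℝ → E n × E n → E n × E n) (hφ : IsHamFlow n H φ)
    (hnc : NoConjugatePoints n φ)
    -- the foliation from the foliation theorem
    (F : E n × E n → E n) (hFcont : Continuous F)
    (hFper : ∀ (x c : E n) (m : Fin n → ℤ), F (x + intVec m, c) = F (x, c))
    (hFlag : ∀ c : E n,
      (∃ K : ℝ≥0, LipschitzWith K fun x => F (x, c)) ∧
      ∃ u : E n → ℝ, ContDiff ℝ 1 u ∧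
        (∀ (x : E n) (m : Fin n → ℤ), u (x + intVec m) = u x) ∧
        ∀ x : E n, F (x, c) = c + gradF n u x)
    (hFinv : ∀ (c : E n) (t : ℝ) (x : E n),
      (φ t (x, F (x, c))).2 = F ((φ t (x, F (x, c))).1, c))
    (hFhomeo : ∀ x : E n, ∃ h : E n ≃ₜ E n, ∀ c : E n, h c = F (x, c))
    -- the time-one map of the flow, descended to `T*𝕋ⁿ`
    (Φ : Torus n × E n → Torus n × E n) (hΦcont : Continuous Φ)
    (hΦcomm : ∀ z : E n × E n, Φ (projT n z) = projT n (φ 1 z)) :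
    ∃ G : Set (E n), Dense G ∧ IsGδ G ∧
      ∀ c ∈ G,
        -- there is exactly one `Φ`-invariant Borel probability measure carried by `𝒯_c`...
        (∃! μ : Measure (Torus n × E n),
          IsProbabilityMeasure μ ∧ μ.map Φ = μ ∧
          μ (projT n '' {z : E n × E n | z.2 = F (z.1, c)})ᶜ = 0) ∧
        -- ... and the support of this measure is the whole of `𝒯_c`
        (∀ μ : Measure (Torus n × E n),
          IsProbabilityMeasure μ → μ.map Φ = μ →
          μ (projT n '' {z : E n × E n | z.2 = F (z.1, c)})ᶜ = 0 →
          ∀ U : Set (Torus n × E n), IsOpen U →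
            (U ∩ projT n '' {z : E n × E n | z.2 = F (z.1, c)}).Nonempty → 0 < μ U) := by
  have h : Foliation n H φ F := ⟨hn, hH, hφ, hnc, hFcont, hFper, hFlag, hFinv, hFhomeo⟩
  obtain ⟨G, hG, hGδ, hS⟩ := h.exists_isGδ_shadowing
  refine ⟨G, hG, hGδ, fun c hc => ?_⟩
  set ι : E n → Torus n × E n := fun x => projT n (x, F (x, c)) with hι
  have hrange : projT n '' {z : E n × E n | z.2 = F (z.1, c)} = Set.range ι := by
    ext y
    constructor
    · rintro ⟨⟨x, p⟩, hp, rfl⟩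
      exact ⟨x, congrArg (fun p => projT n (x, p)) hp.symm⟩
    · rintro ⟨x, rfl⟩
      exact ⟨(x, F (x, c)), rfl, rfl⟩
  have hιcont : Continuous ι :=
    (continuous_pi fun i => (AddCircle.continuous_mk' 1).comp (continuous_apply i)).prodMk
      (hFcont.comp (continuous_id.prodMk continuous_const))
  have hιper : ∀ x (m : Fin n → ℤ), ι (x + intVec m) = ι x := fun x m => by
    simp only [hι, projT, hFper]
    refine Prod.ext (funext fun i => ?_) rfl
    simp [intVec]
  have hΦι : ∀ x, Φ (ι x) = ι (h.f c 1 x) := fun x => by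
    rw [hι, hΦcomm, h.flow_eq]
  rw [hrange]
  refine ⟨?_, fun μ hμ hμΦ hμι U hU hUι =>
    measure_pos_of_shadowing hΦcont hΦι hιcont hιper (hS c hc) hμΦ hμι hU hUι⟩
  obtain ⟨μ, hμ, hμΦ, hμι⟩ := exists_invariant_of_semiconj hΦcont hΦι hιcont hιper
  exact ⟨μ, ⟨hμ, hμΦ, hμι⟩, fun ν ⟨hν, hνΦ, hνι⟩ =>
    ext_of_shadowing hΦcont hΦι hιcont hιper (hS c hc) hνΦ hνι hμΦ hμι⟩

end
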